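/- Let S ⊂ ℝ² be the C⁴ curve with positive curvature parametrized by y_* as in the context, let x₀ = y_*(0) ∈ S, and assume x₀ is generic, i.e. κ·(x₀·τ⃗) is irrational, where τ⃗ is a unit tangent vector to S at x₀. Let f_ε^rec be the reconstruction, via the filtered-backprojection formula with interpolation kernel ik, of the perturbation function f_ε from the discrete data f̂_ε(α_k, p_j). Then for every x̌ ∈ ℝ², lim_{ε→0⁺} [ f_ε^rec(x₀ + ε x̌) − Δf(x₀) · (ik * w * χ_{H₀(0)})(Θ⃗₀ · x̌) ] = 0, where Θ⃗₀ = (1,0), χ_{H₀(0)} is the signed indicator of the interval with endpoints 0 and H₀(0) = ε⁻¹H_ε(0), and * denotes convolution on ℝ (note that χ_{H₀(0)} depends on ε inside the limit). -/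

import Mathlib

open MeasureTheory Filter Topology

/-- Dot product on `ℝ²`. -/
noncomputable def dot2 (u v : ℝ × ℝ) : ℝ := u.1 * v.1 + u.2 * v.2

/-- The unit vector `Θ⃗ = (cos θ, sin θ)`. -/
noncomputable def vec (θ : ℝ) : ℝ × ℝ := (Real.cos θ, Real.sin θ)

/-- The signed indicator `χ_H` of the interval with endpoints `0` and `H`. -/
noncomputable def chiInd (H t : ℝ) : ℝ :=
  if 0 < H ∧ 0 ≤ t ∧ t ≤ H then 1
  else if H < 0 ∧ H ≤ t ∧ t ≤ 0 then -1 else 0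

/-- Convolution on `ℝ`. -/
noncomputable def conv1 (f g : ℝ → ℝ) (x : ℝ) : ℝ := ∫ y : ℝ, f y * g (x - y)

/-- `k` is Lipschitz with constant `L` and vanishes off `(-ρ, ρ)`. -/
structure LipSupp (k : ℝ → ℝ) (L ρ : ℝ) : Prop where
  lip : ∀ x y, |k x - k y| ≤ L * |x - y|
  supp : ∀ x, ρ ≤ |x| → k x = 0
  L_pos : 0 < L
  ρ_pos : 0 < ρ

/-- Up to sign, the Hilbert transform, written as an absolutely convergent integral. -/
noncomputable def hil (k : ℝ → ℝ) (u : ℝ) : ℝ :=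
  Real.pi⁻¹ * ∫ s in Set.Ioi (0:ℝ), (k (u + s) - k (u - s)) / s

namespace LipSupp

variable {k : ℝ → ℝ} {L ρ : ℝ}

lemma continuous (hk : LipSupp k L ρ) : Continuous k := by
  have : LipschitzWith (Real.toNNReal L) k := by
    refine LipschitzWith.of_dist_le_mul fun x y => ?_
    rw [Real.dist_eq, Real.dist_eq, Real.coe_toNNReal _ hk.L_pos.le]
    exact hk.lip x y
  exact this.continuous

lemma bound (hk : LipSupp k L ρ) (x : ℝ) : |k x| ≤ 2 * L * ρ := by
  have hL := hk.L_pos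
  have hρ := hk.ρ_pos
  by_cases h : ρ ≤ |x|
  · rw [hk.supp x h]; simp; positivity
  · have h1 := hk.lip x ρ
    rw [hk.supp ρ (le_abs_self ρ), sub_zero] at h1
    refine h1.trans ?_
    have : |x - ρ| ≤ 2 * ρ := by
      push Not at h
      rw [abs_lt] at h; rw [abs_le]; constructor <;> linarith
    nlinarith

lemma hasCompactSupport (hk : LipSupp k L ρ) : HasCompactSupport k := by
  refine HasCompactSupport.of_support_subset_isCompact (isCompact_Icc (a := -ρ) (b := ρ)) ?_
  intro x hx
  by_contra h
  apply hx
  apply hk.supp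
  rw [Set.mem_Icc, not_and_or] at h
  rw [le_abs]
  rcases h with h | h
  · right; linarith
  · left; linarith

lemma integrable (hk : LipSupp k L ρ) : Integrable k :=
  hk.continuous.integrable_of_hasCompactSupport hk.hasCompactSupport

lemma diffQuot_eq_zero (hk : LipSupp k L ρ) {u s : ℝ} (hs : |u| + ρ ≤ s) :
    (k (u + s) - k (u - s)) / s = 0 := by
  have h1 : k (u + s) = 0 := hk.supp _ (by
    rw [le_abs]; left; linarith [neg_abs_le u])
  have h2 : k (u - s) = 0 := hk.supp _ (by
    rw [le_abs]; right; linarith [le_abs_self u])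
  simp [h1, h2]

lemma abs_diffQuot_le (hk : LipSupp k L ρ) (u s : ℝ) :
    |(k (u + s) - k (u - s)) / s| ≤ 2 * L := by
  have hL := hk.L_pos
  rcases eq_or_ne s 0 with rfl | hs
  · simp; positivity
  · rw [abs_div, div_le_iff₀ (abs_pos.2 hs)]
    refine (hk.lip _ _).trans ?_
    have : |u + s - (u - s)| = 2 * |s| := by
      rw [show u + s - (u - s) = 2 * s by ring, abs_mul]; norm_num
    rw [this]; linarith

lemma abs_diffQuot_le_indicator (hk : LipSupp k L ρ) {u R s : ℝ} (hu : |u| ≤ R) :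
    ‖(k (u + s) - k (u - s)) / s‖ ≤ (Set.Iic (R + ρ)).indicator (fun _ => 2 * L) s := by
  by_cases h : s ≤ R + ρ
  · rw [Set.indicator_of_mem (by exact h)]
    exact hk.abs_diffQuot_le u s
  · rw [hk.diffQuot_eq_zero (by linarith)]
    simp [Set.indicator_of_notMem, h]

lemma integrable_indicator_const (c R : ℝ) :
    Integrable ((Set.Iic R).indicator fun _ : ℝ => c) (volume.restrict (Set.Ioi 0)) := by
  rw [integrable_indicator_iff measurableSet_Iic, IntegrableOn, Measure.restrict_restrict
    measurableSet_Iic]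
  have : Set.Iic R ∩ Set.Ioi (0:ℝ) = Set.Ioc 0 R := by
    ext x; simp [and_comm]
  rw [this]
  exact integrableOn_const (by simp)

lemma measurable_diffQuot (hk : LipSupp k L ρ) (u : ℝ) :
    Measurable fun s => (k (u + s) - k (u - s)) / s := by
  have := hk.continuous.measurable
  fun_prop

lemma integrableOn_diffQuot (hk : LipSupp k L ρ) (u : ℝ) :
    IntegrableOn (fun s => (k (u + s) - k (u - s)) / s) (Set.Ioi 0) :=
  (integrable_indicator_const (2 * L) (|u| + ρ)).mono' (hk.measurable_diffQuot u).aestronglyMeasurable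
    (ae_of_all _ fun _ => hk.abs_diffQuot_le_indicator le_rfl)

lemma continuous_hil (hk : LipSupp k L ρ) : Continuous (hil k) := by
  refine Continuous.mul continuous_const ?_
  rw [continuous_iff_continuousAt]
  intro u₀
  refine continuousAt_of_dominated (bound := (Set.Iic (|u₀| + 1 + ρ)).indicator fun _ => 2 * L)
    ?_ ?_ (integrable_indicator_const _ _) ?_
  · exact Eventually.of_forall fun u => (hk.measurable_diffQuot u).aestronglyMeasurable
  · filter_upwards [Metric.ball_mem_nhds u₀ one_pos] with u hu
    refine ae_of_all _ fun s => hk.abs_diffQuot_le_indicator ?_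
    rw [Metric.mem_ball, Real.dist_eq] at hu
    have := abs_sub_abs_le_abs_sub u u₀
    linarith
  · have := hk.continuous
    exact ae_of_all _ fun s => by fun_prop

lemma hasDerivAt_hil {k' : ℝ → ℝ} {L' : ℝ} (hk : LipSupp k L ρ) (hk' : LipSupp k' L' ρ)
    (hd : ∀ x, HasDerivAt k (k' x) x) (u₀ : ℝ) : HasDerivAt (hil k) (hil k' u₀) u₀ := by
  refine HasDerivAt.const_mul _ ?_
  refine (hasDerivAt_integral_of_dominated_loc_of_deriv_le
    (F' := fun u s => (k' (u + s) - k' (u - s)) / s)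
    (bound := (Set.Iic (|u₀| + 1 + ρ)).indicator fun _ => 2 * L') (Metric.ball_mem_nhds u₀ one_pos)
    ?_ ?_ ?_ ?_ (integrable_indicator_const _ _) ?_).2
  · exact Eventually.of_forall fun u => (hk.measurable_diffQuot u).aestronglyMeasurable
  · exact hk.integrableOn_diffQuot u₀
  · exact (hk'.measurable_diffQuot u₀).aestronglyMeasurable
  · refine ae_of_all _ fun s u hu => hk'.abs_diffQuot_le_indicator ?_
    rw [Metric.mem_ball, Real.dist_eq] at hu
    have := abs_sub_abs_le_abs_sub u u₀
    linarith
  · refine ae_of_all _ fun s u _ => ?_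
    have h1 : HasDerivAt (fun u => k (u + s)) (k' (u + s)) u := (hd (u + s)).comp_add_const u s
    have h2 : HasDerivAt (fun u => k (u - s)) (k' (u - s)) u := (hd (u - s)).comp_sub_const u s
    exact (h1.sub h2).div_const s

/-- Away from the support, `hil k` is an ordinary Cauchy integral. -/
lemma hil_eq_integral (hk : LipSupp k L ρ) {u : ℝ} (hu : 2 * ρ ≤ |u|) :
    hil k u = Real.pi⁻¹ * ∫ x, k x / (x - u) := by
  have hρ := hk.ρ_pos
  unfold hil
  congr 1
  have hbound : ∀ s, |k (u + s) / s| ≤ 2 * L := by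
    intro s
    rcases eq_or_ne s 0 with rfl | hs
    · simp; exact hk.L_pos.le
    · have h0 : |k (u + s)| ≤ L * |s| := by
        have := hk.lip (u + s) u
        rw [hk.supp u (by linarith)] at this
        simpa using this
      rw [abs_div, div_le_iff₀ (abs_pos.2 hs)]
      have := mul_nonneg hk.L_pos.le (abs_nonneg s)
      linarith
  have hm : Measurable fun s => k (u + s) / s := by
    have := hk.continuous.measurable
    fun_prop
  have hI : Integrable fun s => k (u + s) / s := by
    have : Integrable ((Set.Icc (-(|u| + ρ)) (|u| + ρ)).indicator fun _ : ℝ => 2 * L) := by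
      rw [integrable_indicator_iff measurableSet_Icc]
      exact integrableOn_const (by simp)
    refine this.mono' hm.aestronglyMeasurable (ae_of_all _ fun s => ?_)
    by_cases h : s ∈ Set.Icc (-(|u| + ρ)) (|u| + ρ)
    · rw [Set.indicator_of_mem h]; exact hbound s
    · rw [Set.indicator_of_notMem h, hk.supp (u + s)]
      · simp
      · rw [Set.mem_Icc, not_and_or] at h
        rw [le_abs]
        rcases h with h | h
        · right; linarith [le_abs_self u]
        · left; linarith [neg_abs_le u]
  have h1 : ∫ x, k x / (x - u) = ∫ s, k (u + s) / s := by
    rw [← integral_add_left_eq_self (fun x => k x / (x - u)) u]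
    simp
  have h2 : ∫ s in Set.Iic 0, k (u + s) / s = ∫ s in Set.Ioi 0, -(k (u - s) / s) := by
    have := integral_comp_neg_Ioi (0:ℝ) (fun s => k (u + s) / s)
    rw [neg_zero] at this
    rw [← this]
    refine setIntegral_congr_fun measurableSet_Ioi fun s _ => ?_
    simp [div_neg, sub_eq_add_neg]
  rw [h1, ← intervalIntegral.integral_Iic_add_Ioi hI.integrableOn hI.integrableOn (b := (0:ℝ)), h2,
    ← integral_add]
  · refine setIntegral_congr_fun measurableSet_Ioi fun s _ => ?_
    ring
  · have := (hk.integrableOn_diffQuot u).sub (hI.integrableOn (s := Set.Ioi 0))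
    refine this.congr (ae_of_all _ fun s => ?_)
    simp only [Pi.sub_apply]
    ring
  · exact hI.integrableOn

lemma abs_integral_le (hk : LipSupp k L ρ) {f : ℝ → ℝ} {C : ℝ}
    (hf : ∀ x, |x| ≤ ρ → |f x| ≤ C) :
    |∫ x, k x * f x| ≤ 2 * L * ρ * C * (2 * ρ) := by
  have hρ := hk.ρ_pos
  have hL := hk.L_pos
  have : ∫ x, k x * f x = ∫ x in Set.Icc (-ρ) ρ, k x * f x := by
    symm
    refine setIntegral_eq_integral_of_forall_compl_eq_zero fun x hx => ?_
    rw [hk.supp x, zero_mul]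
    by_contra h
    push Not at h
    rw [abs_lt] at h
    exact hx ⟨h.1.le, h.2.le⟩
  rw [this, ← Real.norm_eq_abs]
  refine (norm_setIntegral_le_of_norm_le_const (C := 2 * L * ρ * C) (by simp) fun x hx => ?_).trans ?_
  · rw [Real.norm_eq_abs, abs_mul]
    exact mul_le_mul (hk.bound x) (hf x (abs_le.2 hx)) (abs_nonneg _) (by positivity)
  · rw [Real.volume_real_Icc_of_le (by linarith)]
    apply le_of_eq; ring

lemma abs_hil_le_const (hk : LipSupp k L ρ) {u R : ℝ} (hu : |u| ≤ R) :
    |hil k u| ≤ 2 * L * (R + ρ) := by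
  have hρ := hk.ρ_pos
  have hL := hk.L_pos
  have hR : 0 ≤ R := (abs_nonneg u).trans hu
  unfold hil
  rw [abs_mul, abs_of_pos (inv_pos.2 Real.pi_pos)]
  have h1 : |∫ s in Set.Ioi (0:ℝ), (k (u + s) - k (u - s)) / s| ≤ 2 * L * (R + ρ) := by
    rw [← Real.norm_eq_abs]
    refine (norm_integral_le_of_norm_le (integrable_indicator_const (2 * L) (R + ρ))
      (ae_of_all _ fun s => hk.abs_diffQuot_le_indicator hu)).trans ?_
    rw [integral_indicator measurableSet_Iic, Measure.restrict_restrict measurableSet_Iic]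
    have : Set.Iic (R + ρ) ∩ Set.Ioi (0:ℝ) = Set.Ioc 0 (R + ρ) := by
      ext x; simp [and_comm]
    rw [this, setIntegral_const, Real.volume_real_Ioc_of_le (by linarith)]
    simp; linarith
  have h2 : Real.pi⁻¹ ≤ 1 := inv_le_one_of_one_le₀ (by linarith [Real.pi_gt_three])
  calc _ ≤ 1 * (2 * L * (R + ρ)) := by
        apply mul_le_mul h2 h1 (abs_nonneg _) zero_le_one
    _ = _ := one_mul _

lemma exists_abs_hil_le (hk : LipSupp k L ρ) :
    ∃ C, 0 < C ∧ ∀ u, |hil k u| ≤ C / (1 + |u|) := by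
  have hρ := hk.ρ_pos
  have hL := hk.L_pos
  refine ⟨6 * L * ρ * (1 + 2 * ρ) + 8 * L * ρ ^ 2 * (1 / (2 * ρ) + 1), by positivity, fun u => ?_⟩
  have hpos : 0 < 1 + |u| := by positivity
  rw [le_div_iff₀ hpos]
  rcases le_total (|u|) (2 * ρ) with h | h
  · have h1 := hk.abs_hil_le_const h
    have : |hil k u| * (1 + |u|) ≤ 2 * L * (2 * ρ + ρ) * (1 + 2 * ρ) :=
      mul_le_mul h1 (by linarith) hpos.le (by positivity)
    have h3 : 0 ≤ 8 * L * ρ ^ 2 * (1 / (2 * ρ) + 1) := by positivity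
    nlinarith
  · have hu : 0 < |u| := by linarith
    have h1 : |hil k u| ≤ 2 * L * ρ * (2 / |u|) * (2 * ρ) := by
      rw [hk.hil_eq_integral h, abs_mul, abs_of_pos (inv_pos.2 Real.pi_pos)]
      have h2 : Real.pi⁻¹ ≤ 1 := inv_le_one_of_one_le₀ (by linarith [Real.pi_gt_three])
      have h3 := hk.abs_integral_le (f := fun x => (x - u)⁻¹) (C := 2 / |u|) (by
        intro x hx
        rw [abs_inv, ← one_div, div_le_div_iff₀ _ hu]
        · have := abs_sub_abs_le_abs_sub u x
          rw [abs_sub_comm] at this; linarith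
        · have := abs_sub_abs_le_abs_sub u x
          rw [abs_sub_comm] at this; linarith)
      simp only [div_eq_mul_inv] at h3 ⊢
      nlinarith [abs_nonneg (∫ x, k x * (x - u)⁻¹)]
    have h4 : 1 + |u| ≤ (1 / (2 * ρ) + 1) * |u| := by
      have : 1 ≤ 1 / (2 * ρ) * |u| := by
        rw [one_div, ← div_eq_inv_mul, le_div_iff₀ (by positivity)]; linarith
      linarith
    calc |hil k u| * (1 + |u|) ≤ (2 * L * ρ * (2 / |u|) * (2 * ρ)) * ((1 / (2 * ρ) + 1) * |u|) :=
          mul_le_mul h1 h4 hpos.le (by positivity)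
      _ = 8 * L * ρ ^ 2 * (1 / (2 * ρ) + 1) := by field_simp; ring
      _ ≤ _ := by
        have : 0 ≤ 6 * L * ρ * (1 + 2 * ρ) := by positivity
        linarith

lemma exists_abs_hil_le_sq (hk : LipSupp k L ρ) (h0 : ∫ x, k x = 0) :
    ∃ C, 0 < C ∧ ∀ u, |hil k u| ≤ C / (1 + u ^ 2) := by
  have hρ := hk.ρ_pos
  have hL := hk.L_pos
  refine ⟨6 * L * ρ * (1 + (2 * ρ) ^ 2) + 8 * L * ρ ^ 3 * (1 / (2 * ρ) ^ 2 + 1),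
    by positivity, fun u => ?_⟩
  have hpos : 0 < 1 + u ^ 2 := by positivity
  rw [le_div_iff₀ hpos]
  rcases le_total (|u|) (2 * ρ) with h | h
  · have h1 := hk.abs_hil_le_const h
    have h2 : u ^ 2 ≤ (2 * ρ) ^ 2 := by
      rw [← sq_abs]; gcongr
    have : |hil k u| * (1 + u ^ 2) ≤ 2 * L * (2 * ρ + ρ) * (1 + (2 * ρ) ^ 2) :=
      mul_le_mul h1 (by linarith) hpos.le (by positivity)
    have h3 : 0 ≤ 8 * L * ρ ^ 3 * (1 / (2 * ρ) ^ 2 + 1) := by positivity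
    nlinarith
  · have hu : 0 < |u| := by linarith
    have hsub : ∀ x, |x| ≤ ρ → |u| / 2 ≤ |x - u| := by
      intro x hx
      have := abs_sub_abs_le_abs_sub u x
      rw [abs_sub_comm] at this; linarith
    have h1 : |hil k u| ≤ 2 * L * ρ * (2 * ρ / |u| ^ 2) * (2 * ρ) := by
      rw [hk.hil_eq_integral h, abs_mul, abs_of_pos (inv_pos.2 Real.pi_pos)]
      have h2 : Real.pi⁻¹ ≤ 1 := inv_le_one_of_one_le₀ (by linarith [Real.pi_gt_three])
      have h3 := hk.abs_integral_le (f := fun x => (x - u)⁻¹ + u⁻¹) (C := 2 * ρ / |u| ^ 2)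
        (by
        intro x hx
        have h5 := hsub x hx
        have hxu : x - u ≠ 0 := abs_pos.1 (by linarith)
        have hu0 : u ≠ 0 := abs_pos.1 hu
        have : (x - u)⁻¹ + u⁻¹ = x / ((x - u) * u) := by field_simp; ring
        rw [this, abs_div, abs_mul, div_le_div_iff₀ (by positivity) (by positivity)]
        calc |x| * |u| ^ 2 ≤ ρ * |u| ^ 2 := by gcongr
          _ = 2 * ρ * (|u| / 2 * |u|) := by ring
          _ ≤ _ := by gcongr)
      have h4 : ∫ x, k x / (x - u) = ∫ x, k x * ((x - u)⁻¹ + u⁻¹) := by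
        have hi : Integrable fun x => k x * u⁻¹ := hk.integrable.mul_const _
        by_cases hj : Integrable fun x => k x / (x - u)
        · have : ∀ x, k x * ((x - u)⁻¹ + u⁻¹) = k x / (x - u) + k x * u⁻¹ := fun x => by ring
          simp_rw [this]
          rw [integral_add hj hi, integral_mul_const, h0]; ring
        · rw [integral_undef hj, integral_undef]
          intro hc
          apply hj
          refine (hc.sub hi).congr (ae_of_all _ fun x => ?_)
          simp only [Pi.sub_apply]; ring
      rw [h4]
      nlinarith [abs_nonneg (∫ x, k x * ((x - u)⁻¹ + u⁻¹))]
    have h4 : 1 + u ^ 2 ≤ (1 / (2 * ρ) ^ 2 + 1) * |u| ^ 2 := by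
      have : 1 ≤ 1 / (2 * ρ) ^ 2 * |u| ^ 2 := by
        rw [one_div, ← div_eq_inv_mul, le_div_iff₀ (by positivity), one_mul]; gcongr
      rw [← sq_abs u]; linarith
    calc |hil k u| * (1 + u ^ 2)
        ≤ (2 * L * ρ * (2 * ρ / |u| ^ 2) * (2 * ρ)) * ((1 / (2 * ρ) ^ 2 + 1) * |u| ^ 2) :=
          mul_le_mul h1 h4 hpos.le (by positivity)
      _ = 8 * L * ρ ^ 3 * (1 / (2 * ρ) ^ 2 + 1) := by field_simp; ring
      _ ≤ _ := by
        have : 0 ≤ 6 * L * ρ * (1 + (2 * ρ) ^ 2) := by positivity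
        linarith

end LipSupp

lemma hasSum_inv_odd_sq : HasSum (fun n : ℕ => 1 / (2 * (n:ℝ) + 1) ^ 2) (Real.pi ^ 2 / 8) := by
  have h := hasSum_zeta_two
  have he : HasSum (fun k : ℕ => 1 / (((2 * k : ℕ) : ℝ)) ^ 2) (1 / 4 * (Real.pi ^ 2 / 6)) := by
    have e : (fun k : ℕ => 1 / (((2 * k : ℕ) : ℝ)) ^ 2) = fun k : ℕ => 1 / 4 * (1 / (k:ℝ) ^ 2) := by
      ext k
      push_cast
      rw [mul_pow, one_div, mul_inv]
      norm_num
    rw [e]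
    exact h.mul_left _
  have hs : Summable fun k : ℕ => 1 / (((2 * k + 1 : ℕ) : ℝ)) ^ 2 :=
    h.summable.comp_injective (i := fun k : ℕ => 2 * k + 1) (fun a b hab => by simpa using hab)
  have h2 := (HasSum.even_add_odd (f := fun k : ℕ => 1 / (k : ℝ) ^ 2) he hs.hasSum).unique h
  have h3 : ∑' k : ℕ, 1 / (((2 * k + 1 : ℕ) : ℝ)) ^ 2 = Real.pi ^ 2 / 8 := by linarith
  have h4 := hs.hasSum
  rw [h3] at h4
  simpa using h4

/-- `∫₀¹ log((1+x)/(1-x)) dx/x = π²/4`. -/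
lemma integral_log_div_Ioo :
    ∫ x in Set.Ioo (0:ℝ) 1, (Real.log (1 + x) - Real.log (1 - x)) / x = Real.pi ^ 2 / 4 := by
  have hF : ∀ n : ℕ, ∫ x in Set.Ioo (0:ℝ) 1, 2 * (1 / (2 * (n:ℝ) + 1)) * x ^ (2 * n)
      = 2 * (1 / (2 * (n:ℝ) + 1) ^ 2) := by
    intro n
    rw [← integral_Ioc_eq_integral_Ioo, ← intervalIntegral.integral_of_le zero_le_one,
      intervalIntegral.integral_const_mul, integral_pow]
    have : (2 * (n:ℝ) + 1) ≠ 0 := by positivity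
    push_cast
    field_simp
    simp
  have hs : Summable fun n : ℕ => 2 * (1 / (2 * (n:ℝ) + 1) ^ 2) :=
    hasSum_inv_odd_sq.summable.mul_left 2
  have hnn : ∀ n : ℕ, ∫ x in Set.Ioo (0:ℝ) 1, ‖2 * (1 / (2 * (n:ℝ) + 1)) * x ^ (2 * n)‖
      = 2 * (1 / (2 * (n:ℝ) + 1) ^ 2) := by
    intro n
    rw [← hF n]
    refine setIntegral_congr_fun measurableSet_Ioo fun x hx => ?_
    rw [Real.norm_of_nonneg]
    have := hx.1
    positivity
  have h := hasSum_integral_of_summable_integral_norm (μ := volume.restrict (Set.Ioo (0:ℝ) 1))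
    (F := fun (n : ℕ) (x : ℝ) => 2 * (1 / (2 * (n:ℝ) + 1)) * x ^ (2 * n)) (by
      intro n
      have : Continuous fun x : ℝ => 2 * (1 / (2 * (n:ℝ) + 1)) * x ^ (2 * n) := by fun_prop
      exact (this.integrableOn_Icc (a := 0) (b := 1)).mono_set Set.Ioo_subset_Icc_self) (by
      simp_rw [hnn]; exact hs)
  simp_rw [hF] at h
  have h2 := (hasSum_inv_odd_sq.mul_left 2).unique h
  rw [show Real.pi ^ 2 / 4 = 2 * (Real.pi ^ 2 / 8) by ring, h2]
  refine setIntegral_congr_fun measurableSet_Ioo fun x hx => ?_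
  have h3 := Real.hasSum_log_sub_log_of_abs_lt_one (x := x) (by rw [abs_of_pos hx.1]; exact hx.2)
  have h4 := (h3.div_const x).tsum_eq
  rw [← h4]
  refine tsum_congr fun n => ?_
  have := hx.1.ne'
  rw [pow_succ]
  field_simp

lemma integral_log_div_Ioi :
    ∫ x in Set.Ioi (0:ℝ), Real.log (|1 - x| / (1 + x)) / x = -(Real.pi ^ 2 / 2) := by
  set f : ℝ → ℝ := fun x => Real.log (|1 - x| / (1 + x)) / x with hf
  have hπ := Real.pi_pos
  have h1 : ∫ x in Set.Ioo (0:ℝ) 1, f x = -(Real.pi ^ 2 / 4) := by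
    rw [← integral_log_div_Ioo, ← integral_neg]
    refine setIntegral_congr_fun measurableSet_Ioo fun x hx => ?_
    have h1 : 0 < 1 - x := by linarith [hx.2]
    have h2 : 0 < 1 + x := by linarith [hx.1]
    simp only [hf]
    rw [abs_of_pos h1, Real.log_div h1.ne' h2.ne']
    ring
  have h2 : ∫ x in Set.Ioi (1:ℝ), f x = -(Real.pi ^ 2 / 4) := by
    have h := integral_comp_rpow_Ioi ((Set.Ioi (1:ℝ)).indicator f) (p := -1) (by norm_num)
    rw [setIntegral_indicator measurableSet_Ioi, Set.Ioi_inter_Ioi, sup_of_le_right zero_le_one] at h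
    rw [← h, ← h1, ← Set.Ioi_inter_Iio, ← setIntegral_indicator measurableSet_Iio]
    refine setIntegral_congr_fun measurableSet_Ioi fun x hx => ?_
    have hx : 0 < x := hx
    have hpow : x ^ ((-1:ℝ) - 1) = (x⁻¹) ^ 2 := by
      rw [show (-1:ℝ) - 1 = -((2:ℕ):ℝ) by norm_num, Real.rpow_neg hx.le, Real.rpow_natCast, inv_pow]
    simp only [hpow, Real.rpow_neg_one, abs_neg, abs_one, one_mul, smul_eq_mul]
    by_cases hx1 : x < 1
    · rw [Set.indicator_of_mem (by exact (one_lt_inv₀ hx).2 hx1), Set.indicator_of_mem (by exact hx1)]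
      simp only [hf]
      have e : |1 - x⁻¹| / (1 + x⁻¹) = |1 - x| / (1 + x) := by
        rw [show 1 - x⁻¹ = -(1 - x) / x by field_simp; ring, abs_div, abs_neg, abs_of_pos hx]
        field_simp
        ring
      rw [e]
      field_simp
    · rw [Set.indicator_of_notMem, mul_zero, Set.indicator_of_notMem (by exact hx1)]
      intro h
      exact hx1 ((one_lt_inv₀ hx).1 h)
  have i1 : IntegrableOn f (Set.Ioo 0 1) := by
    by_contra h
    rw [integral_undef h] at h1
    nlinarith
  have i2 : IntegrableOn f (Set.Ioi 1) := by
    by_contra h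
    rw [integral_undef h] at h2
    nlinarith
  have i1' : IntegrableOn f (Set.Ioc 0 1) := by
    rwa [integrableOn_Ioc_iff_integrableOn_Ioo]
  rw [← Set.Ioc_union_Ioi_eq_Ioi (zero_le_one' ℝ),
    setIntegral_union (Set.Ioc_disjoint_Ioi le_rfl) measurableSet_Ioi i1' i2, h2,
    integral_Ioc_eq_integral_Ioo, h1]
  ring

lemma integrableOn_rpow_div_max : IntegrableOn (fun x : ℝ => x ^ (-(1 / 2) : ℝ) / max 1 x) (Set.Ioi 0) := by
  rw [← Set.Ioc_union_Ioi_eq_Ioi (zero_le_one' ℝ)]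
  refine IntegrableOn.union ?_ ?_
  · have h : IntegrableOn (fun x : ℝ => x ^ (-(1 / 2) : ℝ)) (Set.Ioc 0 1) := by
      rw [← intervalIntegrable_iff_integrableOn_Ioc_of_le zero_le_one]
      exact intervalIntegral.intervalIntegrable_rpow' (by norm_num)
    refine h.congr_fun (fun x hx => ?_) measurableSet_Ioc
    simp only [max_eq_left hx.2, div_one]
  · refine (integrableOn_Ioi_rpow_of_lt (a := -(3 / 2)) (by norm_num) one_pos).congr_fun
      (fun x hx => ?_) measurableSet_Ioi
    have hx : 1 < x := hx
    have hx0 : 0 < x := by linarith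
    simp only [max_eq_right hx.le]
    rw [← Real.rpow_sub_one hx0.ne']
    norm_num

lemma integrableOn_abs_rpow_div_max :
    IntegrableOn (fun x : ℝ => |1 - x| ^ (-(1 / 2) : ℝ) / max 1 x) (Set.Ioi 0) := by
  have h : Integrable (fun x : ℝ => |x| ^ (-(1 / 2) : ℝ) / max 1 |x|) := by
    have := integrable_fun_norm_addHaar (E := ℝ) volume (f := fun x : ℝ => x ^ (-(1 / 2) : ℝ) / max 1 x)
    simp only [Real.norm_eq_abs] at this
    rw [this]
    simpa using integrableOn_rpow_div_max
  have h2 := (h.comp_sub_left 1).integrableOn (s := Set.Ioi 0)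
  refine h2.mono' ?_ ?_
  · refine Measurable.aestronglyMeasurable ?_
    fun_prop
  · refine (ae_restrict_iff' measurableSet_Ioi).2 (ae_of_all _ fun x hx => ?_)
    have hx : 0 < x := hx
    rw [Real.norm_of_nonneg (by positivity)]
    refine div_le_div_of_nonneg_left (by positivity) (by positivity) (max_le (le_max_left _ _) ?_)
    rw [le_max_iff]
    rcases le_total x 1 with h | h
    · left; rw [abs_of_nonneg (by linarith)]; linarith
    · right; rw [abs_of_nonpos (by linarith)]; linarith

namespace LipSupp

variable {k : ℝ → ℝ} {L ρ : ℝ}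

/-- The pointwise bound behind the use of Fubini's theorem in the inversion of `hil`. -/
lemma abs_evenPart_sub_le {K : ℝ → ℝ} {L ρ M : ℝ} (hL : 0 < L) (hρ : 0 < ρ) 
    (heven : ∀ x, K (-x) = K x) (hlip : ∀ x y, |K x - K y| ≤ L * |x - y|)
    (hsupp : ∀ x, ρ ≤ |x| → K x = 0) (hM : ∀ x, |K x| ≤ M) {l y : ℝ} (hl : 0 < l) (hl1 : l ≠ 1)
    (hy : 0 < y) :
    |(K (y * (1 + l)) - K (y * (1 - l))) / (l * y)| ≤
      (2 * L + 4 * M + 4 * L * ρ) * ρ ^ (1 / 2 : ℝ) *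
        ((|1 - l| ^ (-(1 / 2) : ℝ) / max 1 l) * (y ^ (-(1 / 2) : ℝ) / max 1 y)) := by
  have hM0 : 0 ≤ M := (abs_nonneg _).trans (hM 0)
  have h1l : 0 < |1 - l| := abs_pos.2 (sub_ne_zero.2 hl1.symm)
  have hnn : 0 ≤ (2 * L + 4 * M + 4 * L * ρ) * ρ ^ (1 / 2 : ℝ) *
        ((|1 - l| ^ (-(1 / 2) : ℝ) / max 1 l) * (y ^ (-(1 / 2) : ℝ) / max 1 y)) := by positivity
  have hle : |1 - l| ≤ 1 + l := by
    rw [abs_le]; constructor <;> linarith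
  by_cases hz : ρ ≤ y * |1 - l|
  · have e1 : K (y * (1 - l)) = 0 := hsupp _ (by rwa [abs_mul, abs_of_pos hy])
    have e2 : K (y * (1 + l)) = 0 := hsupp _ (by
      rw [abs_mul, abs_of_pos hy, abs_of_pos (by linarith : 0 < 1 + l)]
      exact hz.trans (by gcongr))
    rw [e1, e2]
    simpa using hnn
  push Not at hz
  set D := |K (y * (1 + l)) - K (y * (1 - l))| with hD
  have hD0 : 0 ≤ D := abs_nonneg _
  have d1 : D ≤ 2 * L * (l * y) := by
    refine (hlip _ _).trans ?_
    rw [show y * (1 + l) - y * (1 - l) = 2 * (l * y) by ring, abs_of_pos (by positivity)]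
    linarith
  have d2 : D ≤ 2 * L * y := by
    rw [hD, ← heven (y * (1 - l))]
    refine (hlip _ _).trans ?_
    rw [show y * (1 + l) - -(y * (1 - l)) = 2 * y by ring, abs_of_pos (by positivity)]
    linarith
  have d3 : D ≤ 2 * M := by
    refine (abs_sub _ _).trans ?_
    linarith [hM (y * (1 + l)), hM (y * (1 - l))]
  have key : D * (max 1 l * max 1 y) ≤ (2 * L + 4 * M + 4 * L * ρ) * (l * y) := by
    have hly : 0 < l * y := by positivity
    have hLρ : 0 < L * ρ := by positivity
    rcases le_total l 1 with h | h <;> rcases le_total y 1 with h' | h'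
    · rw [max_eq_left h, max_eq_left h']
      nlinarith
    · rw [max_eq_left h, max_eq_right h', one_mul]
      have : D ≤ (2 * L + 4 * M + 4 * L * ρ) * l := by
        rcases le_total l (1 / 2) with h2 | h2
        · have : y ≤ 2 * ρ := by
            rw [abs_of_nonneg (by linarith)] at hz
            nlinarith
          have h3 : L * (l * y) ≤ L * (l * (2 * ρ)) := by gcongr
          nlinarith
        · nlinarith
      nlinarith
    · rw [max_eq_right h, max_eq_left h', mul_one]
      have : D * l ≤ (2 * L * y) * l := by gcongr
      nlinarith
    · rw [max_eq_right h, max_eq_right h']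
      nlinarith
  have hone : 1 ≤ ρ ^ (1 / 2 : ℝ) * (|1 - l| ^ (-(1 / 2) : ℝ) * y ^ (-(1 / 2) : ℝ)) := by
    rw [← Real.mul_rpow h1l.le hy.le, Real.rpow_neg (by positivity), ← div_eq_mul_inv,
      one_le_div (by positivity)]
    gcongr
    linarith
  rw [abs_div, abs_of_pos (by positivity : 0 < l * y), div_le_iff₀ (by positivity)]
  have e : (2 * L + 4 * M + 4 * L * ρ) * ρ ^ (1 / 2 : ℝ) *
      ((|1 - l| ^ (-(1 / 2) : ℝ) / max 1 l) * (y ^ (-(1 / 2) : ℝ) / max 1 y)) * (l * y) =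
      (ρ ^ (1 / 2 : ℝ) * (|1 - l| ^ (-(1 / 2) : ℝ) * y ^ (-(1 / 2) : ℝ))) *
      ((2 * L + 4 * M + 4 * L * ρ) * (l * y) / (max 1 l * max 1 y)) := by
    field_simp
  rw [e]
  have h2 : D ≤ (2 * L + 4 * M + 4 * L * ρ) * (l * y) / (max 1 l * max 1 y) := by
    rw [le_div_iff₀ (by positivity)]; exact key
  calc D ≤ 1 * ((2 * L + 4 * M + 4 * L * ρ) * (l * y) / (max 1 l * max 1 y)) := by rwa [one_mul]
    _ ≤ _ := by gcongr

/-- The Hilbert transform squares to minus the identity. -/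
lemma integral_hil_diffQuot (hk : LipSupp k L ρ) (c : ℝ) :
    ∫ y in Set.Ioi (0:ℝ), (hil k (c + y) - hil k (c - y)) / y = -(Real.pi * k c) := by
  have hL := hk.L_pos
  have hρ := hk.ρ_pos
  have hπ := Real.pi_pos
  have hkc := hk.continuous
  set K : ℝ → ℝ := fun x => k (c + x) + k (c - x) with hK
  have hKc : Continuous K := by fun_prop
  have heven : ∀ x, K (-x) = K x := fun x => by simp only [hK, sub_neg_eq_add, ← sub_eq_add_neg]; ring
  have hlip : ∀ x y, |K x - K y| ≤ 2 * L * |x - y| := fun x y => by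
    have h1 := hk.lip (c + x) (c + y)
    have h2 := hk.lip (c - x) (c - y)
    rw [show c + x - (c + y) = x - y by ring] at h1
    rw [show c - x - (c - y) = -(x - y) by ring, abs_neg] at h2
    have : K x - K y = (k (c + x) - k (c + y)) + (k (c - x) - k (c - y)) := by simp only [hK]; ring
    rw [this]
    refine (abs_add_le _ _).trans ?_
    linarith
  have hsupp : ∀ x, ρ + |c| ≤ |x| → K x = 0 := fun x hx => by
    have h1 : k (c + x) = 0 := hk.supp _ (by
      have := abs_sub_abs_le_abs_sub x (-c)
      rw [abs_neg, sub_neg_eq_add, add_comm x c] at this; linarith)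
    have h2 : k (c - x) = 0 := hk.supp _ (by
      have := abs_sub_abs_le_abs_sub x c
      rw [abs_sub_comm] at this; linarith)
    simp [hK, h1, h2]
  have hM : ∀ x, |K x| ≤ 4 * L * ρ := fun x => by
    refine (abs_add_le _ _).trans ?_
    linarith [hk.bound (c + x), hk.bound (c - x)]
  set G : ℝ → ℝ → ℝ := fun y l => (K (y * (1 + l)) - K (y * (1 - l))) / (l * y) with hG
  have hGint : Integrable (Function.uncurry G)
      ((volume.restrict (Set.Ioi 0)).prod (volume.restrict (Set.Ioi 0))) := by
    have hb := (integrableOn_rpow_div_max.mul_prod integrableOn_abs_rpow_div_max).const_mul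
      ((2 * (2 * L) + 4 * (4 * L * ρ) + 4 * (2 * L) * (ρ + |c|)) * (ρ + |c|) ^ (1 / 2 : ℝ))
    refine hb.mono' ?_ ?_
    · refine Measurable.aestronglyMeasurable ?_
      simp only [hG, Function.uncurry_def]
      have := hKc.measurable
      fun_prop
    · rw [Measure.prod_restrict]
      have hne : ∀ᵐ z ∂((volume : Measure ℝ).prod (volume : Measure ℝ)), z.2 ≠ 1 :=
        Measure.quasiMeasurePreserving_snd.ae (Measure.ae_ne volume 1)
      refine (ae_restrict_iff' (measurableSet_Ioi.prod measurableSet_Ioi)).2 ?_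
      filter_upwards [hne] with z hz hzz
      have := abs_evenPart_sub_le (by positivity : 0 < 2 * L) (by positivity : 0 < ρ + |c|)
        heven hlip hsupp hM (l := z.2) (y := z.1) hzz.2 hz hzz.1
      rw [Real.norm_eq_abs]
      refine this.trans (le_of_eq ?_)
      ring
  have hLHS : ∀ y ∈ Set.Ioi (0:ℝ), (hil k (c + y) - hil k (c - y)) / y
      = Real.pi⁻¹ * ∫ l in Set.Ioi (0:ℝ), G y l := by
    intro y hy
    have hy : 0 < y := hy
    have h := integral_comp_mul_left_Ioi (fun s => (K (y + s) - K (y - s)) / (s * y)) 0 hy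
    rw [mul_zero, smul_eq_mul] at h
    have e : ∀ l, G y l = y * ((K (y + y * l) - K (y - y * l)) / ((y * l) * y)) := by
      intro l
      simp only [hG]
      rw [show y + y * l = y * (1 + l) by ring, show y - y * l = y * (1 - l) by ring]
      field_simp
    simp_rw [e]
    rw [integral_const_mul, h, ← mul_assoc y, mul_inv_cancel₀ hy.ne', one_mul]
    unfold hil
    rw [← mul_sub, ← integral_sub (hk.integrableOn_diffQuot _) (hk.integrableOn_diffQuot _),
      mul_div_assoc, ← integral_div]
    congr 1
    refine setIntegral_congr_fun measurableSet_Ioi fun s _ => ?_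
    simp only [hK]
    rw [show c + (y + s) = c + y + s by ring, show c + (y - s) = c + y - s by ring,
      show c - (y + s) = c - y - s by ring, show c - (y - s) = c - y + s by ring]
    field_simp
    ring
  rw [setIntegral_congr_fun measurableSet_Ioi hLHS, integral_const_mul, integral_integral_swap hGint]
  have hin : ∀ᵐ l ∂(volume.restrict (Set.Ioi (0:ℝ))), ∫ y in Set.Ioi (0:ℝ), G y l
      = (2 * k c) * (Real.log (|1 - l| / (1 + l)) / l) := by
    have hne : ∀ᵐ l ∂(volume.restrict (Set.Ioi (0:ℝ))), l ≠ 1 := by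
      exact ae_restrict_of_ae (Measure.ae_ne volume 1)
    filter_upwards [hne, hGint.prod_left_ae, ae_restrict_mem measurableSet_Ioi] with l hl hint hl0
    have hl0 : 0 < l := hl0
    have h1l : 0 < |1 - l| := abs_pos.2 (sub_ne_zero.2 hl.symm)
    have e : ∀ y, G y l = l⁻¹ * (y⁻¹ • (K ((1 + l) * y) - K (|1 - l| * y))) := by
      intro y
      have : K (|1 - l| * y) = K (y * (1 - l)) := by
        rcases abs_choice (1 - l) with h | h <;> rw [h]
        · rw [mul_comm]
        · rw [← heven]; congr 1; ring
      simp only [hG, smul_eq_mul, this, mul_comm y (1 + l)]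
      field_simp
    have hint' : IntegrableOn (fun y => y⁻¹ • (K ((1 + l) * y) - K (|1 - l| * y))) (Set.Ioi 0) := by
      refine (hint.const_mul l).congr (ae_of_all _ fun y => ?_)
      simp only [e, Function.uncurry_apply_pair]
      rw [mul_inv_cancel_left₀ hl0.ne']
    have hfr := Frullani.integral_Ioi_eq (f := K) (L := K 0) (R := 0) (hKc.locallyIntegrable.locallyIntegrableOn _)
      (by linarith : 0 < 1 + l) h1l (hKc.continuousAt.tendsto.mono_left nhdsWithin_le_nhds) ?_ hint'
    · simp_rw [e]
      rw [integral_const_mul, hfr]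
      simp only [hK, smul_eq_mul, add_zero, sub_zero]
      ring
    · refine tendsto_const_nhds.congr' ?_
      filter_upwards [eventually_ge_atTop (ρ + |c|)] with x hx
      exact (hsupp x (hx.trans (le_abs_self x))).symm
  rw [integral_congr_ae hin, integral_const_mul, integral_log_div_Ioi]
  field_simp

end LipSupp

/-- The interpolation kernel `ik` with derivative `k`, and the aperture function `w`. -/
structure Kernels (ik k w : ℝ → ℝ) (L ρ : ℝ) : Prop where
  ik_lip : LipSupp ik L ρ
  k_lip : LipSupp k L ρ
  w_lip : LipSupp w L ρ
  deriv_ik : ∀ x, HasDerivAt ik (k x) x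
  ik_even : ∀ x, ik (-x) = ik x
  w_even : ∀ x, w (-x) = w x
  w_int : ∫ x, w x = 1
  exact : ∀ u : ℝ, ∑' j : ℤ, ik (u - (j : ℝ)) = 1

/-- The reconstruction kernel `ψ(u, v) = ∑ⱼ (𝓗 ik')(u - j) w(j - u - v)`. -/
noncomputable def latKer (k w : ℝ → ℝ) (u v : ℝ) : ℝ :=
  ∑' j : ℤ, hil k (u - j) * w (j - u - v)

/-- The average of `latKer` over a period of its first variable. -/
noncomputable def latMean (k w : ℝ → ℝ) (v : ℝ) : ℝ := ∫ u in (0:ℝ)..1, latKer k w u v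

lemma support_subset_Icc_of_near {g : ℤ → ℝ} {x r : ℝ} (hg : ∀ j : ℤ, r ≤ |(j:ℝ) - x| → g j = 0) :
    ∀ j ∉ Finset.Icc ⌈x - r⌉ ⌊x + r⌋, g j = 0 := by
  intro j hj
  apply hg
  by_contra h
  push Not at h
  rw [abs_lt] at h
  apply hj
  rw [Finset.mem_Icc, Int.ceil_le, Int.le_floor]
  constructor <;> linarith

lemma card_Icc_near_le {x r : ℝ} (hr : 0 < r) :
    ((Finset.Icc ⌈x - r⌉ ⌊x + r⌋).card : ℝ) ≤ 2 * r + 1 := by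
  rw [Int.card_Icc]
  have h1 : (⌊x + r⌋ : ℝ) ≤ x + r := Int.floor_le _
  have h2 : x - r ≤ (⌈x - r⌉ : ℝ) := Int.le_ceil _
  rcases le_total 0 (⌊x + r⌋ + 1 - ⌈x - r⌉) with h | h
  · have : (((⌊x + r⌋ + 1 - ⌈x - r⌉).toNat : ℤ) : ℝ) = ((⌊x + r⌋ + 1 - ⌈x - r⌉ : ℤ) : ℝ) := by
      rw [Int.toNat_of_nonneg h]
    rw [← Int.cast_natCast, this]
    push_cast
    linarith
  · rw [Int.toNat_of_nonpos h]
    push_cast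
    linarith

lemma summable_of_near {g : ℤ → ℝ} {x r : ℝ} (hg : ∀ j : ℤ, r ≤ |(j:ℝ) - x| → g j = 0) :
    Summable g :=
  summable_of_ne_finset_zero (support_subset_Icc_of_near hg)

lemma abs_tsum_le_of_near {g : ℤ → ℝ} {x r B : ℝ} (hr : 0 < r) (hB : 0 ≤ B)
    (hg : ∀ j : ℤ, r ≤ |(j:ℝ) - x| → g j = 0) (hb : ∀ j : ℤ, |(j:ℝ) - x| < r → |g j| ≤ B) :
    |∑' j, g j| ≤ (2 * r + 1) * B := by
  rw [tsum_eq_sum (support_subset_Icc_of_near hg)]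
  refine (Finset.abs_sum_le_sum_abs _ _).trans ?_
  refine (Finset.sum_le_card_nsmul _ _ B fun j _ => ?_).trans ?_
  · rcases lt_or_ge (|(j:ℝ) - x|) r with h | h
    · exact hb j h
    · rw [hg j h]; simpa using hB
  · rw [nsmul_eq_mul]
    gcongr
    exact card_Icc_near_le hr

namespace LipSupp
variable {k : ℝ → ℝ} {L ρ : ℝ}

lemma mono (hk : LipSupp k L ρ) {L' ρ' : ℝ} (hL : L ≤ L') (hρ : ρ ≤ ρ') : LipSupp k L' ρ' where
  lip x y := (hk.lip x y).trans (by gcongr)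
  supp x hx := hk.supp x (hρ.trans hx)
  L_pos := hk.L_pos.trans_le hL
  ρ_pos := hk.ρ_pos.trans_le hρ

lemma integral_eq_zero_of_odd (hodd : ∀ x, k (-x) = -k x) : ∫ x, k x = 0 := by
  have h := integral_neg_eq_self k volume
  simp_rw [hodd] at h
  rw [integral_neg] at h
  linarith

end LipSupp

namespace Kernels
variable {ik k w : ℝ → ℝ} {L ρ : ℝ}

lemma k_odd (K : Kernels ik k w L ρ) (x : ℝ) : k (-x) = -k x := by
  have h1 := (K.deriv_ik (-x)).comp x (hasDerivAt_neg x)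
  have h2 : ik ∘ Neg.neg = ik := funext K.ik_even
  rw [h2] at h1
  have := h1.unique (K.deriv_ik x)
  linarith

lemma hil_even (K : Kernels ik k w L ρ) (x : ℝ) : hil k (-x) = hil k x := by
  unfold hil
  congr 1
  refine setIntegral_congr_fun measurableSet_Ioi fun s _ => ?_
  rw [show -x + s = -(x - s) by ring, show -x - s = -(x + s) by ring, K.k_odd, K.k_odd]
  ring

lemma exists_abs_hil_le (K : Kernels ik k w L ρ) : ∃ C, 0 < C ∧ ∀ u, |hil k u| ≤ C / (1 + u ^ 2) :=
  K.k_lip.exists_abs_hil_le_sq (LipSupp.integral_eq_zero_of_odd K.k_odd)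

lemma term_eq_zero (K : Kernels ik k w L ρ) (u v : ℝ) (j : ℤ) (h : ρ ≤ |(j:ℝ) - (u + v)|) :
    hil k (u - j) * w (j - u - v) = 0 := by
  rw [K.w_lip.supp (j - u - v) (by rwa [sub_sub]), mul_zero]

lemma summable_term (K : Kernels ik k w L ρ) (u v : ℝ) :
    Summable fun j : ℤ => hil k (u - j) * w (j - u - v) :=
  summable_of_near (K.term_eq_zero u v)

lemma latKer_add_one (u v : ℝ) : latKer k w (u + 1) v = latKer k w u v := by
  unfold latKer
  rw [← (Equiv.addRight (1:ℤ)).tsum_eq]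
  refine tsum_congr fun j => ?_
  simp only [Equiv.coe_addRight, Int.cast_add, Int.cast_one]
  congr 2 <;> ring

lemma one_add_sq_le {v x r : ℝ} (h : |v - x| ≤ r) : 1 + v ^ 2 ≤ 2 * (1 + r ^ 2) * (1 + x ^ 2) := by
  have h1 : (v - x) ^ 2 ≤ r ^ 2 := by
    rw [← sq_abs]; gcongr
  nlinarith [sq_nonneg (v - 2 * x), mul_nonneg (sq_nonneg r) (sq_nonneg x)]

lemma exists_abs_latKer_le (K : Kernels ik k w L ρ) :
    ∃ C, 0 < C ∧ ∀ u v, |latKer k w u v| ≤ C / (1 + v ^ 2) := by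
  obtain ⟨C, hC, hh⟩ := K.exists_abs_hil_le
  have hρ := K.w_lip.ρ_pos
  have hL := K.w_lip.L_pos
  refine ⟨(2 * ρ + 1) * (2 * (1 + ρ ^ 2) * C * (2 * L * ρ)), by positivity, fun u v => ?_⟩
  rw [mul_div_assoc]
  refine abs_tsum_le_of_near hρ (by positivity) (K.term_eq_zero u v) fun j hj => ?_
  rw [abs_mul]
  have h1 : |hil k (u - j)| ≤ 2 * (1 + ρ ^ 2) * C / (1 + v ^ 2) := by
    refine (hh _).trans ?_
    rw [div_le_div_iff₀ (by positivity) (by positivity)]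
    have := one_add_sq_le (v := v) (x := -(u - j)) (r := ρ) (by
      rw [abs_sub_comm] at hj; rw [show v - -(u - j) = u + v - j by ring]; exact hj.le)
    rw [neg_sq] at this
    nlinarith
  calc _ ≤ 2 * (1 + ρ ^ 2) * C / (1 + v ^ 2) * (2 * L * ρ) :=
        mul_le_mul h1 (K.w_lip.bound _) (abs_nonneg _) (by positivity)
    _ = _ := by ring

lemma exists_abs_latKer_sub_le (K : Kernels ik k w L ρ) :
    ∃ C, 0 < C ∧ ∀ u v v', |latKer k w u v - latKer k w u v'| ≤
      C * |v - v'| * (1 / (1 + v ^ 2) + 1 / (1 + v' ^ 2)) := by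
  obtain ⟨C, hC, hh⟩ := K.exists_abs_hil_le
  obtain ⟨C', hC', hb⟩ := K.exists_abs_latKer_le
  have hρ := K.w_lip.ρ_pos
  have hL := K.w_lip.L_pos
  refine ⟨C' + (2 * (ρ + 1) + 1) * (2 * (1 + (ρ + 1) ^ 2) * C * L), by positivity, fun u v v' => ?_⟩
  rcases le_or_gt 1 |v - v'| with h | h
  · refine (abs_sub _ _).trans ((add_le_add (hb u v) (hb u v')).trans ?_)
    rw [div_eq_mul_one_div C', div_eq_mul_one_div C', ← mul_add]
    gcongr
    have : 0 ≤ (2 * (ρ + 1) + 1) * (2 * (1 + (ρ + 1) ^ 2) * C * L) := by positivity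
    nlinarith
  · unfold latKer
    rw [← (K.summable_term u v).tsum_sub (K.summable_term u v')]
    have := abs_tsum_le_of_near (g := fun j : ℤ => hil k (u - j) * w (j - u - v) -
      hil k (u - j) * w (j - u - v')) (x := u + v) (r := ρ + 1)
      (B := 2 * (1 + (ρ + 1) ^ 2) * C / (1 + v ^ 2) * (L * |v - v'|)) (by positivity) (by positivity)
      (by
        intro j hj
        rw [K.term_eq_zero u v j (by linarith), K.term_eq_zero u v' j, sub_zero]
        have := abs_sub_abs_le_abs_sub ((j:ℝ) - (u + v)) ((j:ℝ) - (u + v'))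
        rw [show (j:ℝ) - (u + v) - (j - (u + v')) = -(v - v') by ring, abs_neg] at this
        linarith)
      (by
        intro j hj
        rw [← mul_sub, abs_mul]
        have h1 : |hil k (u - j)| ≤ 2 * (1 + (ρ + 1) ^ 2) * C / (1 + v ^ 2) := by
          refine (hh _).trans ?_
          rw [div_le_div_iff₀ (by positivity) (by positivity)]
          have := one_add_sq_le (v := v) (x := -(u - j)) (r := ρ + 1) (by
            rw [abs_sub_comm] at hj; rw [show v - -(u - j) = u + v - j by ring]; exact hj.le)
          rw [neg_sq] at this
          nlinarith
        refine mul_le_mul h1 ((K.w_lip.lip _ _).trans (le_of_eq ?_)) (abs_nonneg _) (by positivity)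
        rw [show (j:ℝ) - u - v - (j - u - v') = -(v - v') by ring, abs_neg])
    refine this.trans ?_
    have e : (2 * (ρ + 1) + 1) * (2 * (1 + (ρ + 1) ^ 2) * C / (1 + v ^ 2) * (L * |v - v'|)) =
      (2 * (ρ + 1) + 1) * (2 * (1 + (ρ + 1) ^ 2) * C * L) * |v - v'| * (1 / (1 + v ^ 2)) := by
      field_simp
    rw [e]
    gcongr
    · linarith
    · have : 0 ≤ 1 / (1 + v' ^ 2) := by positivity
      linarith

lemma uniformContinuous_hil (K : Kernels ik k w L ρ) : UniformContinuous (hil k) := by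
  obtain ⟨C, hC, hh⟩ := K.exists_abs_hil_le
  refine K.k_lip.continuous_hil.uniformContinuous_of_tendsto_cocompact (x := 0) ?_
  refine squeeze_zero_norm hh (tendsto_const_nhds.div_atTop ?_)
  refine tendsto_atTop_add_const_left _ _ ?_
  have := (tendsto_pow_atTop (α := ℝ) two_ne_zero).comp (tendsto_norm_cocompact_atTop (E := ℝ))
  simpa [Function.comp_def] using this

lemma latKer_uniform (K : Kernels ik k w L ρ) {η : ℝ} (hη : 0 < η) :
    ∃ δ > 0, ∀ u u' v, |u - u'| < δ → |latKer k w u v - latKer k w u' v| ≤ η := by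
  obtain ⟨C, hC, hh⟩ := K.exists_abs_hil_le
  have hρ := K.w_lip.ρ_pos
  have hL := K.w_lip.L_pos
  set N := 2 * (ρ + 1) + 1 with hN
  have hN0 : 0 < N := by positivity
  obtain ⟨δ, hδ, hu⟩ := Metric.uniformContinuous_iff.1 K.uniformContinuous_hil
    (η / (2 * N * (2 * L * ρ))) (by positivity)
  refine ⟨min (min δ 1) (η / (2 * N * C * L)), by positivity, fun u u' v huu => ?_⟩
  have h1 := huu.trans_le ((min_le_left _ _).trans (min_le_left _ _))
  have h2 := huu.trans_le ((min_le_left _ _).trans (min_le_right _ _))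
  have h3 := huu.trans_le (min_le_right _ _)
  unfold latKer
  rw [← (K.summable_term u v).tsum_sub (K.summable_term u' v)]
  have := abs_tsum_le_of_near (g := fun j : ℤ => hil k (u - j) * w (j - u - v) -
      hil k (u' - j) * w (j - u' - v)) (x := u + v) (r := ρ + 1)
      (B := η / N) (by positivity) (by positivity)
      (by
        intro j hj
        rw [K.term_eq_zero u v j (by linarith), K.term_eq_zero u' v j, sub_zero]
        have := abs_sub_abs_le_abs_sub ((j:ℝ) - (u + v)) ((j:ℝ) - (u' + v))
        rw [show (j:ℝ) - (u + v) - (j - (u' + v)) = -(u - u') by ring, abs_neg] at this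
        linarith)
      (by
        intro j hj
        have e : hil k (u - j) * w (j - u - v) - hil k (u' - j) * w (j - u' - v) =
          (hil k (u - j) - hil k (u' - j)) * w (j - u - v) +
          hil k (u' - j) * (w (j - u - v) - w (j - u' - v)) := by ring
        rw [e]
        refine (abs_add_le _ _).trans ?_
        rw [abs_mul, abs_mul]
        have b1 : |hil k (u - j) - hil k (u' - j)| ≤ η / (2 * N * (2 * L * ρ)) := by
          have := hu (a := u - j) (b := u' - j) (by
            rw [Real.dist_eq]; rwa [show u - j - (u' - j) = u - u' by ring])
          rw [Real.dist_eq] at this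
          exact this.le
        have b2 : |hil k (u' - j)| ≤ C := (hh _).trans (div_le_self hC.le (by nlinarith [sq_nonneg (u' - (j:ℝ))]))
        have b3 : |w (j - u - v) - w (j - u' - v)| ≤ L * (η / (2 * N * C * L)) := by
          refine (K.w_lip.lip _ _).trans ?_
          rw [show (j:ℝ) - u - v - (j - u' - v) = -(u - u') by ring, abs_neg]
          gcongr
        have c1 := mul_le_mul b1 (K.w_lip.bound (j - u - v)) (abs_nonneg _) (by positivity)
        have c2 := mul_le_mul b2 b3 (abs_nonneg _) hC.le
        refine (add_le_add c1 c2).trans (le_of_eq ?_)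
        field_simp
        ring)
  refine this.trans (le_of_eq ?_)
  rw [← hN]
  field_simp

lemma continuous_latKer (K : Kernels ik k w L ρ) : Continuous (Function.uncurry (latKer k w)) := by
  obtain ⟨C, hC, hl⟩ := K.exists_abs_latKer_sub_le
  rw [Metric.continuous_iff]
  rintro ⟨u, v⟩ η hη
  obtain ⟨δ, hδ, hu⟩ := K.latKer_uniform (half_pos hη)
  refine ⟨min δ (η / (4 * C)), by positivity, ?_⟩
  rintro ⟨u', v'⟩ h
  rw [Prod.dist_eq, max_lt_iff, Real.dist_eq, Real.dist_eq] at h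
  rw [Real.dist_eq]
  simp only [Function.uncurry_apply_pair]
  have h1 := hu u' u v' (h.1.trans_le (min_le_left _ _))
  have h2 := hl u v' v
  have h3 : |v' - v| < η / (4 * C) := h.2.trans_le (min_le_right _ _)
  have h4 : ∀ x : ℝ, 1 / (1 + x ^ 2) ≤ 1 := fun x => by
    rw [div_le_one (by positivity)]; nlinarith [sq_nonneg x]
  have h5 : C * |v' - v| * (1 / (1 + v' ^ 2) + 1 / (1 + v ^ 2)) ≤ C * |v' - v| * 2 := by
    gcongr; linarith [h4 v, h4 v']
  have h6 : C * |v' - v| * 2 < η / 2 := by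
    rw [lt_div_iff₀ (by positivity)] at h3
    linarith
  have := abs_sub_le (latKer k w u' v') (latKer k w u v') (latKer k w u v)
  linarith

end Kernels

lemma conv1_comm (f g : ℝ → ℝ) (x : ℝ) : conv1 f g x = ∫ y, f (x - y) * g y := by
  unfold conv1
  rw [← integral_sub_left_eq_self (fun y => f y * g (x - y)) volume x]
  simp

namespace LipSupp
variable {f w : ℝ → ℝ} {L ρ : ℝ}

lemma conv1 (hf : LipSupp f L ρ) (hw : LipSupp w L ρ) :
    LipSupp (conv1 f w) (L * (∫ y, |f y|) + 1) (2 * ρ) where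
  lip x x' := by
    have hfc := hf.continuous
    have hwc := hw.continuous
    have hi : ∀ x, Integrable fun y => f y * w (x - y) := fun x =>
      (show Continuous fun y => f y * w (x - y) by fun_prop).integrable_of_hasCompactSupport
        hf.hasCompactSupport.mul_right
    unfold _root_.conv1
    rw [← integral_sub (hi x) (hi x'), ← Real.norm_eq_abs]
    refine (norm_integral_le_of_norm_le ((hf.integrable.abs).const_mul (L * |x - x'|))
      (ae_of_all _ fun y => ?_)).trans ?_
    · rw [← mul_sub, Real.norm_eq_abs, abs_mul, mul_comm]
      gcongr
      have := hw.lip (x - y) (x' - y)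
      rwa [show x - y - (x' - y) = x - x' by ring] at this
    · rw [integral_const_mul]
      nlinarith [abs_nonneg (x - x')]
  supp x hx := by
    unfold _root_.conv1
    have : ∀ y, f y * w (x - y) = 0 := fun y => by
      rcases le_or_gt ρ |y| with h | h
      · rw [hf.supp y h, zero_mul]
      · rw [hw.supp (x - y), mul_zero]
        have := abs_sub_abs_le_abs_sub x y
        linarith
    simp [this]
  L_pos := by
    have : 0 ≤ ∫ y, |f y| := integral_nonneg fun _ => abs_nonneg _
    have := hf.L_pos
    positivity
  ρ_pos := by
    have := hf.ρ_pos
    positivity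

lemma hil_conv1 (hf : LipSupp f L ρ) (hw : LipSupp w L ρ) (v : ℝ) :
    hil (_root_.conv1 f w) v = ∫ y, hil f (v - y) * w y := by
  have hfc := hf.continuous
  have hwc := hw.continuous
  have hi : ∀ x, Integrable fun y => f (x - y) * w y := fun x =>
    (show Continuous fun y => f (x - y) * w y by fun_prop).integrable_of_hasCompactSupport
      hw.hasCompactSupport.mul_left
  have hint : Integrable (Function.uncurry fun s y => (f (v - y + s) - f (v - y - s)) / s * w y)
      ((volume.restrict (Set.Ioi 0)).prod volume) := by
    have hb := (integrable_indicator_const (2 * L) (|v| + ρ + ρ)).mul_prod hw.integrable.abs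
    refine hb.mono' ?_ (ae_of_all _ ?_)
    · refine Measurable.aestronglyMeasurable ?_
      have := hfc.measurable
      have := hwc.measurable
      simp only [Function.uncurry_def]
      fun_prop
    · rintro ⟨s, y⟩
      simp only [Function.uncurry_apply_pair]
      rcases le_or_gt ρ |y| with h | h
      · simp [hw.supp y h]
      · rw [norm_mul, Real.norm_eq_abs (w y)]
        gcongr
        refine hf.abs_diffQuot_le_indicator ?_
        exact (abs_sub _ _).trans (by linarith)
  have h1 : ∀ s ∈ Set.Ioi (0:ℝ), (_root_.conv1 f w (v + s) - _root_.conv1 f w (v - s)) / s =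
      ∫ y, (f (v - y + s) - f (v - y - s)) / s * w y := by
    intro s _
    rw [conv1_comm, conv1_comm, ← integral_sub (hi _) (hi _), ← integral_div]
    refine integral_congr_ae (ae_of_all _ fun y => ?_)
    simp only
    rw [show v + s - y = v - y + s by ring, show v - s - y = v - y - s by ring]
    ring
  unfold hil
  rw [setIntegral_congr_fun measurableSet_Ioi h1, integral_integral_swap hint, ← integral_const_mul]
  refine integral_congr_ae (ae_of_all _ fun y => ?_)
  simp only
  rw [integral_mul_const, mul_assoc]

end LipSupp

namespace Kernels
variable {ik k w : ℝ → ℝ} {L ρ : ℝ}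

lemma hasDerivAt_conv1 (K : Kernels ik k w L ρ) (x₀ : ℝ) :
    HasDerivAt (conv1 ik w) (conv1 k w x₀) x₀ := by
  have hic := K.ik_lip.continuous
  have hkc := K.k_lip.continuous
  have hwc := K.w_lip.continuous
  have e : conv1 ik w = fun x => ∫ y, ik (x - y) * w y := funext fun x => conv1_comm ik w x
  rw [e, conv1_comm]
  refine (hasDerivAt_integral_of_dominated_loc_of_deriv_le (F' := fun x y => k (x - y) * w y)
    (bound := fun y => 2 * L * ρ * |w y|) univ_mem ?_ ?_ ?_ ?_ ?_ ?_).2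
  · exact Eventually.of_forall fun x =>
      (show Continuous fun y => ik (x - y) * w y by fun_prop).aestronglyMeasurable
  · exact (show Continuous fun y => ik (x₀ - y) * w y by fun_prop).integrable_of_hasCompactSupport
      K.w_lip.hasCompactSupport.mul_left
  · exact (show Continuous fun y => k (x₀ - y) * w y by fun_prop).aestronglyMeasurable
  · refine ae_of_all _ fun y x _ => ?_
    rw [Real.norm_eq_abs, abs_mul]
    gcongr
    exact K.k_lip.bound _
  · exact K.w_lip.integrable.abs.const_mul _
  · exact ae_of_all _ fun y x _ => ((K.deriv_ik (x - y)).comp_sub_const x y).mul_const _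

lemma conv1_even (K : Kernels ik k w L ρ) (x : ℝ) : conv1 ik w (-x) = conv1 ik w x := by
  unfold conv1
  rw [← integral_neg_eq_self]
  refine integral_congr_ae (ae_of_all _ fun y => ?_)
  simp only
  rw [K.ik_even, show -x - -y = -(x - y) by ring, K.w_even]

lemma tsum_k_eq_zero (K : Kernels ik k w L ρ) (u : ℝ) : ∑' j : ℤ, k (u - j) = 0 := by
  have hρ := K.ik_lip.ρ_pos
  set S := Finset.Icc ⌈u - (ρ + 1)⌉ ⌊u + (ρ + 1)⌋ with hS
  have h1 : HasDerivAt (fun x => ∑ j ∈ S, ik (x - j)) (∑ j ∈ S, k (u - j)) u :=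
    HasDerivAt.fun_sum fun j _ => (K.deriv_ik (u - j)).comp_sub_const u _
  have h2 : (fun x => ∑ j ∈ S, ik (x - j)) =ᶠ[𝓝 u] fun _ => 1 := by
    filter_upwards [Metric.ball_mem_nhds u one_pos] with x hx
    rw [Metric.mem_ball, Real.dist_eq] at hx
    rw [← K.exact x, tsum_eq_sum]
    refine support_subset_Icc_of_near fun j hj => K.ik_lip.supp _ ?_
    have := abs_sub_abs_le_abs_sub ((j:ℝ) - u) (j - x)
    rw [show (j:ℝ) - u - (j - x) = x - u by ring] at this
    rw [abs_sub_comm]; linarith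
  have h3 := (h1.congr_of_eventuallyEq h2.symm).unique (hasDerivAt_const u (1:ℝ))
  rw [tsum_eq_sum, h3]
  refine support_subset_Icc_of_near fun j hj => K.k_lip.supp _ ?_
  rw [abs_sub_comm]; linarith

lemma summable_hil (K : Kernels ik k w L ρ) (u : ℝ) : Summable fun j : ℤ => hil k (u - j) := by
  obtain ⟨C, hC, hh⟩ := K.exists_abs_hil_le
  have h1 : Summable fun j : ℤ => 2 * (1 + u ^ 2) * C * (1 / (1 + (j:ℝ) ^ 2)) := by
    refine Summable.mul_left _ ?_
    refine Summable.of_norm_bounded_eventually (g := fun j : ℤ => 1 / (j:ℝ) ^ 2)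
      (Real.summable_one_div_int_pow.2 one_lt_two) ?_
    have : ∀ᶠ j : ℤ in cofinite, j ≠ 0 :=
      (Set.finite_singleton (0:ℤ)).eventually_cofinite_notMem
    filter_upwards [this] with j hj
    have : (j:ℝ) ≠ 0 := by exact_mod_cast hj
    rw [Real.norm_of_nonneg (by positivity)]
    gcongr
    linarith
  refine Summable.of_norm_bounded h1 fun j => (hh _).trans ?_
  rw [mul_one_div, div_le_div_iff₀ (by positivity) (by positivity)]
  have := one_add_sq_le (v := (j:ℝ)) (x := -(u - j)) (r := |u|) (by
    rw [show (j:ℝ) - -(u - j) = u by ring])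
  rw [neg_sq, sq_abs] at this
  nlinarith

lemma tsum_hil_eq_zero (K : Kernels ik k w L ρ) (u : ℝ) : ∑' j : ℤ, hil k (u - j) = 0 := by
  have hρ := K.k_lip.ρ_pos
  have hL := K.k_lip.L_pos
  have hπ := Real.pi_pos
  set S : ℕ → Finset ℤ := fun N => Finset.Icc (-(N:ℤ)) N with hS
  have hsum := (K.summable_hil u).hasSum
  have ht : Tendsto (fun N => ∑ j ∈ S N, hil k (u - j)) atTop (𝓝 (∑' j : ℤ, hil k (u - j))) :=
    hsum.comp (Finset.tendsto_Icc_neg (R := ℤ))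
  refine tendsto_nhds_unique ht ?_
  set T : ℕ → ℝ → ℝ := fun N x => ∑ j ∈ S N, k (x - j) with hT
  set M := (2 * ρ + 1) * (2 * L * ρ) with hM
  have hM0 : 0 < M := by positivity
  have hTb : ∀ N x, |T N x| ≤ M := by
    intro N x
    have e : T N x = ∑' j : ℤ, (if j ∈ S N then k (x - j) else 0) := by
      rw [tsum_eq_sum (s := S N) (by intro b hb; simp [hb])]
      exact Finset.sum_congr rfl fun j hj => by simp [hj]
    rw [e]
    refine abs_tsum_le_of_near (x := x) hρ (by positivity) (fun j hj => ?_) (fun j _ => ?_)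
    · rw [K.k_lip.supp _ (by rwa [abs_sub_comm]), ite_self]
    · split_ifs
      · exact K.k_lip.bound _
      · simp; positivity
  have hTin : ∀ (N : ℕ) (x : ℝ), |x| ≤ N - ρ → T N x = 0 := by
    intro N x hx
    rw [← K.tsum_k_eq_zero x, tsum_eq_sum]
    intro j hj
    refine K.k_lip.supp _ ?_
    have hj' : (N:ℝ) < |(j:ℝ)| := by
      have : (N:ℤ) < |j| := by
        by_contra h
        push Not at h
        exact hj (Finset.mem_Icc.2 (abs_le.1 h))
      exact_mod_cast this
    have := abs_sub_abs_le_abs_sub (j:ℝ) x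
    rw [abs_sub_comm] at this
    linarith
  have hTout : ∀ (N : ℕ) (x : ℝ), N + ρ ≤ |x| → T N x = 0 := by
    intro N x hx
    refine Finset.sum_eq_zero fun j hj => K.k_lip.supp _ ?_
    have hj' : |(j:ℝ)| ≤ N := by
      have : |j| ≤ (N:ℤ) := abs_le.2 (Finset.mem_Icc.1 hj)
      exact_mod_cast this
    have := abs_sub_abs_le_abs_sub x (j:ℝ)
    linarith
  have hsumhil : ∀ N, ∑ j ∈ S N, hil k (u - j) = Real.pi⁻¹ * ∫ s in Set.Ioi (0:ℝ),
      (T N (u + s) - T N (u - s)) / s := by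
    intro N
    unfold hil
    rw [← Finset.mul_sum, ← integral_finsetSum _ fun j _ => K.k_lip.integrableOn_diffQuot _]
    congr 1
    refine setIntegral_congr_fun measurableSet_Ioi fun s _ => ?_
    simp only [hT]
    rw [← Finset.sum_sub_distrib, Finset.sum_div]
    refine Finset.sum_congr rfl fun j _ => ?_
    rw [show u - (j:ℝ) + s = u + s - j by ring, show u - (j:ℝ) - s = u - s - j by ring]
  simp_rw [hsumhil]
  have hden : Tendsto (fun N : ℕ => (N:ℝ) - ρ - |u|) atTop atTop := by
    have := tendsto_natCast_atTop_atTop (R := ℝ)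
    exact tendsto_atTop_add_const_right _ _ (tendsto_atTop_add_const_right _ _ this)
  have hlim : Tendsto (fun N : ℕ => Real.pi⁻¹ * (2 * M * (2 * (ρ + |u|)) / ((N:ℝ) - ρ - |u|)))
      atTop (𝓝 0) := by
    have := (hden.const_div_atTop (2 * M * (2 * (ρ + |u|)))).const_mul Real.pi⁻¹
    simpa using this
  refine squeeze_zero_norm' ?_ hlim
  filter_upwards [hden.eventually_gt_atTop 0] with N hN
  rw [norm_mul, Real.norm_of_nonneg (by positivity : 0 ≤ Real.pi⁻¹)]
  gcongr
  set A := (N:ℝ) - ρ - |u| with hA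
  set B := (N:ℝ) + ρ + |u| with hB
  have hAB : A ≤ B := by linarith [abs_nonneg u]
  have hz : ∀ s ∈ Set.Ioi (0:ℝ) \ Set.Icc A B, (T N (u + s) - T N (u - s)) / s = 0 := by
    intro s hs
    have hs0 : 0 < s := hs.1
    have ha := abs_add_le u s
    have hb := abs_sub u s
    have hc := abs_sub_abs_le_abs_sub s (-u)
    have hd := abs_sub_abs_le_abs_sub s u
    rw [abs_neg, sub_neg_eq_add, add_comm s u] at hc
    rw [abs_sub_comm s u] at hd
    rw [abs_of_pos hs0] at ha hb hc hd
    have h2 := hs.2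
    rw [Set.mem_Icc, not_and_or] at h2
    rcases h2 with h2 | h2
    · rw [hTin N (u + s) (by linarith), hTin N (u - s) (by linarith)]; simp
    · rw [hTout N (u + s) (by linarith), hTout N (u - s) (by linarith)]; simp
  rw [setIntegral_eq_of_subset_of_forall_sdiff_eq_zero measurableSet_Ioi
    (fun s hs => lt_of_lt_of_le hN hs.1) hz]
  refine (norm_setIntegral_le_of_norm_le_const (C := 2 * M / A) (by simp) fun s hs => ?_).trans ?_
  · have hs0 : 0 < s := lt_of_lt_of_le hN hs.1
    rw [norm_div, Real.norm_of_nonneg hs0.le]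
    have : ‖T N (u + s) - T N (u - s)‖ ≤ 2 * M := by
      refine (norm_sub_le _ _).trans ?_
      rw [Real.norm_eq_abs, Real.norm_eq_abs]
      linarith [hTb N (u + s), hTb N (u - s)]
    gcongr
    exact hs.1
  · rw [Real.volume_real_Icc_of_le hAB]
    apply le_of_eq
    rw [show B - A = 2 * (ρ + |u|) by rw [hA, hB]; ring]
    ring

lemma integral_latKer (K : Kernels ik k w L ρ) (u : ℝ) : ∫ v, latKer k w u v = 0 := by
  unfold latKer
  have hi : ∀ j : ℤ, Integrable fun v => w ((j:ℝ) - u - v) := fun j => K.w_lip.integrable.comp_sub_left _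
  have hn : ∀ j : ℤ, ∫ v, ‖hil k (u - j) * w (j - u - v)‖ = |hil k (u - j)| * ∫ v, |w v| := by
    intro j
    simp_rw [norm_mul, Real.norm_eq_abs]
    rw [integral_const_mul, integral_sub_left_eq_self (fun v => |w v|)]
  rw [← integral_tsum_of_summable_integral_norm (fun j => (hi j).const_mul _)]
  · simp_rw [integral_const_mul]
    have : ∀ j : ℤ, ∫ v, w ((j:ℝ) - u - v) = 1 := fun j => by
      rw [integral_sub_left_eq_self (fun v => w v), K.w_int]
    simp_rw [this, mul_one]
    exact K.tsum_hil_eq_zero u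
  · simp_rw [hn]
    exact (K.summable_hil u).abs.mul_right _

lemma latMean_eq_hil (K : Kernels ik k w L ρ) (v : ℝ) : latMean k w v = hil (conv1 k w) v := by
  rw [K.k_lip.hil_conv1 K.w_lip]
  set f : ℝ → ℝ := fun x => hil k x * w (-x - v) with hf
  have hfc : Continuous f := by
    have := K.k_lip.continuous_hil
    have := K.w_lip.continuous
    fun_prop
  have hfi : Integrable f := by
    refine hfc.integrable_of_hasCompactSupport ?_
    refine HasCompactSupport.mul_left ?_
    have := K.w_lip.hasCompactSupport.comp_homeomorph ((Homeomorph.neg ℝ).trans (Homeomorph.subRight v))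
    exact this
  have h1 : latMean k w v = ∫ x, f x := by
    have hs := hfi.hasSum_intervalIntegral_comp_add_int
    have hs' := hfi.norm.hasSum_intervalIntegral_comp_add_int
    simp_rw [intervalIntegral.integral_of_le zero_le_one] at hs hs'
    rw [← hs.tsum_eq, integral_tsum_of_summable_integral_norm _ hs'.summable]
    · unfold latMean
      rw [intervalIntegral.integral_of_le zero_le_one]
      refine setIntegral_congr_fun measurableSet_Ioc fun u _ => ?_
      unfold latKer
      rw [← (Equiv.neg ℤ).tsum_eq]
      refine tsum_congr fun j => ?_
      simp only [hf, Equiv.neg_apply, Int.cast_neg, sub_neg_eq_add]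
      congr 2; ring
    · intro n
      exact (show Continuous fun x : ℝ => f (x + n) by fun_prop).integrableOn_Ioc
  rw [h1, ← integral_sub_right_eq_self f v]
  refine integral_congr_ae (ae_of_all _ fun y => ?_)
  simp only [hf]
  rw [show -(y - v) - v = -y by ring, K.w_even, show y - v = -(v - y) by ring, K.hil_even]

end Kernels

section Equidistribution

/-- Uniform convergence of the Birkhoff averages of `F` under rotation by `l` to the mean of `F`. -/
def RotAverages (l : AddCircle (1:ℝ)) (F : C(AddCircle (1:ℝ), ℂ)) : Prop :=
  ∀ η > (0:ℝ), ∃ N₀ : ℕ, ∀ N ≥ N₀, ∀ u : AddCircle (1:ℝ),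
    ‖∑ j ∈ Finset.range N, F (u + j • l) - N * ∫ x, F x ∂AddCircle.haarAddCircle‖ ≤ η * N

lemma integrable_haarAddCircle (F : C(AddCircle (1:ℝ), ℂ)) :
    Integrable F (AddCircle.haarAddCircle) :=
  F.continuous.integrable_of_hasCompactSupport (HasCompactSupport.of_compactSpace _)

lemma RotAverages.fourier {l : AddCircle (1:ℝ)} (hl : ∀ n : ℤ, n ≠ 0 → n • l ≠ 0) (n : ℤ) :
    RotAverages l (fourier n) := by
  intro η hη
  by_cases hn : n = 0
  · subst hn
    refine ⟨0, fun N _ u => ?_⟩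
    simp only [fourier_zero, Finset.sum_const, Finset.card_range, nsmul_eq_mul, mul_one,
      integral_const, probReal_univ, one_smul, sub_self, norm_zero]
    positivity
  · have hint : ∫ x, (_root_.fourier n : C(AddCircle (1:ℝ), ℂ)) x ∂AddCircle.haarAddCircle = 0 := by
      have := integral_eq_zero_of_add_right_eq_neg (μ := AddCircle.haarAddCircle)
        (fourier_add_half_inv_index hn (zero_lt_one' ℝ))
      exact this
    have hq : (_root_.fourier n : C(AddCircle (1:ℝ), ℂ)) l ≠ 1 := by
      intro h
      apply hl n hn
      rw [fourier_apply] at h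
      apply AddCircle.injective_toCircle one_ne_zero
      rw [AddCircle.toCircle_zero]
      exact Circle.ext h
    set q := (_root_.fourier n : C(AddCircle (1:ℝ), ℂ)) l with hqdef
    have hsub : (0:ℝ) < ‖q - 1‖ := norm_pos_iff.2 (sub_ne_zero.2 hq)
    have hqn : ‖q‖ = 1 := by rw [hqdef, fourier_apply]; exact Circle.norm_coe _
    obtain ⟨N₀, hN₀⟩ := exists_nat_ge (2 / ‖q - 1‖ / η)
    refine ⟨N₀, fun N hN u => ?_⟩
    have hpow : ∀ j : ℕ, (_root_.fourier n : C(AddCircle (1:ℝ), ℂ)) (u + j • l)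
        = (_root_.fourier n : C(AddCircle (1:ℝ), ℂ)) u * q ^ j := by
      intro j
      induction j with
      | zero => simp
      | succ j ih =>
        have : u + (j + 1) • l = (u + j • l) + l := by rw [succ_nsmul, add_assoc]
        rw [this]
        simp only [fourier_apply, smul_add, AddCircle.toCircle_add, Circle.coe_mul] at ih hqdef ⊢
        rw [ih, hqdef, pow_succ, mul_assoc]
    rw [hint, mul_zero, sub_zero, Finset.sum_congr rfl fun j _ => hpow j, ← Finset.mul_sum,
      geom_sum_eq hq, norm_mul, norm_div]
    have h1 : ‖(_root_.fourier n : C(AddCircle (1:ℝ), ℂ)) u‖ = 1 := by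
      rw [fourier_apply]; exact Circle.norm_coe _
    have h2 : ‖q ^ N - 1‖ ≤ 2 := by
      refine (norm_sub_le _ _).trans ?_
      rw [norm_pow, hqn]; norm_num
    rw [h1, one_mul]
    have h3 : 2 / ‖q - 1‖ ≤ η * N := by
      have h4 : (N₀:ℝ) ≤ N := by exact_mod_cast hN
      have := hN₀.trans h4
      rwa [div_le_iff₀ hη, mul_comm] at this
    exact (div_le_div_of_nonneg_right h2 hsub.le).trans h3

lemma RotAverages.of_near {l : AddCircle (1:ℝ)} {F : C(AddCircle (1:ℝ), ℂ)}
    (h : ∀ η > (0:ℝ), ∃ G, RotAverages l G ∧ ‖F - G‖ ≤ η) : RotAverages l F := by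
  intro η hη
  obtain ⟨G, hG, hFG⟩ := h (η / 3) (by positivity)
  obtain ⟨N₀, hN₀⟩ := hG (η / 3) (by positivity)
  refine ⟨N₀, fun N hN u => ?_⟩
  have hpt : ∀ x, ‖F x - G x‖ ≤ η / 3 := fun x => ((F - G).norm_coe_le_norm x).trans hFG
  have h1 : ‖∑ j ∈ Finset.range N, F (u + j • l) - ∑ j ∈ Finset.range N, G (u + j • l)‖ ≤ N * (η / 3) := by
    rw [← Finset.sum_sub_distrib]
    refine (norm_sum_le_of_le _ fun j _ => hpt _).trans ?_
    simp
  have h2 : ‖(∫ x, F x ∂AddCircle.haarAddCircle) - ∫ x, G x ∂AddCircle.haarAddCircle‖ ≤ η / 3 := by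
    rw [← integral_sub (integrable_haarAddCircle F) (integrable_haarAddCircle G)]
    refine (norm_integral_le_of_norm_le_const (ae_of_all _ hpt)).trans ?_
    simp
  have h3 := hN₀ N hN u
  set a := ∑ j ∈ Finset.range N, F (u + j • l)
  set b := ∑ j ∈ Finset.range N, G (u + j • l)
  set c := ∫ x, F x ∂AddCircle.haarAddCircle
  set d := ∫ x, G x ∂AddCircle.haarAddCircle
  have h4 : ‖(N:ℂ) * (c - d)‖ ≤ N * (η / 3) := by
    rw [norm_mul, Complex.norm_natCast]
    gcongr
  calc ‖a - N * c‖ = ‖(a - b) + (b - N * d) - N * (c - d)‖ := by congr 1; ring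
    _ ≤ ‖a - b‖ + ‖b - N * d‖ + ‖(N:ℂ) * (c - d)‖ := (norm_sub_le _ _).trans (by gcongr; exact norm_add_le _ _)
    _ ≤ N * (η / 3) + η / 3 * N + N * (η / 3) := by gcongr
    _ = η * N := by ring

lemma RotAverages.add {l : AddCircle (1:ℝ)} {F G : C(AddCircle (1:ℝ), ℂ)}
    (hF : RotAverages l F) (hG : RotAverages l G) : RotAverages l (F + G) := by
  intro η hη
  obtain ⟨N₁, h₁⟩ := hF (η / 2) (by positivity)
  obtain ⟨N₂, h₂⟩ := hG (η / 2) (by positivity)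
  refine ⟨max N₁ N₂, fun N hN u => ?_⟩
  have e1 := h₁ N ((le_max_left _ _).trans hN) u
  have e2 := h₂ N ((le_max_right _ _).trans hN) u
  simp only [ContinuousMap.add_apply]
  rw [integral_add (integrable_haarAddCircle F) (integrable_haarAddCircle G), Finset.sum_add_distrib,
    mul_add, add_sub_add_comm]
  refine (norm_add_le _ _).trans ?_
  linarith

lemma RotAverages.smul {l : AddCircle (1:ℝ)} {F : C(AddCircle (1:ℝ), ℂ)}
    (hF : RotAverages l F) (c : ℂ) : RotAverages l (c • F) := by
  intro η hη
  obtain ⟨N₁, h₁⟩ := hF (η / (‖c‖ + 1)) (by positivity)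
  refine ⟨N₁, fun N hN u => ?_⟩
  have e1 := h₁ N hN u
  simp only [ContinuousMap.smul_apply, smul_eq_mul]
  rw [integral_const_mul, ← Finset.mul_sum, mul_left_comm, ← mul_sub, norm_mul]
  calc _ ≤ ‖c‖ * (η / (‖c‖ + 1) * N) := by gcongr
    _ = η * N * (‖c‖ / (‖c‖ + 1)) := by ring
    _ ≤ η * N * 1 := by gcongr; rw [div_le_one (by positivity)]; linarith
    _ = _ := mul_one _

lemma rotAverages {l : AddCircle (1:ℝ)} (hl : ∀ n : ℤ, n ≠ 0 → n • l ≠ 0)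
    (F : C(AddCircle (1:ℝ), ℂ)) : RotAverages l F := by
  have hspan : ∀ G ∈ Submodule.span ℂ (Set.range (@_root_.fourier (1:ℝ))), RotAverages l G := by
    intro G hG
    induction hG using Submodule.span_induction with
    | mem x hx => obtain ⟨n, rfl⟩ := hx; exact RotAverages.fourier hl n
    | zero => exact zero_smul ℂ (_root_.fourier (T := (1:ℝ)) 0) ▸ (RotAverages.fourier hl 0).smul 0
    | add x y _ _ hx hy => exact hx.add hy
    | smul c x _ hx => exact hx.smul c
  refine RotAverages.of_near fun η hη => ?_
  have h : F ∈ (Submodule.span ℂ (Set.range (@_root_.fourier (1:ℝ)))).topologicalClosure := by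
    rw [span_fourier_closure_eq_top]; trivial
  rw [← SetLike.mem_coe, Submodule.topologicalClosure_coe, Metric.mem_closure_iff] at h
  obtain ⟨G, hG, hd⟩ := h η hη
  exact ⟨G, hspan G hG, by rw [← dist_eq_norm]; exact hd.le⟩

/-- Weyl's equidistribution theorem, uniformly in the starting point. -/
theorem equidistribution {f : ℝ → ℝ} (hf : Continuous f) (hper : Function.Periodic f 1)
    {lam : ℝ} (hlam : Irrational lam) {η : ℝ} (hη : 0 < η) :
    ∃ N₀ : ℕ, ∀ N ≥ N₀, ∀ u : ℝ,
      |∑ j ∈ Finset.range N, f (u + j * lam) - N * ∫ x in (0:ℝ)..1, f x| ≤ η * N := by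
  have hcont : Continuous (hper.lift) := by
    exact continuous_coinduced_dom.2 hf
  let F : C(AddCircle (1:ℝ), ℂ) := ⟨fun x => (hper.lift x : ℂ), Complex.continuous_ofReal.comp hcont⟩
  have hl : ∀ n : ℤ, n ≠ 0 → n • (lam : AddCircle (1:ℝ)) ≠ 0 := by
    intro n hn h
    rw [← AddCircle.coe_zsmul, AddCircle.coe_eq_zero_iff] at h
    obtain ⟨m, hm⟩ := h
    apply (hlam.intCast_mul hn).ne_int m
    simpa using hm.symm
  obtain ⟨N₀, hN₀⟩ := rotAverages hl F η hη
  refine ⟨N₀, fun N hN u => ?_⟩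
  have h := hN₀ N hN (u : AddCircle (1:ℝ))
  have h1 : ∀ j : ℕ, F ((u : AddCircle (1:ℝ)) + j • (lam : AddCircle (1:ℝ))) = (f (u + j * lam) : ℂ) := by
    intro j
    rw [← AddCircle.coe_nsmul, ← AddCircle.coe_add, nsmul_eq_mul]
    rfl
  have h2 : ∫ x, F x ∂AddCircle.haarAddCircle = ((∫ x in (0:ℝ)..1, f x : ℝ) : ℂ) := by
    have h3 := AddCircle.intervalIntegral_preimage (1:ℝ) 0 (fun x => F x)
    rw [AddCircle.volume_eq_smul_haarAddCircle, ENNReal.ofReal_one, one_smul, zero_add] at h3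
    rw [← h3, ← intervalIntegral.integral_ofReal]
    rfl
  rw [Finset.sum_congr rfl fun j _ => h1 j, h2] at h
  rw [← Real.norm_eq_abs, ← Complex.norm_real]
  push_cast
  exact h

end Equidistribution

namespace Kernels
variable {ik k w : ℝ → ℝ} {L ρ : ℝ}

lemma abs_latMean_le {C : ℝ} (hC : ∀ u v, |latKer k w u v| ≤ C / (1 + v ^ 2)) (v : ℝ) :
    |latMean k w v| ≤ C / (1 + v ^ 2) := by
  have := intervalIntegral.norm_integral_le_of_norm_le_const (a := 0) (b := 1)
    (f := fun u => latKer k w u v) (C := C / (1 + v ^ 2)) fun u _ => by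
      rw [Real.norm_eq_abs]; exact hC u v
  simpa [latMean] using this

lemma continuous_latKer_left (K : Kernels ik k w L ρ) (v : ℝ) :
    Continuous fun u => latKer k w u v :=
  K.continuous_latKer.comp (continuous_id.prodMk continuous_const)

lemma abs_latMean_sub_le (K : Kernels ik k w L ρ) {v v' B : ℝ}
    (hB : ∀ u, |latKer k w u v - latKer k w u v'| ≤ B) :
    |latMean k w v - latMean k w v'| ≤ B := by
  unfold latMean
  rw [← intervalIntegral.integral_sub ((K.continuous_latKer_left v).intervalIntegrable _ _)
    ((K.continuous_latKer_left v').intervalIntegrable _ _)]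
  have := intervalIntegral.norm_integral_le_of_norm_le_const (a := 0) (b := 1)
    (f := fun u => latKer k w u v - latKer k w u v') (C := B) fun u _ => hB u
  simpa using this

/-- Averages of the reconstruction kernel along an irrational rotation converge uniformly. -/
theorem latKer_average (K : Kernels ik k w L ρ) {lam : ℝ} (hlam : Irrational lam) {η : ℝ}
    (hη : 0 < η) :
    ∃ N : ℕ, 0 < N ∧ ∀ u v : ℝ,
      |(N:ℝ)⁻¹ * ∑ j ∈ Finset.range N, latKer k w (u + j * lam) v - latMean k w v| ≤ η := by
  obtain ⟨C, hC, hb⟩ := K.exists_abs_latKer_le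
  obtain ⟨C', hC', hb'⟩ := K.exists_abs_latKer_sub_le
  have key : ∀ M : ℝ, ∃ N₀ : ℕ, ∀ N ≥ N₀, ∀ v ∈ Set.Icc (-M) M, ∀ u : ℝ,
      |∑ j ∈ Finset.range N, latKer k w (u + j * lam) v - N * latMean k w v| ≤ η * N := by
    intro M
    refine isCompact_Icc.induction_on (p := fun s => ∃ N₀ : ℕ, ∀ N ≥ N₀, ∀ v ∈ s, ∀ u : ℝ,
      |∑ j ∈ Finset.range N, latKer k w (u + j * lam) v - N * latMean k w v| ≤ η * N) ?_ ?_ ?_ ?_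
    · exact ⟨0, by simp⟩
    · rintro s t hst ⟨N₀, h⟩
      exact ⟨N₀, fun N hN v hv => h N hN v (hst hv)⟩
    · rintro s t ⟨N₁, h₁⟩ ⟨N₂, h₂⟩
      refine ⟨max N₁ N₂, fun N hN v hv => ?_⟩
      rcases hv with hv | hv
      · exact h₁ N ((le_max_left _ _).trans hN) v hv
      · exact h₂ N ((le_max_right _ _).trans hN) v hv
    · intro v _
      obtain ⟨N₀, hN₀⟩ := equidistribution (K.continuous_latKer_left v)
        (fun u => latKer_add_one u v) hlam (η := η / 3) (by positivity)
      refine ⟨_, mem_nhdsWithin_of_mem_nhds (Metric.ball_mem_nhds v (ε := η / (6 * C')) (by positivity)),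
        N₀, fun N hN v' hv' u => ?_⟩
      have hd : |v' - v| ≤ η / (6 * C') := by
        rw [← Real.dist_eq]; exact (Metric.mem_ball.1 hv').le
      have hpt : ∀ u, |latKer k w u v' - latKer k w u v| ≤ η / 3 := by
        intro u
        refine (hb' u v' v).trans ?_
        have e1 : 1 / (1 + v' ^ 2) ≤ 1 := by rw [div_le_one (by positivity)]; nlinarith
        have e2 : 1 / (1 + v ^ 2) ≤ 1 := by rw [div_le_one (by positivity)]; nlinarith
        calc C' * |v' - v| * (1 / (1 + v' ^ 2) + 1 / (1 + v ^ 2)) ≤ C' * (η / (6 * C')) * (1 + 1) := by gcongr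
          _ = η / 3 := by field_simp; ring
      have h1 : |∑ j ∈ Finset.range N, latKer k w (u + j * lam) v'
          - ∑ j ∈ Finset.range N, latKer k w (u + j * lam) v| ≤ N * (η / 3) := by
        rw [← Finset.sum_sub_distrib]
        refine (Finset.abs_sum_le_sum_abs _ _).trans ?_
        refine (Finset.sum_le_card_nsmul _ _ (η / 3) fun j _ => hpt _).trans ?_
        simp
      have h2 := K.abs_latMean_sub_le hpt
      have h3 := hN₀ N hN u
      change |_ - (N:ℝ) * latMean k w v| ≤ _ at h3
      have h4 : |(N:ℝ) * (latMean k w v' - latMean k w v)| ≤ N * (η / 3) := by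
        rw [abs_mul, Nat.abs_cast]; gcongr
      rw [abs_le] at *
      constructor <;> nlinarith
  obtain ⟨N₀, hN₀⟩ := key (max 1 (2 * C / η))
  refine ⟨N₀ + 1, Nat.succ_pos _, fun u v => ?_⟩
  have hN : (0:ℝ) < ((N₀ + 1 : ℕ) : ℝ) := by exact_mod_cast Nat.succ_pos _
  by_cases hv : v ∈ Set.Icc (-(max 1 (2 * C / η))) (max 1 (2 * C / η))
  · have h := hN₀ (N₀ + 1) (Nat.le_succ _) v hv u
    rw [show ((N₀ + 1 : ℕ) : ℝ)⁻¹ * ∑ j ∈ Finset.range (N₀ + 1), latKer k w (u + j * lam) v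
      - latMean k w v = ((N₀ + 1 : ℕ) : ℝ)⁻¹ * (∑ j ∈ Finset.range (N₀ + 1), latKer k w (u + j * lam) v
      - ((N₀ + 1 : ℕ) : ℝ) * latMean k w v) by rw [mul_sub, inv_mul_cancel_left₀ hN.ne'], abs_mul, abs_inv, Nat.abs_cast]
    rw [inv_mul_le_iff₀ hN]
    linarith
  · rw [Set.mem_Icc, ← abs_le, not_le] at hv
    have hv1 : 1 ≤ |v| := (le_max_left _ _).trans hv.le
    have hv2 : 2 * C / η ≤ |v| := (le_max_right _ _).trans hv.le
    have hsq : |v| ≤ 1 + v ^ 2 := by rw [← sq_abs]; nlinarith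
    have hsmall : C / (1 + v ^ 2) ≤ η / 2 := by
      rw [div_le_iff₀ (by positivity)]
      rw [div_le_iff₀ hη] at hv2
      nlinarith
    have h1 : |((N₀ + 1 : ℕ) : ℝ)⁻¹ * ∑ j ∈ Finset.range (N₀ + 1), latKer k w (u + j * lam) v| ≤ η / 2 := by
      rw [abs_mul, abs_inv, Nat.abs_cast, inv_mul_le_iff₀ hN]
      refine (Finset.abs_sum_le_sum_abs _ _).trans ?_
      refine (Finset.sum_le_card_nsmul _ _ (η / 2) fun j _ => (hb _ v).trans hsmall).trans ?_
      simp
    have h2 := (abs_latMean_le hb v).trans hsmall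
    refine (abs_sub _ _).trans ?_
    linarith

end Kernels

/-- Kernels of mean zero in the second variable, decaying quadratically, and Hölder in the first. -/
structure OscKer (J : ℝ → ℝ → ℝ) (K γ : ℝ) : Prop where
  cont : Continuous (Function.uncurry J)
  bound : ∀ x V, |J x V| ≤ K / (1 + V ^ 2)
  holder : ∀ x x' V, |J x V - J x' V| ≤ K * |x - x'| ^ γ / (1 + V ^ 2)
  mean : ∀ x, ∫ V, J x V = 0

/-- The constant `∫ |t|^γ / (1 + t²) dt`. -/
noncomputable def momentConst (γ : ℝ) : ℝ := ∫ t : ℝ, |t| ^ γ / (1 + t ^ 2)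

lemma continuous_moment {γ : ℝ} (hγ : 0 < γ) : Continuous fun t : ℝ => |t| ^ γ / (1 + t ^ 2) :=
  (continuous_abs.rpow_const fun _ => Or.inr hγ.le).div (by fun_prop) fun t => by positivity

lemma integrable_moment {γ : ℝ} (hγ : 0 < γ) (hγ1 : γ < 1) :
    Integrable fun t : ℝ => |t| ^ γ / (1 + t ^ 2) := by
  have h := (integrable_one_add_norm (E := ℝ) (μ := volume) (r := 2 - γ)
    (by simp only [Module.finrank_self, Nat.cast_one]; linarith)).const_mul 2
  refine h.mono' (continuous_moment hγ).aestronglyMeasurable (ae_of_all _ fun t => ?_)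
  rw [Real.norm_eq_abs, Real.norm_eq_abs, abs_of_nonneg (by positivity), neg_sub]
  have h1 : (0:ℝ) < 1 + |t| := by positivity
  rw [Real.rpow_sub h1, div_le_iff₀ (by positivity)]
  have h2 : |t| ^ γ ≤ (1 + |t|) ^ γ := by gcongr; linarith
  have h3 : (1 + |t|) ^ (2:ℝ) ≤ 2 * (1 + t ^ 2) := by
    rw [Real.rpow_two, ← sq_abs t]; nlinarith [sq_nonneg (1 - |t|)]
  calc |t| ^ γ ≤ (1 + |t|) ^ γ := h2
    _ = (1 + |t|) ^ γ / (1 + |t|) ^ (2:ℝ) * (1 + |t|) ^ (2:ℝ) := by field_simp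
    _ ≤ (1 + |t|) ^ γ / (1 + |t|) ^ (2:ℝ) * (2 * (1 + t ^ 2)) := by gcongr
    _ = _ := by ring

lemma momentConst_nonneg (γ : ℝ) : 0 ≤ momentConst γ :=
  integral_nonneg fun t => by positivity

lemma integrable_scaledMoment {γ m : ℝ} (hγ : 0 < γ) (hγ1 : γ < 1) (hm : 0 < m) (p : ℝ) :
    Integrable (fun x : ℝ => |x - p| ^ γ / (1 + m ^ 2 * (x - p) ^ 2)) ∧
      ∫ x : ℝ, |x - p| ^ γ / (1 + m ^ 2 * (x - p) ^ 2) = m ^ (-(1 + γ)) * momentConst γ := by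
  have e : (fun x : ℝ => |x| ^ γ / (1 + m ^ 2 * x ^ 2))
      = fun x => m ^ (-γ) * (|m * x| ^ γ / (1 + (m * x) ^ 2)) := by
    funext x
    rw [abs_mul, abs_of_pos hm, Real.mul_rpow hm.le (abs_nonneg _), Real.rpow_neg hm.le, mul_pow]
    have : m ^ γ ≠ 0 := (Real.rpow_pos_of_pos hm _).ne'
    field_simp
  constructor
  · refine Integrable.comp_sub_right (f := fun x : ℝ => |x| ^ γ / (1 + m ^ 2 * x ^ 2)) ?_ p
    rw [e]
    exact ((integrable_moment hγ hγ1).comp_mul_left' hm.ne').const_mul _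
  · rw [integral_sub_right_eq_self (fun x : ℝ => |x| ^ γ / (1 + m ^ 2 * x ^ 2)) p, e,
      integral_const_mul, Measure.integral_comp_mul_left (fun x : ℝ => |x| ^ γ / (1 + x ^ 2)) m]
    rw [abs_of_pos (inv_pos.2 hm), smul_eq_mul, ← mul_assoc, neg_add, Real.rpow_add hm,
      Real.rpow_neg_one, mul_comm (m⁻¹)]
    rfl

lemma abs_integral_le_moment {γ m A p : ℝ} (hγ : 0 < γ) (hγ1 : γ < 1) (hm : 0 < m)
    {F : ℝ → ℝ} (hF : ∀ x, |F x| ≤ A * (|x - p| ^ γ / (1 + m ^ 2 * (x - p) ^ 2))) :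
    |∫ x, F x| ≤ A * (m ^ (-(1 + γ)) * momentConst γ) := by
  obtain ⟨h1, h2⟩ := integrable_scaledMoment hγ hγ1 hm p
  rw [← h2, ← integral_const_mul]
  exact norm_integral_le_of_norm_le (f := F) (h1.const_mul A) (ae_of_all _ fun x => hF x)

lemma integrable_of_abs_le_inv {m A p : ℝ} (hm : 0 < m) {F : ℝ → ℝ} (hFm : AEStronglyMeasurable F)
    (hF : ∀ x, |F x| ≤ A / (1 + m ^ 2 * (x - p) ^ 2)) : Integrable F := by
  have h : Integrable fun x : ℝ => A / (1 + m ^ 2 * (x - p) ^ 2) := by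
    refine Integrable.comp_sub_right (f := fun x : ℝ => A / (1 + m ^ 2 * x ^ 2)) ?_ p
    have := (integrable_inv_one_add_sq.comp_mul_left' hm.ne').const_mul A
    simpa only [mul_pow, div_eq_mul_inv] using this
  exact h.mono' hFm (ae_of_all _ hF)

lemma min_le_rpow {A B t γ z : ℝ} (hA : 0 ≤ A) (hB : 0 ≤ B) (ht : 0 ≤ t) (hγ : 0 < γ) (hγ1 : γ ≤ 1)
    (h1 : z ≤ A) (h2 : z ≤ B * t) : z ≤ (A + B) * t ^ γ := by
  have hp : 0 ≤ t ^ γ := Real.rpow_nonneg ht _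
  rcases le_total t 1 with h | h
  · have : t ≤ t ^ γ := by
      rcases ht.eq_or_lt with h0 | h0
      · rw [← h0]; exact Real.rpow_nonneg le_rfl _
      · simpa using Real.rpow_le_rpow_of_exponent_ge h0 h hγ1
    nlinarith
  · have : 1 ≤ t ^ γ := Real.one_le_rpow h hγ.le
    nlinarith [mul_nonneg hB hp]

namespace OscKer
variable {J : ℝ → ℝ → ℝ} {K γ : ℝ}

lemma K_nonneg (hJ : OscKer J K γ) : 0 ≤ K := by
  have := (abs_nonneg _).trans (hJ.bound 0 0)
  simpa using this

lemma continuous_comp (hJ : OscKer J K γ) {b : ℝ → ℝ} (hb : Continuous b) :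
    Continuous fun x => J x (b x) :=
  hJ.cont.comp (continuous_id.prodMk hb)

lemma bound_of_le (hJ : OscKer J K γ) {m x p V : ℝ} (hm : 0 ≤ m) (h : m * |x - p| ≤ |V|) (z : ℝ) :
    |J z V| ≤ K / (1 + m ^ 2 * (x - p) ^ 2) := by
  refine (hJ.bound z V).trans ?_
  have : m ^ 2 * (x - p) ^ 2 ≤ V ^ 2 := by
    rw [← sq_abs V, ← sq_abs (x - p), ← mul_pow]
    have := mul_nonneg hm (abs_nonneg (x - p))
    gcongr
  have := hJ.K_nonneg
  gcongr

/-- Lower bound on increments from a lower bound on the derivative. -/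
lemma mul_abs_sub_le {b b' : ℝ → ℝ} {m : ℝ} (hb : ∀ x, HasDerivAt b (b' x) x)
    (hm : ∀ x, m ≤ b' x) (x p : ℝ) : m * |x - p| ≤ |b x - b p| := by
  have key : ∀ x y, x ≤ y → m * (y - x) ≤ b y - b x := fun x y hxy =>
    mul_sub_le_image_sub_of_le_deriv (fun z => (hb z).differentiableAt)
      (fun z => by rw [(hb z).deriv]; exact hm z) hxy
  rcases le_total x p with h | h
  · rw [abs_of_nonpos (by linarith), abs_sub_comm]
    refine le_trans ?_ (le_abs_self _)
    linarith [key x p h]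
  · rw [abs_of_nonneg (by linarith)]
    exact (key p x h).trans (le_abs_self _)

/-- Oscillation estimate for a phase with derivative bounded below. -/
theorem transversal (hJ : OscKer J K γ) (hγ : 0 < γ) (hγ1 : γ < 1) {b b' : ℝ → ℝ} {m C₂ B : ℝ}
    (hm : 0 < m) (hb : ∀ x, HasDerivAt b (b' x) x) (hb'm : ∀ x, m ≤ b' x)
    (hb'C : ∀ x, b' x ≤ C₂ * m) (hb'L : ∀ x x', |b' x - b' x'| ≤ B * m * |x - x'|) :
    |∫ x, J x (b x)| ≤ K * (2 + C₂ + B) * (m ^ (-(1 + γ)) * momentConst γ) := by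
  have hK := hJ.K_nonneg
  have hbc : Continuous b := continuous_iff_continuousAt.2 fun x => (hb x).continuousAt
  have hdiff : Differentiable ℝ b := fun x => (hb x).differentiableAt
  have hmono : ∀ x y, x ≤ y → m * (y - x) ≤ b y - b x := fun x y hxy =>
    mul_sub_le_image_sub_of_le_deriv hdiff (fun z => by rw [(hb z).deriv]; exact hb'm z) hxy
  have hsurj : Function.Surjective b := by
    intro V
    have h1 := hmono 0 (|V - b 0| / m) (by positivity)
    have h2 := hmono (-(|V - b 0| / m)) 0 (by simp; positivity)
    have e : m * (|V - b 0| / m) = |V - b 0| := by field_simp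
    have := intermediate_value_univ (-(|V - b 0| / m)) (|V - b 0| / m) hbc
    apply this
    constructor <;> nlinarith [le_abs_self (V - b 0), neg_abs_le (V - b 0)]
  have hinj : Function.Injective b := by
    intro x y hxy
    have := mul_abs_sub_le hb hb'm x y
    rw [hxy, sub_self, abs_zero] at this
    have h0 : |x - y| ≤ 0 := by nlinarith
    linarith [abs_nonpos_iff.1 h0]
  obtain ⟨p, hp⟩ := hsurj 0
  have hlow : ∀ x, m * |x - p| ≤ |b x| := fun x => by
    simpa [hp] using mul_abs_sub_le hb hb'm x p
  have hC₂ : 1 ≤ C₂ := by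
    have := (hb'm 0).trans (hb'C 0)
    nlinarith
  have hB : 0 ≤ B := by
    have h := (abs_nonneg _).trans (hb'L 1 0)
    simp only [sub_zero, abs_one, mul_one] at h
    nlinarith
  have hpp : 0 < b' p := hm.trans_le (hb'm p)
  have hb'c : Continuous b' := by
    have : LipschitzWith (Real.toNNReal (B * m)) b' := LipschitzWith.of_dist_le_mul fun x y => by
      rw [Real.dist_eq, Real.dist_eq, Real.coe_toNNReal _ (by positivity)]
      exact hb'L x y
    exact this.continuous
  have hI0 : ∫ x, b' x * J p (b x) = 0 := by
    have h := integral_image_eq_integral_abs_deriv_smul (s := Set.univ) MeasurableSet.univ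
      (fun x _ => (hb x).hasDerivWithinAt) hinj.injOn (J p)
    rw [Set.image_univ, hsurj.range_eq, Measure.restrict_univ, hJ.mean] at h
    rw [h]
    refine integral_congr_ae (ae_of_all _ fun x => ?_)
    simp only [smul_eq_mul]
    rw [abs_of_pos (hm.trans_le (hb'm x))]
  have hint1 : Integrable fun x => J x (b x) :=
    integrable_of_abs_le_inv hm (hJ.continuous_comp hbc).aestronglyMeasurable
      fun x => hJ.bound_of_le hm.le (hlow x) x
  have hint2 : Integrable fun x => (b' p)⁻¹ * (b' x * J p (b x)) := by
    refine Integrable.const_mul ?_ _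
    refine integrable_of_abs_le_inv (A := C₂ * m * K) (p := p) hm ?_ fun x => ?_
    · exact (hb'c.mul (hJ.cont.comp (continuous_const.prodMk hbc))).aestronglyMeasurable
    · rw [abs_mul, mul_div_assoc]
      gcongr
      · rw [abs_of_pos (hm.trans_le (hb'm x))]; exact hb'C x
      · exact hJ.bound_of_le hm.le (hlow x) p
  have hsplit : ∫ x, J x (b x) = ∫ x, (J x (b x) - (b' p)⁻¹ * (b' x * J p (b x))) := by
    rw [integral_sub hint1 hint2, integral_const_mul, hI0, mul_zero, sub_zero]
  rw [hsplit]
  refine abs_integral_le_moment (p := p) hγ hγ1 hm fun x => ?_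
  have hden : 1 / (1 + b x ^ 2) ≤ 1 / (1 + m ^ 2 * (x - p) ^ 2) := by
    have : m ^ 2 * (x - p) ^ 2 ≤ b x ^ 2 := by
      rw [← sq_abs (b x), ← sq_abs (x - p), ← mul_pow]
      exact pow_le_pow_left₀ (by positivity) (hlow x) 2
    gcongr
  have h1 : |J x (b x) - J p (b x)| ≤ K * (|x - p| ^ γ / (1 + m ^ 2 * (x - p) ^ 2)) := by
    refine (hJ.holder _ _ _).trans ?_
    rw [mul_div_assoc, div_eq_mul_one_div, div_eq_mul_one_div (_ ^ γ)]
    gcongr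
  have h2 : |1 - (b' p)⁻¹ * b' x| ≤ (1 + C₂ + B) * |x - p| ^ γ := by
    refine min_le_rpow (by linarith) hB (abs_nonneg _) hγ hγ1.le ?_ ?_
    · have h3 : 0 ≤ (b' p)⁻¹ * b' x := by
        have := hm.trans_le (hb'm x)
        positivity
      have h4 : (b' p)⁻¹ * b' x ≤ C₂ := by
        rw [inv_mul_le_iff₀ hpp]
        nlinarith [hb'C x, hb'm p]
      rw [abs_le]; constructor <;> linarith
    · rw [show 1 - (b' p)⁻¹ * b' x = (b' p)⁻¹ * (b' p - b' x) by field_simp, abs_mul,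
        abs_of_pos (inv_pos.2 hpp), inv_mul_le_iff₀ hpp]
      refine (hb'L _ _).trans ?_
      rw [abs_sub_comm]
      have := mul_nonneg hB (abs_nonneg (x - p))
      nlinarith [hb'm p]
  have h3 : |J p (b x)| ≤ K / (1 + m ^ 2 * (x - p) ^ 2) := hJ.bound_of_le hm.le (hlow x) p
  calc |J x (b x) - (b' p)⁻¹ * (b' x * J p (b x))|
      = |(J x (b x) - J p (b x)) + (1 - (b' p)⁻¹ * b' x) * J p (b x)| := by congr 1; ring
    _ ≤ |J x (b x) - J p (b x)| + |1 - (b' p)⁻¹ * b' x| * |J p (b x)| := by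
      rw [← abs_mul]; exact abs_add_le _ _
    _ ≤ K * (|x - p| ^ γ / (1 + m ^ 2 * (x - p) ^ 2))
        + (1 + C₂ + B) * |x - p| ^ γ * (K / (1 + m ^ 2 * (x - p) ^ 2)) := by gcongr
    _ = _ := by ring

end OscKer

namespace OscKer
variable {J : ℝ → ℝ → ℝ} {K γ : ℝ}

lemma comp_neg (hJ : OscKer J K γ) : OscKer (fun x V => J (-x) V) K γ where
  cont := hJ.cont.comp (by fun_prop : Continuous fun q : ℝ × ℝ => (-q.1, q.2))
  bound x V := hJ.bound _ V
  holder x x' V := by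
    refine (hJ.holder _ _ V).trans_eq ?_
    rw [show -x - -x' = -(x - x') by ring, abs_neg]
  mean x := hJ.mean _

lemma neg_comp (hJ : OscKer J K γ) : OscKer (fun x V => J x (-V)) K γ where
  cont := hJ.cont.comp (by fun_prop : Continuous fun q : ℝ × ℝ => (q.1, -q.2))
  bound x V := by simpa using hJ.bound x (-V)
  holder x x' V := by simpa using hJ.holder x x' (-V)
  mean x := by rw [integral_neg_eq_self (J x)]; exact hJ.mean x

lemma _root_.hasDerivAt_primitive {b g : ℝ → ℝ} (hg : Continuous g) (p x : ℝ) :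
    HasDerivAt (fun x => b p + ∫ t in p..x, g t) (g x) x :=
  (intervalIntegral.integral_hasDerivAt_right (hg.intervalIntegrable _ _)
    (hg.stronglyMeasurableAtFilter _ _) hg.continuousAt).const_add _

lemma _root_.primitive_eq {b b' g : ℝ → ℝ} (hb : ∀ x, HasDerivAt b (b' x) x) (hb' : Continuous b')
    {l u p x : ℝ} (hg : ∀ x ∈ Set.Icc l u, g x = b' x) (hp : p ∈ Set.Icc l u)
    (hx : x ∈ Set.Icc l u) : b p + ∫ t in p..x, g t = b x := by
  have h1 : ∫ t in p..x, g t = ∫ t in p..x, b' t :=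
    intervalIntegral.integral_congr fun t ht => hg t (Set.uIcc_subset_Icc hp hx ht)
  rw [h1, intervalIntegral.integral_eq_sub_of_hasDerivAt (fun t _ => hb t)
    (hb'.intervalIntegrable _ _)]
  ring

/-- Clamping to the interval `[l, u]`. -/
noncomputable def _root_.clamp (l u x : ℝ) : ℝ := max l (min u x)

lemma _root_.clamp_mem {l u : ℝ} (h : l ≤ u) (x : ℝ) : clamp l u x ∈ Set.Icc l u :=
  ⟨le_max_left _ _, max_le h (min_le_left _ _)⟩

lemma _root_.clamp_eq {l u x : ℝ} (h : x ∈ Set.Icc l u) : clamp l u x = x := by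
  rw [clamp, min_eq_right h.2, max_eq_right h.1]

lemma _root_.abs_clamp_sub_le (l u x y : ℝ) : |clamp l u x - clamp l u y| ≤ |x - y| :=
  (abs_max_sub_max_le_max l (min u x) l (min u y)).trans (by
    rw [sub_self, abs_zero]
    refine max_le (abs_nonneg _) ((abs_min_sub_min_le_max u x u y).trans ?_)
    rw [sub_self, abs_zero]
    exact max_le (abs_nonneg _) le_rfl)

lemma _root_.continuous_clamp (l u : ℝ) : Continuous (clamp l u) := by
  unfold clamp; fun_prop

lemma _root_.quad_mono {b b' : ℝ → ℝ} {c : ℝ} (hb : ∀ x, HasDerivAt b (b' x) x)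
    (h : ∀ x, 0 ≤ x → c * x ≤ b' x) {x z : ℝ} (hx : 0 ≤ x) (hz : x ≤ z) :
    c / 2 * (z ^ 2 - x ^ 2) ≤ b z - b x := by
  have hd : ∀ x, HasDerivAt (fun x => b x - c / 2 * x ^ 2) (b' x - c * x) x := fun x => by
    refine ((hb x).sub (((hasDerivAt_id x).pow 2).const_mul (c / 2))).congr_deriv ?_
    simp only [id_eq, Nat.cast_ofNat]
    ring
  have hm : MonotoneOn (fun x => b x - c / 2 * x ^ 2) (Set.Ici 0) := by
    refine monotoneOn_of_deriv_nonneg (convex_Ici 0)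
      (fun x _ => (hd x).continuousAt.continuousWithinAt)
      (fun x _ => (hd x).differentiableAt.differentiableWithinAt) fun x hx => ?_
    rw [interior_Ici] at hx
    rw [(hd x).deriv]
    linarith [h x (le_of_lt hx)]
  have := hm (show (0:ℝ) ≤ x from hx) (show (0:ℝ) ≤ z from hx.trans hz) hz
  simp only at this
  linarith

/-- Half-line oscillation estimate for a quadratic phase with a zero. -/
lemma half_quadratic {γ c C₁ Λ : ℝ} (hγ : 0 < γ) (hγ1 : γ < 1) (hc : 0 < c) (hcC : c ≤ C₁)
    (hΛ : 0 ≤ Λ) :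
    ∃ D, 0 ≤ D ∧ ∀ {J : ℝ → ℝ → ℝ} {K : ℝ}, OscKer J K γ → ∀ {b b' : ℝ → ℝ},
      (∀ x, HasDerivAt b (b' x) x) → (∀ x, 0 ≤ x → c * x ≤ b' x) → (∀ x, 0 ≤ x → b' x ≤ C₁ * x) →
      (∀ x x', |b' x - b' x'| ≤ Λ * |x - x'|) → b 0 ≤ -1 →
      IntegrableOn (fun x => J x (b x)) (Set.Ioi 0) ∧
      |∫ x in Set.Ioi 0, J x (b x)| ≤ K * D * (1 + |b 0|) ^ (-((1 + γ) / 2)) := by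
  have hC₁ : 0 < C₁ := hc.trans_le hcC
  set p₀ := √(2 / C₁) with hp₀
  have hp₀pos : 0 < p₀ := by positivity
  set c₁ := c / 2 / √C₁ with hc₁
  have hc₁pos : 0 < c₁ := by positivity
  have hM := momentConst_nonneg γ
  refine ⟨((2 + 4 * C₁ / c + 2 * Λ / (c * p₀)) + 2 * (2 / p₀) ^ γ) * (c₁ ^ (-(1 + γ)) * momentConst γ),
    by positivity, ?_⟩
  intro J K hJ b b' hb h1 h2 hL hβ
  have hK := hJ.K_nonneg
  have hbc : Continuous b := continuous_iff_continuousAt.2 fun x => (hb x).continuousAt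
  have hb'c : Continuous b' := by
    have : LipschitzWith (Real.toNNReal Λ) b' := LipschitzWith.of_dist_le_mul fun x y => by
      rw [Real.dist_eq, Real.dist_eq, Real.coe_toNNReal _ hΛ]
      exact hL x y
    exact this.continuous
  have hlo : ∀ {x z : ℝ}, 0 ≤ x → x ≤ z → c / 2 * (z ^ 2 - x ^ 2) ≤ b z - b x :=
    fun hx hz => quad_mono hb h1 hx hz
  have hhi : ∀ {z : ℝ}, 0 ≤ z → b z - b 0 ≤ C₁ / 2 * z ^ 2 := fun {z} hz => by
    have := quad_mono (c := -C₁) (fun x => (hb x).neg) (fun x hx => by linarith [h2 x hx]) le_rfl hz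
    simp only [Pi.neg_apply] at this
    linarith
  have hβ0 : b 0 < 0 := by linarith
  obtain ⟨p, hp0, hp⟩ : ∃ p, 0 ≤ p ∧ b p = 0 := by
    have hX : (0:ℝ) ≤ √(2 * |b 0| / c) := Real.sqrt_nonneg _
    have hbX : 0 ≤ b √(2 * |b 0| / c) := by
      have := hlo le_rfl hX
      rw [Real.sq_sqrt (by positivity)] at this
      have e : c / 2 * (2 * |b 0| / c - 0 ^ 2) = |b 0| := by field_simp; ring
      rw [e, abs_of_neg hβ0] at this
      rw [abs_of_neg hβ0]
      linarith
    obtain ⟨p, hp, hp'⟩ := intermediate_value_Icc hX hbc.continuousOn ⟨hβ0.le, hbX⟩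
    exact ⟨p, hp.1, hp'⟩
  have hp2 : 2 * |b 0| / C₁ ≤ p ^ 2 := by
    have := hhi hp0
    rw [div_le_iff₀ hC₁, abs_of_neg hβ0]
    linarith
  have hpp₀ : p₀ ≤ p := by
    rw [hp₀]
    refine Real.sqrt_le_iff.2 ⟨hp0, le_trans ?_ hp2⟩
    gcongr
    rw [abs_of_neg hβ0]; linarith
  have hppos : 0 < p := hp₀pos.trans_le hpp₀
  set m := c * p / 2 with hm
  have hmpos : 0 < m := by positivity
  have hmlow : c₁ * √(1 + |b 0|) ≤ m := by
    have e : √((1 + |b 0|) / C₁) ≤ p := by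
      refine Real.sqrt_le_iff.2 ⟨hp0, le_trans ?_ hp2⟩
      gcongr
      rw [abs_of_neg hβ0]; linarith
    rw [Real.sqrt_div (by positivity)] at e
    calc c₁ * √(1 + |b 0|) = c / 2 * (√(1 + |b 0|) / √C₁) := by rw [hc₁]; ring
      _ ≤ c / 2 * p := by gcongr
      _ = m := by rw [hm]; ring
  have hfar : ∀ x, 0 ≤ x → m * |x - p| ≤ |b x| := by
    intro x hx
    rcases le_total x p with h | h
    · have := hlo hx h
      rw [abs_of_nonpos (sub_nonpos.2 h)]
      refine le_trans ?_ (neg_le_abs _)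
      have e : c / 2 * (p ^ 2 - x ^ 2) = m * (p - x) + c / 2 * x * (p - x) := by rw [hm]; ring
      have := mul_nonneg (mul_nonneg (half_pos hc).le hx) (sub_nonneg.2 h)
      linarith
    · have := hlo hp0 h
      rw [abs_of_nonneg (sub_nonneg.2 h)]
      refine le_trans ?_ (le_abs_self _)
      have e : c / 2 * (x ^ 2 - p ^ 2) = m * (x - p) + c / 2 * x * (x - p) := by rw [hm]; ring
      have := mul_nonneg (mul_nonneg (half_pos hc).le hx) (sub_nonneg.2 h)
      linarith
  have hint : IntegrableOn (fun x => J x (b x)) (Set.Ioi 0) := by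
    rw [← integrable_indicator_iff measurableSet_Ioi]
    refine integrable_of_abs_le_inv (A := K) (p := p) hmpos
      ((hJ.continuous_comp hbc).aestronglyMeasurable.indicator measurableSet_Ioi) fun x => ?_
    by_cases hx : x ∈ Set.Ioi (0:ℝ)
    · rw [Set.indicator_of_mem hx]
      exact hJ.bound_of_le hmpos.le (hfar x (le_of_lt hx)) x
    · rw [Set.indicator_of_notMem hx, abs_zero]; positivity
  refine ⟨hint, ?_⟩
  set g : ℝ → ℝ := fun x => b' (clamp (p / 2) (2 * p) x) with hg
  have hmem : p ∈ Set.Icc (p / 2) (2 * p) := ⟨by linarith, by linarith⟩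
  have hgc : Continuous g := hb'c.comp (continuous_clamp _ _)
  set bt : ℝ → ℝ := fun x => b p + ∫ t in p..x, g t with hbt
  have hbtd : ∀ x, HasDerivAt bt (g x) x := fun x => hasDerivAt_primitive hgc p x
  have hbteq : ∀ x ∈ Set.Icc (p / 2) (2 * p), bt x = b x := fun x hx =>
    primitive_eq hb hb'c (fun x hx => by rw [hg]; simp only [clamp_eq hx]) hmem hx
  have hbtp : bt p = 0 := by rw [hbteq p hmem, hp]
  have hgm : ∀ x, m ≤ g x := fun x => by
    have h := clamp_mem (show p / 2 ≤ 2 * p by linarith) x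
    refine le_trans ?_ (h1 _ (by linarith [h.1]))
    rw [hm, mul_div_assoc]
    exact mul_le_mul_of_nonneg_left h.1 hc.le
  have hgC : ∀ x, g x ≤ 4 * C₁ / c * m := fun x => by
    have h := clamp_mem (show p / 2 ≤ 2 * p by linarith) x
    refine (h2 _ (by linarith [h.1])).trans ?_
    rw [show 4 * C₁ / c * m = C₁ * (2 * p) by rw [hm]; field_simp; ring]
    exact mul_le_mul_of_nonneg_left h.2 hC₁.le
  have hgL : ∀ x x', |g x - g x'| ≤ 2 * Λ / (c * p₀) * m * |x - x'| := fun x x' => by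
    refine (hL _ _).trans ?_
    have e : Λ ≤ 2 * Λ / (c * p₀) * m := by
      rw [hm, show 2 * Λ / (c * p₀) * (c * p / 2) = Λ * (p / p₀) by field_simp]
      have : 1 ≤ p / p₀ := by rw [one_le_div hp₀pos]; exact hpp₀
      nlinarith
    calc _ ≤ Λ * |x - x'| := mul_le_mul_of_nonneg_left (abs_clamp_sub_le _ _ _ _) hΛ
      _ ≤ _ := by gcongr
  have hT := hJ.transversal hγ hγ1 hmpos hbtd hgm hgC hgL
  have hbtc : Continuous bt := continuous_iff_continuousAt.2 fun x => (hbtd x).continuousAt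
  have hbtfar : ∀ x, m * |x - p| ≤ |bt x| := fun x => by
    simpa [hbtp] using mul_abs_sub_le hbtd hgm x p
  have hbtint : Integrable fun x => J x (bt x) :=
    integrable_of_abs_le_inv hmpos (hJ.continuous_comp hbtc).aestronglyMeasurable
      fun x => hJ.bound_of_le hmpos.le (hbtfar x) x
  have hR : |∫ x, ((Set.Ioi 0).indicator (fun x => J x (b x)) x - J x (bt x))|
      ≤ 2 * K * (2 / p₀) ^ γ * (m ^ (-(1 + γ)) * momentConst γ) := by
    refine abs_integral_le_moment (p := p) hγ hγ1 hmpos fun x => ?_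
    by_cases hx : x ∈ Set.Icc (p / 2) (2 * p)
    · have hx0 : (0:ℝ) < x := by linarith [hx.1]
      rw [Set.indicator_of_mem (by exact hx0), hbteq x hx, sub_self, abs_zero]
      positivity
    · have hxp : p / 2 ≤ |x - p| := by
        by_contra hcon
        push Not at hcon
        rw [abs_lt] at hcon
        exact hx ⟨by linarith, by linarith⟩
      have e1 : |(Set.Ioi 0).indicator (fun x => J x (b x)) x| ≤ K / (1 + m ^ 2 * (x - p) ^ 2) := by
        by_cases hx0 : x ∈ Set.Ioi (0:ℝ)
        · rw [Set.indicator_of_mem hx0]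
          exact hJ.bound_of_le hmpos.le (hfar x (le_of_lt hx0)) x
        · rw [Set.indicator_of_notMem hx0, abs_zero]; positivity
      have e2 := hJ.bound_of_le hmpos.le (hbtfar x) x
      have e3 : 1 ≤ (2 / p₀) ^ γ * |x - p| ^ γ := by
        rw [← Real.mul_rpow (by positivity) (abs_nonneg _)]
        refine Real.one_le_rpow ?_ hγ.le
        rw [div_mul_eq_mul_div, one_le_div hp₀pos]
        linarith
      calc _ ≤ K / (1 + m ^ 2 * (x - p) ^ 2) + K / (1 + m ^ 2 * (x - p) ^ 2) :=
            (abs_sub _ _).trans (add_le_add e1 e2)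
        _ = 2 * (K / (1 + m ^ 2 * (x - p) ^ 2)) * 1 := by ring
        _ ≤ 2 * (K / (1 + m ^ 2 * (x - p) ^ 2)) * ((2 / p₀) ^ γ * |x - p| ^ γ) := by gcongr
        _ = _ := by ring
  rw [integral_sub ((integrable_indicator_iff measurableSet_Ioi).2 hint) hbtint,
    integral_indicator measurableSet_Ioi] at hR
  have hpow : m ^ (-(1 + γ)) ≤ c₁ ^ (-(1 + γ)) * (1 + |b 0|) ^ (-((1 + γ) / 2)) := by
    refine (Real.rpow_le_rpow_of_nonpos (by positivity) hmlow (by linarith)).trans_eq ?_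
    rw [Real.mul_rpow hc₁pos.le (Real.sqrt_nonneg _), Real.sqrt_eq_rpow, ← Real.rpow_mul (by positivity)]
    congr 2; ring
  have htot : |∫ x in Set.Ioi 0, J x (b x)| ≤
      K * ((2 + 4 * C₁ / c + 2 * Λ / (c * p₀)) + 2 * (2 / p₀) ^ γ) * momentConst γ * m ^ (-(1 + γ)) := by
    rw [abs_le] at hR hT ⊢
    constructor <;> nlinarith
  refine htot.trans ?_
  calc _ ≤ K * ((2 + 4 * C₁ / c + 2 * Λ / (c * p₀)) + 2 * (2 / p₀) ^ γ) * momentConst γ *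
        (c₁ ^ (-(1 + γ)) * (1 + |b 0|) ^ (-((1 + γ) / 2))) := by gcongr
    _ = _ := by ring

/-- Oscillation estimate for a phase with a nondegenerate critical point at the origin. -/
theorem quadratic {γ c C₁ Λ : ℝ} (hγ : 0 < γ) (hγ1 : γ < 1) (hc : 0 < c) (hcC : c ≤ C₁)
    (hΛ : 0 ≤ Λ) :
    ∃ D, 0 ≤ D ∧ ∀ {J : ℝ → ℝ → ℝ} {K : ℝ}, OscKer J K γ → ∀ {b b' : ℝ → ℝ},
      (∀ x, HasDerivAt b (b' x) x) → (∀ x, c * x ^ 2 ≤ x * b' x) → (∀ x, x * b' x ≤ C₁ * x ^ 2) →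
      (∀ x x', |b' x - b' x'| ≤ Λ * |x - x'|) →
      Integrable (fun x => J x (b x)) ∧
      |∫ x, J x (b x)| ≤ K * D * (1 + |b 0|) ^ (-((1 + γ) / 2)) := by
  obtain ⟨D, hD, hhalf⟩ := half_quadratic hγ hγ1 hc hcC hΛ
  set s := √(c / 2) with hs
  have hspos : 0 < s := by positivity
  set I₀ := ∫ x : ℝ, 1 / (1 + s ^ 2 * (x - 0) ^ 2) with hI₀
  have hI₀nn : 0 ≤ I₀ := integral_nonneg fun x => by positivity
  refine ⟨2 * D + 16 * I₀, by positivity, ?_⟩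
  intro J K hJ b b' hb h1 h2 hL
  have hK := hJ.K_nonneg
  have hbc : Continuous b := continuous_iff_continuousAt.2 fun x => (hb x).continuousAt
  have hbneg : ∀ x, HasDerivAt (fun x => b (-x)) (-b' (-x)) x := fun x => by
    exact ((hb (-x)).scomp x (hasDerivAt_neg x)).congr_deriv (neg_one_smul _ _)
  have key : ∀ {b' : ℝ → ℝ}, (∀ x, c * x ^ 2 ≤ x * b' x) → (∀ x, x * b' x ≤ C₁ * x ^ 2) →
      (∀ x x', |b' x - b' x'| ≤ Λ * |x - x'|) →
      (∀ x, 0 ≤ x → c * x ≤ b' x) ∧ (∀ x, 0 ≤ x → b' x ≤ C₁ * x) := by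
    intro b' h1 h2 hL
    have hc' : Continuous b' := by
      have : LipschitzWith (Real.toNNReal Λ) b' := LipschitzWith.of_dist_le_mul fun x y => by
        rw [Real.dist_eq, Real.dist_eq, Real.coe_toNNReal _ hΛ]
        exact hL x y
      exact this.continuous
    have hpos : ∀ x ∈ Set.Ioi (0:ℝ), c * x ≤ b' x ∧ b' x ≤ C₁ * x := fun x hx => by
      have hx : 0 < x := hx
      constructor
      · have := h1 x; nlinarith
      · have := h2 x; nlinarith
    have hcl : ∀ x ∈ Set.Ici (0:ℝ), c * x ≤ b' x ∧ b' x ≤ C₁ * x := by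
      rw [← closure_Ioi]
      have hclosed : IsClosed {x : ℝ | c * x ≤ b' x ∧ b' x ≤ C₁ * x} :=
        (isClosed_le (by fun_prop) hc').inter (isClosed_le hc' (by fun_prop))
      exact closure_minimal hpos hclosed
    exact ⟨fun x hx => (hcl x hx).1, fun x hx => (hcl x hx).2⟩
  have hn1 : ∀ x, c * x ^ 2 ≤ x * -b' (-x) := fun x => by have := h1 (-x); nlinarith
  have hn2 : ∀ x, x * -b' (-x) ≤ C₁ * x ^ 2 := fun x => by have := h2 (-x); nlinarith
  have hnL : ∀ x x', |-b' (-x) - -b' (-x')| ≤ Λ * |x - x'| := fun x x' => by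
    have := hL (-x') (-x)
    rw [show -b' (-x) - -b' (-x') = b' (-x') - b' (-x) by ring]
    rwa [show -x' - -x = x - x' by ring] at this
  obtain ⟨p1, p2⟩ := key h1 h2 hL
  obtain ⟨q1, q2⟩ := key hn1 hn2 hnL
  by_cases hβ : b 0 ≤ -1
  · obtain ⟨i1, e1⟩ := hhalf hJ hb p1 p2 hL hβ
    obtain ⟨i2, e2⟩ := hhalf hJ.comp_neg hbneg q1 q2 hnL (by simpa using hβ)
    have i2' : IntegrableOn (fun x => J x (b x)) (Set.Iic 0) := by
      have h : IntegrableOn (fun x => J (-x) (b (-x))) (Set.Ici 0) := (integrableOn_Ici_iff_integrableOn_Ioi).2 i2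
      have h3 := (integrable_indicator_iff measurableSet_Ici).2 h
      rw [← integrable_indicator_iff measurableSet_Iic]
      refine h3.comp_neg.congr (ae_of_all _ fun x => ?_)
      simp only [Set.indicator, Set.mem_Ici, Set.mem_Iic, neg_nonneg, neg_neg]
    have hsum := integral_add_compl (μ := volume) (f := fun x => J x (b x)) (measurableSet_Ioi (a := (0:ℝ)))
    rw [Set.compl_Ioi] at hsum
    have hI : Integrable fun x => J x (b x) := by
      rw [← integrableOn_univ, ← Set.Iic_union_Ioi (a := (0:ℝ))]
      exact i2'.union i1
    refine ⟨hI, ?_⟩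
    rw [← hsum hI]
    rw [integral_comp_neg_Ioi (0:ℝ) (fun x => J x (b x)), neg_zero] at e2
    refine (abs_add_le _ _).trans ?_
    have hr : 0 ≤ (1 + |b 0|) ^ (-((1 + γ) / 2)) := by positivity
    have := mul_nonneg (mul_nonneg hK hI₀nn) hr
    nlinarith
  · push Not at hβ
    have hlow : ∀ x, b 0 + c / 2 * x ^ 2 ≤ b x := by
      intro x
      rcases le_total 0 x with hx | hx
      · have := quad_mono hb p1 le_rfl hx
        linarith
      · have := quad_mono hbneg q1 le_rfl (neg_nonneg.2 hx)
        simp only [neg_neg, neg_zero] at this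
        nlinarith
    have hss : s ^ 2 = c / 2 := by rw [hs, Real.sq_sqrt (by positivity)]
    have hbd : ∀ x, |J x (b x)| ≤ (16 * K / (1 + |b 0|)) / (1 + s ^ 2 * (x - 0) ^ 2) := by
      intro x
      refine (hJ.bound x _).trans ?_
      rw [div_div]
      rw [div_le_div_iff₀ (by positivity) (by positivity), hss, sub_zero]
      have hl := hlow x
      have ht : 0 ≤ c / 2 * x ^ 2 := by positivity
      set t := c / 2 * x ^ 2
      have h3 : (1 + |b 0|) ≤ 2 + (b 0 + 1) := by
        rcases abs_cases (b 0) with h | h <;> linarith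
      have h4 : (1 + |b 0|) * (1 + t) ≤ (2 + (b 0 + 1)) * (1 + t) := by gcongr
      have h5 : (b 0 + 1 + t) ^ 2 ≤ (b x + 1) ^ 2 := by
        apply pow_le_pow_left₀ <;> linarith
      have h6 : (2 + (b 0 + 1)) * (1 + t) ≤ 16 * (1 + b x ^ 2) := by
        have hs0 : 0 ≤ b 0 + 1 := by linarith
        nlinarith [sq_nonneg (b x - 1), mul_nonneg hs0 ht, sq_nonneg (b 0 + 1 - 1), sq_nonneg (t - 1)]
      nlinarith
    have hI : Integrable fun x => J x (b x) :=
      integrable_of_abs_le_inv hspos (hJ.continuous_comp hbc).aestronglyMeasurable hbd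
    refine ⟨hI, ?_⟩
    have hdom : Integrable fun x : ℝ => 1 / (1 + s ^ 2 * (x - 0) ^ 2) :=
      integrable_of_abs_le_inv (A := 1) (p := 0) hspos
        (Measurable.aestronglyMeasurable (by fun_prop)) fun x => by
        rw [abs_of_nonneg (by positivity)]
    have h1 : |∫ x, J x (b x)| ≤ 16 * K / (1 + |b 0|) * I₀ := by
      rw [hI₀, ← integral_const_mul]
      refine norm_integral_le_of_norm_le (f := fun x => J x (b x)) (hdom.const_mul _)
        (ae_of_all _ fun x => ?_)
      rw [Real.norm_eq_abs, mul_one_div]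
      exact hbd x
    have h2 : (1 + |b 0|)⁻¹ ≤ (1 + |b 0|) ^ (-((1 + γ) / 2)) := by
      rw [← Real.rpow_neg_one]
      apply Real.rpow_le_rpow_of_exponent_le
      · linarith [abs_nonneg (b 0)]
      · linarith
    refine h1.trans ?_
    rw [div_eq_mul_inv]
    have hr : 0 ≤ (1 + |b 0|) ^ (-((1 + γ) / 2)) := by positivity
    calc 16 * K * (1 + |b 0|)⁻¹ * I₀ ≤ 16 * K * (1 + |b 0|) ^ (-((1 + γ) / 2)) * I₀ := by gcongr
      _ ≤ K * (2 * D + 16 * I₀) * (1 + |b 0|) ^ (-((1 + γ) / 2)) := by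
        have := mul_nonneg (mul_nonneg hK hD) hr
        nlinarith

end OscKer

/-- Mean-zero functions with quadratic decay and a decaying Lipschitz bound. -/
structure DecKer (p : ℝ → ℝ) (C : ℝ) : Prop where
  bound : ∀ v, |p v| ≤ C / (1 + v ^ 2)
  lip : ∀ v v', |p v - p v'| ≤ C * |v - v'| * (1 / (1 + v ^ 2) + 1 / (1 + v' ^ 2))
  mean : ∫ v, p v = 0

/-- Bounded Hölder functions with common constant. -/
structure HolderBdd (f : ℝ → ℝ) (A γ : ℝ) : Prop where
  bound : ∀ x, |f x| ≤ A
  holder : ∀ x x', |f x - f x'| ≤ A * |x - x'| ^ γ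

namespace HolderBdd
variable {f g : ℝ → ℝ} {A B γ : ℝ}

lemma nonneg (hf : HolderBdd f A γ) : 0 ≤ A := (abs_nonneg _).trans (hf.bound 0)

lemma continuous (hf : HolderBdd f A γ) (hγ : 0 < γ) : Continuous f := by
  rw [continuous_iff_continuousAt]
  intro x
  have h : Tendsto (fun x' => A * |x' - x| ^ γ) (𝓝 x) (𝓝 0) := by
    have : Continuous fun x' : ℝ => A * |x' - x| ^ γ :=
      continuous_const.mul ((continuous_abs.comp (continuous_id.sub continuous_const)).rpow_const
        fun _ => Or.inr hγ.le)
    have h := this.tendsto x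
    simpa [Real.zero_rpow hγ.ne'] using h
  exact tendsto_iff_dist_tendsto_zero.2 (squeeze_zero (fun _ => dist_nonneg)
    (fun x' => by rw [Real.dist_eq]; exact hf.holder x' x) h)

lemma comp_neg (hf : HolderBdd f A γ) : HolderBdd (fun x => f (-x)) A γ where
  bound x := hf.bound _
  holder x x' := by
    have := hf.holder (-x) (-x')
    rwa [show -x - -x' = -(x - x') by ring, abs_neg] at this

lemma comp_add (hf : HolderBdd f A γ) (c : ℝ) : HolderBdd (fun x => f (c + x)) A γ where
  bound x := hf.bound _
  holder x x' := by
    have := hf.holder (c + x) (c + x')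
    rwa [show c + x - (c + x') = x - x' by ring] at this

lemma mul (hf : HolderBdd f A γ) (hg : HolderBdd g B γ) :
    HolderBdd (fun x => f x * g x) (2 * A * B) γ where
  bound x := by
    have := hf.nonneg
    have := hg.nonneg
    rw [abs_mul]
    have := mul_le_mul (hf.bound x) (hg.bound x) (abs_nonneg _) hf.nonneg
    nlinarith [mul_nonneg hf.nonneg hg.nonneg]
  holder x x' := by
    have := hf.nonneg
    have := hg.nonneg
    calc |f x * g x - f x' * g x'| = |f x * (g x - g x') + (f x - f x') * g x'| := by congr 1; ring
      _ ≤ |f x| * |g x - g x'| + |f x - f x'| * |g x'| := by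
        rw [← abs_mul, ← abs_mul]; exact abs_add_le _ _
      _ ≤ A * (B * |x - x'| ^ γ) + A * |x - x'| ^ γ * B := by
        gcongr
        · exact hf.bound x
        · exact hg.holder x x'
        · exact hf.holder x x'
        · exact hg.bound x'
      _ = _ := by ring

lemma add (hf : HolderBdd f A γ) (hg : HolderBdd g B γ) :
    HolderBdd (fun x => f x + g x) (A + B) γ where
  bound x := (abs_add_le _ _).trans (add_le_add (hf.bound x) (hg.bound x))
  holder x x' := by
    calc |f x + g x - (f x' + g x')| = |(f x - f x') + (g x - g x')| := by congr 1; ring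
      _ ≤ A * |x - x'| ^ γ + B * |x - x'| ^ γ :=
        (abs_add_le _ _).trans (add_le_add (hf.holder x x') (hg.holder x x'))
      _ = _ := by ring

lemma of_lipschitz {L : ℝ} (hγ : 0 < γ) (hγ1 : γ ≤ 1) (hL : 0 ≤ L) (hb : ∀ x, |f x| ≤ A)
    (hl : ∀ x x', |f x - f x'| ≤ L * |x - x'|) : HolderBdd f (2 * A + L) γ where
  bound x := by
    have := (abs_nonneg _).trans (hb x)
    linarith [hb x]
  holder x x' := by
    have hA := (abs_nonneg _).trans (hb x)
    exact min_le_rpow (by positivity) hL (abs_nonneg _) hγ hγ1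
      ((abs_sub _ _).trans (by linarith [hb x, hb x'])) (hl x x')

end HolderBdd

namespace DecKer
variable {p : ℝ → ℝ} {C γ : ℝ}

lemma C_nonneg (hp : DecKer p C) : 0 ≤ C := by
  have := (abs_nonneg _).trans (hp.bound 0)
  simpa using this

lemma lip_const (hp : DecKer p C) (v v' : ℝ) : |p v - p v'| ≤ 2 * C * |v - v'| := by
  refine (hp.lip v v').trans ?_
  have h : ∀ v : ℝ, 1 / (1 + v ^ 2) ≤ 1 := fun v => by
    rw [div_le_one (by positivity)]; nlinarith
  have := mul_nonneg hp.C_nonneg (abs_nonneg (v - v'))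
  nlinarith [h v, h v']

lemma bound_const (hp : DecKer p C) (v : ℝ) : |p v| ≤ C := by
  refine (hp.bound v).trans (div_le_self hp.C_nonneg ?_)
  nlinarith

lemma continuous (hp : DecKer p C) : Continuous p := by
  have h := hp.C_nonneg
  have : LipschitzWith (Real.toNNReal (2 * C)) p := LipschitzWith.of_dist_le_mul fun x y => by
    rw [Real.dist_eq, Real.dist_eq, Real.coe_toNNReal _ (by positivity)]
    exact hp.lip_const x y
  exact this.continuous

lemma _root_.inv_one_add_sq_add_le {V s S : ℝ} (hs : |s| ≤ S) :
    1 / (1 + (V + s) ^ 2) ≤ 2 * (1 + S ^ 2) / (1 + V ^ 2) := by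
  rw [div_le_div_iff₀ (by positivity) (by positivity), one_mul]
  refine Kernels.one_add_sq_le ?_
  rwa [show V - (V + s) = -s by ring, abs_neg]

lemma oscKer (hp : DecKer p C) {G s : ℝ → ℝ} {A S : ℝ} (hγ : 0 < γ) (hG : HolderBdd G A γ)
    (hs : HolderBdd s S γ) :
    OscKer (fun x V => G x * p (V + s x)) (4 * C * A * (1 + S) * (1 + S ^ 2)) γ := by
  have hC := hp.C_nonneg
  have hA := hG.nonneg
  have hS := hs.nonneg
  have hb : ∀ x V, |p (V + s x)| ≤ 2 * C * (1 + S ^ 2) / (1 + V ^ 2) := fun x V => by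
    refine (hp.bound _).trans ?_
    have := mul_le_mul_of_nonneg_left (inv_one_add_sq_add_le (V := V) (hs.bound x)) hC
    rw [mul_one_div] at this
    exact this.trans_eq (by ring)
  refine ⟨?_, fun x V => ?_, fun x x' V => ?_, fun x => ?_⟩
  · exact ((hG.continuous hγ).comp continuous_fst).mul (hp.continuous.comp
      (continuous_snd.add ((hs.continuous hγ).comp continuous_fst)))
  · rw [abs_mul]
    calc |G x| * |p (V + s x)| ≤ A * (2 * C * (1 + S ^ 2) / (1 + V ^ 2)) := by
          gcongr
          · exact hG.bound x
          · exact hb x V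
      _ = 2 * C * A * 1 * (1 + S ^ 2) / (1 + V ^ 2) := by ring
      _ ≤ 4 * C * A * (1 + S) * (1 + S ^ 2) / (1 + V ^ 2) := by gcongr <;> linarith
  · have h1 : |p (V + s x) - p (V + s x')| ≤
        C * (S * |x - x'| ^ γ) * (4 * (1 + S ^ 2) / (1 + V ^ 2)) := by
      refine (hp.lip _ _).trans ?_
      have e1 := inv_one_add_sq_add_le (V := V) (hs.bound x)
      have e2 := inv_one_add_sq_add_le (V := V) (hs.bound x')
      rw [show V + s x - (V + s x') = s x - s x' by ring]
      gcongr
      · exact hs.holder x x'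
      · exact (add_le_add e1 e2).trans_eq (by ring)
    calc |G x * p (V + s x) - G x' * p (V + s x')|
        = |G x * (p (V + s x) - p (V + s x')) + (G x - G x') * p (V + s x')| := by congr 1; ring
      _ ≤ |G x| * |p (V + s x) - p (V + s x')| + |G x - G x'| * |p (V + s x')| := by
        rw [← abs_mul, ← abs_mul]; exact abs_add_le _ _
      _ ≤ A * (C * (S * |x - x'| ^ γ) * (4 * (1 + S ^ 2) / (1 + V ^ 2)))
          + A * |x - x'| ^ γ * (2 * C * (1 + S ^ 2) / (1 + V ^ 2)) := by
        gcongr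
        · exact hG.bound x
        · exact hG.holder x x'
        · exact hb x' V
      _ = (4 * C * A * (1 / 2 + S) * (1 + S ^ 2)) * |x - x'| ^ γ / (1 + V ^ 2) := by ring
      _ ≤ _ := by gcongr; norm_num
  · rw [integral_const_mul, integral_add_right_eq_self p, hp.mean, mul_zero]

end DecKer

/-- Lower bound for the quadratic phase, uniform in bounded perturbations. -/
lemma one_add_sq_le_phase {R S : ℝ} (hR : 0 < R) (x α s : ℝ) (hs : |s| ≤ S) :
    1 + (x - α) ^ 2 ≤ (2 + 2 / R * (1 + S)) * (1 + α ^ 2) *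
      (1 + (R * (x ^ 2 / 2 - α * x) + s) ^ 2) := by
  have hS := (abs_nonneg s).trans hs
  set V := R * (x ^ 2 / 2 - α * x) + s with hV
  have h1 : (x - α) ^ 2 = 2 / R * (V - s) + α ^ 2 := by rw [hV]; field_simp; ring
  have h2 : V - s ≤ (1 + S) * (1 + V ^ 2) := by
    have := neg_le_of_abs_le hs
    nlinarith [sq_nonneg (V - 1), mul_nonneg hS (sq_nonneg V), sq_nonneg V]
  have hq : 0 < 2 / R := by positivity
  set q := 2 / R
  have h3 := mul_le_mul_of_nonneg_left h2 hq.le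
  have h4 : 0 ≤ q * (1 + S) * (1 + V ^ 2) * α ^ 2 := by positivity
  have h5 := mul_nonneg (sq_nonneg α) (sq_nonneg V)
  rw [h1]
  nlinarith [sq_nonneg V, sq_nonneg α]

namespace Kernels
variable {ik k w : ℝ → ℝ} {L ρ : ℝ}

/-- A single constant for all the kernels `latKer k w u`. -/
lemma exists_decKer (K : Kernels ik k w L ρ) : ∃ C, 0 < C ∧ ∀ u, DecKer (latKer k w u) C := by
  obtain ⟨C, hC, hb⟩ := K.exists_abs_latKer_le
  obtain ⟨C', hC', hb'⟩ := K.exists_abs_latKer_sub_le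
  refine ⟨C + C', by positivity, fun u => ⟨fun v => (hb u v).trans ?_, fun v v' => (hb' u v v').trans ?_,
    K.integral_latKer u⟩⟩
  · gcongr; linarith
  · gcongr; linarith

end Kernels

lemma DecKer.average {C : ℝ} {N : ℕ} (hN : 0 < N) {p : ℕ → ℝ → ℝ} (hp : ∀ j, DecKer (p j) C) :
    DecKer (fun v => (N:ℝ)⁻¹ * ∑ j ∈ Finset.range N, p j v) C := by
  have hN' : (0:ℝ) < N := by exact_mod_cast hN
  have key : ∀ {f : ℕ → ℝ} {B : ℝ}, (∀ j, |f j| ≤ B) → |(N:ℝ)⁻¹ * ∑ j ∈ Finset.range N, f j| ≤ B := by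
    intro f B h
    rw [abs_mul, abs_inv, Nat.abs_cast, inv_mul_le_iff₀ hN']
    refine (Finset.abs_sum_le_sum_abs _ _).trans ?_
    refine (Finset.sum_le_card_nsmul _ _ B fun j _ => h j).trans ?_
    simp
  refine ⟨fun v => key fun j => (hp j).bound v, fun v v' => ?_, ?_⟩
  · rw [← mul_sub, ← Finset.sum_sub_distrib]
    exact key fun j => (hp j).lip v v'
  · rw [integral_const_mul, integral_finsetSum]
    · simp [(hp _).mean]
    · intro j _
      refine integrable_of_abs_le_inv (A := C) (m := 1) (p := 0) one_pos
        (hp j).continuous.aestronglyMeasurable fun x => ?_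
      simpa using (hp j).bound x

namespace Kernels
variable {ik k w : ℝ → ℝ} {L ρ : ℝ}

lemma decKer_latMean (K : Kernels ik k w L ρ) {C : ℝ} (hC : ∀ u, DecKer (latKer k w u) C) :
    DecKer (latMean k w) C := by
  refine ⟨abs_latMean_le fun u v => (hC u).bound v, fun v v' =>
    K.abs_latMean_sub_le fun u => (hC u).lip v v', ?_⟩
  unfold latMean
  simp_rw [intervalIntegral.integral_of_le zero_le_one]
  rw [integral_integral_swap]
  · simp [(hC _).mean]
  · have hd : Integrable (fun q : ℝ × ℝ => (C / (1 + q.1 ^ 2)) * 1)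
        (volume.prod (volume.restrict (Set.Ioc (0:ℝ) 1))) := by
      refine Integrable.mul_prod (f := fun v : ℝ => C / (1 + v ^ 2)) (g := fun _ : ℝ => (1:ℝ)) ?_ ?_
      · simpa only [div_eq_mul_inv] using integrable_inv_one_add_sq.const_mul C
      · exact integrable_const _
    refine hd.mono' ?_ (ae_of_all _ fun q => ?_)
    · exact (K.continuous_latKer.comp continuous_swap).aestronglyMeasurable
    · rw [mul_one]
      exact (hC q.2).bound q.1

lemma conv1_ik_lipSupp (K : Kernels ik k w L ρ) :
    ∃ L', LipSupp (conv1 ik w) L' (2 * ρ) ∧ LipSupp (conv1 k w) L' (2 * ρ) := by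
  have h1 := K.ik_lip.conv1 K.w_lip
  have h2 := K.k_lip.conv1 K.w_lip
  exact ⟨_, h1.mono (le_max_left _ _) le_rfl, h2.mono (le_max_right _ _) le_rfl⟩

end Kernels

section
variable {p P : ℝ → ℝ} {C : ℝ}

/-- The truncated angular integral of the phase, divided by the phase derivative. -/
noncomputable def truncKer (P : ℝ → ℝ) (R : ℝ) (s : ℝ → ℝ) (A x : ℝ) : ℝ :=
  (P (R * x ^ 2 / 2 + s x + R * A * x) - P (R * x ^ 2 / 2 + s x - R * A * x)) / (R * x)

lemma DecKer.abs_primitive_sub_le (hp : DecKer p C) (hP : ∀ x, HasDerivAt P (p x) x) (x y : ℝ) :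
    |P x - P y| ≤ C * |x - y| := by
  have := Convex.norm_image_sub_le_of_norm_hasDerivWithin_le (f := P) (f' := p) (C := C)
    (s := Set.univ) (fun z _ => (hP z).hasDerivWithinAt) (fun z _ => hp.bound_const z) convex_univ
    (Set.mem_univ y) (Set.mem_univ x)
  simpa only [Real.norm_eq_abs] using this

lemma inv_one_add_abs_add_le {V s S : ℝ} (hs : |s| ≤ S) :
    1 / (1 + |V + s|) ≤ (1 + S) / (1 + |V|) := by
  have hS := (abs_nonneg s).trans hs
  rw [div_le_div_iff₀ (by positivity) (by positivity)]
  have h1 : |V| ≤ |V + s| + S := by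
    have := abs_sub (V + s) s
    rw [add_sub_cancel_right] at this
    linarith
  nlinarith [abs_nonneg (V + s), mul_nonneg hS (abs_nonneg (V + s))]

/-- Contribution of `(0, 1]` to the truncated identity. -/
lemma tendsto_truncKer_near {G s : ℝ → ℝ} {g S R γ : ℝ} (hp : DecKer p C)
    (hP : ∀ x, HasDerivAt P (p x) x) (hPb : ∀ x, |P x| ≤ C / (1 + |x|)) (hγ : 0 < γ)
    (hG : HolderBdd G g γ) (hs : HolderBdd s S γ) (hR : 0 < R) :
    Tendsto (fun A : ℝ => ∫ x in Set.Ioi 0, (Set.Iic 1).indicator (fun x => G x * truncKer P R s A x) x)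
      atTop (𝓝 (∫ y in Set.Ioi 0, R⁻¹ * G 0 * ((P (s 0 + y) - P (s 0 - y)) / y))) := by
  have hPc : Continuous P := continuous_iff_continuousAt.2 fun x => (hP x).continuousAt
  have hGc := hG.continuous hγ
  have hsc := hs.continuous hγ
  have hg := hG.nonneg
  have hS := hs.nonneg
  have hC := hp.C_nonneg
  have hsub : ∀ᶠ A : ℝ in atTop,
      ∫ y in Set.Ioi 0, (Set.Iic (R * A)).indicator (fun y => R⁻¹ * G (y / (R * A)) *
        ((P (R * (y / (R * A)) ^ 2 / 2 + s (y / (R * A)) + y) -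
          P (R * (y / (R * A)) ^ 2 / 2 + s (y / (R * A)) - y)) / y)) y
      = ∫ x in Set.Ioi 0, (Set.Iic 1).indicator (fun x => G x * truncKer P R s A x) x := by
    filter_upwards [eventually_gt_atTop 0] with A hA
    have hRA : 0 < R * A := by positivity
    have h := integral_comp_mul_left_Ioi (fun x => (Set.Iic 1).indicator (fun x => G x * truncKer P R s A x) x)
      0 (inv_pos.2 hRA)
    rw [mul_zero, inv_inv, smul_eq_mul] at h
    have hpt : ∀ y ∈ Set.Ioi (0:ℝ), (Set.Iic (R * A)).indicator (fun y => R⁻¹ * G (y / (R * A)) *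
        ((P (R * (y / (R * A)) ^ 2 / 2 + s (y / (R * A)) + y) -
          P (R * (y / (R * A)) ^ 2 / 2 + s (y / (R * A)) - y)) / y)) y
        = (R * A)⁻¹ * (Set.Iic 1).indicator (fun x => G x * truncKer P R s A x) ((R * A)⁻¹ * y) := by
      intro y hy
      have hy : 0 < y := hy
      have e : (R * A)⁻¹ * y = y / (R * A) := by rw [mul_comm]; rfl
      rw [e]
      by_cases hle : y ≤ R * A
      · rw [Set.indicator_of_mem (by exact hle), Set.indicator_of_mem (by
          rw [Set.mem_Iic, div_le_one hRA]; exact hle)]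
        unfold truncKer
        rw [show R * A * (y / (R * A)) = y by field_simp]
        field_simp
      · rw [Set.indicator_of_notMem (by exact hle), Set.indicator_of_notMem (by
          rw [Set.mem_Iic, div_le_one hRA]; exact hle), mul_zero]
    rw [setIntegral_congr_fun measurableSet_Ioi hpt, integral_const_mul, h, inv_mul_cancel_left₀ hRA.ne']
  refine Tendsto.congr' hsub ?_
  set c₀ := R / 2 + S with hc₀
  have hc₀nn : 0 ≤ c₀ := by positivity
  refine tendsto_integral_filter_of_dominated_convergence
    (fun y => R⁻¹ * g * (4 * C * (1 + c₀)) / (1 + y ^ 2)) ?_ ?_ ?_ ?_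
  · refine Eventually.of_forall fun A => AEStronglyMeasurable.indicator ?_ measurableSet_Iic
    refine Measurable.aestronglyMeasurable ?_
    have := hPc.measurable
    have := hGc.measurable
    have := hsc.measurable
    fun_prop
  · filter_upwards [eventually_gt_atTop 0] with A hA
    refine (ae_restrict_iff' measurableSet_Ioi).2 (ae_of_all _ fun y hy => ?_)
    have hy : 0 < y := hy
    have hRA : 0 < R * A := by positivity
    rw [Real.norm_eq_abs]
    by_cases hle : y ≤ R * A
    · rw [Set.indicator_of_mem (by exact hle)]
      set t := y / (R * A) with ht
      have ht0 : 0 ≤ t := by positivity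
      have ht1 : t ≤ 1 := by rw [ht, div_le_one hRA]; exact hle
      set c := R * t ^ 2 / 2 + s t with hc
      have hcb : |c| ≤ c₀ := by
        refine (abs_add_le _ _).trans (add_le_add ?_ (hs.bound t))
        rw [abs_of_nonneg (by positivity)]
        nlinarith [mul_nonneg hR.le ht0, mul_nonneg hR.le (sub_nonneg.2 ht1)]
      have hq : |(P (c + y) - P (c - y)) / y| ≤ 4 * C * (1 + c₀) / (1 + y ^ 2) := by
        rw [abs_div, abs_of_pos hy, div_le_div_iff₀ hy (by positivity)]
        rcases le_total y 1 with h1 | h1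
        · have := hp.abs_primitive_sub_le hP (c + y) (c - y)
          rw [show c + y - (c - y) = 2 * y by ring, abs_of_pos (show 0 < 2 * y by positivity)] at this
          have h2 : 1 + y ^ 2 ≤ 2 := by nlinarith
          calc _ ≤ C * (2 * y) * 2 := by gcongr
            _ = 4 * C * (1 + 0) * y := by ring
            _ ≤ _ := by gcongr
        · have e1 := (hPb (c + y)).trans_eq (div_eq_mul_one_div _ _)
          have e2 := (hPb (c - y)).trans_eq (div_eq_mul_one_div _ _)
          have f1 := inv_one_add_abs_add_le (V := y) hcb
          have f2 := inv_one_add_abs_add_le (V := -y) hcb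
          rw [abs_neg] at f2
          rw [add_comm] at f1
          rw [neg_add_eq_sub] at f2
          rw [abs_of_pos hy] at f1 f2
          rw [add_comm y c] at f1
          have : |P (c + y) - P (c - y)| ≤ 2 * C * (1 + c₀) / (1 + y) := by
            refine (abs_sub _ _).trans ?_
            have g1 := mul_le_mul_of_nonneg_left f1 hC
            have g2 := mul_le_mul_of_nonneg_left f2 hC
            calc _ ≤ C * ((1 + c₀) / (1 + y)) + C * ((1 + c₀) / (1 + y)) := by
                  refine add_le_add (e1.trans ?_) (e2.trans ?_)
                  · rwa [add_comm 1 |c + y|]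
                  · exact g2
              _ = _ := by ring
          rw [le_div_iff₀ (by positivity)] at this
          have h3 : 1 + y ^ 2 ≤ 2 * ((1 + y) * y) := by nlinarith
          calc _ ≤ |P (c + y) - P (c - y)| * (2 * ((1 + y) * y)) := by gcongr
            _ = |P (c + y) - P (c - y)| * (1 + y) * (2 * y) := by ring
            _ ≤ 2 * C * (1 + c₀) * (2 * y) := by gcongr
            _ = _ := by ring
      rw [abs_mul, abs_mul, abs_of_pos (inv_pos.2 hR), mul_div_assoc]
      gcongr
      exact hG.bound _
    · rw [Set.indicator_of_notMem (by exact hle), abs_zero]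
      positivity
  · simp only [div_eq_mul_inv]
    exact (integrable_inv_one_add_sq.const_mul (R⁻¹ * g * (4 * C * (1 + c₀)))).restrict
  · refine (ae_restrict_iff' measurableSet_Ioi).2 (ae_of_all _ fun y hy => ?_)
    have hy : 0 < y := hy
    have ht : Tendsto (fun A : ℝ => y / (R * A)) atTop (𝓝 0) :=
      tendsto_const_nhds.div_atTop (tendsto_id.const_mul_atTop hR)
    have hlim : Continuous fun t => R⁻¹ * G t * ((P (R * t ^ 2 / 2 + s t + y) -
          P (R * t ^ 2 / 2 + s t - y)) / y) := by fun_prop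
    have h := (hlim.tendsto 0).comp ht
    have e : R⁻¹ * G 0 * ((P (R * 0 ^ 2 / 2 + s 0 + y) - P (R * 0 ^ 2 / 2 + s 0 - y)) / y)
        = R⁻¹ * G 0 * ((P (s 0 + y) - P (s 0 - y)) / y) := by simp
    rw [e] at h
    refine h.congr' ?_
    filter_upwards [(tendsto_id.const_mul_atTop hR).eventually_ge_atTop y] with A hA
    rw [Set.indicator_of_mem (by exact hA)]
    rfl

lemma far_phase_le {r A x : ℝ} (hr : 0 < r) (hA : 1 ≤ A) (hx : 1 ≤ x) :
    1 / x * (1 / (1 + r * x * |x - 2 * A|)) ≤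
      A⁻¹ * (r⁻¹ * (1 / x ^ 2)) + √A⁻¹ * (2 * (min 1 r)⁻¹ * (1 + |x - 2 * A|) ^ (-(3 / 2) : ℝ)) := by
  have hx0 : 0 < x := by linarith
  have hA0 : 0 < A := by linarith
  have hq : 0 < min 1 r := lt_min one_pos hr
  set z := |x - 2 * A| with hz
  have hz0 : 0 ≤ z := abs_nonneg _
  rcases le_total A x with h | h
  · have hzx : z ≤ x := by rw [hz, abs_le]; constructor <;> linarith
    have h1 : √A * √(1 + z) ≤ 2 * x := by
      rw [← Real.sqrt_mul hA0.le]
      refine Real.sqrt_le_iff.2 ⟨by linarith, ?_⟩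
      nlinarith
    have h2 : min 1 r * (1 + z) ≤ 1 + r * x * z := by
      have e1 : min 1 r ≤ 1 := min_le_left _ _
      have e2 : min 1 r ≤ r := min_le_right _ _
      have e3 : min 1 r * z ≤ r * z := by gcongr
      have e4 : r * z ≤ r * x * z := by
        have := mul_nonneg hr.le hz0
        nlinarith
      nlinarith
    have h3 : (1 + z) ^ (-(3 / 2) : ℝ) = 1 / (√(1 + z) * (1 + z)) := by
      rw [Real.sqrt_eq_rpow, Real.rpow_neg (by positivity), show (3 / 2 : ℝ) = 1 / 2 + 1 by norm_num,
        Real.rpow_add (by positivity), Real.rpow_one]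
      exact (one_div _).symm
    have h4 : 1 / x * (1 / (1 + r * x * z)) ≤ √A⁻¹ * (2 * (min 1 r)⁻¹ * (1 + z) ^ (-(3 / 2) : ℝ)) := by
      rw [h3, Real.sqrt_inv]
      have hsA : 0 < √A := by positivity
      have hsz : 0 < √(1 + z) := by positivity
      rw [one_div_mul_one_div, show (√A)⁻¹ * (2 * (min 1 r)⁻¹ * (1 / (√(1 + z) * (1 + z))))
        = 2 / ((√A * √(1 + z)) * (min 1 r * (1 + z))) by field_simp]
      rw [div_le_div_iff₀ (by positivity) (by positivity), one_mul]
      calc _ ≤ (2 * x) * (1 + r * x * z) := by gcongr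
        _ = _ := by ring
    have : 0 ≤ A⁻¹ * (r⁻¹ * (1 / x ^ 2)) := by positivity
    linarith
  · have hzA : A ≤ z := by
      rw [hz]
      refine le_trans ?_ (neg_le_abs _)
      linarith
    have h1 : 1 / x * (1 / (1 + r * x * z)) ≤ A⁻¹ * (r⁻¹ * (1 / x ^ 2)) := by
      rw [one_div_mul_one_div, show A⁻¹ * (r⁻¹ * (1 / x ^ 2)) = 1 / (x * (r * x * A)) by field_simp]
      have : r * x * A ≤ 1 + r * x * z := by
        have := mul_le_mul_of_nonneg_left hzA (mul_nonneg hr.le hx0.le)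
        linarith
      gcongr
    have : 0 ≤ √A⁻¹ * (2 * (min 1 r)⁻¹ * (1 + z) ^ (-(3 / 2) : ℝ)) := by positivity
    linarith

/-- Contribution of `(1, ∞)` to the truncated identity. -/
lemma tendsto_truncKer_far {G s : ℝ → ℝ} {g S R γ : ℝ} (hPb : ∀ x, |P x| ≤ C / (1 + |x|))
    (hG : HolderBdd G g γ) (hs : HolderBdd s S γ) (hR : 0 < R) :
    Tendsto (fun A : ℝ => ∫ x in Set.Ioi 0, (Set.Ioi 1).indicator (fun x => G x * truncKer P R s A x) x)
      atTop (𝓝 0) := by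
  have hg := hG.nonneg
  have hS := hs.nonneg
  have hC : 0 ≤ C := by
    have := (abs_nonneg _).trans (hPb 0)
    simpa using this
  set r := R / 2 with hr
  have hrpos : 0 < r := by positivity
  set D := g * (R⁻¹ * (C * (1 + S))) with hD
  have hDnn : 0 ≤ D := by positivity
  set N := ∫ t : ℝ, (1 + |t|) ^ (-(3 / 2) : ℝ) with hN
  have hNint : Integrable fun t : ℝ => (1 + |t|) ^ (-(3 / 2) : ℝ) := by
    have := integrable_one_add_norm (E := ℝ) (μ := volume) (r := 3 / 2)
      (by simp only [Module.finrank_self, Nat.cast_one]; norm_num)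
    simpa only [Real.norm_eq_abs] using this
  have hxint : Integrable fun x : ℝ => 2 * (1 + x ^ 2)⁻¹ := integrable_inv_one_add_sq.const_mul 2
  set M := ∫ x : ℝ, 2 * (1 + x ^ 2)⁻¹ with hM
  have hbound : ∀ᶠ A : ℝ in atTop, |∫ x in Set.Ioi 0, (Set.Ioi 1).indicator (fun x => G x * truncKer P R s A x) x|
      ≤ D * (A⁻¹ * ((R⁻¹ + r⁻¹) * M) + √A⁻¹ * (2 * (min 1 r)⁻¹ * N)) := by
    filter_upwards [eventually_ge_atTop 1] with A hA
    have hA0 : 0 < A := by linarith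
    have hshift : Integrable fun x : ℝ => (1 + |x - 2 * A|) ^ (-(3 / 2) : ℝ) := hNint.comp_sub_right (2 * A)
    have hNs : ∫ x : ℝ, (1 + |x - 2 * A|) ^ (-(3 / 2) : ℝ) = N :=
      integral_sub_right_eq_self (fun t : ℝ => (1 + |t|) ^ (-(3 / 2) : ℝ)) (2 * A)
    rw [← hNs, hM, ← integral_const_mul, ← integral_const_mul, ← integral_const_mul, ← integral_const_mul,
      ← integral_add ((hxint.const_mul _).const_mul _) ((hshift.const_mul _).const_mul _),
      ← integral_const_mul, ← integral_indicator measurableSet_Ioi]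
    refine norm_integral_le_of_norm_le (f := fun x => (Set.Ioi 0).indicator
      ((Set.Ioi 1).indicator (fun x => G x * truncKer P R s A x)) x)
      ((((hxint.const_mul _).const_mul _).add ((hshift.const_mul _).const_mul _)).const_mul _)
      (ae_of_all _ fun x => ?_)
    rw [Real.norm_eq_abs, Set.indicator_indicator]
    by_cases hx : x ∈ Set.Ioi (0:ℝ) ∩ Set.Ioi 1
    · rw [Set.indicator_of_mem hx]
      have hx1 : 1 < x := hx.2
      have hx0 : 0 < x := by linarith
      have e1 := (hPb (R * x ^ 2 / 2 + s x + R * A * x)).trans_eq (div_eq_mul_one_div _ _)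
      have e2 := (hPb (R * x ^ 2 / 2 + s x - R * A * x)).trans_eq (div_eq_mul_one_div _ _)
      have f1 := inv_one_add_abs_add_le (V := R * x ^ 2 / 2 + R * A * x) (hs.bound x)
      have f2 := inv_one_add_abs_add_le (V := R * x ^ 2 / 2 - R * A * x) (hs.bound x)
      rw [add_right_comm] at f1
      rw [sub_add_eq_add_sub] at f2
      have f2' : |R * x ^ 2 / 2 - R * A * x| = r * x * |x - 2 * A| := by
        rw [show R * x ^ 2 / 2 - R * A * x = r * x * (x - 2 * A) by rw [hr]; ring, abs_mul,
          abs_of_pos (by positivity)]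
      have f1' : (1 + S) / (1 + |R * x ^ 2 / 2 + R * A * x|) ≤ (1 + S) * (1 / (R * A * x)) := by
        rw [abs_of_pos (by positivity), mul_one_div]
        gcongr
        have : 0 < R * x ^ 2 / 2 := by positivity
        linarith
      have hT : |truncKer P R s A x| ≤ R⁻¹ * (C * (1 + S)) *
          (1 / x * (1 / (R * A * x)) + 1 / x * (1 / (1 + r * x * |x - 2 * A|))) := by
        unfold truncKer
        rw [abs_div, abs_of_pos (show 0 < R * x by positivity), div_le_iff₀ (by positivity)]
        have g1 := e1.trans (mul_le_mul_of_nonneg_left (f1.trans f1') hC)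
        have g2 := e2.trans (mul_le_mul_of_nonneg_left f2 hC)
        rw [f2'] at g2
        refine (abs_sub _ _).trans ((add_le_add g1 g2).trans_eq ?_)
        field_simp
      have hfar := far_phase_le hrpos hA hx1.le
      have hxx : 1 / x ^ 2 ≤ 2 * (1 + x ^ 2)⁻¹ := by
        rw [← div_eq_mul_inv, div_le_div_iff₀ (by positivity) (by positivity)]
        nlinarith
      rw [abs_mul]
      calc |G x| * |truncKer P R s A x| ≤ g * (R⁻¹ * (C * (1 + S)) *
          (1 / x * (1 / (R * A * x)) + (A⁻¹ * (r⁻¹ * (1 / x ^ 2)) +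
            √A⁻¹ * (2 * (min 1 r)⁻¹ * (1 + |x - 2 * A|) ^ (-(3 / 2) : ℝ))))) := by
            gcongr
            · exact hG.bound x
            · exact hT.trans (by gcongr)
        _ = D * (A⁻¹ * ((R⁻¹ + r⁻¹) * (1 / x ^ 2)) +
            √A⁻¹ * (2 * (min 1 r)⁻¹ * (1 + |x - 2 * A|) ^ (-(3 / 2) : ℝ))) := by
            rw [hD, show 1 / x * (1 / (R * A * x)) = A⁻¹ * (R⁻¹ * (1 / x ^ 2)) by field_simp]; ring
        _ ≤ _ := by gcongr
    · rw [Set.indicator_of_notMem hx, abs_zero]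
      have : 0 < min 1 r := lt_min one_pos hrpos
      positivity
  have hz : Tendsto (fun A : ℝ => D * (A⁻¹ * ((R⁻¹ + r⁻¹) * M) + √A⁻¹ * (2 * (min 1 r)⁻¹ * N)))
      atTop (𝓝 0) := by
    have h1 : Tendsto (fun A : ℝ => A⁻¹) atTop (𝓝 0) := tendsto_inv_atTop_zero
    have h2 : Tendsto (fun A : ℝ => √A⁻¹) atTop (𝓝 0) := by
      have := (Real.continuous_sqrt.tendsto 0).comp h1
      rwa [Real.sqrt_zero] at this
    have := ((h1.mul_const ((R⁻¹ + r⁻¹) * M)).add (h2.mul_const (2 * (min 1 r)⁻¹ * N))).const_mul D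
    simpa using this
  exact squeeze_zero_norm' hbound hz

end

/-- Oscillatory integral with phase `R (x² / 2 - α x) + s(x)`. -/
noncomputable def phaseInt (R : ℝ) (G p s : ℝ → ℝ) (α : ℝ) : ℝ :=
  ∫ x, G x * p (R * (x ^ 2 / 2 - α * x) + s x)

lemma integrable_one_add_mul_sq_rpow {c γ : ℝ} (hc : 0 < c) (hγ : 0 < γ) :
    Integrable fun α : ℝ => (1 + c * α ^ 2) ^ (-((1 + γ) / 2)) := by
  have h := integrable_rpow_neg_one_add_norm_sq (E := ℝ) (μ := volume) (r := 1 + γ)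
    (by simp only [Module.finrank_self, Nat.cast_one]; linarith)
  have h2 := h.comp_mul_left' (R := √c) (by positivity)
  refine h2.congr (ae_of_all _ fun α => ?_)
  simp only [Real.norm_eq_abs, sq_abs, mul_pow, Real.sq_sqrt hc.le, neg_div]

lemma continuous_phase {R : ℝ} {G p s : ℝ → ℝ} (hG : Continuous G) (hp : Continuous p)
    (hs : Continuous s) :
    Continuous fun q : ℝ × ℝ => G q.2 * p (R * (q.2 ^ 2 / 2 - q.1 * q.2) + s q.2) := by
  fun_prop

/-- Decay of the oscillatory integral in its parameter. -/
theorem exists_abs_phaseInt_le {γ R : ℝ} (hγ : 0 < γ) (hγ1 : γ < 1) (hR : 0 < R) :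
    ∃ D, 0 ≤ D ∧ ∀ {p G s : ℝ → ℝ} {C g S : ℝ}, DecKer p C → HolderBdd G g γ → HolderBdd s S γ →
      ∀ α, Integrable (fun x => G x * p (R * (x ^ 2 / 2 - α * x) + s x)) ∧
        |phaseInt R G p s α| ≤
          4 * C * g * (1 + S) * (1 + S ^ 2) * D * (1 + R / 2 * α ^ 2) ^ (-((1 + γ) / 2)) := by
  obtain ⟨D, hD, hq⟩ := OscKer.quadratic hγ hγ1 hR le_rfl hR.le
  refine ⟨D, hD, ?_⟩
  intro p G s C g S hp hG hs α
  have hJ := hp.oscKer hγ (hG.comp_add α) (hs.comp_add α)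
  have hb : ∀ z, HasDerivAt (fun z => R * z ^ 2 / 2 - R * α ^ 2 / 2) (R * z) z := by
    intro z
    refine (((hasDerivAt_pow 2 z).const_mul R).div_const 2).sub_const _ |>.congr_deriv ?_
    norm_num
    ring
  obtain ⟨h1, h2⟩ := hq hJ hb (fun x => le_of_eq (by ring)) (fun x => le_of_eq (by ring))
    (fun x x' => by rw [← mul_sub, abs_mul, abs_of_pos hR])
  have e : (fun z => G (α + z) * p (R * z ^ 2 / 2 - R * α ^ 2 / 2 + s (α + z)))
      = fun z => (fun x => G x * p (R * (x ^ 2 / 2 - α * x) + s x)) (α + z) := by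
    funext z
    simp only
    congr 3
    ring
  rw [e] at h1 h2
  rw [integral_add_left_eq_self (fun x => G x * p (R * (x ^ 2 / 2 - α * x) + s x)) α] at h2
  constructor
  · have := h1.comp_add_left (-α)
    simpa only [add_neg_cancel_left] using this
  · refine h2.trans_eq ?_
    congr 3
    rw [abs_of_nonpos]
    · ring
    · have : 0 ≤ R * α ^ 2 := by positivity
      norm_num
      linarith

section
variable {p P G s : ℝ → ℝ} {C g S R γ : ℝ}

lemma integral_phase_eq_truncKer (hp : DecKer p C) (hP : ∀ x, HasDerivAt P (p x) x) (hR : 0 < R)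
    (A : ℝ) {x : ℝ} (hx : x ≠ 0) :
    ∫ α in (-A)..A, p (R * (x ^ 2 / 2 - α * x) + s x) = truncKer P R s A x := by
  have hd : ∀ α : ℝ, HasDerivAt (fun α => P (R * (x ^ 2 / 2 - α * x) + s x) / (-(R * x)))
      (p (R * (x ^ 2 / 2 - α * x) + s x)) α := by
    intro α
    have h1 : HasDerivAt (fun α => R * (x ^ 2 / 2 - α * x) + s x) (-(R * x)) α := by
      refine ((((hasDerivAt_id α).mul_const x).const_sub _).const_mul R).add_const _ |>.congr_deriv ?_
      ring
    refine (((hP _).comp α h1).div_const (-(R * x))).congr_deriv ?_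
    field_simp
  have hc := hp.continuous
  rw [intervalIntegral.integral_eq_sub_of_hasDerivAt (fun α _ => hd α)
    (Continuous.intervalIntegrable (by fun_prop) _ _)]
  unfold truncKer
  rw [show R * (x ^ 2 / 2 - A * x) + s x = R * x ^ 2 / 2 + s x - R * A * x by ring,
    show R * (x ^ 2 / 2 - -A * x) + s x = R * x ^ 2 / 2 + s x + R * A * x by ring]
  field_simp
  ring

lemma integrable_phase_prod (hp : DecKer p C) (hγ : 0 < γ)
    (hG : HolderBdd G g γ) (hs : HolderBdd s S γ) (hR : 0 < R) (A : ℝ) :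
    Integrable (fun q : ℝ × ℝ => G q.2 * p (R * (q.2 ^ 2 / 2 - q.1 * q.2) + s q.2))
      ((volume.restrict (Set.Ioc (-A) A)).prod volume) := by
  have hg := hG.nonneg
  have hS := hs.nonneg
  have hC := hp.C_nonneg
  set M := g * C * ((2 + 2 / R * (1 + S)) * (1 + A ^ 2)) * (2 * (1 + A ^ 2)) with hM
  have hd : Integrable (fun q : ℝ × ℝ => (1:ℝ) * (M * (1 + q.2 ^ 2)⁻¹))
      ((volume.restrict (Set.Ioc (-A) A)).prod volume) :=
    Integrable.mul_prod (f := fun _ : ℝ => (1:ℝ)) (g := fun x : ℝ => M * (1 + x ^ 2)⁻¹)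
      (integrable_const _) (integrable_inv_one_add_sq.const_mul M)
  refine hd.mono' ?_ ?_
  · exact (continuous_phase (hG.continuous hγ) hp.continuous (hs.continuous hγ)).aestronglyMeasurable
  · have hmem : ∀ᵐ q : ℝ × ℝ ∂((volume.restrict (Set.Ioc (-A) A)).prod volume), q.1 ∈ Set.Ioc (-A) A := by
      have : ∀ᵐ α ∂(volume.restrict (Set.Ioc (-A) A)), α ∈ Set.Ioc (-A) A :=
        ae_restrict_mem measurableSet_Ioc
      exact Measure.quasiMeasurePreserving_fst.ae this
    filter_upwards [hmem] with q hq
    obtain ⟨α, x⟩ := q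
    simp only at hq ⊢
    have hαA : |α| ≤ A := abs_le.2 ⟨hq.1.le, hq.2⟩
    have hα2 : α ^ 2 ≤ A ^ 2 := by rw [← sq_abs]; gcongr
    have h1 := one_add_sq_le_phase hR x α (s x) (hs.bound x)
    have h2 := inv_one_add_sq_add_le (V := x) (s := -α) (S := A) (by rwa [abs_neg])
    set V := R * (x ^ 2 / 2 - α * x) + s x
    have h3 : 1 / (1 + V ^ 2) ≤ (2 + 2 / R * (1 + S)) * (1 + α ^ 2) * (1 / (1 + (x + -α) ^ 2)) := by
      rw [← sub_eq_add_neg, mul_one_div, div_le_div_iff₀ (by positivity) (by positivity), one_mul]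
      exact h1
    rw [Real.norm_eq_abs, abs_mul, one_mul]
    calc |G x| * |p V| ≤ g * (C * (1 / (1 + V ^ 2))) := by
          gcongr
          · exact hG.bound x
          · rw [mul_one_div]; exact hp.bound V
      _ ≤ g * (C * ((2 + 2 / R * (1 + S)) * (1 + A ^ 2) * (2 * (1 + A ^ 2) / (1 + x ^ 2)))) := by
          gcongr
          exact h3.trans (by gcongr)
      _ = _ := by rw [hM]; ring

/-- Exact value of the integral over the parameter of the oscillatory integrals. -/
theorem integral_phaseInt {Fv : ℝ → ℝ} (hp : DecKer p C) (hP : ∀ x, HasDerivAt P (p x) x)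
    (hPb : ∀ x, |P x| ≤ C / (1 + |x|)) (hγ : 0 < γ) (hγ1 : γ < 1) (hG : HolderBdd G g γ)
    (hs : HolderBdd s S γ) (hR : 0 < R)
    (hF : ∀ c, ∫ y in Set.Ioi (0:ℝ), (P (c + y) - P (c - y)) / y = -(Real.pi * Fv c)) :
    Integrable (phaseInt R G p s) ∧
      ∫ α, phaseInt R G p s α = -(2 * Real.pi / R) * G 0 * Fv (s 0) := by
  obtain ⟨D, hD, hb⟩ := exists_abs_phaseInt_le hγ hγ1 hR
  have hcont := continuous_phase (R := R) (hG.continuous hγ) hp.continuous (hs.continuous hγ)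
  have hint : Integrable (phaseInt R G p s) := by
    refine ((integrable_one_add_mul_sq_rpow (c := R / 2) (by positivity) hγ).const_mul
      (4 * C * g * (1 + S) * (1 + S ^ 2) * D)).mono' ?_ (ae_of_all _ fun α => ?_)
    · exact (hcont.stronglyMeasurable.integral_prod_right (ν := volume)).aestronglyMeasurable
    · exact (hb hp hG hs α).2
  refine ⟨hint, ?_⟩
  have hlim := intervalIntegral_tendsto_integral hint tendsto_neg_atTop_atBot tendsto_id
  refine tendsto_nhds_unique hlim ?_
  have heq : ∀ᶠ A : ℝ in atTop,
      ((∫ x in Set.Ioi 0, (Set.Iic 1).indicator (fun x => G x * truncKer P R s A x) x) +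
        ∫ x in Set.Ioi 0, (Set.Ioi 1).indicator (fun x => G x * truncKer P R s A x) x) +
      ((∫ x in Set.Ioi 0, (Set.Iic 1).indicator
          (fun x => G (-x) * truncKer P R (fun x => s (-x)) A x) x) +
        ∫ x in Set.Ioi 0, (Set.Ioi 1).indicator
          (fun x => G (-x) * truncKer P R (fun x => s (-x)) A x) x)
      = ∫ α in (-A)..(id A), phaseInt R G p s α := by
    filter_upwards [eventually_ge_atTop 0] with A hA
    have hprod := integrable_phase_prod hp hγ hG hs hR A
    have hae : ∀ᵐ x : ℝ, ∫ α in Set.Ioc (-A) A, G x * p (R * (x ^ 2 / 2 - α * x) + s x)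
        = G x * truncKer P R s A x := by
      filter_upwards [Measure.ae_ne volume (0:ℝ)] with x hx
      rw [integral_const_mul, ← intervalIntegral.integral_of_le (by linarith),
        integral_phase_eq_truncKer hp hP hR A hx]
    have hTi : Integrable fun x => G x * truncKer P R s A x :=
      hprod.integral_prod_right.congr hae
    have hneg : (fun x => G (-x) * truncKer P R (fun x => s (-x)) A x)
        = fun x => (fun x => G x * truncKer P R s A x) (-x) := by
      funext x
      simp only [truncKer]
      rw [show R * (-x) ^ 2 / 2 + s (-x) + R * A * (-x) = R * x ^ 2 / 2 + s (-x) - R * A * x by ring,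
        show R * (-x) ^ 2 / 2 + s (-x) - R * A * (-x) = R * x ^ 2 / 2 + s (-x) + R * A * x by ring,
        mul_neg, div_neg, ← neg_div, neg_sub]
    have hsplit : ∀ f : ℝ → ℝ, Integrable f →
        (∫ x in Set.Ioi 0, (Set.Iic 1).indicator f x) + ∫ x in Set.Ioi 0, (Set.Ioi 1).indicator f x
          = ∫ x in Set.Ioi 0, f x := by
      intro f hf
      rw [← integral_add (hf.restrict.indicator measurableSet_Iic)
        (hf.restrict.indicator measurableSet_Ioi)]
      refine integral_congr_ae (ae_of_all _ fun x => ?_)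
      simp only [← Set.compl_Iic, Set.indicator_self_add_compl_apply]
    rw [hneg, hsplit _ hTi, hsplit _ hTi.comp_neg, integral_comp_neg_Ioi (0:ℝ) fun x => G x * truncKer P R s A x,
      neg_zero, id, intervalIntegral.integral_of_le (by linarith)]
    rw [add_comm, ← setIntegral_union (Set.Iic_disjoint_Ioi le_rfl) measurableSet_Ioi
      hTi.integrableOn hTi.integrableOn, Set.Iic_union_Ioi, setIntegral_univ, ← integral_congr_ae hae]
    exact (integral_integral_swap hprod).symm
  refine Tendsto.congr' heq ?_
  have h1 := (tendsto_truncKer_near hp hP hPb hγ hG hs hR).add (tendsto_truncKer_far hPb hG hs hR)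
  have h2 := (tendsto_truncKer_near hp hP hPb hγ hG.comp_neg hs.comp_neg hR).add
    (tendsto_truncKer_far hPb hG.comp_neg hs.comp_neg hR)
  have h3 := h1.add h2
  convert h3 using 2
  simp only [neg_zero, integral_const_mul, hF]
  field_simp
  ring
end

namespace Kernels
variable {ik k w G s : ℝ → ℝ} {L ρ g S R γ : ℝ}

theorem integral_phaseInt (K : Kernels ik k w L ρ) (hγ : 0 < γ) (hγ1 : γ < 1)
    (hG : HolderBdd G g γ) (hs : HolderBdd s S γ) (hR : 0 < R) :
    Integrable (phaseInt R G (latMean k w) s) ∧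
      ∫ α, phaseInt R G (latMean k w) s α = -(2 * Real.pi / R) * G 0 * conv1 ik w (s 0) := by
  obtain ⟨L', h1, h2⟩ := K.conv1_ik_lipSupp
  obtain ⟨C, hC, hdec⟩ := K.exists_decKer
  obtain ⟨C', hC', hP⟩ := h1.exists_abs_hil_le
  have hm := (K.decKer_latMean hdec)
  have hm' : DecKer (latMean k w) (C + C') := by
    refine ⟨fun v => (hm.bound v).trans ?_, fun v v' => (hm.lip v v').trans ?_, hm.mean⟩
    · gcongr; linarith
    · gcongr; linarith
  refine _root_.integral_phaseInt (P := hil (conv1 ik w)) hm' (fun x => ?_) (fun x => (hP x).trans ?_)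
    hγ hγ1 hG hs hR h1.integral_hil_diffQuot
  · rw [K.latMean_eq_hil]
    exact h1.hasDerivAt_hil h2 K.hasDerivAt_conv1 x
  · gcongr; linarith

end Kernels

lemma quad_bounds {b b' : ℝ → ℝ} {c C : ℝ} (hb : ∀ x, HasDerivAt b (b' x) x) (h0 : b' 0 = 0)
    (h1 : ∀ x, c * x ^ 2 ≤ x * b' x) (h2 : ∀ x, x * b' x ≤ C * x ^ 2) (z : ℝ) :
    c / 2 * z ^ 2 ≤ b z - b 0 ∧ b z - b 0 ≤ C / 2 * z ^ 2 := by
  have key : ∀ {b b' : ℝ → ℝ} {c : ℝ}, (∀ x, HasDerivAt b (b' x) x) → b' 0 = 0 →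
      (∀ x, c * x ^ 2 ≤ x * b' x) → ∀ z, c / 2 * z ^ 2 ≤ b z - b 0 := by
    intro b b' c hb h0 h1 z
    rcases le_total 0 z with hz | hz
    · have := quad_mono hb (c := c) (fun x hx => by
        rcases hx.eq_or_lt with rfl | hx
        · simp [h0]
        · have := h1 x
          rw [pow_two, mul_left_comm] at this
          exact le_of_mul_le_mul_left this hx) le_rfl hz
      simpa using this
    · have hb2 : ∀ x, HasDerivAt (fun x => b (-x)) (-b' (-x)) x := fun x => by
        have := (hb (-x)).scomp x (hasDerivAt_neg x)
        rwa [neg_one_smul] at this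
      have := quad_mono hb2 (c := c) (fun x hx => by
        rcases hx.eq_or_lt with rfl | hx
        · simp [h0]
        · have := h1 (-x)
          rw [neg_mul, neg_sq, pow_two, mul_left_comm, ← mul_neg] at this
          exact le_of_mul_le_mul_left this hx) le_rfl (neg_nonneg.2 hz)
      simpa using this
  refine ⟨key hb h0 h1 z, ?_⟩
  have := key (b := fun x => -b x) (b' := fun x => -b' x) (c := -C) (fun x => (hb x).neg) (by simp [h0])
    (fun x => by have := h2 x; linarith) z
  linarith

lemma clamp_signs {l u α : ℝ} (hα : α ∈ Set.Icc l u) (θ : ℝ) :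
    0 ≤ (θ - α) * (clamp l u θ - α) ∧ 0 ≤ (θ - α) * (θ - clamp l u θ) := by
  have hlu := hα.1.trans hα.2
  rcases le_total θ u with h | h
  · rcases le_total l θ with h' | h'
    · rw [clamp_eq ⟨h', h⟩, sub_self, mul_zero]
      exact ⟨mul_self_nonneg _, le_rfl⟩
    · rw [clamp, min_eq_right h, max_eq_left h']
      have := hα.1
      constructor <;> nlinarith
  · rw [clamp, min_eq_left h, max_eq_right hlu]
    have := hα.2
    constructor <;> nlinarith

lemma sin_mul_self_bounds {m : ℝ} (hm : |m| ≤ 1) : m ^ 2 / 2 ≤ m * Real.sin m ∧ m * Real.sin m ≤ m ^ 2 := by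
  have key : ∀ m : ℝ, 0 ≤ m → m ≤ 1 → m ^ 2 / 2 ≤ m * Real.sin m ∧ m * Real.sin m ≤ m ^ 2 := by
    intro m h0 h1
    rcases h0.eq_or_lt with rfl | hp
    · simp
    · have e1 := Real.sin_gt_sub_cube hp
      have e2 := Real.sin_lt hp
      have e3 : m ^ 3 ≤ m := by nlinarith [mul_pos hp hp]
      constructor <;> nlinarith
  rcases le_total 0 m with h | h
  · rw [abs_of_nonneg h] at hm; exact key m h hm
  · rw [abs_of_nonpos h] at hm
    have := key (-m) (by linarith) hm
    rwa [neg_sq, Real.sin_neg, neg_mul_neg] at this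

/-- Bounds for the radius of curvature `R` on the arc of half-width `4 r` around `θ₁`. -/
structure ArcRadius (R : ℝ → ℝ) (θ₁ r R₁ R₂ Λ : ℝ) : Prop where
  r_pos : 0 < r
  r_le : r ≤ 1 / 10
  R₁_pos : 0 < R₁
  Λ_nonneg : 0 ≤ Λ
  low : ∀ θ, |θ - θ₁| ≤ 4 * r → R₁ ≤ R θ
  upp : ∀ θ, |θ - θ₁| ≤ 4 * r → R θ ≤ R₂
  lip : ∀ θ θ', |θ - θ₁| ≤ 4 * r → |θ' - θ₁| ≤ 4 * r → |R θ - R θ'| ≤ Λ * |θ - θ'|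

namespace ArcRadius
variable {R : ℝ → ℝ} {θ₁ r R₁ R₂ Λ α : ℝ}

lemma le_upp (h : ArcRadius R θ₁ r R₁ R₂ Λ) : R₁ ≤ R₂ := by
  have : |θ₁ - θ₁| ≤ 4 * r := by rw [sub_self, abs_zero]; linarith [h.r_pos]
  exact (h.low _ this).trans (h.upp _ this)

lemma clamp_near (h : ArcRadius R θ₁ r R₁ R₂ Λ) (θ : ℝ) :
    |clamp (θ₁ - 3 * r) (θ₁ + 3 * r) θ - θ₁| ≤ 3 * r := by
  have := clamp_mem (show θ₁ - 3 * r ≤ θ₁ + 3 * r by linarith [h.r_pos]) θ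
  rw [abs_le]
  constructor <;> linarith [this.1, this.2]

/-- The phase derivative `R(θ) sin(θ - α)`, continued linearly off the arc. -/
noncomputable def _root_.nearSlope (R : ℝ → ℝ) (θ₁ r α θ : ℝ) : ℝ :=
  R (clamp (θ₁ - 3 * r) (θ₁ + 3 * r) θ) * Real.sin (clamp (θ₁ - 3 * r) (θ₁ + 3 * r) θ - α) +
    (θ - clamp (θ₁ - 3 * r) (θ₁ + 3 * r) θ)

lemma lip_mul_sin (h : ArcRadius R θ₁ r R₁ R₂ Λ) {m m' : ℝ} (hm : |m - θ₁| ≤ 4 * r)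
    (hm' : |m' - θ₁| ≤ 4 * r) :
    |R m * Real.sin (m - α) - R m' * Real.sin (m' - α)| ≤ (Λ + R₂) * |m - m'| := by
  have h1 := h.lip m m' hm hm'
  have h2 : |Real.sin (m - α) - Real.sin (m' - α)| ≤ |m - m'| := by
    have := Real.abs_sin_sub_sin_le (m - α) (m' - α)
    rwa [sub_sub_sub_cancel_right] at this
  have h3 : |R m'| ≤ R₂ := by
    rw [abs_of_nonneg (h.R₁_pos.le.trans (h.low m' hm'))]
    exact h.upp m' hm'
  calc |R m * Real.sin (m - α) - R m' * Real.sin (m' - α)|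
      = |(R m - R m') * Real.sin (m - α) + R m' * (Real.sin (m - α) - Real.sin (m' - α))| := by
        congr 1; ring
    _ ≤ (Λ * |m - m'|) * 1 + R₂ * |m - m'| := by
        refine (abs_add_le _ _).trans ?_
        rw [abs_mul, abs_mul]
        have := Real.abs_sin_le_one (m - α)
        have := (abs_nonneg _).trans h1
        have := (abs_nonneg _).trans h3
        gcongr
    _ = _ := by ring

lemma nearSlope_lip (h : ArcRadius R θ₁ r R₁ R₂ Λ) (θ θ' : ℝ) :
    |nearSlope R θ₁ r α θ - nearSlope R θ₁ r α θ'| ≤ (Λ + R₂ + 2) * |θ - θ'| := by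
  have hr := h.r_pos
  unfold nearSlope
  set m := clamp (θ₁ - 3 * r) (θ₁ + 3 * r) θ with hm
  set m' := clamp (θ₁ - 3 * r) (θ₁ + 3 * r) θ' with hm'
  have hcl : |m - m'| ≤ |θ - θ'| := abs_clamp_sub_le _ _ _ _
  have h1 := h.lip_mul_sin (α := α) ((h.clamp_near θ).trans (by linarith)) ((h.clamp_near θ').trans (by linarith))
  rw [← hm, ← hm'] at h1
  have hR₂ : 0 ≤ R₂ := h.R₁_pos.le.trans h.le_upp
  have hΛ := h.Λ_nonneg
  calc _ = |(R m * Real.sin (m - α) - R m' * Real.sin (m' - α)) + ((θ - θ') - (m - m'))| := by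
        congr 1; ring
    _ ≤ (Λ + R₂) * |θ - θ'| + (|θ - θ'| + |θ - θ'|) :=
        (abs_add_le _ _).trans (add_le_add (h1.trans (by gcongr)) ((abs_sub _ _).trans (by gcongr)))
    _ = _ := by ring

lemma nearSlope_bounds (h : ArcRadius R θ₁ r R₁ R₂ Λ) (hα : |α - θ₁| ≤ 2 * r) (θ : ℝ) :
    min (R₁ / 2) 1 * (θ - α) ^ 2 ≤ (θ - α) * nearSlope R θ₁ r α θ ∧
      (θ - α) * nearSlope R θ₁ r α θ ≤ max R₂ 1 * (θ - α) ^ 2 := by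
  have hr := h.r_pos
  have hrl := h.r_le
  rw [abs_le] at hα
  unfold nearSlope
  obtain ⟨s1, s2⟩ := clamp_signs (l := θ₁ - 3 * r) (u := θ₁ + 3 * r) (α := α)
    ⟨by linarith, by linarith⟩ θ
  have hn := h.clamp_near θ
  set m := clamp (θ₁ - 3 * r) (θ₁ + 3 * r) θ with hm
  have hlo := h.low m (hn.trans (by linarith))
  have hup := h.upp m (hn.trans (by linarith))
  have hR1 := h.R₁_pos
  rw [abs_le] at hn
  have hm1 : |m - α| ≤ 1 := by rw [abs_le]; constructor <;> linarith
  obtain ⟨t1, t2⟩ := sin_mul_self_bounds hm1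
  have hsin : ∃ q, R₁ / 2 ≤ q ∧ q ≤ R₂ ∧ R m * Real.sin (m - α) = q * (m - α) := by
    rcases eq_or_ne (m - α) 0 with e | e
    · exact ⟨R₂, by linarith, le_rfl, by simp [e]⟩
    · have hsq : 0 < (m - α) ^ 2 := by positivity
      refine ⟨R m * ((m - α) * Real.sin (m - α)) / (m - α) ^ 2, ?_, ?_, ?_⟩
      · rw [le_div_iff₀ hsq]
        nlinarith
      · rw [div_le_iff₀ hsq]
        nlinarith
      · field_simp
  obtain ⟨q, q1, q2, hq⟩ := hsin
  rw [hq]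
  have e1 : (θ - α) * (q * (m - α) + (θ - m)) = q * ((θ - α) * (m - α)) + (θ - α) * (θ - m) := by ring
  have e2 : (θ - α) ^ 2 = (θ - α) * (m - α) + (θ - α) * (θ - m) := by ring
  rw [e1, e2]
  have c1 : min (R₁ / 2) 1 ≤ q := (min_le_left _ _).trans q1
  have c2 : min (R₁ / 2) 1 ≤ 1 := min_le_right _ _
  have c3 : q ≤ max R₂ 1 := q2.trans (le_max_left _ _)
  have c4 : 1 ≤ max R₂ 1 := le_max_right _ _
  set X := (θ - α) * (m - α)
  set Y := (θ - α) * (θ - m)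
  constructor <;> nlinarith

/-- The phase, continued off the arc. -/
noncomputable def _root_.nearPhase (b R : ℝ → ℝ) (θ₁ r α θ : ℝ) : ℝ :=
  b α + ∫ t in α..θ, nearSlope R θ₁ r α t

lemma continuous_nearSlope (h : ArcRadius R θ₁ r R₁ R₂ Λ) : Continuous (nearSlope R θ₁ r α) := by
  have : LipschitzWith (Real.toNNReal (Λ + R₂ + 2)) (nearSlope R θ₁ r α) := by
    refine LipschitzWith.of_dist_le_mul fun x y => ?_
    have hR₂ : 0 ≤ R₂ := h.R₁_pos.le.trans h.le_upp
    have hΛ := h.Λ_nonneg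
    rw [Real.dist_eq, Real.dist_eq, Real.coe_toNNReal _ (by positivity)]
    exact h.nearSlope_lip x y
  exact this.continuous

lemma hasDerivAt_nearPhase (h : ArcRadius R θ₁ r R₁ R₂ Λ) (b : ℝ → ℝ) (θ : ℝ) :
    HasDerivAt (nearPhase b R θ₁ r α) (nearSlope R θ₁ r α θ) θ :=
  hasDerivAt_primitive h.continuous_nearSlope α θ

lemma nearPhase_eq (h : ArcRadius R θ₁ r R₁ R₂ Λ) {b b' : ℝ → ℝ} (hb : ∀ θ, HasDerivAt b (b' θ) θ)
    (hb' : Continuous b') (hbR : ∀ θ, |θ - θ₁| ≤ 4 * r → b' θ = R θ * Real.sin (θ - α))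
    (hα : |α - θ₁| ≤ 2 * r) {θ : ℝ} (hθ : |θ - θ₁| ≤ 3 * r) : nearPhase b R θ₁ r α θ = b θ := by
  have hr := h.r_pos
  rw [abs_le] at hα hθ
  refine primitive_eq (l := θ₁ - 3 * r) (u := θ₁ + 3 * r) hb hb' (fun t ht => ?_)
    ⟨by linarith, by linarith⟩ ⟨by linarith, by linarith⟩
  rw [hbR t (by rw [abs_le]; constructor <;> linarith [ht.1, ht.2]), nearSlope, clamp_eq ht, sub_self,
    add_zero]

/-- Quadratic growth of the phase away from its critical point. -/
lemma phase_sub_bounds (h : ArcRadius R θ₁ r R₁ R₂ Λ) {b b' : ℝ → ℝ} (hb : ∀ θ, HasDerivAt b (b' θ) θ)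
    (hb' : Continuous b') (hbR : ∀ θ, |θ - θ₁| ≤ 4 * r → b' θ = R θ * Real.sin (θ - α))
    (hα : |α - θ₁| ≤ 2 * r) {θ : ℝ} (hθ : |θ - θ₁| ≤ 3 * r) :
    min (R₁ / 2) 1 / 2 * (θ - α) ^ 2 ≤ b θ - b α ∧ b θ - b α ≤ max R₂ 1 / 2 * (θ - α) ^ 2 := by
  have hr := h.r_pos
  have hd : ∀ z, HasDerivAt (fun z => nearPhase b R θ₁ r α (α + z)) (nearSlope R θ₁ r α (α + z)) z :=
    fun z => (h.hasDerivAt_nearPhase b (α + z)).comp_const_add α z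
  have h0 : nearSlope R θ₁ r α (α + 0) = 0 := by
    rw [abs_le] at hα
    rw [add_zero, nearSlope, clamp_eq ⟨by linarith, by linarith⟩]
    simp
  have hb2 := fun z => h.nearSlope_bounds hα (α + z)
  simp only [add_sub_cancel_left] at hb2
  have := quad_bounds hd h0 (fun z => (hb2 z).1) (fun z => (hb2 z).2) (θ - α)
  simp only [add_sub_cancel, add_zero] at this
  rwa [h.nearPhase_eq hb hb' hbR hα hθ, h.nearPhase_eq hb hb' hbR hα (hα.trans (by linarith))] at this

/-- Rescaling of the arc variable. -/
lemma _root_.integral_rescale (f : ℝ → ℝ) (c : ℝ) {ε : ℝ} (hε : 0 < ε) :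
    ∫ θ, f θ = √ε * ∫ x, f (c + √ε * x) := by
  have hs : 0 < √ε := Real.sqrt_pos.2 hε
  rw [Measure.integral_comp_mul_left (fun t => f (c + t)) (√ε), abs_of_pos (inv_pos.2 hs), smul_eq_mul,
    mul_inv_cancel_left₀ hs.ne', integral_add_left_eq_self]

/-- Oscillation estimate when the critical point lies near the arc. -/
theorem near_bound (h : ArcRadius R θ₁ r R₁ R₂ Λ) {γ : ℝ} (hγ : 0 < γ) (hγ1 : γ < 1) :
    ∃ D, 0 ≤ D ∧ ∀ {ε α : ℝ}, 0 < ε → |α - θ₁| ≤ 2 * r →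
      ∀ {b b' : ℝ → ℝ}, (∀ θ, HasDerivAt b (b' θ) θ) → Continuous b' →
      (∀ θ, |θ - θ₁| ≤ 4 * r → b' θ = R θ * Real.sin (θ - α)) →
      ∀ {p G s : ℝ → ℝ} {C g S : ℝ}, DecKer p C → HolderBdd (fun x => G (α + √ε * x)) g γ →
      HolderBdd (fun x => s (α + √ε * x)) S γ → (∀ θ, r ≤ |θ - θ₁| → G θ = 0) →
      |∫ θ, G θ * p (b θ / ε + s θ)| ≤
        √ε * (4 * C * g * (1 + S) * (1 + S ^ 2) * D * (1 + |b α| / ε) ^ (-((1 + γ) / 2))) := by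
  have hR1 := h.R₁_pos
  have hR₂ : 0 ≤ R₂ := hR1.le.trans h.le_upp
  have hΛ := h.Λ_nonneg
  obtain ⟨D, hD, hq⟩ := OscKer.quadratic (γ := γ) (c := min (R₁ / 2) 1) (C₁ := max R₂ 1)
    (Λ := Λ + R₂ + 2) hγ hγ1 (lt_min (by linarith) one_pos)
    ((min_le_right _ _).trans (le_max_right _ _)) (by positivity)
  refine ⟨D, hD, ?_⟩
  intro ε α hε hα b b' hb hb' hbR p G s C g S hp hG hs hG0
  have hr := h.r_pos
  have hsε : 0 < √ε := Real.sqrt_pos.2 hε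
  have hsq : √ε * √ε = ε := Real.mul_self_sqrt hε.le
  have hext : ∀ θ, G θ * p (b θ / ε + s θ) = G θ * p (nearPhase b R θ₁ r α θ / ε + s θ) := by
    intro θ
    rcases lt_or_ge |θ - θ₁| r with hθ | hθ
    · rw [h.nearPhase_eq hb hb' hbR hα (by linarith)]
    · rw [hG0 θ hθ, zero_mul, zero_mul]
  simp only [hext]
  rw [integral_rescale _ α hε, abs_mul, abs_of_pos hsε]
  gcongr
  have hd : ∀ x, HasDerivAt (fun x => nearPhase b R θ₁ r α (α + √ε * x) / ε)
      (nearSlope R θ₁ r α (α + √ε * x) / √ε) x := by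
    intro x
    have h1 : HasDerivAt (fun x => α + √ε * x) √ε x := by
      simpa using ((hasDerivAt_id x).const_mul √ε).const_add α
    refine (((h.hasDerivAt_nearPhase b _).comp x h1).div_const ε).congr_deriv ?_
    rw [div_eq_div_iff hε.ne' hsε.ne', mul_assoc, hsq]
  have hb2 := fun x => h.nearSlope_bounds hα (α + √ε * x)
  simp only [add_sub_cancel_left, mul_pow, Real.sq_sqrt hε.le] at hb2
  have hscale : ∀ x, x * (nearSlope R θ₁ r α (α + √ε * x) / √ε)
      = √ε * x * nearSlope R θ₁ r α (α + √ε * x) / ε := by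
    intro x
    rw [mul_div_assoc', div_eq_div_iff hsε.ne' hε.ne']
    linear_combination -(x * nearSlope R θ₁ r α (α + √ε * x)) * hsq
  refine ((hq (hp.oscKer hγ hG hs) hd (fun x => ?_) (fun x => ?_) (fun x x' => ?_)).2).trans_eq ?_
  · rw [hscale, le_div_iff₀ hε]
    linarith [(hb2 x).1]
  · rw [hscale, div_le_iff₀ hε]
    linarith [(hb2 x).2]
  · rw [← sub_div, abs_div, abs_of_pos hsε, div_le_iff₀ hsε]
    refine (h.nearSlope_lip _ _).trans_eq ?_
    rw [add_sub_add_left_eq_sub, ← mul_sub, abs_mul, abs_of_pos hsε]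
    ring
  · rw [mul_zero, add_zero, h.nearPhase_eq hb hb' hbR hα (hα.trans (by linarith)), abs_div, abs_of_pos hε]

/-- Oscillation estimate when the phase has no critical point near the arc. -/
theorem far_bound (h : ArcRadius R θ₁ r R₁ R₂ Λ) {γ : ℝ} (hγ : 0 < γ) (hγ1 : γ < 1) :
    ∃ D, 0 ≤ D ∧ ∀ {ε α : ℝ}, 0 < ε → ε ≤ 1 → 2 * r ≤ α - θ₁ → α - θ₁ ≤ Real.pi - 2 * r →
      ∀ {b b' : ℝ → ℝ}, (∀ θ, HasDerivAt b (b' θ) θ) → Continuous b' →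
      (∀ θ, |θ - θ₁| ≤ 4 * r → b' θ = R θ * Real.sin (θ - α)) →
      ∀ {p G s : ℝ → ℝ} {C g S : ℝ}, DecKer p C → HolderBdd (fun x => G (θ₁ + √ε * x)) g γ →
      HolderBdd (fun x => s (θ₁ + √ε * x)) S γ → (∀ θ, r ≤ |θ - θ₁| → G θ = 0) →
      |∫ θ, G θ * p (b θ / ε + s θ)| ≤
        √ε * (4 * C * g * (1 + S) * (1 + S ^ 2) * D * √ε ^ (1 + γ)) := by
  have hR1 := h.R₁_pos
  have hR₂ : 0 < R₂ := hR1.trans_le h.le_upp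
  have hΛ := h.Λ_nonneg
  have hr := h.r_pos
  have hrl := h.r_le
  have hπ := Real.pi_gt_three
  have hsin : 0 < Real.sin r := Real.sin_pos_of_pos_of_lt_pi hr (by linarith)
  set m := R₁ * Real.sin r with hm
  have hm0 : 0 < m := by positivity
  set B := (Λ + R₂) / m with hB
  have hB0 : 0 ≤ B := by positivity
  have hmom := momentConst_nonneg γ
  refine ⟨(2 + R₂ / m + B) * (m ^ (-(1 + γ)) * momentConst γ), by positivity, ?_⟩
  intro ε α hε hε1 hα1 hα2 b b' hb hb' hbR p G s C g S hp hG hs hG0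
  have hsε : 0 < √ε := Real.sqrt_pos.2 hε
  have hsq : √ε * √ε = ε := Real.mul_self_sqrt hε.le
  have hsε1 : √ε ≤ 1 := Real.sqrt_le_one.2 hε1
  set q : ℝ → ℝ := fun θ => -(R (clamp (θ₁ - r) (θ₁ + r) θ) *
    Real.sin (clamp (θ₁ - r) (θ₁ + r) θ - α)) with hq
  have hcl : ∀ θ, |clamp (θ₁ - r) (θ₁ + r) θ - θ₁| ≤ r := fun θ => by
    have := clamp_mem (show θ₁ - r ≤ θ₁ + r by linarith) θ
    rw [abs_le]
    constructor <;> linarith [this.1, this.2]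
  have hql : ∀ θ θ', |q θ - q θ'| ≤ (Λ + R₂) * |θ - θ'| := by
    intro θ θ'
    simp only [hq]
    rw [neg_sub_neg, abs_sub_comm]
    refine (h.lip_mul_sin ((hcl θ).trans (by linarith)) ((hcl θ').trans (by linarith))).trans ?_
    have := abs_clamp_sub_le (θ₁ - r) (θ₁ + r) θ θ'
    gcongr
  have hqc : Continuous q := by
    have : LipschitzWith (Real.toNNReal (Λ + R₂)) q := by
      refine LipschitzWith.of_dist_le_mul fun x y => ?_
      rw [Real.dist_eq, Real.dist_eq, Real.coe_toNNReal _ (by positivity)]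
      exact hql x y
    exact this.continuous
  have hqlow : ∀ θ, m ≤ q θ := by
    intro θ
    have h1 := hcl θ
    have h2 := h.low _ (h1.trans (by linarith))
    simp only [hq]
    rw [← mul_neg, ← Real.sin_neg, neg_sub]
    rw [abs_le] at h1
    refine mul_le_mul h2 ?_ hsin.le (hR1.le.trans h2)
    set t := clamp (θ₁ - r) (θ₁ + r) θ
    rcases le_total (α - t) (Real.pi / 2) with h3 | h3
    · exact Real.sin_le_sin_of_le_of_le_pi_div_two (by linarith) h3 (by linarith)
    · rw [← Real.sin_pi_sub (α - t)]
      exact Real.sin_le_sin_of_le_of_le_pi_div_two (by linarith) (by linarith) (by linarith)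
  have hqupp : ∀ θ, q θ ≤ R₂ := by
    intro θ
    have h1 := h.upp _ ((hcl θ).trans (by linarith))
    have h2 := h.low _ ((hcl θ).trans (by linarith))
    simp only [hq]
    rw [← mul_neg]
    have := Real.neg_one_le_sin (clamp (θ₁ - r) (θ₁ + r) θ - α)
    nlinarith
  set bt : ℝ → ℝ := fun θ => -b θ₁ + ∫ t in θ₁..θ, q t with hbt
  have hbtd : ∀ θ, HasDerivAt bt (q θ) θ := fun θ =>
    hasDerivAt_primitive (b := fun θ => -b θ) hqc θ₁ θ
  have hbteq : ∀ θ, |θ - θ₁| ≤ r → bt θ = -b θ := by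
    intro θ hθ
    rw [abs_le] at hθ
    refine primitive_eq (b := fun θ => -b θ) (b' := fun θ => -b' θ) (l := θ₁ - r) (u := θ₁ + r)
      (fun θ => (hb θ).neg) hb'.neg (fun t ht => ?_) ⟨by linarith, by linarith⟩
      ⟨by linarith, by linarith⟩
    rw [hbR t (by rw [abs_le]; constructor <;> linarith [ht.1, ht.2])]
    simp only [hq]
    rw [clamp_eq ht]
  have hext : ∀ θ, G θ * p (b θ / ε + s θ) = G θ * p (-(bt θ / ε) + s θ) := by
    intro θ
    rcases lt_or_ge |θ - θ₁| r with hθ | hθ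
    · rw [hbteq θ hθ.le, neg_div, neg_neg]
    · rw [hG0 θ hθ, zero_mul, zero_mul]
  simp only [hext]
  rw [integral_rescale _ θ₁ hε, abs_mul, abs_of_pos hsε]
  gcongr
  have hd : ∀ x, HasDerivAt (fun x => bt (θ₁ + √ε * x) / ε) (q (θ₁ + √ε * x) / √ε) x := by
    intro x
    have h1 : HasDerivAt (fun x => θ₁ + √ε * x) √ε x := by
      simpa using ((hasDerivAt_id x).const_mul √ε).const_add θ₁
    refine (((hbtd _).comp x h1).div_const ε).congr_deriv ?_
    rw [div_eq_div_iff hε.ne' hsε.ne', mul_assoc, hsq]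
  refine ((hp.oscKer hγ hG hs).neg_comp.transversal hγ hγ1 (m := m / √ε) (C₂ := R₂ / m) (B := B)
    (by positivity) hd (fun x => ?_) (fun x => ?_) fun x x' => ?_).trans_eq ?_
  · gcongr; exact hqlow _
  · rw [show R₂ / m * (m / √ε) = R₂ / √ε by field_simp]
    gcongr; exact hqupp _
  · rw [← sub_div, abs_div, abs_of_pos hsε, div_le_iff₀ hsε]
    refine (hql _ _).trans ?_
    rw [add_sub_add_left_eq_sub, ← mul_sub, abs_mul, abs_of_pos hsε, hB]
    rw [show (Λ + R₂) / m * (m / √ε) * |x - x'| * √ε = (Λ + R₂) * (1 * |x - x'|) by field_simp]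
    gcongr
  · rw [Real.div_rpow hm0.le hsε.le, Real.rpow_neg hsε.le, div_inv_eq_mul]
    ring

end ArcRadius

lemma dot2_sub_right (u a b : ℝ × ℝ) : dot2 u (a - b) = dot2 u a - dot2 u b := by
  simp only [dot2, Prod.fst_sub, Prod.snd_sub]; ring

lemma dot2_add_right (u a b : ℝ × ℝ) : dot2 u (a + b) = dot2 u a + dot2 u b := by
  simp only [dot2, Prod.fst_add, Prod.snd_add]; ring

lemma dot2_smul_right (c : ℝ) (u a : ℝ × ℝ) : dot2 u (c • a) = c * dot2 u a := by
  simp only [dot2, Prod.smul_fst, Prod.smul_snd, smul_eq_mul]; ring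

lemma dot2_smul_left (c : ℝ) (u a : ℝ × ℝ) : dot2 (c • u) a = c * dot2 u a := by
  simp only [dot2, Prod.smul_fst, Prod.smul_snd, smul_eq_mul]; ring

lemma dot2_vec_vec (α θ : ℝ) : dot2 (vec α) (vec θ) = Real.cos (θ - α) := by
  rw [Real.cos_sub]; simp only [dot2, vec]; ring

lemma abs_dot2_vec_le (α : ℝ) (z : ℝ × ℝ) : |dot2 (vec α) z| ≤ |z.1| + |z.2| := by
  refine (abs_add_le _ _).trans ?_
  simp only [vec, abs_mul]
  have := Real.abs_cos_le_one α
  have := Real.abs_sin_le_one α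
  have := abs_nonneg z.1
  have := abs_nonneg z.2
  nlinarith

lemma vec_add_int_mul_pi (α : ℝ) (j : ℤ) : vec (α + j * Real.pi) = ((-1 : ℝ) ^ j) • vec α := by
  simp [vec, Real.cos_add_int_mul_pi, Real.sin_add_int_mul_pi, Prod.smul_mk, smul_eq_mul]

lemma neg_one_zpow_cases (j : ℤ) : (-1 : ℝ) ^ j = 1 ∨ (-1 : ℝ) ^ j = -1 := by
  rcases Int.even_or_odd j with h | h
  · exact Or.inl h.neg_one_zpow
  · exact Or.inr h.neg_one_zpow

lemma HolderBdd.of_two_bounds {f : ℝ → ℝ} {A B γ : ℝ} (hγ : 0 < γ) (hγ1 : γ ≤ 1) (hB : 0 ≤ B)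
    (hb : ∀ x, |f x| ≤ A) (hl : ∀ x x', |f x - f x'| ≤ B * (|x - x'| + |x - x'| ^ γ)) :
    HolderBdd f (2 * A + 2 * B) γ where
  bound x := by
    have := (abs_nonneg _).trans (hb x)
    linarith [hb x]
  holder x x' := by
    have hA := (abs_nonneg _).trans (hb x)
    rcases le_total |x - x'| 1 with h | h
    · have h2 : |x - x'| ≤ |x - x'| ^ γ := by
        have := Real.rpow_le_rpow_of_exponent_ge' (abs_nonneg (x - x')) h hγ.le hγ1
        rwa [Real.rpow_one] at this
      have h3 := hl x x'
      have h4 : 0 ≤ |x - x'| ^ γ := by positivity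
      nlinarith
    · have h2 : 1 ≤ |x - x'| ^ γ := Real.one_le_rpow h hγ.le
      have h3 : |f x - f x'| ≤ 2 * A := (abs_sub _ _).trans (by linarith [hb x, hb x'])
      nlinarith

lemma DecKer.comp_neg {p : ℝ → ℝ} {C : ℝ} (hp : DecKer p C) : DecKer (fun v => p (-v)) C where
  bound v := by have := hp.bound (-v); rwa [neg_sq] at this
  lip v v' := by
    have := hp.lip (-v) (-v')
    rw [neg_sq, neg_sq, show -v - -v' = -(v - v') by ring, abs_neg] at this
    exact this
  mean := by rw [integral_neg_eq_self p]; exact hp.mean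

/-- A curved arc carrying a scaled perturbation family `Ht` and a density `g`. -/
structure ArcData (γ : ℝ) (y y' : ℝ → ℝ × ℝ) (R : ℝ → ℝ) (θ₁ r R₁ R₂ Λ : ℝ) (Ht : ℝ → ℝ → ℝ)
    (g : ℝ × ℝ → ℝ) (c₀ ε₁ M Lg : ℝ) : Prop where
  rad : ArcRadius R θ₁ r R₁ R₂ Λ
  γ_pos : 0 < γ
  γ_lt : γ < 1
  ε₁_pos : 0 < ε₁
  ε₁_le : ε₁ ≤ 1
  holder : ∀ ε ∈ Set.Ioo 0 ε₁, ∀ c, HolderBdd (fun x => Ht ε (c + √ε * x)) c₀ γ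
  deriv_y : ∀ θ, HasDerivAt y (y' θ) θ
  cont_y' : Continuous y'
  y'_eq : ∀ θ, |θ - θ₁| ≤ 4 * r → y' θ = (R θ * Real.sin θ, -(R θ * Real.cos θ))
  Lg_nonneg : 0 ≤ Lg
  g_bound : ∀ q, |g q| ≤ M
  g_lip : ∀ q q', |g q - g q'| ≤ Lg * (|q.1 - q'.1| + |q.2 - q'.2|)
  g_zero : ∀ θ t, r ≤ |θ - θ₁| → g (θ, t) = 0

/-- Amplitude of the arc integral. -/
noncomputable def amp (Ht : ℝ → ℝ → ℝ) (g : ℝ × ℝ → ℝ) (ε σ θ : ℝ) : ℝ :=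
  Ht ε θ * g (θ, ε * (σ * Ht ε θ))

/-- Shift of the phase caused by the perturbation and the evaluation point. -/
noncomputable def shf (Ht : ℝ → ℝ → ℝ) (xc : ℝ × ℝ) (ε σ α θ : ℝ) : ℝ :=
  σ * Ht ε θ * Real.cos (θ - α) - dot2 (vec α) xc

/-- The contribution of the arc to a single view. -/
noncomputable def arcInt (y : ℝ → ℝ × ℝ) (x₀ xc : ℝ × ℝ) (Ht : ℝ → ℝ → ℝ) (g : ℝ × ℝ → ℝ)
    (p : ℝ → ℝ) (ε σ α : ℝ) : ℝ :=
  ∫ θ, amp Ht g ε σ θ * p (dot2 (vec α) (y θ - x₀) / ε + shf Ht xc ε σ α θ)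

lemma arcInt_add_int_mul_pi (y : ℝ → ℝ × ℝ) (x₀ xc : ℝ × ℝ) (Ht : ℝ → ℝ → ℝ) (g : ℝ × ℝ → ℝ)
    (p : ℝ → ℝ) (ε σ α : ℝ) (j : ℤ) :
    arcInt y x₀ xc Ht g p ε σ (α + j * Real.pi) =
      arcInt y x₀ xc Ht g (fun v => p ((-1) ^ j * v)) ε σ α := by
  unfold arcInt shf
  congr 1 with θ
  simp only [vec_add_int_mul_pi, dot2_smul_left]
  rw [show θ - (α + j * Real.pi) = -((α - θ) + j * Real.pi) by ring, Real.cos_neg,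
    Real.cos_add_int_mul_pi, ← neg_sub θ α, Real.cos_neg]
  ring_nf

lemma DecKer.comp_sign {p : ℝ → ℝ} {C : ℝ} (hp : DecKer p C) (j : ℤ) :
    DecKer (fun v => p ((-1) ^ j * v)) C := by
  rcases neg_one_zpow_cases j with h | h
  · simpa [h] using hp
  · simpa [h] using hp.comp_neg

namespace ArcData
variable {γ : ℝ} {y y' : ℝ → ℝ × ℝ} {R : ℝ → ℝ} {θ₁ r R₁ R₂ Λ : ℝ} {Ht : ℝ → ℝ → ℝ}
  {g : ℝ × ℝ → ℝ} {c₀ ε₁ M Lg : ℝ}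

lemma abs_Ht_le (h : ArcData γ y y' R θ₁ r R₁ R₂ Λ Ht g c₀ ε₁ M Lg) {ε : ℝ} (hε : ε ∈ Set.Ioo 0 ε₁)
    (θ : ℝ) : |Ht ε θ| ≤ c₀ := by
  simpa using (h.holder ε hε θ).bound 0

lemma c₀_nonneg (h : ArcData γ y y' R θ₁ r R₁ R₂ Λ Ht g c₀ ε₁ M Lg) : 0 ≤ c₀ :=
  (abs_nonneg _).trans (h.abs_Ht_le (ε := ε₁ / 2) ⟨half_pos h.ε₁_pos, half_lt_self h.ε₁_pos⟩ 0)

lemma M_nonneg (h : ArcData γ y y' R θ₁ r R₁ R₂ Λ Ht g c₀ ε₁ M Lg) : 0 ≤ M :=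
  (abs_nonneg _).trans (h.g_bound 0)

lemma holder_amp (h : ArcData γ y y' R θ₁ r R₁ R₂ Λ Ht g c₀ ε₁ M Lg) {ε σ : ℝ}
    (hε : ε ∈ Set.Ioo 0 ε₁) (hσ : σ ∈ Set.Icc (0:ℝ) 1) (c : ℝ) :
    HolderBdd (fun x => amp Ht g ε σ (c + √ε * x))
      (2 * c₀ * (2 * M + 2 * (Lg * (1 + c₀)))) γ := by
  have hc := h.c₀_nonneg
  have hL := h.Lg_nonneg
  have hs1 : √ε ≤ 1 := Real.sqrt_le_one.2 (hε.2.le.trans h.ε₁_le)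
  have he1 : ε ≤ 1 := hε.2.le.trans h.ε₁_le
  have H := h.holder ε hε c
  refine H.mul (HolderBdd.of_two_bounds h.γ_pos h.γ_lt.le (by positivity) (fun x => h.g_bound _)
    fun x x' => (h.g_lip _ _).trans ?_)
  have e1 : |c + √ε * x - (c + √ε * x')| ≤ |x - x'| := by
    rw [add_sub_add_left_eq_sub, ← mul_sub, abs_mul, abs_of_nonneg (Real.sqrt_nonneg _)]
    exact mul_le_of_le_one_left (abs_nonneg _) hs1
  have e2 : |ε * (σ * Ht ε (c + √ε * x)) - ε * (σ * Ht ε (c + √ε * x'))| ≤ c₀ * |x - x'| ^ γ := by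
    rw [← mul_sub, ← mul_sub, abs_mul, abs_mul, abs_of_pos hε.1, abs_of_nonneg hσ.1]
    calc _ ≤ 1 * (1 * (c₀ * |x - x'| ^ γ)) := by
          gcongr
          · exact mul_nonneg hσ.1 (abs_nonneg _)
          · exact hσ.2
          · exact H.holder x x'
      _ = _ := by ring
  have e3 : 0 ≤ |x - x'| ^ γ := by positivity
  have e4 := abs_nonneg (x - x')
  calc _ ≤ Lg * (|x - x'| + c₀ * |x - x'| ^ γ) := by gcongr
    _ ≤ Lg * ((1 + c₀) * (|x - x'| + |x - x'| ^ γ)) := by gcongr; nlinarith [mul_nonneg hc e4]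
    _ = _ := by ring

lemma holder_shf (h : ArcData γ y y' R θ₁ r R₁ R₂ Λ Ht g c₀ ε₁ M Lg) (xc : ℝ × ℝ) {ε σ : ℝ}
    (hε : ε ∈ Set.Ioo 0 ε₁) (hσ : σ ∈ Set.Icc (0:ℝ) 1) (α c : ℝ) :
    HolderBdd (fun x => shf Ht xc ε σ α (c + √ε * x)) (2 * c₀ * 3 + (|xc.1| + |xc.2|)) γ := by
  have hc := h.c₀_nonneg
  have hs1 : √ε ≤ 1 := Real.sqrt_le_one.2 (hε.2.le.trans h.ε₁_le)
  have H := h.holder ε hε c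
  have H1 : HolderBdd (fun x => σ * Ht ε (c + √ε * x)) c₀ γ := by
    refine ⟨fun x => ?_, fun x x' => ?_⟩
    · rw [abs_mul, abs_of_nonneg hσ.1]
      exact (mul_le_of_le_one_left (abs_nonneg _) hσ.2).trans (H.bound x)
    · rw [← mul_sub, abs_mul, abs_of_nonneg hσ.1]
      exact (mul_le_of_le_one_left (abs_nonneg _) hσ.2).trans (H.holder x x')
  have H2 : HolderBdd (fun x => Real.cos (c + √ε * x - α)) (2 * 1 + 1) γ := by
    refine HolderBdd.of_lipschitz h.γ_pos h.γ_lt.le zero_le_one (fun x => Real.abs_cos_le_one _)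
      fun x x' => (Real.abs_cos_sub_cos_le _ _).trans ?_
    rw [one_mul, show c + √ε * x - α - (c + √ε * x' - α) = √ε * (x - x') by ring, abs_mul,
      abs_of_nonneg (Real.sqrt_nonneg _)]
    exact mul_le_of_le_one_left (abs_nonneg _) hs1
  have H3 : HolderBdd (fun _ => -dot2 (vec α) xc) (|xc.1| + |xc.2|) γ := by
    refine ⟨fun x => ?_, fun x x' => ?_⟩
    · rw [abs_neg]; exact abs_dot2_vec_le _ _
    · simp only [sub_self, abs_zero]; positivity
  have := (H1.mul H2).add H3
  norm_num at this
  simpa only [shf, sub_eq_add_neg] using this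

lemma hasDerivAt_phase (h : ArcData γ y y' R θ₁ r R₁ R₂ Λ Ht g c₀ ε₁ M Lg) (x₀ : ℝ × ℝ) (α θ : ℝ) :
    HasDerivAt (fun θ => dot2 (vec α) (y θ - x₀)) (dot2 (vec α) (y' θ)) θ := by
  have h1 : HasDerivAt (fun θ => (y θ - x₀).1) (y' θ).1 θ :=
    (((h.deriv_y θ).sub_const x₀).fst)
  have h2 : HasDerivAt (fun θ => (y θ - x₀).2) (y' θ).2 θ :=
    (((h.deriv_y θ).sub_const x₀).snd)
  exact (h1.const_mul _).add (h2.const_mul _)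

lemma continuous_phase_deriv (h : ArcData γ y y' R θ₁ r R₁ R₂ Λ Ht g c₀ ε₁ M Lg) (α : ℝ) :
    Continuous fun θ => dot2 (vec α) (y' θ) := by
  have := h.cont_y'
  unfold dot2
  fun_prop

lemma phase_deriv_eq (h : ArcData γ y y' R θ₁ r R₁ R₂ Λ Ht g c₀ ε₁ M Lg) (α : ℝ) {θ : ℝ}
    (hθ : |θ - θ₁| ≤ 4 * r) : dot2 (vec α) (y' θ) = R θ * Real.sin (θ - α) := by
  rw [h.y'_eq θ hθ, Real.sin_sub]
  simp only [dot2, vec]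
  ring

lemma amp_zero (h : ArcData γ y y' R θ₁ r R₁ R₂ Λ Ht g c₀ ε₁ M Lg) (ε σ : ℝ) {θ : ℝ}
    (hθ : r ≤ |θ - θ₁|) : amp Ht g ε σ θ = 0 := by
  rw [amp, h.g_zero θ _ hθ, mul_zero]

/-- Uniform decay of the contribution of the arc to one view, near and far from tangency. -/
theorem exists_abs_arcInt_le (h : ArcData γ y y' R θ₁ r R₁ R₂ Λ Ht g c₀ ε₁ M Lg)
    (x₀ xc : ℝ × ℝ) (Cp : ℝ) :
    ∃ C, 0 ≤ C ∧ ∀ ε ∈ Set.Ioo 0 ε₁, ∀ σ ∈ Set.Icc (0:ℝ) 1, ∀ p, DecKer p Cp → ∀ (α : ℝ) (j : ℤ),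
      (|α - θ₁| ≤ 2 * r → |arcInt y x₀ xc Ht g p ε σ (α + j * Real.pi)| ≤
        √ε * (C * (1 + |dot2 (vec α) (y α - x₀)| / ε) ^ (-((1 + γ) / 2)))) ∧
      (2 * r ≤ α - θ₁ → α - θ₁ ≤ Real.pi - 2 * r →
        |arcInt y x₀ xc Ht g p ε σ (α + j * Real.pi)| ≤ √ε * (C * √ε ^ (1 + γ))) := by
  obtain ⟨D, hD, hn⟩ := h.rad.near_bound h.γ_pos h.γ_lt
  obtain ⟨D', hD', hf⟩ := h.rad.far_bound h.γ_pos h.γ_lt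
  set A := 2 * c₀ * (2 * M + 2 * (Lg * (1 + c₀))) with hA
  set S := 2 * c₀ * 3 + (|xc.1| + |xc.2|) with hS
  have hc := h.c₀_nonneg
  have hM := h.M_nonneg
  have hL := h.Lg_nonneg
  have hA0 : 0 ≤ A := by positivity
  have hS0 : 0 ≤ S := by positivity
  rcases lt_or_ge Cp 0 with hCp | hCp
  · exact ⟨0, le_rfl, fun ε _ σ _ p hp => absurd hp.C_nonneg (not_le.2 hCp)⟩
  set B := 4 * Cp * A * (1 + S) * (1 + S ^ 2) with hB
  have hB0 : 0 ≤ B := by positivity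
  refine ⟨B * (D + D'), by positivity, fun ε hε σ hσ p hp α j => ?_⟩
  rw [arcInt_add_int_mul_pi]
  have hε1 : ε ≤ 1 := hε.2.le.trans h.ε₁_le
  refine ⟨fun hα => ?_, fun hα hα' => ?_⟩
  · refine (hn hε.1 hα (h.hasDerivAt_phase x₀ α) (h.continuous_phase_deriv α)
      (fun θ hθ => h.phase_deriv_eq α hθ) (hp.comp_sign j) (h.holder_amp hε hσ α)
      (h.holder_shf xc hε hσ α α) (fun θ hθ => h.amp_zero ε σ hθ)).trans ?_
    have : 0 ≤ (1 + |dot2 (vec α) (y α - x₀)| / ε) ^ (-((1 + γ) / 2)) := by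
      have := hε.1
      positivity
    gcongr
    linarith
  · refine (hf hε.1 hε1 hα hα' (h.hasDerivAt_phase x₀ α) (h.continuous_phase_deriv α)
      (fun θ hθ => h.phase_deriv_eq α hθ) (hp.comp_sign j) (h.holder_amp hε hσ θ₁)
      (h.holder_shf xc hε hσ α θ₁) (fun θ hθ => h.amp_zero ε σ hθ)).trans ?_
    have : 0 ≤ √ε ^ (1 + γ) := by positivity
    gcongr
    linarith

end ArcData

lemma exists_sum_lattice_le {c q : ℝ} (hc : 0 < c) (hq : 1 < q) :
    ∃ C, 0 ≤ C ∧ ∀ (t : ℝ) (s : Finset ℤ), ∑ k ∈ s, (1 + c * |(k:ℝ) - t|) ^ (-q) ≤ C := by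
  have hsum : Summable fun m : ℤ => (1 + |(m:ℝ)|) ^ (-q) := by
    have h1 : Summable fun m : ℤ => |(m:ℝ)| ^ (-q) + (if m = 0 then (1:ℝ) else 0) :=
      (Real.summable_abs_int_rpow hq).add
        (summable_of_ne_finset_zero (s := {0}) fun b hb => by
          rw [if_neg (by simpa using hb)])
    refine Summable.of_nonneg_of_le (fun m => by positivity) (fun m => ?_) h1
    rcases eq_or_ne m 0 with rfl | hm
    · simp
      exact Real.zero_rpow_nonneg _
    · rw [if_neg hm, add_zero]
      have : (0:ℝ) < |(m:ℝ)| := by positivity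
      exact Real.rpow_le_rpow_of_nonpos this (by linarith) (by linarith)
  set A := max 2 (1 / c) with hA
  have hA0 : 0 < A := lt_of_lt_of_le two_pos (le_max_left _ _)
  have hT : 0 ≤ ∑' m : ℤ, (1 + |(m:ℝ)|) ^ (-q) := tsum_nonneg fun m => by positivity
  refine ⟨A ^ q * ∑' m : ℤ, (1 + |(m:ℝ)|) ^ (-q), by positivity, fun t s => ?_⟩
  have hsh : Summable fun k : ℤ => (1 + |((k - ⌊t⌋ : ℤ):ℝ)|) ^ (-q) :=
    (Equiv.subRight ⌊t⌋).summable_iff.2 hsum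
  calc ∑ k ∈ s, (1 + c * |(k:ℝ) - t|) ^ (-q)
      ≤ ∑ k ∈ s, A ^ q * (1 + |((k - ⌊t⌋ : ℤ):ℝ)|) ^ (-q) := by
        refine Finset.sum_le_sum fun k _ => ?_
        have h1 : |((k - ⌊t⌋ : ℤ):ℝ)| ≤ |(k:ℝ) - t| + 1 := by
          push_cast
          have e1 := Int.floor_le t
          have e2 := (Int.lt_floor_add_one t).le
          have : |t - ⌊t⌋| ≤ 1 := by rw [abs_le]; constructor <;> linarith
          calc |(k:ℝ) - ⌊t⌋| = |((k:ℝ) - t) + (t - ⌊t⌋)| := by congr 1; ring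
            _ ≤ _ := (abs_add_le _ _).trans (by linarith)
        have h2 : 1 + |((k - ⌊t⌋ : ℤ):ℝ)| ≤ A * (1 + c * |(k:ℝ) - t|) := by
          have e1 : 2 ≤ A := le_max_left _ _
          have e2 : 1 ≤ A * c := by
            have := le_max_right 2 (1 / c)
            rwa [div_le_iff₀ hc] at this
          nlinarith [abs_nonneg ((k:ℝ) - t)]
        have h3 : 0 < 1 + c * |(k:ℝ) - t| := by positivity
        have h4 : 0 < 1 + |((k - ⌊t⌋ : ℤ):ℝ)| := by positivity
        calc (1 + c * |(k:ℝ) - t|) ^ (-q) = A ^ q * (A * (1 + c * |(k:ℝ) - t|)) ^ (-q) := by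
              rw [Real.mul_rpow hA0.le h3.le, ← mul_assoc, ← Real.rpow_add hA0, add_neg_cancel,
                Real.rpow_zero, one_mul]
          _ ≤ _ := by
              gcongr A ^ q * ?_
              exact Real.rpow_le_rpow_of_nonpos h4 h2 (by linarith)
    _ = A ^ q * ∑ k ∈ s, (1 + |((k - ⌊t⌋ : ℤ):ℝ)|) ^ (-q) := by rw [Finset.mul_sum]
    _ ≤ A ^ q * ∑' k : ℤ, (1 + |((k - ⌊t⌋ : ℤ):ℝ)|) ^ (-q) := by
        gcongr
        exact hsh.sum_le_tsum s fun k _ => by positivity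
    _ = _ := by
        congr 1
        exact (Equiv.subRight ⌊t⌋).tsum_eq fun m : ℤ => (1 + |(m:ℝ)|) ^ (-q)

/-- The views `k` with `|k κ ε| ≤ π/2`. -/
noncomputable def views (κ ε : ℝ) : Finset ℤ :=
  Finset.Icc (-⌊Real.pi / 2 / (κ * ε)⌋) ⌊Real.pi / 2 / (κ * ε)⌋

lemma mem_views {κ ε : ℝ} (h : 0 < κ * ε) (k : ℤ) :
    k ∈ views κ ε ↔ |(k:ℝ) * (κ * ε)| ≤ Real.pi / 2 := by
  rw [views, Finset.mem_Icc, abs_mul, abs_of_pos h, ← le_div_iff₀ h, neg_le, Int.le_floor,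
    Int.le_floor, abs_le', Int.cast_neg, and_comm]

lemma card_views_le {κ ε : ℝ} (h : 0 < κ * ε) :
    ((views κ ε).card : ℝ) ≤ Real.pi / (κ * ε) + 1 := by
  have hπ := Real.pi_pos
  have h0 : 0 ≤ ⌊Real.pi / 2 / (κ * ε)⌋ := Int.floor_nonneg.2 (by positivity)
  rw [views, Int.card_Icc, show ⌊Real.pi / 2 / (κ * ε)⌋ + 1 - -⌊Real.pi / 2 / (κ * ε)⌋ =
    2 * ⌊Real.pi / 2 / (κ * ε)⌋ + 1 by ring, ← Int.cast_natCast, Int.toNat_of_nonneg (by omega)]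
  push_cast
  have := Int.floor_le (Real.pi / 2 / (κ * ε))
  have e : Real.pi / (κ * ε) = 2 * (Real.pi / 2 / (κ * ε)) := by ring
  linarith

lemma sqrt_mul_le {ε b γ : ℝ} (hε : 0 < ε) (hb : 0 ≤ b) (hγ : 0 < γ) (hγ1 : γ < 1) :
    √ε * b ≤ ε ^ (γ / 4) * (ε + b ^ (1 / (1 / 2 + γ / 4))) := by
  have h1 : 0 < 1 / 2 + γ / 4 := by positivity
  have hY := Real.geom_mean_le_arith_mean2_weighted (w₁ := 1 / 2 - γ / 4) (w₂ := 1 / 2 + γ / 4)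
    (p₁ := ε) (p₂ := b ^ (1 / (1 / 2 + γ / 4))) (by linarith) h1.le hε.le (by positivity) (by ring)
  rw [← Real.rpow_mul hb, one_div_mul_cancel h1.ne', Real.rpow_one] at hY
  have e : √ε = ε ^ (γ / 4) * ε ^ (1 / 2 - γ / 4) := by
    rw [← Real.rpow_add hε, Real.sqrt_eq_rpow]; congr 1; ring
  rw [e, mul_assoc]
  gcongr
  refine hY.trans ?_
  have : 0 ≤ b ^ (1 / (1 / 2 + γ / 4)) := by positivity
  nlinarith

namespace ArcData
variable {γ : ℝ} {y y' : ℝ → ℝ × ℝ} {R : ℝ → ℝ} {θ₁ r R₁ R₂ Λ : ℝ} {Ht : ℝ → ℝ → ℝ}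
  {g : ℝ × ℝ → ℝ} {c₀ ε₁ M Lg : ℝ}

/-- An arc whose tangent lines through `x₀` cross it transversally contributes `O(ε^{γ/4})`. -/
theorem exists_abs_sum_arcInt_le (h : ArcData γ y y' R θ₁ r R₁ R₂ Λ Ht g c₀ ε₁ M Lg)
    (x₀ xc : ℝ × ℝ) (Cp : ℝ) {κ c : ℝ} (hκ : 0 < κ) (hc : 0 < c)
    (hlow : ∀ α, |α - θ₁| ≤ 2 * r → c * |α - θ₁| ≤ |dot2 (vec α) (y α - x₀)|) :
    ∃ C, 0 ≤ C ∧ ∀ ε ∈ Set.Ioo 0 ε₁, ∀ σ ∈ Set.Icc (0:ℝ) 1, ∀ p : ℤ → ℝ → ℝ,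
      (∀ k, DecKer (p k) Cp) →
      |∑ k ∈ views κ ε, arcInt y x₀ xc Ht g (p k) ε σ (k * (κ * ε))| ≤ C * ε ^ (γ / 4) := by
  obtain ⟨C, hC, hb⟩ := h.exists_abs_arcInt_le x₀ xc Cp
  have hγ := h.γ_pos
  have hγ1 := h.γ_lt
  have hπ := Real.pi_pos
  have hr := h.rad.r_pos
  set P := 1 / (1 / 2 + γ / 4) with hP
  have hP0 : 0 < P := by positivity
  have hq : 1 < (1 + γ) / 2 * P := by
    rw [hP, mul_one_div, lt_div_iff₀ (by positivity)]
    linarith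
  obtain ⟨Cl, hCl, hlat⟩ := exists_sum_lattice_le (c := c * κ) (by positivity) hq
  obtain ⟨m, hm⟩ := exists_nat_ge ((Real.pi / 2 + |θ₁| + 2 * r) / Real.pi + 1)
  set J := Finset.Icc (-(m:ℤ)) m with hJ
  refine ⟨C * ((Real.pi / κ + 1) * 2 + J.card * Cl), by positivity, fun ε hε σ hσ p hp => ?_⟩
  have hε0 := hε.1
  have hε1 : ε ≤ 1 := hε.2.le.trans h.ε₁_le
  have hκε : 0 < κ * ε := by positivity
  have key : ∀ k ∈ views κ ε, |arcInt y x₀ xc Ht g (p k) ε σ (k * (κ * ε))| ≤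
      C * ε ^ (γ / 4) * (2 * ε + ∑ j ∈ J,
        (1 + c * κ * |(k:ℝ) - (j * Real.pi + θ₁) / (κ * ε)|) ^ (-((1 + γ) / 2 * P))) := by
    intro k hk
    rw [mem_views hκε] at hk
    set α := (k:ℝ) * (κ * ε) with hα
    set j := ⌊(α - θ₁ + 2 * r) / Real.pi⌋ with hj
    have hj1 := Int.floor_le ((α - θ₁ + 2 * r) / Real.pi)
    have hj2 := Int.lt_floor_add_one ((α - θ₁ + 2 * r) / Real.pi)
    rw [← hj, le_div_iff₀ hπ] at hj1
    rw [← hj, div_lt_iff₀ hπ] at hj2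
    have hjJ : j ∈ J := by
      have hk' := abs_le.1 hk
      have ht := abs_le.1 (le_refl |θ₁|)
      rw [hJ, Finset.mem_Icc]
      have hm' : (Real.pi / 2 + |θ₁| + 2 * r) ≤ (m - 1) * Real.pi := by
        rw [← div_le_iff₀ hπ]; linarith
      constructor
      · have : (-(m:ℝ)) * Real.pi ≤ j * Real.pi := by nlinarith
        have := le_of_mul_le_mul_right this hπ
        exact_mod_cast this
      · have : (j:ℝ) * Real.pi ≤ m * Real.pi := by nlinarith
        have := le_of_mul_le_mul_right this hπ
        exact_mod_cast this
    obtain ⟨hnear, hfar⟩ := hb ε hε σ hσ (p k) (hp k) (α - j * Real.pi) j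
    rw [sub_add_cancel] at hnear hfar
    have hterm : ∀ i : ℤ, 0 ≤ (1 + c * κ * |(k:ℝ) - (i * Real.pi + θ₁) / (κ * ε)|) ^
      (-((1 + γ) / 2 * P)) := fun i => by positivity
    have hsum0 := Finset.sum_nonneg fun i (_ : i ∈ J) => hterm i
    rcases le_or_gt |α - j * Real.pi - θ₁| (2 * r) with hn | hn
    · refine (hnear hn).trans ?_
      set d := |dot2 (vec (α - j * Real.pi)) (y (α - j * Real.pi) - x₀)| with hd
      have hlo := hlow _ hn
      set b := (1 + d / ε) ^ (-((1 + γ) / 2)) with hbdef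
      have hd0 : 0 ≤ d := abs_nonneg _
      have hy := sqrt_mul_le hε0 (b := b) (by positivity) hγ hγ1
      have hbP : b ^ P ≤ (1 + c * κ * |(k:ℝ) - (j * Real.pi + θ₁) / (κ * ε)|) ^
          (-((1 + γ) / 2 * P)) := by
        rw [hbdef, ← Real.rpow_mul (by positivity), ← neg_mul]
        refine Real.rpow_le_rpow_of_nonpos (by positivity) ?_ (by nlinarith)
        have e : c * κ * |(k:ℝ) - (j * Real.pi + θ₁) / (κ * ε)| = c * |α - j * Real.pi - θ₁| / ε := by
          rw [show α - j * Real.pi - θ₁ = (κ * ε) * ((k:ℝ) - (j * Real.pi + θ₁) / (κ * ε)) by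
            rw [mul_sub, mul_div_cancel₀ _ hκε.ne', hα]; ring, abs_mul, abs_of_pos hκε]
          field_simp
        rw [e]
        gcongr
      have hle := Finset.single_le_sum (fun i _ => hterm i) hjJ
      calc √ε * (C * b) = C * (√ε * b) := by ring
        _ ≤ C * (ε ^ (γ / 4) * (ε + b ^ P)) := by gcongr
        _ ≤ C * (ε ^ (γ / 4) * (2 * ε + ∑ j ∈ J,
          (1 + c * κ * |(k:ℝ) - (j * Real.pi + θ₁) / (κ * ε)|) ^ (-((1 + γ) / 2 * P)))) := by
            gcongr
            · linarith
            · exact hbP.trans hle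
        _ = _ := by ring
    · have hn1 : 2 * r ≤ α - j * Real.pi - θ₁ := by
        rcases lt_abs.1 hn with h' | h' <;> linarith
      refine (hfar hn1 (by linarith)).trans ?_
      have e1 : √ε * √ε ^ (1 + γ) = ε ^ (γ / 4) * (ε ^ (γ / 4) * ε) := by
        rw [Real.sqrt_eq_rpow, ← Real.rpow_mul hε0.le, ← Real.rpow_add hε0]
        nth_rewrite 4 [← Real.rpow_one ε]
        rw [← Real.rpow_add hε0, ← Real.rpow_add hε0]
        congr 1; ring
      have e2 : ε ^ (γ / 4) ≤ 1 := Real.rpow_le_one hε0.le hε1 (by positivity)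
      calc √ε * (C * √ε ^ (1 + γ)) = C * (√ε * √ε ^ (1 + γ)) := by ring
        _ = C * ε ^ (γ / 4) * (ε ^ (γ / 4) * ε) := by rw [e1]; ring
        _ ≤ C * ε ^ (γ / 4) * (1 * ε) := by gcongr
        _ ≤ _ := by gcongr C * ε ^ (γ / 4) * ?_; linarith
  calc |∑ k ∈ views κ ε, arcInt y x₀ xc Ht g (p k) ε σ (k * (κ * ε))|
      ≤ ∑ k ∈ views κ ε, C * ε ^ (γ / 4) * (2 * ε + ∑ j ∈ J,
        (1 + c * κ * |(k:ℝ) - (j * Real.pi + θ₁) / (κ * ε)|) ^ (-((1 + γ) / 2 * P))) :=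
        (Finset.abs_sum_le_sum_abs _ _).trans (Finset.sum_le_sum key)
    _ = C * ε ^ (γ / 4) * (2 * ((views κ ε).card * ε) + ∑ j ∈ J, ∑ k ∈ views κ ε,
        (1 + c * κ * |(k:ℝ) - (j * Real.pi + θ₁) / (κ * ε)|) ^ (-((1 + γ) / 2 * P))) := by
        rw [← Finset.mul_sum, Finset.sum_add_distrib, Finset.sum_const, Finset.sum_comm, nsmul_eq_mul]
        ring
    _ ≤ C * ε ^ (γ / 4) * (2 * (Real.pi / κ + 1) + ∑ j ∈ J, Cl) := by
        gcongr
        · calc ((views κ ε).card : ℝ) * ε ≤ (Real.pi / (κ * ε) + 1) * ε := by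
                gcongr; exact card_views_le hκε
            _ = Real.pi / κ + ε := by field_simp
            _ ≤ _ := by linarith
        · exact hlat _ _
    _ = _ := by rw [Finset.sum_const, nsmul_eq_mul]; ring

end ArcData

lemma one_add_sq_le_of_phase {c x t T V B : ℝ} (hc : 0 < c) (ht : |t| ≤ T) (hB : 0 ≤ B)
    (hV : c * (x - t) ^ 2 - B ≤ V) :
    1 + x ^ 2 ≤ (1 + 2 * T ^ 2 + 2 / c * (1 + B)) * (1 + |V|) := by
  have h0 := abs_nonneg V
  have h1 : (x - t) ^ 2 ≤ 1 / c * (1 + B) * (1 + |V|) := by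
    rw [one_div, inv_mul_eq_div, div_mul_eq_mul_div, le_div_iff₀ hc]
    nlinarith [le_abs_self V]
  have h2 : t ^ 2 ≤ T ^ 2 := sq_le_sq' (by linarith [(abs_le.1 ht).1]) (abs_le.1 ht).2
  have h3 : x ^ 2 ≤ 2 * (x - t) ^ 2 + 2 * t ^ 2 := by nlinarith [sq_nonneg (x - 2 * t)]
  have h4 : 2 / c * (1 + B) * (1 + |V|) = 2 * (1 / c * (1 + B) * (1 + |V|)) := by ring
  nlinarith [sq_nonneg T]

lemma one_div_one_add_sq_le {x V Q : ℝ} (h : 1 + x ^ 2 ≤ Q * (1 + |V|)) :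
    1 / (1 + V ^ 2) ≤ 2 * Q / (1 + x ^ 2) := by
  have hQ : 0 < Q := by
    by_contra! hn
    have : Q * (1 + |V|) ≤ 0 := mul_nonpos_of_nonpos_of_nonneg hn (by positivity)
    nlinarith [sq_nonneg x]
  rw [div_le_div_iff₀ (by positivity) (by positivity), one_mul]
  have : 1 + |V| ≤ 2 * (1 + V ^ 2) := by nlinarith [sq_abs V, sq_nonneg (|V| - 1)]
  nlinarith

lemma abs_sin_sub_le (x : ℝ) : |Real.sin x - x| ≤ |x| ^ 3 := by
  have key : ∀ x : ℝ, 0 < x → |Real.sin x - x| ≤ |x| ^ 3 := by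
    intro x hx
    have k1 := Real.sin_gt_sub_cube hx
    have k2 := Real.sin_lt hx
    rw [abs_of_pos hx, abs_le]
    constructor <;> nlinarith [pow_pos hx 3]
  rcases lt_trichotomy x 0 with h | h | h
  · have := key (-x) (by linarith)
    rwa [Real.sin_neg, abs_neg, ← neg_sub', abs_neg] at this
  · simp [h]
  · exact key x h

namespace ArcData
variable {γ : ℝ} {y y' : ℝ → ℝ × ℝ} {R : ℝ → ℝ} {r R₁ R₂ Λ : ℝ} {Ht : ℝ → ℝ → ℝ}
  {g : ℝ × ℝ → ℝ} {c₀ ε₁ M Lg : ℝ}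

/-- Quadratic approximation of the phase near the tangency point. -/
lemma abs_phase_sub_quadratic_le (h : ArcData γ y y' R 0 r R₁ R₂ Λ Ht g c₀ ε₁ M Lg) {α θ : ℝ}
    (hθ : |θ| ≤ 4 * r) :
    |dot2 (vec α) (y θ - y 0) - R 0 * (θ ^ 2 / 2 - α * θ)| ≤
      (Λ * |θ| * (|θ| + |α|) + R 0 * (|θ| + |α|) ^ 3) * |θ| := by
  have hΛ := h.rad.Λ_nonneg
  have h00 : |(0:ℝ) - 0| ≤ 4 * r := by rw [sub_self, abs_zero]; linarith [h.rad.r_pos]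
  have hR0 : 0 ≤ R 0 := h.rad.R₁_pos.le.trans (h.rad.low 0 h00)
  set D : ℝ → ℝ := fun z => dot2 (vec α) (y z - y 0) - R 0 * (z ^ 2 / 2 - α * z) with hD
  have hd : ∀ z, HasDerivAt D (dot2 (vec α) (y' z) - R 0 * (z - α)) z := fun z => by
    refine (h.hasDerivAt_phase (y 0) α z).sub ?_
    have := (((hasDerivAt_pow 2 z).div_const 2).sub ((hasDerivAt_id z).const_mul α)).const_mul (R 0)
    refine this.congr_deriv ?_
    norm_num
  have hbd : ∀ z ∈ Set.uIcc 0 θ, ‖dot2 (vec α) (y' z) - R 0 * (z - α)‖ ≤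
      Λ * |θ| * (|θ| + |α|) + R 0 * (|θ| + |α|) ^ 3 := by
    intro z hz
    have hz1 : |z| ≤ |θ| := by
      have := Set.abs_sub_left_of_mem_uIcc hz
      simpa using this
    have hz4 : |z - 0| ≤ 4 * r := by rw [sub_zero]; exact hz1.trans hθ
    have hza : |z - α| ≤ |θ| + |α| := (abs_sub _ _).trans (by linarith)
    rw [h.phase_deriv_eq α hz4, Real.norm_eq_abs]
    have e1 := abs_sin_sub_le (z - α)
    calc |R z * Real.sin (z - α) - R 0 * (z - α)|
        = |(R z - R 0) * Real.sin (z - α) + R 0 * (Real.sin (z - α) - (z - α))| := by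
          congr 1; ring
      _ ≤ (Λ * |z - 0|) * |z - α| + R 0 * |z - α| ^ 3 := by
          refine (abs_add_le _ _).trans ?_
          rw [abs_mul, abs_mul, abs_of_nonneg hR0]
          have := h.rad.lip z 0 hz4 h00
          have := Real.abs_sin_le_abs (x := z - α)
          gcongr
      _ ≤ _ := by rw [sub_zero]; gcongr
  have := Convex.norm_image_sub_le_of_norm_hasDerivWithin_le
    (fun z hz => (hd z).hasDerivWithinAt) hbd (convex_uIcc 0 θ) Set.left_mem_uIcc Set.right_mem_uIcc
  have hD0 : D 0 = 0 := by simp [hD, dot2]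
  rw [hD0, sub_zero, sub_zero] at this
  exact this

/-- Uniform decay in the view angle for the arc through `y 0`. -/
theorem exists_abs_arcInt_zero_le (h : ArcData γ y y' R 0 r R₁ R₂ Λ Ht g c₀ ε₁ M Lg)
    (xc : ℝ × ℝ) (Cp : ℝ) :
    ∃ C c, 0 ≤ C ∧ 0 < c ∧ ∀ ε ∈ Set.Ioo 0 ε₁, ∀ σ ∈ Set.Icc (0:ℝ) 1, ∀ p, DecKer p Cp → ∀ α : ℝ,
      |α| ≤ Real.pi / 2 → |arcInt y (y 0) xc Ht g p ε σ α| ≤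
        √ε * (C * (1 + c * (α ^ 2 / ε)) ^ (-((1 + γ) / 2))) := by
  obtain ⟨C, hC, hb⟩ := h.exists_abs_arcInt_le (y 0) xc Cp
  have hγ := h.γ_pos
  set c := min (R₁ / 2) 1 / 2 with hc
  have hc0 : 0 < c := by have := h.rad.R₁_pos; positivity
  have hc1 : c ≤ 1 / 2 := by rw [hc]; have := min_le_right (R₁ / 2) 1; linarith
  have hπ := Real.pi_gt_three
  have hπ4 := Real.pi_lt_four
  have hr := h.rad.r_pos
  have hrl := h.rad.r_le
  refine ⟨C * 3 ^ ((1 + γ) / 2), c, by positivity, hc0, fun ε hε σ hσ p hp α hα => ?_⟩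
  have hε0 := hε.1
  have hε1 : ε ≤ 1 := hε.2.le.trans h.ε₁_le
  have h3 : 1 ≤ (3:ℝ) ^ ((1 + γ) / 2) := Real.one_le_rpow (by norm_num) (by positivity)
  rcases le_or_gt |α| (2 * r) with hn | hn
  · have h1 := (hb ε hε σ hσ p hp α 0).1 (by rwa [sub_zero])
    rw [Int.cast_zero, zero_mul, add_zero] at h1
    refine h1.trans ?_
    have h2 := (h.rad.phase_sub_bounds (h.hasDerivAt_phase (y 0) α) (h.continuous_phase_deriv α)
      (fun θ hθ => h.phase_deriv_eq α hθ) (by rwa [sub_zero]) (θ := 0)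
      (by rw [sub_zero, abs_zero]; linarith)).1
    have h0 : dot2 (vec α) (y 0 - y 0) = 0 := by simp [dot2]
    rw [h0, zero_sub, zero_sub, neg_sq] at h2
    have h4 : c * α ^ 2 ≤ |dot2 (vec α) (y α - y 0)| := h2.trans (neg_le_abs _)
    have h5 : (1 + |dot2 (vec α) (y α - y 0)| / ε) ^ (-((1 + γ) / 2)) ≤
        (1 + c * (α ^ 2 / ε)) ^ (-((1 + γ) / 2)) := by
      refine Real.rpow_le_rpow_of_nonpos (by positivity) ?_ (by linarith)
      rw [← mul_div_assoc]
      gcongr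
    calc _ ≤ √ε * (C * 1 * (1 + c * (α ^ 2 / ε)) ^ (-((1 + γ) / 2))) := by
          rw [mul_one]; gcongr
      _ ≤ _ := by gcongr
  · have h1 : |arcInt y (y 0) xc Ht g p ε σ α| ≤ √ε * (C * √ε ^ (1 + γ)) := by
      rcases lt_abs.1 hn with hp' | hp'
      · have h1 := (hb ε hε σ hσ p hp α 0).2 (by linarith) (by linarith [(abs_le.1 hα).2])
        rwa [Int.cast_zero, zero_mul, add_zero] at h1
      · have h1 := (hb ε hε σ hσ p hp (α + Real.pi) (-1)).2
          (by linarith [(abs_le.1 hα).1]) (by linarith)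
        rwa [Int.cast_neg, Int.cast_one, neg_one_mul, add_neg_cancel_right] at h1
    refine h1.trans ?_
    rw [mul_assoc C]
    gcongr
    have e1 : √ε ^ (1 + γ) = ε ^ ((1 + γ) / 2) := by
      rw [Real.sqrt_eq_rpow, ← Real.rpow_mul hε0.le]; congr 1; ring
    have hα2 : α ^ 2 ≤ 4 := by
      have := sq_le_sq' (by linarith [(abs_le.1 hα).1]) (show α ≤ 2 by linarith [(abs_le.1 hα).2])
      linarith
    have e2 : 1 + c * (α ^ 2 / ε) ≤ 3 / ε := by
      rw [le_div_iff₀ hε0]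
      have : c * (α ^ 2 / ε) * ε = c * α ^ 2 := by field_simp
      rw [add_mul, this, one_mul]
      nlinarith [sq_nonneg α]
    rw [e1]
    calc ε ^ ((1 + γ) / 2) = 3 ^ ((1 + γ) / 2) * (3 / ε) ^ (-((1 + γ) / 2)) := by
          rw [Real.rpow_neg (by positivity), Real.div_rpow (by norm_num) hε0.le, inv_div,
            mul_div_cancel₀ _ (by positivity)]
      _ ≤ _ := by
          gcongr 3 ^ ((1 + γ) / 2) * ?_
          exact Real.rpow_le_rpow_of_nonpos (by positivity) e2 (by linarith)

end ArcData

lemma tendsto_sqrt_nhdsGT : Tendsto (fun ε : ℝ => √ε) (𝓝[>] 0) (𝓝 0) := by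
  have := Real.continuous_sqrt.tendsto 0
  rw [Real.sqrt_zero] at this
  exact this.mono_left nhdsWithin_le_nhds

lemma tendsto_id_nhdsGT : Tendsto (fun ε : ℝ => ε) (𝓝[>] 0) (𝓝 0) :=
  tendsto_id.mono_left nhdsWithin_le_nhds

namespace ArcData
variable {γ : ℝ} {y y' : ℝ → ℝ × ℝ} {R : ℝ → ℝ} {r R₁ R₂ Λ : ℝ} {Ht : ℝ → ℝ → ℝ}
  {g : ℝ × ℝ → ℝ} {c₀ ε₁ M Lg : ℝ}

lemma R_zero_pos (h : ArcData γ y y' R 0 r R₁ R₂ Λ Ht g c₀ ε₁ M Lg) : 0 < R 0 :=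
  h.rad.R₁_pos.trans_le (h.rad.low 0 (by rw [sub_self, abs_zero]; linarith [h.rad.r_pos]))

lemma eventually_mem (h : ArcData γ y y' R 0 r R₁ R₂ Λ Ht g c₀ ε₁ M Lg) :
    ∀ᶠ ε in 𝓝[>] (0:ℝ), ε ∈ Set.Ioo 0 ε₁ := Ioo_mem_nhdsGT h.ε₁_pos

lemma holder_shf_zero (h : ArcData γ y y' R 0 r R₁ R₂ Λ Ht g c₀ ε₁ M Lg) (xc : ℝ × ℝ) {ε σ : ℝ}
    (hε : ε ∈ Set.Ioo 0 ε₁) (hσ : σ ∈ Set.Icc (0:ℝ) 1) :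
    HolderBdd (fun x => σ * Ht ε (√ε * x) - xc.1) (c₀ + |xc.1|) γ := by
  have H := h.holder ε hε 0
  simp only [zero_add] at H
  refine ⟨fun x => (abs_sub _ _).trans ?_, fun x x' => ?_⟩
  · rw [abs_mul, abs_of_nonneg hσ.1]
    have := (mul_le_of_le_one_left (abs_nonneg _) hσ.2).trans (H.bound x)
    gcongr
  · rw [sub_sub_sub_cancel_right, ← mul_sub, abs_mul, abs_of_nonneg hσ.1]
    refine ((mul_le_of_le_one_left (abs_nonneg _) hσ.2).trans (H.holder x x')).trans ?_
    gcongr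
    linarith [abs_nonneg xc.1]

lemma holder_density (h : ArcData γ y y' R 0 r R₁ R₂ Λ Ht g c₀ ε₁ M Lg) {ε : ℝ}
    (hε : ε ∈ Set.Ioo 0 ε₁) :
    HolderBdd (fun x => g (0, 0) * Ht ε (√ε * x)) (M * c₀) γ := by
  have H := h.holder ε hε 0
  simp only [zero_add] at H
  have hM := h.M_nonneg
  have hc := h.c₀_nonneg
  refine ⟨fun x => ?_, fun x x' => ?_⟩
  · rw [abs_mul]
    have := h.g_bound (0, 0)
    have := H.bound x
    gcongr
  · rw [← mul_sub, abs_mul, mul_assoc]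
    have := h.g_bound (0, 0)
    have := H.holder x x'
    gcongr

/-- The rescaled contribution of the arc approaches the model oscillatory integral. -/
theorem tendsto_arcInt_sub_phaseInt (h : ArcData γ y y' R 0 r R₁ R₂ Λ Ht g c₀ ε₁ M Lg)
    {ik k w : ℝ → ℝ} {L ρ Cp : ℝ} (K : Kernels ik k w L ρ) (hp : ∀ u, DecKer (latKer k w u) Cp)
    (xc : ℝ × ℝ) {σ t : ℝ} (hσ : σ ∈ Set.Icc (0:ℝ) 1) {αf uf uf' : ℝ → ℝ}
    (hα : Tendsto (fun ε => αf ε / √ε) (𝓝[>] 0) (𝓝 t))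
    (hu : Tendsto (fun ε => uf ε - uf' ε) (𝓝[>] 0) (𝓝 0)) :
    Tendsto (fun ε => (√ε)⁻¹ * arcInt y (y 0) xc Ht g (latKer k w (uf ε)) ε σ (αf ε) -
      phaseInt (R 0) (fun x => g (0, 0) * Ht ε (√ε * x)) (latKer k w (uf' ε))
        (fun x => σ * Ht ε (√ε * x) - xc.1) t) (𝓝[>] 0) (𝓝 0) := by
  have hc := h.c₀_nonneg
  have hM := h.M_nonneg
  have hL := h.Lg_nonneg
  have hR := h.R_zero_pos
  have hr := h.rad.r_pos
  have hCp : 0 ≤ Cp := (hp 0).C_nonneg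
  set T := |t| + 1 with hT
  set V : ℝ → ℝ → ℝ := fun ε x => dot2 (vec (αf ε)) (y (√ε * x) - y 0) / ε + shf Ht xc ε σ (αf ε) (√ε * x)
    with hV
  set V' : ℝ → ℝ → ℝ := fun ε x => R 0 * (x ^ 2 / 2 - t * x) + (σ * Ht ε (√ε * x) - xc.1) with hV'
  set I₁ : ℝ → ℝ → ℝ := fun ε x => amp Ht g ε σ (√ε * x) * latKer k w (uf ε) (V ε x) with hI₁
  set I₂ : ℝ → ℝ → ℝ := fun ε x => (g (0, 0) * Ht ε (√ε * x)) * latKer k w (uf' ε) (V' ε x) with hI₂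
  have htε : ∀ᶠ ε in 𝓝[>] (0:ℝ), |αf ε / √ε| ≤ T := by
    have := hα.abs.eventually (gt_mem_nhds (show |t| < T by rw [hT]; linarith))
    exact this.mono fun ε h => h.le
  have hsm : ∀ᶠ ε in 𝓝[>] (0:ℝ), √ε * T ≤ 2 * r := by
    have : Tendsto (fun ε : ℝ => √ε * T) (𝓝[>] 0) (𝓝 (0 * T)) := tendsto_sqrt_nhdsGT.mul_const T
    rw [zero_mul] at this
    exact (this.eventually (gt_mem_nhds (show 0 < 2 * r by linarith))).mono fun ε h => h.le
  set S := 2 * c₀ * 3 + (|xc.1| + |xc.2|) with hS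
  have hS0 : 0 ≤ S := by positivity
  set c := min (min (R₁ / 2) 1 / 2) (R 0 / 2) with hcdef
  have hc0 : 0 < c := by have := h.rad.R₁_pos; positivity
  set B := max R₂ 1 / 2 * T ^ 2 + R 0 / 2 * T ^ 2 + S with hB
  have hT0 : 0 ≤ T := by positivity
  have hB0 : 0 ≤ B := by
    have : 0 ≤ max R₂ 1 := le_trans zero_le_one (le_max_right _ _)
    positivity
  set Q := 1 + 2 * T ^ 2 + 2 / c * (1 + B) with hQ
  have hQ0 : 0 ≤ Q := by positivity
  have hbA : ∀ ε ∈ Set.Ioo 0 ε₁, ∀ θ, |amp Ht g ε σ θ| ≤ c₀ * M := fun ε hε θ => by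
    rw [amp, abs_mul]
    have := h.abs_Ht_le hε θ
    have := h.g_bound (θ, ε * (σ * Ht ε θ))
    gcongr
  have hg0 : ∀ ε ∈ Set.Ioo 0 ε₁, ∀ θ, |g (0, 0) * Ht ε θ| ≤ c₀ * M := fun ε hε θ => by
    rw [abs_mul, mul_comm]
    have := h.abs_Ht_le hε θ
    have := h.g_bound (0, 0)
    gcongr
  have hshf : ∀ ε ∈ Set.Ioo 0 ε₁, ∀ x, |shf Ht xc ε σ (αf ε) (√ε * x)| ≤ S := fun ε hε x => by
    have := (h.holder_shf xc hε hσ (αf ε) 0).bound x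
    rwa [zero_add] at this
  have hshf' : ∀ ε ∈ Set.Ioo 0 ε₁, ∀ x, |σ * Ht ε (√ε * x) - xc.1| ≤ S := fun ε hε x => by
    refine ((h.holder_shf_zero xc hε hσ).bound x).trans ?_
    rw [hS]; have := abs_nonneg xc.2; linarith
  have hTt : |t| ≤ T := by rw [hT]; linarith
  -- both integrands are dominated by a fixed integrable function
  have dom₁ : ∀ᶠ ε in 𝓝[>] (0:ℝ), ∀ x, |I₁ ε x| ≤ c₀ * M * Cp * (2 * Q) * (1 + x ^ 2)⁻¹ := by
    filter_upwards [h.eventually_mem, htε, hsm] with ε hε ht hs x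
    have hε0 := hε.1
    have hsε := Real.sqrt_pos.2 hε0
    rcases le_or_gt r |√ε * x| with hx | hx
    · simp only [hI₁, h.amp_zero ε σ (θ := √ε * x) (by rwa [sub_zero]), zero_mul, abs_zero]
      positivity
    have hα2 : |αf ε - 0| ≤ 2 * r := by
      rw [abs_div, abs_of_pos hsε, div_le_iff₀ hsε] at ht
      rw [sub_zero]; linarith
    have b1 := (h.rad.phase_sub_bounds (h.hasDerivAt_phase (y 0) (αf ε)) (h.continuous_phase_deriv _)
      (fun θ hθ => h.phase_deriv_eq _ hθ) hα2 (θ := √ε * x) (by rw [sub_zero]; linarith)).1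
    have b2 := (h.rad.phase_sub_bounds (h.hasDerivAt_phase (y 0) (αf ε)) (h.continuous_phase_deriv _)
      (fun θ hθ => h.phase_deriv_eq _ hθ) hα2 (θ := 0) (by rw [sub_zero, abs_zero]; linarith)).2
    have h0 : dot2 (vec (αf ε)) (y 0 - y 0) = 0 := by simp [dot2]
    rw [h0, zero_sub, zero_sub, neg_sq] at b2
    set s := αf ε / √ε with hsdef
    have hαs : αf ε = √ε * s := by rw [hsdef, mul_div_cancel₀ _ hsε.ne']
    have hsq : √ε * √ε = ε := Real.mul_self_sqrt hε0.le
    rw [hαs] at b1 b2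
    have hs2 : s ^ 2 ≤ T ^ 2 := sq_le_sq' (by linarith [(abs_le.1 ht).1]) (abs_le.1 ht).2
    have hVlow : c * (x - s) ^ 2 - B ≤ V ε x := by
      have e1 : c * (x - s) ^ 2 ≤ min (R₁ / 2) 1 / 2 * (x - s) ^ 2 := by
        gcongr; exact min_le_left _ _
      have e2 : min (R₁ / 2) 1 / 2 * (x - s) ^ 2 - max R₂ 1 / 2 * s ^ 2 ≤
          dot2 (vec (αf ε)) (y (√ε * x) - y 0) / ε := by
        rw [le_div_iff₀ hε0, hαs]
        have k1 : min (R₁ / 2) 1 / 2 * (√ε * x - √ε * s) ^ 2 = min (R₁ / 2) 1 / 2 * (x - s) ^ 2 * ε := by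
          linear_combination min (R₁ / 2) 1 / 2 * (x - s) ^ 2 * hsq
        have k2 : max R₂ 1 / 2 * (√ε * s) ^ 2 = max R₂ 1 / 2 * s ^ 2 * ε := by
            linear_combination max R₂ 1 / 2 * s ^ 2 * hsq
        rw [k1] at b1
        rw [k2] at b2
        linarith
      have e3 : max R₂ 1 / 2 * s ^ 2 ≤ max R₂ 1 / 2 * T ^ 2 := by
        have : 0 ≤ max R₂ 1 := le_trans zero_le_one (le_max_right _ _)
        gcongr
      have e4 := (abs_le.1 (hshf ε hε x)).1
      have e5 : 0 ≤ R 0 / 2 * T ^ 2 := by positivity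
      simp only [hV]
      linarith
    have e := one_div_one_add_sq_le (one_add_sq_le_of_phase hc0 ht hB0 hVlow)
    calc |I₁ ε x| = |amp Ht g ε σ (√ε * x)| * |latKer k w (uf ε) (V ε x)| := abs_mul _ _
      _ ≤ (c₀ * M) * (Cp * (1 / (1 + V ε x ^ 2))) := by
          have := hbA ε hε (√ε * x)
          have := (hp (uf ε)).bound (V ε x)
          rw [← mul_one_div] at this
          gcongr
      _ ≤ (c₀ * M) * (Cp * (2 * Q / (1 + x ^ 2))) := by gcongr
      _ = _ := by rw [div_eq_mul_inv]; ring
  have dom₂ : ∀ᶠ ε in 𝓝[>] (0:ℝ), ∀ x, |I₂ ε x| ≤ c₀ * M * Cp * (2 * Q) * (1 + x ^ 2)⁻¹ := by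
    filter_upwards [h.eventually_mem] with ε hε x
    have hVlow : c * (x - t) ^ 2 - B ≤ V' ε x := by
      have e1 : c * (x - t) ^ 2 ≤ R 0 / 2 * (x - t) ^ 2 := by
        gcongr; exact min_le_right _ _
      have e3 : R 0 / 2 * t ^ 2 ≤ R 0 / 2 * T ^ 2 := by
        have := sq_le_sq' (by linarith [(abs_le.1 hTt).1]) (abs_le.1 hTt).2
        gcongr
      have e4 := (abs_le.1 (hshf' ε hε x)).1
      have e5 : 0 ≤ max R₂ 1 / 2 * T ^ 2 := by
        have : 0 ≤ max R₂ 1 := le_trans zero_le_one (le_max_right _ _)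
        positivity
      simp only [hV']
      linarith
    have e := one_div_one_add_sq_le (one_add_sq_le_of_phase hc0 hTt hB0 hVlow)
    calc |I₂ ε x| = |g (0, 0) * Ht ε (√ε * x)| * |latKer k w (uf' ε) (V' ε x)| := abs_mul _ _
      _ ≤ (c₀ * M) * (Cp * (1 / (1 + V' ε x ^ 2))) := by
          have := hg0 ε hε (√ε * x)
          have := (hp (uf' ε)).bound (V' ε x)
          rw [← mul_one_div] at this
          gcongr
      _ ≤ (c₀ * M) * (Cp * (2 * Q / (1 + x ^ 2))) := by gcongr
      _ = _ := by rw [div_eq_mul_inv]; ring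
  have hint : Integrable fun x : ℝ => c₀ * M * Cp * (2 * Q) * (1 + x ^ 2)⁻¹ :=
    integrable_inv_one_add_sq.const_mul _
  have cont₁ : ∀ᶠ ε in 𝓝[>] (0:ℝ), Continuous (I₁ ε) := by
    filter_upwards [h.eventually_mem] with ε hε
    have k1 := (h.holder_amp hε hσ 0).continuous h.γ_pos
    have k2 := (h.holder_shf xc hε hσ (αf ε) 0).continuous h.γ_pos
    simp only [zero_add] at k1 k2
    have k3 : Continuous fun θ => dot2 (vec (αf ε)) (y θ - y 0) :=
      continuous_iff_continuousAt.2 fun θ => (h.hasDerivAt_phase (y 0) (αf ε) θ).continuousAt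
    exact k1.mul ((hp _).continuous.comp
      (((k3.comp (continuous_const.mul continuous_id)).div_const _).add k2))
  have cont₂ : ∀ᶠ ε in 𝓝[>] (0:ℝ), Continuous (I₂ ε) := by
    filter_upwards [h.eventually_mem] with ε hε
    have k1 := (h.holder_density hε).continuous h.γ_pos
    have k2 := (h.holder_shf_zero xc hε hσ).continuous h.γ_pos
    exact k1.mul ((hp _).continuous.comp (by simp only [hV']; fun_prop))
  have hlim : Tendsto (fun ε => ∫ x, (I₁ ε x - I₂ ε x)) (𝓝[>] 0) (𝓝 (∫ _ : ℝ, (0:ℝ))) := by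
    refine tendsto_integral_filter_of_dominated_convergence
      (fun x => 2 * (c₀ * M * Cp * (2 * Q) * (1 + x ^ 2)⁻¹)) ?_ ?_ (hint.const_mul 2) ?_
    · filter_upwards [cont₁, cont₂] with ε h1 h2 using (h1.sub h2).aestronglyMeasurable
    · filter_upwards [dom₁, dom₂] with ε h1 h2
      refine ae_of_all _ fun x => ?_
      rw [Real.norm_eq_abs]
      exact (abs_sub _ _).trans (by linarith [h1 x, h2 x])
    · refine ae_of_all _ fun x => ?_
      have ha : Tendsto (fun ε => amp Ht g ε σ (√ε * x) - g (0, 0) * Ht ε (√ε * x)) (𝓝[>] 0) (𝓝 0) := by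
        have hup : Tendsto (fun ε : ℝ => c₀ * (Lg * (√ε * |x| + ε * c₀))) (𝓝[>] 0)
            (𝓝 (c₀ * (Lg * (0 * |x| + 0 * c₀)))) :=
          (((tendsto_sqrt_nhdsGT.mul_const _).add (tendsto_id_nhdsGT.mul_const _)).const_mul _).const_mul _
        rw [zero_mul, zero_mul, add_zero, mul_zero, mul_zero] at hup
        refine squeeze_zero_norm' ?_ hup
        filter_upwards [h.eventually_mem] with ε hε
        have e1 := h.abs_Ht_le hε (√ε * x)
        have e2 := h.g_lip (√ε * x, ε * (σ * Ht ε (√ε * x))) (0, 0)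
        simp only [sub_zero] at e2
        have e3 : |ε * (σ * Ht ε (√ε * x))| ≤ ε * c₀ := by
          rw [abs_mul, abs_mul, abs_of_pos hε.1, abs_of_nonneg hσ.1]
          have := hε.1
          gcongr
          exact (mul_le_of_le_one_left (abs_nonneg _) hσ.2).trans e1
        rw [Real.norm_eq_abs, amp, mul_comm (g (0, 0)), ← mul_sub, abs_mul]
        gcongr
        refine e2.trans ?_
        rw [abs_mul, abs_of_nonneg (Real.sqrt_nonneg _)]
        gcongr
      have hVV : Tendsto (fun ε => V ε x - V' ε x) (𝓝[>] 0) (𝓝 0) := by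
        have hαf : Tendsto αf (𝓝[>] 0) (𝓝 0) := by
          have h1 := (tendsto_sqrt_nhdsGT).mul hα
          rw [zero_mul] at h1
          refine h1.congr' ?_
          filter_upwards [self_mem_nhdsWithin] with ε (hε : 0 < ε)
          rw [mul_div_cancel₀ _ (Real.sqrt_pos.2 hε).ne']
        have hxs : Tendsto (fun ε : ℝ => √ε * x) (𝓝[>] 0) (𝓝 0) := by
          simpa using tendsto_sqrt_nhdsGT.mul_const x
        have hcos : Tendsto (fun ε => Real.cos (√ε * x - αf ε) - 1) (𝓝[>] 0) (𝓝 0) := by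
          have := (Real.continuous_cos.tendsto _).comp (hxs.sub hαf)
          rw [sub_zero, Real.cos_zero] at this
          simpa using this.sub_const 1
        have hxc : Tendsto (fun ε => dot2 (vec (αf ε)) xc - xc.1) (𝓝[>] 0) (𝓝 0) := by
          have h1 := (Real.continuous_cos.tendsto _).comp hαf
          have h2 := (Real.continuous_sin.tendsto _).comp hαf
          rw [Real.cos_zero] at h1
          rw [Real.sin_zero] at h2
          have := ((h1.mul_const xc.1).add (h2.mul_const xc.2)).sub_const xc.1
          simpa [dot2, vec] using this
        have hta : Tendsto (fun ε => |αf ε / √ε|) (𝓝[>] 0) (𝓝 |t|) := hα.abs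
        have hup : Tendsto (fun ε : ℝ =>
            (Λ * |x| * (|x| + |αf ε / √ε|) * √ε + R 0 * (|x| + |αf ε / √ε|) ^ 3 * ε) * |x| +
              R 0 * |x| * |t - αf ε / √ε| + c₀ * |Real.cos (√ε * x - αf ε) - 1| +
              |dot2 (vec (αf ε)) xc - xc.1|) (𝓝[>] 0)
            (𝓝 ((Λ * |x| * (|x| + |t|) * 0 + R 0 * (|x| + |t|) ^ 3 * 0) * |x| +
              R 0 * |x| * |t - t| + c₀ * |0| + |0|)) :=
          (((((((hta.const_add _).const_mul _).mul tendsto_sqrt_nhdsGT).add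
            ((((hta.const_add _).pow 3).const_mul _).mul tendsto_id_nhdsGT)).mul_const _).add
            ((hα.const_sub t).abs.const_mul _)).add (hcos.abs.const_mul _)).add hxc.abs
        rw [show ((Λ * |x| * (|x| + |t|) * 0 + R 0 * (|x| + |t|) ^ 3 * 0) * |x| +
              R 0 * |x| * |t - t| + c₀ * |(0:ℝ)| + |(0:ℝ)|) = 0 by simp] at hup
        have hx4 : ∀ᶠ ε : ℝ in 𝓝[>] 0, |√ε * x| ≤ 4 * r := by
          have := hxs.abs.eventually (gt_mem_nhds (show |(0:ℝ)| < 4 * r by rw [abs_zero]; linarith))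
          exact this.mono fun ε h => h.le
        refine squeeze_zero_norm' ?_ hup
        filter_upwards [h.eventually_mem, hx4] with ε hε hx
        have hε0 := hε.1
        have hsε := Real.sqrt_pos.2 hε0
        have hsq : √ε * √ε = ε := Real.mul_self_sqrt hε0.le
        have hq := h.abs_phase_sub_quadratic_le (α := αf ε) hx
        set s := αf ε / √ε with hsdef
        have hαs : αf ε = √ε * s := by rw [hsdef, mul_div_cancel₀ _ hsε.ne']
        have e1 : |dot2 (vec (αf ε)) (y (√ε * x) - y 0) / ε - R 0 * (x ^ 2 / 2 - s * x)| ≤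
            (Λ * |x| * (|x| + |s|) * √ε + R 0 * (|x| + |s|) ^ 3 * ε) * |x| := by
          have k : dot2 (vec (αf ε)) (y (√ε * x) - y 0) / ε - R 0 * (x ^ 2 / 2 - s * x) =
              (dot2 (vec (αf ε)) (y (√ε * x) - y 0) -
                R 0 * ((√ε * x) ^ 2 / 2 - αf ε * (√ε * x))) / ε := by
            rw [sub_div]
            congr 1
            rw [eq_div_iff hε0.ne']
            linear_combination -R 0 * (x ^ 2 / 2 - s * x) * hsq + R 0 * √ε * x * hαs
          rw [k, abs_div, abs_of_pos hε0, div_le_iff₀ hε0]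
          refine hq.trans (le_of_eq ?_)
          have a1 : |√ε * x| = √ε * |x| := by rw [abs_mul, abs_of_pos hsε]
          have a2 : |αf ε| = √ε * |s| := by rw [hαs, abs_mul, abs_of_pos hsε]
          rw [a1, a2]
          linear_combination (Λ * |x| ^ 2 * (|x| + |s|) * √ε +
            R 0 * (|x| + |s|) ^ 3 * |x| * (√ε * √ε + ε)) * hsq
        have e2 := h.abs_Ht_le hε (√ε * x)
        have key : V ε x - V' ε x =
            (dot2 (vec (αf ε)) (y (√ε * x) - y 0) / ε - R 0 * (x ^ 2 / 2 - s * x)) +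
            R 0 * x * (t - s) + σ * Ht ε (√ε * x) * (Real.cos (√ε * x - αf ε) - 1) +
            -(dot2 (vec (αf ε)) xc - xc.1) := by
          simp only [hV, hV', shf]; ring
        rw [Real.norm_eq_abs, key]
        refine (abs_add_le _ _).trans ?_
        rw [abs_neg]
        gcongr
        refine (abs_add_le _ _).trans ?_
        gcongr
        · refine (abs_add_le _ _).trans ?_
          gcongr
          rw [abs_mul, abs_mul, abs_of_pos hR]
        · rw [abs_mul, abs_mul, abs_of_nonneg hσ.1]
          gcongr
          exact (mul_le_of_le_one_left (abs_nonneg _) hσ.2).trans e2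
      have hker : Tendsto (fun ε => latKer k w (uf ε) (V ε x) - latKer k w (uf' ε) (V ε x))
          (𝓝[>] 0) (𝓝 0) := by
        rw [Metric.tendsto_nhds]
        intro η hη
        obtain ⟨δ, hδ, hun⟩ := K.latKer_uniform (half_pos hη)
        filter_upwards [(Metric.tendsto_nhds.1 hu) δ hδ] with ε hε
        rw [Real.dist_eq, sub_zero] at hε ⊢
        exact (hun _ _ _ hε).trans_lt (half_lt_self hη)
      have hup : Tendsto (fun ε => |amp Ht g ε σ (√ε * x) - g (0, 0) * Ht ε (√ε * x)| * Cp +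
          c₀ * M * (|latKer k w (uf ε) (V ε x) - latKer k w (uf' ε) (V ε x)| +
            2 * Cp * |V ε x - V' ε x|)) (𝓝[>] 0) (𝓝 (|0| * Cp + c₀ * M * (|0| + 2 * Cp * |0|))) :=
        (ha.abs.mul_const _).add ((hker.abs.add (hVV.abs.const_mul _)).const_mul _)
      rw [abs_zero, zero_mul, mul_zero, add_zero, mul_zero, add_zero] at hup
      refine squeeze_zero_norm' ?_ hup
      filter_upwards [h.eventually_mem] with ε hε
      rw [Real.norm_eq_abs]
      have e1 := hg0 ε hε (√ε * x)
      have e2 := (hp (uf ε)).bound_const (V ε x)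
      have e3 := (hp (uf' ε)).lip_const (V ε x) (V' ε x)
      calc |I₁ ε x - I₂ ε x|
          = |(amp Ht g ε σ (√ε * x) - g (0, 0) * Ht ε (√ε * x)) * latKer k w (uf ε) (V ε x) +
            (g (0, 0) * Ht ε (√ε * x)) * ((latKer k w (uf ε) (V ε x) - latKer k w (uf' ε) (V ε x)) +
              (latKer k w (uf' ε) (V ε x) - latKer k w (uf' ε) (V' ε x)))| := by
            simp only [hI₁, hI₂]; congr 1; ring
        _ ≤ _ := by
            refine (abs_add_le _ _).trans ?_
            rw [abs_mul, abs_mul (g (0, 0) * Ht ε (√ε * x))]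
            gcongr
            exact (abs_add_le _ _).trans (by gcongr)
  rw [integral_zero] at hlim
  refine hlim.congr' ?_
  filter_upwards [h.eventually_mem, cont₁, cont₂, dom₁, dom₂] with ε hε h1 h2 d1 d2
  have hsε := Real.sqrt_pos.2 hε.1
  rw [integral_sub (hint.mono' h1.aestronglyMeasurable (ae_of_all _ d1))
    (hint.mono' h2.aestronglyMeasurable (ae_of_all _ d2))]
  congr 1
  rw [arcInt, integral_rescale (fun θ => amp Ht g ε σ θ * latKer k w (uf ε)
    (dot2 (vec (αf ε)) (y θ - y 0) / ε + shf Ht xc ε σ (αf ε) θ)) 0 hε.1, ← mul_assoc, inv_mul_cancel₀ hsε.ne', one_mul]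
  simp only [zero_add]
  rfl

end ArcData

lemma integral_comp_floor {F : Finset ℤ} {a : ℤ → ℝ} (hF : ∀ k ∉ F, a k = 0) {δ : ℝ} (hδ : 0 < δ)
    (j : ℤ) :
    Integrable (fun t : ℝ => a (⌊t / δ⌋ + j)) ∧ ∫ t : ℝ, a (⌊t / δ⌋ + j) = δ * ∑ k ∈ F, a k := by
  set J : ℤ → Set ℝ := fun k => Set.Ico (((k - j : ℤ) : ℝ) * δ) ((((k - j : ℤ) : ℝ) + 1) * δ) with hJ
  have key : ∀ t : ℝ, a (⌊t / δ⌋ + j) = ∑ k ∈ F, (J k).indicator (fun _ => a k) t := fun t => by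
    have hmem : ∀ k, t ∈ J k ↔ k = ⌊t / δ⌋ + j := fun k => by
      rw [hJ, Set.mem_Ico, ← le_div_iff₀ hδ, ← div_lt_iff₀ hδ, ← Int.floor_eq_iff]
      omega
    simp only [Set.indicator_apply, hmem]
    rw [Finset.sum_ite_eq']
    split_ifs with h
    · rfl
    · exact hF _ h
  have hvol : ∀ k, volume.real (J k) = δ := fun k => by
    rw [hJ, Real.volume_real_Ico_of_le (by nlinarith)]; ring
  have hI : ∀ k ∈ F, Integrable ((J k).indicator fun _ : ℝ => a k) := fun k _ =>
    (integrable_indicator_iff measurableSet_Ico).2 (integrableOn_const (by simp))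
  simp only [key]
  refine ⟨integrable_finsetSum _ hI, ?_⟩
  rw [integral_finsetSum _ hI, Finset.mul_sum]
  refine Finset.sum_congr rfl fun k _ => ?_
  rw [integral_indicator measurableSet_Ico, setIntegral_const, hvol, smul_eq_mul]

lemma rpow_neg_le_of_near {c δ t q : ℝ} {s N : ℝ} (hc : 0 < c) (hq : 0 ≤ q) (hδ : 0 < δ) (hδ1 : δ ≤ 1)
    (hs : |t / δ - s| ≤ N) :
    (1 + c * (s * δ) ^ 2) ^ (-q) ≤ (2 + 2 * c * N ^ 2) ^ q * (1 + c * t ^ 2) ^ (-q) := by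
  have hQ : 1 + c * t ^ 2 ≤ (2 + 2 * c * N ^ 2) * (1 + c * (s * δ) ^ 2) := by
    have h1 : (t - s * δ) ^ 2 ≤ N ^ 2 := by
      rw [← sq_abs (t - s * δ)]
      have : t - s * δ = (t / δ - s) * δ := by field_simp
      rw [this, abs_mul, abs_of_pos hδ]
      have h0 := abs_nonneg (t / δ - s)
      have : |t / δ - s| * δ ≤ N * 1 := by gcongr; linarith
      rw [mul_one] at this
      gcongr
    have h2 : t ^ 2 ≤ 2 * (s * δ) ^ 2 + 2 * N ^ 2 := by nlinarith [sq_nonneg (t - 2 * (s * δ))]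
    have h3 : 0 ≤ c * N ^ 2 * (c * (s * δ) ^ 2) := by positivity
    nlinarith
  have hQ0 : 0 < 2 + 2 * c * N ^ 2 := by positivity
  calc (1 + c * (s * δ) ^ 2) ^ (-q)
      ≤ ((1 + c * t ^ 2) / (2 + 2 * c * N ^ 2)) ^ (-q) := by
        refine Real.rpow_le_rpow_of_nonpos (by positivity) ?_ (by linarith)
        rwa [div_le_iff₀' hQ0]
    _ = _ := by
        rw [Real.div_rpow (by positivity) hQ0.le, Real.rpow_neg hQ0.le, div_inv_eq_mul, mul_comm]

/-- A lattice sum of step `δ → 0` whose local averages approach `Φ` up to an error which can be made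
small in mean is asymptotic to `∫ Φ`. -/
theorem tendsto_sum_sub_integral {δ : ℝ → ℝ} {F : ℝ → Finset ℤ} {a : ℝ → ℤ → ℝ} {Φ m : ℝ → ℝ → ℝ}
    {C C' c c' γ : ℝ} (hγ : 0 < γ) (hc : 0 < c) (hc' : 0 < c') (hC : 0 ≤ C)
    (hδ : ∀ᶠ ε in 𝓝[>] (0:ℝ), 0 < δ ε ∧ δ ε ≤ 1)
    (hF : ∀ ε, ∀ k ∉ F ε, a ε k = 0)
    (ha : ∀ᶠ ε in 𝓝[>] (0:ℝ), ∀ k : ℤ, |a ε k| ≤ C * (1 + c * (k * δ ε) ^ 2) ^ (-((1 + γ) / 2)))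
    (hΦ : ∀ᶠ ε in 𝓝[>] (0:ℝ), Integrable (Φ ε))
    (hΦb : ∀ᶠ ε in 𝓝[>] (0:ℝ), ∀ t, |Φ ε t| ≤ C' * (1 + c' * t ^ 2) ^ (-((1 + γ) / 2)))
    (hm : ∀ η > 0, Integrable (m η)) (hm0 : ∀ η > 0, ∀ t, 0 ≤ m η t)
    (hmlim : Tendsto (fun η => ∫ t, m η t) (𝓝[>] 0) (𝓝 0))
    (havg : ∀ η > 0, ∃ N : ℕ, 0 < N ∧ ∀ t, ∀ ζ > 0, ∀ᶠ ε in 𝓝[>] (0:ℝ),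
      |(N:ℝ)⁻¹ * ∑ j ∈ Finset.range N, a ε (⌊t / δ ε⌋ + j) - Φ ε t| ≤ m η t + ζ) :
    Tendsto (fun ε => δ ε * ∑ k ∈ F ε, a ε k - ∫ t, Φ ε t) (𝓝[>] 0) (𝓝 0) := by
  rw [Metric.tendsto_nhds]
  intro e he
  obtain ⟨η, hη, hηm⟩ : ∃ η > 0, ∫ t, m η t < e / 2 := by
    have h1 := hmlim.eventually (gt_mem_nhds (half_pos he))
    obtain ⟨η, h2, h3⟩ := (h1.and self_mem_nhdsWithin).exists
    exact ⟨η, h3, h2⟩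
  obtain ⟨N, hN, hav⟩ := havg η hη
  have hN0 : (0:ℝ) < N := by exact_mod_cast hN
  set q := (1 + γ) / 2 with hq
  have hq0 : 0 ≤ q := by positivity
  set A : ℝ → ℝ → ℝ := fun ε t => (N:ℝ)⁻¹ * ∑ j ∈ Finset.range N, a ε (⌊t / δ ε⌋ + j) with hA
  have hAint : ∀ᶠ ε in 𝓝[>] (0:ℝ), Integrable (A ε) ∧ ∫ t, A ε t = δ ε * ∑ k ∈ F ε, a ε k := by
    filter_upwards [hδ] with ε hδε
    have hj := fun j : ℕ => integral_comp_floor (hF ε) hδε.1 (j : ℤ)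
    refine ⟨(integrable_finsetSum _ fun j _ => (hj j).1).const_mul _, ?_⟩
    rw [hA]
    simp only
    rw [integral_const_mul, integral_finsetSum _ fun j _ => (hj j).1,
      Finset.sum_congr rfl fun j _ => (hj j).2, Finset.sum_const, Finset.card_range, nsmul_eq_mul,
      ← mul_assoc, inv_mul_cancel₀ hN0.ne', one_mul]
  set K := C * (2 + 2 * c * (N:ℝ) ^ 2) ^ q with hK
  have hAb : ∀ᶠ ε in 𝓝[>] (0:ℝ), ∀ t, |A ε t| ≤ K * (1 + c * t ^ 2) ^ (-q) := by
    filter_upwards [hδ, ha] with ε hδε haε t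
    have hb : ∀ j ∈ Finset.range N, |a ε (⌊t / δ ε⌋ + j)| ≤ K * (1 + c * t ^ 2) ^ (-q) := fun j hj => by
      refine (haε _).trans ?_
      rw [hK, mul_assoc]
      refine mul_le_mul_of_nonneg_left (rpow_neg_le_of_near hc hq0 hδε.1 hδε.2 ?_) hC
      have hjN : (j:ℝ) + 1 ≤ N := by exact_mod_cast Finset.mem_range.1 hj
      have h1 := Int.floor_le (t / δ ε)
      have h2 := Int.lt_floor_add_one (t / δ ε)
      have h3 : (0:ℝ) ≤ j := j.cast_nonneg
      push_cast
      rw [abs_le]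
      constructor <;> linarith
    rw [hA, abs_mul, abs_of_pos (inv_pos.2 hN0), inv_mul_le_iff₀ hN0]
    refine (Finset.abs_sum_le_sum_abs _ _).trans ((Finset.sum_le_sum hb).trans (le_of_eq ?_))
    rw [Finset.sum_const, Finset.card_range, nsmul_eq_mul]
  have hbd : Integrable fun t : ℝ => K * (1 + c * t ^ 2) ^ (-q) + C' * (1 + c' * t ^ 2) ^ (-q) :=
    ((integrable_one_add_mul_sq_rpow hc hγ).const_mul _).add
      ((integrable_one_add_mul_sq_rpow hc' hγ).const_mul _)
  have hDb : ∀ᶠ ε in 𝓝[>] (0:ℝ), ∀ t,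
      |A ε t - Φ ε t| ≤ K * (1 + c * t ^ 2) ^ (-q) + C' * (1 + c' * t ^ 2) ^ (-q) := by
    filter_upwards [hAb, hΦb] with ε h1 h2 t using (abs_sub _ _).trans (add_le_add (h1 t) (h2 t))
  have hlim : Tendsto (fun ε => ∫ t, max (|A ε t - Φ ε t| - m η t) 0) (𝓝[>] 0)
      (𝓝 (∫ _ : ℝ, (0:ℝ))) := by
    refine tendsto_integral_filter_of_dominated_convergence _ ?_ ?_ hbd ?_
    · filter_upwards [hAint, hΦ] with ε h1 h2
      exact (((h1.1.sub h2).abs.sub (hm η hη)).sup (integrable_zero ℝ ℝ volume)).aestronglyMeasurable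
    · filter_upwards [hDb] with ε h1
      refine ae_of_all _ fun t => ?_
      rw [Real.norm_eq_abs, abs_of_nonneg (le_max_right _ _)]
      have := hm0 η hη t
      exact max_le (by linarith [h1 t]) ((abs_nonneg _).trans (h1 t))
    · refine ae_of_all _ fun t => ?_
      rw [Metric.tendsto_nhds]
      intro ζ hζ
      filter_upwards [hav t (ζ / 2) (half_pos hζ)] with ε h1
      rw [Real.dist_eq, sub_zero, abs_of_nonneg (le_max_right _ _)]
      exact max_lt (by linarith) hζ
  rw [integral_zero] at hlim
  filter_upwards [hAint, hΦ, hlim.eventually (gt_mem_nhds (half_pos he))] with ε h1 h2 h3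
  rw [Real.dist_eq, sub_zero, ← h1.2, ← integral_sub h1.1 h2]
  have hi := (h1.1.sub h2).abs
  have hs : Integrable fun t => max (|A ε t - Φ ε t| - m η t) 0 :=
    (hi.sub (hm η hη)).sup (integrable_zero ℝ ℝ volume)
  calc |∫ t, (A ε t - Φ ε t)| ≤ ∫ t, |A ε t - Φ ε t| := abs_integral_le_integral_abs
    _ ≤ ∫ t, (max (|A ε t - Φ ε t| - m η t) 0 + m η t) := by
        refine integral_mono hi (hs.add (hm η hη)) fun t => ?_
        simp only
        have := le_max_left (|A ε t - Φ ε t| - m η t) 0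
        linarith
    _ < e := by rw [integral_add hs (hm η hη)]; linarith

lemma phaseInt_average {R α : ℝ} {G s : ℝ → ℝ} {p : ℕ → ℝ → ℝ} (N : ℕ)
    (hI : ∀ j, Integrable fun x => G x * p j (R * (x ^ 2 / 2 - α * x) + s x)) :
    (N:ℝ)⁻¹ * ∑ j ∈ Finset.range N, phaseInt R G (p j) s α =
      phaseInt R G (fun v => (N:ℝ)⁻¹ * ∑ j ∈ Finset.range N, p j v) s α := by
  simp only [phaseInt]
  rw [← integral_finsetSum _ fun j _ => hI j, ← integral_const_mul]
  refine integral_congr_ae (ae_of_all _ fun x => ?_)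
  simp only
  rw [← Finset.mul_sum]
  ring

/-- Two decaying kernels which are uniformly close give close oscillatory integrals. -/
lemma abs_phaseInt_sub_le {R C A S η γ : ℝ} {G s p p' : ℝ → ℝ} (hR : 0 < R) (hη : 0 ≤ η)
    (hp : DecKer p C) (hp' : DecKer p' C) (hG : HolderBdd G A γ) (hs : HolderBdd s S γ)
    (hpp : ∀ v, |p v - p' v| ≤ η) (t : ℝ)
    (hI : Integrable fun x => G x * p (R * (x ^ 2 / 2 - t * x) + s x))
    (hI' : Integrable fun x => G x * p' (R * (x ^ 2 / 2 - t * x) + s x)) :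
    |phaseInt R G p s t - phaseInt R G p' s t| ≤
      A * (2 * √C * (4 + 4 / R * (1 + S)) * Real.pi) * √η * (1 + t ^ 2) := by
  have hA := hG.nonneg
  have hS := hs.nonneg
  have hC := hp.C_nonneg
  set Q := (4 + 4 / R * (1 + S)) * (1 + t ^ 2) with hQ
  have hQ0 : 0 ≤ Q := by positivity
  set V : ℝ → ℝ := fun x => R * (x ^ 2 / 2 - t * x) + s x with hV
  have hVl : ∀ x, 1 + x ^ 2 ≤ Q * (1 + |V x|) := fun x => by
    have h1 := one_add_sq_le_of_phase (c := R / 2) (x := x) (t := t) (T := |t|) (V := V x)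
      (B := R / 2 * t ^ 2 + S) (by positivity) le_rfl (by positivity) (by
        have := (abs_le.1 (hs.bound x)).1
        simp only [hV]
        linarith)
    refine h1.trans (mul_le_mul_of_nonneg_right ?_ (by positivity))
    rw [sq_abs]
    have e : 2 / (R / 2) * (1 + (R / 2 * t ^ 2 + S)) = 4 / R * (1 + S) + 2 * t ^ 2 := by
      field_simp; ring
    rw [e, hQ]
    have : 0 ≤ 4 / R * (1 + S) * t ^ 2 := by positivity
    nlinarith
  have hd : ∀ x, |p (V x) - p' (V x)| ≤ 2 * √C * √η * Q * (1 + x ^ 2)⁻¹ := fun x => by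
    have h1 : |p (V x) - p' (V x)| * (1 + V x ^ 2) ≤ 2 * C := by
      have e1 := hp.bound (V x)
      have e2 := hp'.bound (V x)
      rw [le_div_iff₀ (by positivity)] at e1 e2
      have := mul_le_mul_of_nonneg_right (abs_sub (p (V x)) (p' (V x)))
        (show 0 ≤ 1 + V x ^ 2 by positivity)
      linarith
    have h2 : (1 + x ^ 2) ^ 2 ≤ Q ^ 2 * (2 * (1 + V x ^ 2)) := by
      have : (1 + |V x|) ^ 2 ≤ 2 * (1 + V x ^ 2) := by
        nlinarith [sq_nonneg (1 - |V x|), sq_abs (V x)]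
      calc (1 + x ^ 2) ^ 2 ≤ (Q * (1 + |V x|)) ^ 2 := by gcongr; exact hVl x
        _ = Q ^ 2 * (1 + |V x|) ^ 2 := by ring
        _ ≤ _ := by gcongr
    rw [← div_eq_mul_inv, le_div_iff₀ (by positivity)]
    refine abs_le_of_sq_le_sq' ?_ (by positivity) |>.2
    have hsC := Real.sq_sqrt hC
    have hsη := Real.sq_sqrt hη
    calc (|p (V x) - p' (V x)| * (1 + x ^ 2)) ^ 2
        = |p (V x) - p' (V x)| * (|p (V x) - p' (V x)| * (1 + x ^ 2) ^ 2) := by ring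
      _ ≤ η * (|p (V x) - p' (V x)| * (Q ^ 2 * (2 * (1 + V x ^ 2)))) := by
          gcongr; exact hpp _
      _ = η * (Q ^ 2 * 2 * (|p (V x) - p' (V x)| * (1 + V x ^ 2))) := by ring
      _ ≤ η * (Q ^ 2 * 2 * (2 * C)) := by gcongr
      _ = _ := by linear_combination (-4 * √η ^ 2 * Q ^ 2) * hsC - 4 * C * Q ^ 2 * hsη
  rw [phaseInt, phaseInt, ← integral_sub hI hI']
  refine (norm_integral_le_of_norm_le
    (f := fun x => G x * p (R * (x ^ 2 / 2 - t * x) + s x) - G x * p' (R * (x ^ 2 / 2 - t * x) + s x))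
    ((integrable_inv_one_add_sq).const_mul (A * (2 * √C * √η * Q))) (ae_of_all _ fun x => ?_)).trans
    (le_of_eq ?_)
  · rw [← mul_sub, Real.norm_eq_abs, abs_mul, mul_assoc]
    have := hG.bound x
    have := hd x
    gcongr
  · rw [integral_const_mul, integral_univ_inv_one_add_sq, hQ]
    ring

lemma tendsto_integral_min {f : ℝ → ℝ} (hf : Integrable f) (hfc : Continuous f) (hf0 : ∀ t, 0 ≤ f t)
    {B : ℝ} (hB : 0 ≤ B) :
    (∀ η > 0, Integrable fun t => min (f t) (B * √η * (1 + t ^ 2))) ∧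
      Tendsto (fun η => ∫ t, min (f t) (B * √η * (1 + t ^ 2))) (𝓝[>] 0) (𝓝 0) := by
  have hc : ∀ η : ℝ, Continuous fun t => min (f t) (B * √η * (1 + t ^ 2)) := fun η =>
    hfc.min (by fun_prop)
  have hb : ∀ η t : ℝ, ‖min (f t) (B * √η * (1 + t ^ 2))‖ ≤ f t := fun η t => by
    rw [Real.norm_eq_abs, abs_of_nonneg (le_min (hf0 t) (by positivity))]
    exact min_le_left _ _
  refine ⟨fun η _ => hf.mono' (hc η).aestronglyMeasurable (ae_of_all _ (hb η)), ?_⟩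
  have := tendsto_integral_filter_of_dominated_convergence (l := 𝓝[>] (0:ℝ))
    (F := fun η t => min (f t) (B * √η * (1 + t ^ 2))) (f := fun _ => 0) f
    (Eventually.of_forall fun η => (hc η).aestronglyMeasurable)
    (Eventually.of_forall fun η => ae_of_all _ (hb η)) hf (ae_of_all _ fun t => ?_)
  · rwa [integral_zero] at this
  · have hup : Tendsto (fun η : ℝ => B * √η * (1 + t ^ 2)) (𝓝[>] 0) (𝓝 0) := by
      simpa using (tendsto_sqrt_nhdsGT.const_mul B).mul_const (1 + t ^ 2)
    exact squeeze_zero (fun η => le_min (hf0 t) (by positivity)) (fun η => min_le_right _ _) hup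

lemma hasStrictDerivAt_dot2_vec (x : ℝ × ℝ) :
    HasStrictDerivAt (fun α => dot2 (vec α) x) x.2 0 := by
  have h1 := ((Real.hasStrictDerivAt_cos 0).mul_const x.1).add
    ((Real.hasStrictDerivAt_sin 0).mul_const x.2)
  refine HasStrictDerivAt.congr_deriv (f := fun α => dot2 (vec α) x) h1 ?_
  simp

/-- Consecutive detector offsets near the normal direction differ by the rotation number. -/
lemma tendsto_offset_sub {κ : ℝ} (hκ : 0 < κ) (x₀ xc : ℝ × ℝ) {n : ℝ → ℤ} (j : ℕ)
    (hn : Tendsto (fun ε => (n ε : ℝ) * (κ * ε)) (𝓝[>] 0) (𝓝 0)) :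
    Tendsto (fun ε => dot2 (vec (((n ε + j : ℤ) : ℝ) * (κ * ε))) (x₀ + ε • xc) / ε -
      (dot2 (vec ((n ε : ℝ) * (κ * ε))) (x₀ + ε • xc) / ε + j * (κ * x₀.2))) (𝓝[>] 0) (𝓝 0) := by
  have hnj : Tendsto (fun ε => ((n ε + j : ℤ) : ℝ) * (κ * ε)) (𝓝[>] 0) (𝓝 0) := by
    have : Tendsto (fun ε : ℝ => (j:ℝ) * (κ * ε)) (𝓝[>] 0) (𝓝 0) := by
      simpa using (tendsto_id_nhdsGT.const_mul κ).const_mul (j:ℝ)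
    have := hn.add this
    rw [add_zero] at this
    refine this.congr fun ε => ?_
    push_cast; ring
  have hd : Tendsto (fun ε => dot2 (vec (((n ε + j : ℤ) : ℝ) * (κ * ε))) xc -
      dot2 (vec ((n ε : ℝ) * (κ * ε))) xc) (𝓝[>] 0) (𝓝 0) := by
    have hc := (hasStrictDerivAt_dot2_vec xc).hasDerivAt.continuousAt
    simpa using (hc.tendsto.comp hnj).sub (hc.tendsto.comp hn)
  have hlo := (hasStrictDerivAt_dot2_vec x₀).isLittleO.comp_tendsto (hnj.prodMk_nhds hn)
  have hj : (fun ε : ℝ => ((n ε + j : ℤ) : ℝ) * (κ * ε) - (n ε : ℝ) * (κ * ε)) =O[𝓝[>] 0]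
      fun ε => ε :=
    Asymptotics.IsBigO.of_bound (j * κ) (Eventually.of_forall fun ε => by
      rw [show ((n ε + j : ℤ) : ℝ) * (κ * ε) - (n ε : ℝ) * (κ * ε) = (j * κ) * ε by push_cast; ring,
        norm_mul, Real.norm_of_nonneg (by positivity)])
  have h2 := (hlo.trans_isBigO hj).tendsto_div_nhds_zero
  have h3 := h2.add hd
  rw [add_zero] at h3
  refine h3.congr' ?_
  filter_upwards [self_mem_nhdsWithin] with ε (hε : 0 < ε)
  simp only [Function.comp_apply, dot2_add_right, dot2_smul_right, ContinuousLinearMap.toSpanSingleton_apply,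
    smul_eq_mul]
  push_cast
  field_simp
  ring

namespace ArcData
variable {γ : ℝ} {y y' : ℝ → ℝ × ℝ} {R : ℝ → ℝ} {r R₁ R₂ Λ : ℝ} {Ht : ℝ → ℝ → ℝ}
  {g : ℝ × ℝ → ℝ} {c₀ ε₁ M Lg : ℝ}

/-- The sum over all views of the contributions of an arc with normal direction `0` at the
reconstruction point. -/
theorem tendsto_sum_arcInt (h : ArcData γ y y' R 0 r R₁ R₂ Λ Ht g c₀ ε₁ M Lg)
    {ik k w : ℝ → ℝ} {L ρ : ℝ} (K : Kernels ik k w L ρ) (xc : ℝ × ℝ) {κ σ : ℝ} (hκ : 0 < κ)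
    (hlam : Irrational (κ * (y 0).2)) (hσ : σ ∈ Set.Icc (0:ℝ) 1) :
    Tendsto (fun ε => κ * ∑ n ∈ views κ ε, arcInt y (y 0) xc Ht g
        (latKer k w (dot2 (vec (n * (κ * ε))) (y 0 + ε • xc) / ε)) ε σ (n * (κ * ε)) +
      2 * Real.pi / R 0 * (g (0, 0) * Ht ε 0) * conv1 ik w (σ * Ht ε 0 - xc.1)) (𝓝[>] 0) (𝓝 0) := by
  obtain ⟨Cp, hCp, hp⟩ := K.exists_decKer
  obtain ⟨C, c, hC, hc, hbd⟩ := h.exists_abs_arcInt_zero_le xc Cp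
  have hR := h.R_zero_pos
  have hγ := h.γ_pos
  obtain ⟨D, hD, hph⟩ := exists_abs_phaseInt_le hγ h.γ_lt hR
  have hM := h.M_nonneg
  have hc₀ := h.c₀_nonneg
  have hpm := K.decKer_latMean hp
  set u : ℝ → ℤ → ℝ := fun ε n => dot2 (vec (n * (κ * ε))) (y 0 + ε • xc) / ε with hu
  set δ : ℝ → ℝ := fun ε => κ * √ε with hδ
  set a : ℝ → ℤ → ℝ := fun ε n => if n ∈ views κ ε then
    (√ε)⁻¹ * arcInt y (y 0) xc Ht g (latKer k w (u ε n)) ε σ (n * (κ * ε)) else 0 with ha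
  set G : ℝ → ℝ → ℝ := fun ε x => g (0, 0) * Ht ε (√ε * x) with hG
  set s : ℝ → ℝ → ℝ := fun ε x => σ * Ht ε (√ε * x) - xc.1 with hs
  set Φ : ℝ → ℝ → ℝ := fun ε t => phaseInt (R 0) (G ε) (latMean k w) (s ε) t with hΦ
  set S := c₀ + |xc.1| with hS
  have hS0 : 0 ≤ S := by positivity
  set E := 4 * Cp * (M * c₀) * (1 + S) * (1 + S ^ 2) * D with hE
  have hE0 : 0 ≤ E := by positivity
  set B := M * c₀ * (2 * √Cp * (4 + 4 / R 0 * (1 + S)) * Real.pi) with hB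
  have hB0 : 0 ≤ B := by have := Real.pi_pos; positivity
  set f : ℝ → ℝ := fun t => 2 * (E * (1 + R 0 / 2 * t ^ 2) ^ (-((1 + γ) / 2))) with hf
  have hfi : Integrable f :=
    ((integrable_one_add_mul_sq_rpow (half_pos hR) hγ).const_mul E).const_mul 2
  have hfc : Continuous f := by
    refine continuous_const.mul (continuous_const.mul
      (Continuous.rpow_const (by fun_prop) fun t => Or.inl ?_))
    positivity
  have hf0 : ∀ t, 0 ≤ f t := fun t => by positivity
  obtain ⟨hmi, hml⟩ := tendsto_integral_min hfi hfc hf0 hB0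
  have hδlim : Tendsto δ (𝓝[>] 0) (𝓝 0) := by simpa using tendsto_sqrt_nhdsGT.const_mul κ
  have hδev : ∀ᶠ ε in 𝓝[>] (0:ℝ), 0 < δ ε ∧ δ ε ≤ 1 := by
    filter_upwards [self_mem_nhdsWithin, hδlim.eventually (gt_mem_nhds one_pos)] with ε h1 h2
    exact ⟨mul_pos hκ (Real.sqrt_pos.2 h1), h2.le⟩
  have hmain := tendsto_sum_sub_integral (δ := δ) (F := views κ) (a := a) (Φ := Φ)
    (m := fun η t => min (f t) (B * √η * (1 + t ^ 2))) (C := C) (C' := E) (c := c) (c' := R 0 / 2)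
    hγ hc (half_pos hR) hC hδev (fun ε n hn => if_neg hn) ?_ ?_ ?_ hmi
    (fun η _ t => le_min (hf0 t) (by positivity)) hml ?_
  · refine hmain.congr' ?_
    filter_upwards [h.eventually_mem] with ε hε
    have hε0 := hε.1
    have hsε := Real.sqrt_pos.2 hε0
    rw [(K.integral_phaseInt hγ h.γ_lt (h.holder_density hε) (h.holder_shf_zero xc hε hσ) hR).2]
    have e : ∑ n ∈ views κ ε, a ε n = (√ε)⁻¹ * ∑ n ∈ views κ ε,
        arcInt y (y 0) xc Ht g (latKer k w (u ε n)) ε σ (n * (κ * ε)) := by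
      rw [Finset.mul_sum]
      exact Finset.sum_congr rfl fun n hn => if_pos hn
    rw [e, mul_zero, hδ, mul_assoc κ, ← mul_assoc (√ε), mul_inv_cancel₀ hsε.ne', one_mul]
    simp only [hu]
    ring
  · filter_upwards [h.eventually_mem] with ε hε n
    have hε0 := hε.1
    have hsε := Real.sqrt_pos.2 hε0
    by_cases hn : n ∈ views κ ε
    · simp only [ha, if_pos hn]
      rw [abs_mul, abs_of_pos (inv_pos.2 hsε), inv_mul_le_iff₀ hsε]
      have h1 := hbd ε hε σ hσ _ (hp (u ε n)) _ ((mem_views (mul_pos hκ hε0) n).1 hn)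
      have e : ((n:ℝ) * (κ * ε)) ^ 2 / ε = (n * δ ε) ^ 2 := by
        rw [hδ, mul_pow, mul_pow, mul_pow, mul_pow, Real.sq_sqrt hε0.le]
        field_simp
      rwa [e] at h1
    · simp only [ha, if_neg hn, abs_zero]
      positivity
  · filter_upwards [h.eventually_mem] with ε hε
    exact (K.integral_phaseInt hγ h.γ_lt (h.holder_density hε) (h.holder_shf_zero xc hε hσ) hR).1
  · filter_upwards [h.eventually_mem] with ε hε t
    exact (hph hpm (h.holder_density hε) (h.holder_shf_zero xc hε hσ) t).2
  · intro η hη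
    obtain ⟨N, hN, hav⟩ := K.latKer_average hlam hη
    refine ⟨N, hN, fun t ζ hζ => ?_⟩
    set P : ℝ → ℕ → ℝ → ℝ := fun ε j => latKer k w (u ε ⌊t / δ ε⌋ + j * (κ * (y 0).2)) with hP
    have hnlim : Tendsto (fun ε => (⌊t / δ ε⌋ : ℝ) * δ ε) (𝓝[>] 0) (𝓝 t) := by
      have h1 : Tendsto (fun ε => t - δ ε) (𝓝[>] 0) (𝓝 t) := by simpa using hδlim.const_sub t
      refine tendsto_of_tendsto_of_tendsto_of_le_of_le' h1 tendsto_const_nhds ?_ ?_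
      · filter_upwards [hδev] with ε h2
        have := Int.lt_floor_add_one (t / δ ε)
        rw [div_lt_iff₀ h2.1] at this
        linarith
      · filter_upwards [hδev] with ε h2
        exact (le_div_iff₀ h2.1).1 (Int.floor_le (t / δ ε))
    have hnj : ∀ j : ℕ, Tendsto (fun ε => ((⌊t / δ ε⌋ + j : ℤ) : ℝ) * δ ε) (𝓝[>] 0) (𝓝 t) := fun j => by
      have := hnlim.add (hδlim.const_mul (j:ℝ))
      rw [mul_zero, add_zero] at this
      refine this.congr fun ε => ?_
      push_cast; ring
    have hsq : ∀ ε : ℝ, 0 < ε → ∀ x : ℝ, x * (κ * ε) = x * δ ε * √ε := fun ε hε x => by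
      simp only [hδ]
      linear_combination -x * κ * Real.mul_self_sqrt hε.le
    have hα0 : ∀ j : ℕ, Tendsto (fun ε => ((⌊t / δ ε⌋ + j : ℤ) : ℝ) * (κ * ε)) (𝓝[>] 0) (𝓝 0) :=
      fun j => by
        have := (hnj j).mul tendsto_sqrt_nhdsGT
        rw [mul_zero] at this
        refine this.congr' ?_
        filter_upwards [self_mem_nhdsWithin] with ε hε
        rw [hsq ε hε]
    have hj : ∀ j : ℕ, Tendsto (fun ε => a ε (⌊t / δ ε⌋ + j) - phaseInt (R 0) (G ε) (P ε j) (s ε) t)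
        (𝓝[>] 0) (𝓝 0) := fun j => by
      have h1 := h.tendsto_arcInt_sub_phaseInt K hp xc hσ (t := t)
        (αf := fun ε => ((⌊t / δ ε⌋ + j : ℤ) : ℝ) * (κ * ε)) (uf := fun ε => u ε (⌊t / δ ε⌋ + j))
        (uf' := fun ε => u ε ⌊t / δ ε⌋ + j * (κ * (y 0).2)) ?_ ?_
      · refine h1.congr' ?_
        have hv : ∀ᶠ ε in 𝓝[>] (0:ℝ), |((⌊t / δ ε⌋ + j : ℤ) : ℝ) * (κ * ε)| ≤ Real.pi / 2 := by
          have := (hα0 j).abs.eventually (gt_mem_nhds (show |(0:ℝ)| < Real.pi / 2 by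
            rw [abs_zero]; exact Real.pi_div_two_pos))
          exact this.mono fun ε h => h.le
        filter_upwards [self_mem_nhdsWithin, hv] with ε (hε : 0 < ε) h2
        simp only [ha, if_pos ((mem_views (mul_pos hκ hε) _).2 h2)]
        rfl
      · refine (hnj j).congr' ?_
        filter_upwards [self_mem_nhdsWithin] with ε (hε : 0 < ε)
        rw [hsq ε hε, mul_div_cancel_right₀ _ (Real.sqrt_pos.2 hε).ne']
      · refine tendsto_offset_sub hκ (y 0) xc j ?_
        simpa using hα0 0
    have hsum := (tendsto_finsetSum (Finset.range N) fun j _ => hj j).const_mul ((N:ℝ)⁻¹)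
    rw [Finset.sum_const_zero, mul_zero] at hsum
    filter_upwards [h.eventually_mem, (hsum.abs).eventually (gt_mem_nhds (show |(0:ℝ)| < ζ by
      rwa [abs_zero]))] with ε hε hζε
    have hGε := h.holder_density hε
    have hsε := h.holder_shf_zero xc hε hσ
    have hPd : ∀ j, DecKer (P ε j) Cp := fun j => hp _
    have hPa := DecKer.average hN hPd
    have hI := hph hPa hGε hsε t
    have hI' := hph hpm hGε hsε t
    have havr := phaseInt_average (R := R 0) (α := t) (G := G ε) (s := s ε) (p := P ε) N
      fun j => (hph (hPd j) hGε hsε t).1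
    have hd : |phaseInt (R 0) (G ε) (fun v => (N:ℝ)⁻¹ * ∑ j ∈ Finset.range N, P ε j v) (s ε) t - Φ ε t| ≤
        min (f t) (B * √η * (1 + t ^ 2)) := by
      refine le_min ?_ ?_
      · refine (abs_sub _ _).trans ?_
        have h1 := hI.2
        have h2 := hI'.2
        simp only [hf]
        rw [two_mul]
        exact add_le_add h1 h2
      · exact abs_phaseInt_sub_le hR hη.le hPa hpm hGε hsε (fun v => hav _ v) t hI.1 hI'.1
    rw [Finset.sum_sub_distrib, mul_sub, havr] at hζε
    calc |(N:ℝ)⁻¹ * ∑ j ∈ Finset.range N, a ε (⌊t / δ ε⌋ + j) - Φ ε t| ≤ _ := abs_sub_le _ _ _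
      _ ≤ _ := by rw [add_comm]; exact add_le_add hd hζε.le

end ArcData

namespace LipSupp
variable {k : ℝ → ℝ} {L ρ : ℝ}

lemma integrableOn_div (hk : LipSupp k L ρ) (q : ℝ) {δ : ℝ} (hδ : 0 < δ) :
    IntegrableOn (fun p => k p / (p - q)) {p | δ < |p - q|} := by
  have hm : MeasurableSet {p : ℝ | δ < |p - q|} := measurableSet_lt measurable_const (by fun_prop)
  refine Integrable.mono' (hk.integrable.norm.const_mul δ⁻¹).integrableOn
    (Measurable.aestronglyMeasurable (by have := hk.continuous.measurable; fun_prop)) ?_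
  refine (ae_restrict_iff' hm).2 (ae_of_all _ fun p (hp : δ < |p - q|) => ?_)
  rw [norm_div, div_eq_inv_mul, Real.norm_eq_abs (p - q)]
  gcongr

/-- The truncated integrals converge to the principal value. -/
lemma tendsto_truncated (hk : LipSupp k L ρ) (q : ℝ) :
    Tendsto (fun δ => ∫ p in {p | δ < |p - q|}, k p / (p - q)) (𝓝[>] 0) (𝓝 (Real.pi * hil k q)) := by
  have key : ∀ δ > 0, ∫ p in {p | δ < |p - q|}, k p / (p - q) =
      ∫ s in Set.Ioi 0, (Set.Ioi δ).indicator (fun s => (k (q + s) - k (q - s)) / s) s := by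
    intro δ hδ
    have hm : MeasurableSet {p : ℝ | δ < |p - q|} := measurableSet_lt measurable_const (by fun_prop)
    have hi : Integrable ({p | δ < |p - q|}.indicator fun p => k p / (p - q)) :=
      (integrable_indicator_iff hm).2 (hk.integrableOn_div q hδ)
    set φ : ℝ → ℝ := fun s => {p | δ < |p - q|}.indicator (fun p => k p / (p - q)) (q + s) with hφ
    have hφi : Integrable φ := hi.comp_add_left q
    have hneg : Integrable fun s => φ (-s) := hφi.comp_neg
    rw [← integral_indicator hm,
      ← integral_add_left_eq_self ({p | δ < |p - q|}.indicator fun p => k p / (p - q)) q,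
      ← intervalIntegral.integral_Iic_add_Ioi (b := 0) hφi.integrableOn hφi.integrableOn]
    have h1 := integral_comp_neg_Ioi 0 φ
    rw [neg_zero] at h1
    rw [← h1, ← integral_add hneg.integrableOn hφi.integrableOn]
    refine setIntegral_congr_fun measurableSet_Ioi fun s (hs : 0 < s) => ?_
    simp only [hφ, Set.indicator_apply, Set.mem_ofPred_eq, Set.mem_Ioi, add_sub_cancel_left, abs_neg,
      abs_of_pos hs]
    split_ifs
    · rw [sub_eq_add_neg q s, div_neg]; ring
    · rw [add_zero]
  have hlim : Tendsto (fun δ => ∫ s in Set.Ioi 0,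
      (Set.Ioi δ).indicator (fun s => (k (q + s) - k (q - s)) / s) s) (𝓝[>] 0)
      (𝓝 (∫ s in Set.Ioi 0, (k (q + s) - k (q - s)) / s)) := by
    refine tendsto_integral_filter_of_dominated_convergence
      (fun s => ‖(k (q + s) - k (q - s)) / s‖) ?_ ?_ (hk.integrableOn_diffQuot q).norm ?_
    · exact Eventually.of_forall fun δ =>
        ((hk.measurable_diffQuot q).indicator measurableSet_Ioi).aestronglyMeasurable
    · exact Eventually.of_forall fun δ => ae_of_all _ fun s => norm_indicator_le_norm_self _ _
    · refine (ae_restrict_iff' measurableSet_Ioi).2 (ae_of_all _ fun s (hs : 0 < s) => ?_)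
      refine tendsto_const_nhds.congr' ?_
      filter_upwards [Ioo_mem_nhdsGT hs] with δ hδ
      rw [Set.indicator_of_mem (show s ∈ Set.Ioi δ from hδ.2)]
  have : Real.pi * hil k q = ∫ s in Set.Ioi 0, (k (q + s) - k (q - s)) / s := by
    rw [hil, ← mul_assoc, mul_inv_cancel₀ Real.pi_ne_zero, one_mul]
  rw [this]
  refine hlim.congr' ?_
  filter_upwards [self_mem_nhdsWithin] with δ hδ using (key δ hδ).symm

lemma comp_div_sub (hk : LipSupp k L ρ) {ε : ℝ} (hε : 0 < ε) (c : ℝ) :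
    LipSupp (fun p => k (p / ε - c)) (L / ε) (ε * (ρ + |c|)) where
  lip x z := by
    refine (hk.lip _ _).trans (le_of_eq ?_)
    rw [sub_sub_sub_cancel_right, ← sub_div, abs_div, abs_of_pos hε]
    ring
  supp x hx := by
    refine hk.supp _ ?_
    have h1 : ρ + |c| ≤ |x / ε| := by
      rw [abs_div, abs_of_pos hε, le_div_iff₀ hε]; linarith
    linarith [abs_sub_abs_le_abs_sub (x / ε) c]
  L_pos := div_pos hk.L_pos hε
  ρ_pos := by have := hk.ρ_pos; have := abs_nonneg c; positivity

lemma _root_.hil_comp_div_sub (k : ℝ → ℝ) {ε : ℝ} (hε : 0 < ε) (c q : ℝ) :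
    hil (fun p => k (p / ε - c)) q = hil k (q / ε - c) := by
  rw [hil, hil]
  congr 1
  have h := integral_comp_mul_left_Ioi (fun s => (k ((q + s) / ε - c) - k ((q - s) / ε - c)) / s) 0 hε
  rw [mul_zero, smul_eq_mul] at h
  have h2 := congrArg (ε * ·) h
  simp only [← mul_assoc, mul_inv_cancel₀ hε.ne', one_mul] at h2
  rw [← h2, ← integral_const_mul]
  refine setIntegral_congr_fun measurableSet_Ioi fun s (hs : 0 < s) => ?_
  rw [show (q + ε * s) / ε - c = q / ε - c + s by field_simp; ring,
    show (q - ε * s) / ε - c = q / ε - c - s by field_simp; ring]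
  field_simp

end LipSupp

/-- The backprojection over all views of the filtered and interpolated data of `f`. -/
noncomputable def viewSum (κ : ℝ) (k w : ℝ → ℝ) (ε : ℝ) (x : ℝ × ℝ) (f : ℝ × ℝ → ℝ) : ℝ :=
  ∑ n ∈ views κ ε, ε⁻¹ * ∫ z, latKer k w (dot2 (vec (n * (κ * ε))) x / ε)
    (dot2 (vec (n * (κ * ε))) (z - x) / ε) * f z

namespace Kernels
variable {ik k w : ℝ → ℝ} {L ρ : ℝ}

/-- The principal value integral of the interpolated data of a single view. -/
lemma principalValue_eq (K : Kernels ik k w L ρ) {ε : ℝ} (hε : 0 < ε) {a : ℤ → ℝ} {J : Finset ℤ}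
    (ha : ∀ j ∉ J, a j = 0) {q I : ℝ}
    (hI : Tendsto (fun δ : ℝ => ∫ p in {p : ℝ | δ < |p - q|},
      deriv (fun p' : ℝ => ∑' j : ℤ, ik ((p' - (j : ℝ) * ε) / ε) * a j) p / (p - q)) (𝓝[>] 0) (𝓝 I)) :
    I = ε⁻¹ * Real.pi * ∑ j ∈ J, hil k (q / ε - j) * a j := by
  have hd : ∀ p, deriv (fun p' : ℝ => ∑' j : ℤ, ik ((p' - (j : ℝ) * ε) / ε) * a j) p =
      ∑ j ∈ J, ε⁻¹ * a j * k (p / ε - j) := fun p => by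
    have e : (fun p' : ℝ => ∑' j : ℤ, ik ((p' - (j : ℝ) * ε) / ε) * a j) =
        fun p' => ∑ j ∈ J, ik (p' / ε - j) * a j := by
      funext p'
      rw [tsum_eq_sum fun j hj => by rw [ha j hj, mul_zero]]
      refine Finset.sum_congr rfl fun j _ => ?_
      rw [sub_div, mul_div_cancel_right₀ _ hε.ne']
    rw [e]
    refine (HasDerivAt.fun_sum fun j _ => ?_).deriv
    have h1 : HasDerivAt (fun p' : ℝ => p' / ε - j) ε⁻¹ p := by
      simpa using ((hasDerivAt_id p).div_const ε).sub_const (j:ℝ)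
    refine (((K.deriv_ik _).comp p h1).mul_const (a j)).congr_deriv ?_
    ring
  have hlim : Tendsto (fun δ : ℝ => ∑ j ∈ J, ε⁻¹ * a j *
      ∫ p in {p : ℝ | δ < |p - q|}, k (p / ε - j) / (p - q)) (𝓝[>] 0)
      (𝓝 (∑ j ∈ J, ε⁻¹ * a j * (Real.pi * hil k (q / ε - j)))) := by
    refine tendsto_finsetSum _ fun j _ => ?_
    rw [← hil_comp_div_sub k hε]
    exact ((K.k_lip.comp_div_sub hε j).tendsto_truncated q).const_mul _
  have heq : I = ∑ j ∈ J, ε⁻¹ * a j * (Real.pi * hil k (q / ε - j)) := by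
    refine tendsto_nhds_unique hI (hlim.congr' ?_)
    filter_upwards [self_mem_nhdsWithin] with δ (hδ : 0 < δ)
    simp only [hd, Finset.sum_div, mul_div_assoc]
    have hi : ∀ j ∈ J, Integrable (fun p => ε⁻¹ * a j * (k (p / ε - j) / (p - q)))
        (volume.restrict {p | δ < |p - q|}) := fun j _ =>
      ((K.k_lip.comp_div_sub hε j).integrableOn_div q hδ).const_mul _
    rw [integral_finsetSum _ hi]
    simp only [integral_const_mul]
  rw [heq, Finset.mul_sum]
  exact Finset.sum_congr rfl fun j _ => by ring

/-- The contribution of a single view to the reconstruction. -/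
lemma sum_hil_mul_data (K : Kernels ik k w L ρ) {ε B : ℝ} (hε : 0 < ε) {f : ℝ × ℝ → ℝ}
    (hf : Integrable f) (hsupp : ∀ z, B ≤ ‖z‖ → f z = 0) (α : ℝ) (x : ℝ × ℝ) {a : ℤ → ℝ}
    (ha : ∀ j : ℤ, a j = ε⁻¹ * ∫ z, w (((j : ℝ) * ε - dot2 (vec α) z) / ε) * f z) :
    ∃ J : Finset ℤ, (∀ j ∉ J, a j = 0) ∧ ∑ j ∈ J, hil k (dot2 (vec α) x / ε - j) * a j =
      ε⁻¹ * ∫ z, latKer k w (dot2 (vec α) x / ε) (dot2 (vec α) (z - x) / ε) * f z := by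
  set Q := ρ + 2 * |B| / ε with hQ
  have hw0 : ∀ j : ℤ, Q ≤ |(j:ℝ)| → ∀ z, w (((j : ℝ) * ε - dot2 (vec α) z) / ε) * f z = 0 :=
    fun j hj z => by
      by_cases hz : B ≤ ‖z‖
      · rw [hsupp z hz, mul_zero]
      rw [K.w_lip.supp, zero_mul]
      have h1 : |dot2 (vec α) z| ≤ 2 * |B| := by
        have h2 := abs_dot2_vec_le α z
        have h3 : |z.1| ≤ ‖z‖ := norm_fst_le z
        have h4 : |z.2| ≤ ‖z‖ := norm_snd_le z
        have h5 := le_abs_self B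
        push Not at hz
        linarith
      rw [sub_div, mul_div_cancel_right₀ _ hε.ne']
      have h2 : |dot2 (vec α) z / ε| ≤ 2 * |B| / ε := by
        rw [abs_div, abs_of_pos hε]; gcongr
      linarith [abs_sub_abs_le_abs_sub (j:ℝ) (dot2 (vec α) z / ε)]
  have hJ : ∀ j : ℤ, j ∉ Finset.Icc (-⌈Q⌉) ⌈Q⌉ → Q ≤ |(j:ℝ)| := fun j hj => by
    by_contra! hlt
    refine hj (Finset.mem_Icc.2 ?_)
    have h1 := abs_lt.1 hlt
    have h2 := Int.le_ceil Q
    constructor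
    · have : ((-⌈Q⌉ : ℤ) : ℝ) < j := by push_cast; linarith
      exact_mod_cast this.le
    · have : (j:ℝ) < (⌈Q⌉ : ℤ) := by linarith
      exact_mod_cast this.le
  refine ⟨Finset.Icc (-⌈Q⌉) ⌈Q⌉, fun j hj => ?_, ?_⟩
  · rw [ha, integral_congr_ae (ae_of_all _ (hw0 j (hJ j hj))), integral_zero, mul_zero]
  · have hwi : ∀ j : ℤ, Integrable fun z => w (((j : ℝ) * ε - dot2 (vec α) z) / ε) * f z := fun j => by
      refine hf.bdd_mul (c := 2 * L * ρ) (Continuous.aestronglyMeasurable ?_)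
        (ae_of_all _ fun z => K.w_lip.bound _)
      refine K.w_lip.continuous.comp ?_
      simp only [dot2]
      fun_prop
    simp only [ha]
    have e : ∀ j : ℤ, hil k (dot2 (vec α) x / ε - j) *
        (ε⁻¹ * ∫ z, w (((j : ℝ) * ε - dot2 (vec α) z) / ε) * f z) =
        ε⁻¹ * ∫ z, hil k (dot2 (vec α) x / ε - j) *
          (w (((j : ℝ) * ε - dot2 (vec α) z) / ε) * f z) := fun j => by
      rw [integral_const_mul]; ring
    rw [Finset.sum_congr rfl fun j _ => e j, ← Finset.mul_sum,
      ← integral_finsetSum _ fun j _ => (hwi j).const_mul _]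
    congr 1
    refine integral_congr_ae (ae_of_all _ fun z => ?_)
    simp only
    by_cases hz : f z = 0
    · simp [hz]
    · rw [latKer, tsum_eq_sum (s := Finset.Icc (-⌈Q⌉) ⌈Q⌉), Finset.sum_mul]
      · refine Finset.sum_congr rfl fun j _ => ?_
        rw [dot2_sub_right, show ((j:ℝ) * ε - dot2 (vec α) z) / ε =
          j - dot2 (vec α) x / ε - (dot2 (vec α) z - dot2 (vec α) x) / ε by field_simp; ring]
        ring
      · intro j hj
        have := (mul_eq_zero.1 (hw0 j (hJ j hj) z)).resolve_right hz
        rw [dot2_sub_right, show j - dot2 (vec α) x / ε - (dot2 (vec α) z - dot2 (vec α) x) / ε =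
          ((j:ℝ) * ε - dot2 (vec α) z) / ε by field_simp; ring, this, mul_zero]

/-- The discrete filtered backprojection formula. -/
theorem reconstruction_eq (K : Kernels ik k w L ρ) {κ ε B : ℝ} (hκ : 0 < κ) (hε : 0 < ε)
    {f : ℝ × ℝ → ℝ} (hf : Integrable f) (hsupp : ∀ z, B ≤ ‖z‖ → f z = 0) (x : ℝ × ℝ) {a : ℤ → ℤ → ℝ}
    (ha : ∀ n j : ℤ, a n j = ε⁻¹ * ∫ z : ℝ × ℝ,
      w (((j : ℝ) * ε - dot2 (vec ((n : ℝ) * (κ * ε))) z) / ε) * f z) {I : ℤ → ℝ}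
    (hI : ∀ n : ℤ, Tendsto (fun δ : ℝ => ∫ p in {p : ℝ | δ < |p - dot2 (vec ((n : ℝ) * (κ * ε))) x|},
      deriv (fun p' : ℝ => ∑' j : ℤ, ik ((p' - (j : ℝ) * ε) / ε) * a n j) p /
        (p - dot2 (vec ((n : ℝ) * (κ * ε))) x)) (𝓝[>] 0) (𝓝 (I n))) :
    -(κ * ε / (2 * Real.pi)) * ∑' n : ℤ,
      (if |(n : ℝ) * (κ * ε)| ≤ Real.pi / 2 then (1 / Real.pi) * I n else 0) =
      -(κ / (2 * Real.pi)) * viewSum κ k w ε x f := by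
  have hI' : ∀ n : ℤ, I n = ε⁻¹ * Real.pi * (ε⁻¹ * ∫ z, latKer k w (dot2 (vec (n * (κ * ε))) x / ε)
      (dot2 (vec (n * (κ * ε))) (z - x) / ε) * f z) := fun n => by
    obtain ⟨J, h0, h1⟩ := K.sum_hil_mul_data hε hf hsupp (n * (κ * ε)) x (ha n)
    rw [K.principalValue_eq hε h0 (hI n), h1]
  rw [tsum_eq_sum (s := views κ ε) fun n hn =>
      if_neg fun h => hn ((mem_views (mul_pos hκ hε) n).2 h),
    Finset.sum_congr rfl fun n hn => if_pos ((mem_views (mul_pos hκ hε) n).1 hn)]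
  rw [viewSum, Finset.mul_sum, Finset.mul_sum]
  refine Finset.sum_congr rfl fun n _ => ?_
  rw [hI']
  have := Real.pi_ne_zero
  field_simp

end Kernels

/-- The signed indicator of the open interval with endpoints `0` and `H`. -/
noncomputable def sgnInd (H t : ℝ) : ℝ := if 0 < t ∧ t < H then 1 else if H < t ∧ t < 0 then -1 else 0

lemma abs_sgnInd_le (H t : ℝ) : |sgnInd H t| ≤ 1 := by
  unfold sgnInd
  split_ifs <;> simp

lemma measurable_sgnInd : Measurable fun q : ℝ × ℝ => sgnInd q.1 q.2 := by
  have h1 : MeasurableSet {q : ℝ × ℝ | 0 < q.2 ∧ q.2 < q.1} :=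
    (measurableSet_lt measurable_const measurable_snd).inter
      (measurableSet_lt measurable_snd measurable_fst)
  have h2 : MeasurableSet {q : ℝ × ℝ | q.1 < q.2 ∧ q.2 < 0} :=
    (measurableSet_lt measurable_fst measurable_snd).inter
      (measurableSet_lt measurable_snd measurable_const)
  exact Measurable.ite h1 measurable_const (Measurable.ite h2 measurable_const measurable_const)

lemma integral_sgnInd_mul (H : ℝ) (F : ℝ → ℝ) :
    ∫ t, sgnInd H t * F t = H * ∫ σ in (0:ℝ)..1, F (σ * H) := by
  have e : H * ∫ σ in (0:ℝ)..1, F (σ * H) = ∫ t in (0:ℝ)..H, F t := by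
    simp
  rw [e]
  rcases le_total 0 H with h | h
  · have e1 : (fun t => sgnInd H t * F t) = (Set.Ioo 0 H).indicator F := by
      funext t
      by_cases ht : t ∈ Set.Ioo 0 H
      · rw [Set.indicator_of_mem ht, sgnInd, if_pos ⟨ht.1, ht.2⟩, one_mul]
      · rw [Set.indicator_of_notMem ht, sgnInd, if_neg (show ¬(0 < t ∧ t < H) from ht), if_neg, zero_mul]
        rintro ⟨h1, h2⟩
        linarith
    rw [e1, integral_indicator measurableSet_Ioo, intervalIntegral.integral_of_le h,
      integral_Ioc_eq_integral_Ioo]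
  · have e1 : (fun t => sgnInd H t * F t) = (Set.Ioo H 0).indicator (fun t => -F t) := by
      funext t
      by_cases ht : t ∈ Set.Ioo H 0
      · rw [Set.indicator_of_mem ht, sgnInd, if_neg, if_pos ⟨ht.1, ht.2⟩, neg_one_mul]
        rintro ⟨h1, h2⟩
        linarith [ht.2]
      · rw [Set.indicator_of_notMem ht, sgnInd, if_neg, if_neg (show ¬(H < t ∧ t < 0) from ht), zero_mul]
        rintro ⟨h1, h2⟩
        linarith
    rw [e1, integral_indicator measurableSet_Ioo, intervalIntegral.integral_of_ge h, integral_neg,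
      integral_Ioc_eq_integral_Ioo]

/-- Tube coordinates along the curve `y`. -/
noncomputable def tubeMap (y : ℝ → ℝ × ℝ) (q : ℝ × ℝ) : ℝ × ℝ := y q.1 + q.2 • vec q.1

/-- The derivative of `tubeMap` at `q`, where `v` is the derivative of the curve. -/
noncomputable def tubeDeriv (v q : ℝ × ℝ) : ℝ × ℝ →L[ℝ] ℝ × ℝ :=
  (Matrix.toLin (.finTwoProd ℝ) (.finTwoProd ℝ)
    !![v.1 - q.2 * Real.sin q.1, Real.cos q.1;
      v.2 + q.2 * Real.cos q.1, Real.sin q.1]).toContinuousLinearMap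

lemma contDiff_vec {n : WithTop ℕ∞} : ContDiff ℝ n vec :=
  Real.contDiff_cos.prodMk Real.contDiff_sin

lemma contDiff_tubeMap {y : ℝ → ℝ × ℝ} {n : WithTop ℕ∞} (hy : ContDiff ℝ n y) :
    ContDiff ℝ n (tubeMap y) :=
  (hy.comp contDiff_fst).add (contDiff_snd.smul (contDiff_vec.comp contDiff_fst))

lemma hasFDerivAt_tubeMap {y : ℝ → ℝ × ℝ} {v q : ℝ × ℝ} (hy : HasDerivAt y v q.1) :
    HasFDerivAt (tubeMap y) (tubeDeriv v q) q := by
  unfold tubeDeriv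
  rw [Matrix.toLin_finTwoProd_toContinuousLinearMap]
  have h1 : HasDerivAt (fun θ => (y θ).1) v.1 q.1 := hy.fst
  have h2 : HasDerivAt (fun θ => (y θ).2) v.2 q.1 := hy.snd
  have hf : HasFDerivAt (fun p : ℝ × ℝ => p.1) (ContinuousLinearMap.fst ℝ ℝ ℝ) q := hasFDerivAt_fst
  have hs : HasFDerivAt (fun p : ℝ × ℝ => p.2) (ContinuousLinearMap.snd ℝ ℝ ℝ) q := hasFDerivAt_snd
  have k1 := (h1.comp_hasFDerivAt q hf).add
    (hs.mul ((Real.hasDerivAt_cos q.1).comp_hasFDerivAt q hf))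
  have k2 := (h2.comp_hasFDerivAt q hf).add
    (hs.mul ((Real.hasDerivAt_sin q.1).comp_hasFDerivAt q hf))
  refine (k1.prodMk k2).congr_fderiv ?_
  ext <;> (simp; try ring)

lemma det_tubeDeriv (R : ℝ) (q : ℝ × ℝ) :
    (tubeDeriv (R * Real.sin q.1, -(R * Real.cos q.1)) q).det = R - q.2 := by
  unfold tubeDeriv
  simp only [LinearMap.det_toContinuousLinearMap, LinearMap.det_toLin, Matrix.det_fin_two_of]
  linear_combination (R - q.2) * Real.sin_sq_add_cos_sq q.1

/-- A perturbation supported between a curve and its perturbation. -/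
structure Tube (γ a c₀ ε₁ : ℝ) (Ht : ℝ → ℝ → ℝ) (y y' : ℝ → ℝ × ℝ) (R : ℝ → ℝ) (df : ℝ × ℝ → ℝ)
    (fp : ℝ → ℝ × ℝ → ℝ) : Prop where
  a_pos : 0 < a
  γ_pos : 0 < γ
  γ_lt : γ < 1
  ε₁_pos : 0 < ε₁
  ε₁_le : ε₁ ≤ 1
  holder : ∀ ε ∈ Set.Ioo 0 ε₁, ∀ c, HolderBdd (fun x => Ht ε (c + √ε * x)) c₀ γ
  smooth_y : ContDiff ℝ 1 y
  deriv_y : ∀ θ, HasDerivAt y (y' θ) θ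
  cont_y' : Continuous y'
  smooth_R : ContDiff ℝ 1 R
  R_pos : ∀ θ, |θ| < a → 0 < R θ
  y'_eq : ∀ θ, |θ| < a → y' θ = (R θ * Real.sin θ, -(R θ * Real.cos θ))
  smooth_df : ContDiff ℝ 1 df
  vanish : ∃ δ > 0, ∀ x, dist x (y a) < δ ∨ dist x (y (-a)) < δ → df x = 0
  tube : ∀ ε ∈ Set.Ioo 0 ε₁, ∀ θ ∈ Set.Icc (-a) a, ∀ t,
    fp ε (tubeMap y (θ, t)) = sgnInd (ε * Ht ε θ) t * df (tubeMap y (θ, t))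
  out : ∀ ε ∈ Set.Ioo 0 ε₁, ∀ x, (∀ θ ∈ Set.Icc (-a) a, ∀ t, x ≠ tubeMap y (θ, t)) → fp ε x = 0

namespace Tube
variable {γ a c₀ ε₁ : ℝ} {Ht : ℝ → ℝ → ℝ} {y y' : ℝ → ℝ × ℝ} {R : ℝ → ℝ} {df : ℝ × ℝ → ℝ}
  {fp : ℝ → ℝ × ℝ → ℝ}

lemma eq_zero_of_df (T : Tube γ a c₀ ε₁ Ht y y' R df fp) {ε : ℝ} (hε : ε ∈ Set.Ioo 0 ε₁) {x : ℝ × ℝ}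
    (hx : df x = 0) : fp ε x = 0 := by
  by_cases h : ∀ θ ∈ Set.Icc (-a) a, ∀ t, x ≠ tubeMap y (θ, t)
  · exact T.out ε hε x h
  · push Not at h
    obtain ⟨θ, hθ, t, rfl⟩ := h
    rw [T.tube ε hε θ hθ, hx, mul_zero]

lemma abs_Ht_le (T : Tube γ a c₀ ε₁ Ht y y' R df fp) {ε : ℝ} (hε : ε ∈ Set.Ioo 0 ε₁) (θ : ℝ) :
    |Ht ε θ| ≤ c₀ := by
  simpa using (T.holder ε hε θ).bound 0

lemma continuous_Ht (T : Tube γ a c₀ ε₁ Ht y y' R df fp) {ε : ℝ} (hε : ε ∈ Set.Ioo 0 ε₁) :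
    Continuous (Ht ε) := by
  have h := (T.holder ε hε 0).continuous T.γ_pos
  have hs : 0 < √ε := Real.sqrt_pos.2 hε.1
  have h2 : Continuous fun θ => Ht ε (0 + √ε * (θ / √ε)) := h.comp (continuous_id.div_const _)
  refine h2.congr fun θ => ?_
  rw [zero_add, mul_div_cancel₀ _ hs.ne']

/-- The support of the perturbation is contained in a tube of width `O(ε)`. -/
lemma exists_of_ne_zero (T : Tube γ a c₀ ε₁ Ht y y' R df fp) {ε : ℝ} (hε : ε ∈ Set.Ioo 0 ε₁) {x : ℝ × ℝ}
    (hx : fp ε x ≠ 0) : ∃ θ ∈ Set.Icc (-a) a, dist x (y θ) ≤ c₀ * ε := by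
  by_cases h : ∀ θ ∈ Set.Icc (-a) a, ∀ t, x ≠ tubeMap y (θ, t)
  · exact absurd (T.out ε hε x h) hx
  · push Not at h
    obtain ⟨θ, hθ, t, rfl⟩ := h
    refine ⟨θ, hθ, ?_⟩
    rw [T.tube ε hε θ hθ] at hx
    have h1 := left_ne_zero_of_mul hx
    have h2 : |t| ≤ |ε * Ht ε θ| := by
      unfold sgnInd at h1
      split_ifs at h1 with h3 h4
      · rw [abs_of_pos h3.1]; exact h3.2.le.trans (le_abs_self _)
      · rw [abs_of_neg h4.2]; exact (neg_le_neg h4.1.le).trans (neg_le_abs _)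
      · exact absurd rfl h1
    rw [abs_mul, abs_of_pos hε.1] at h2
    have h3 := mul_le_mul_of_nonneg_left (T.abs_Ht_le hε θ) hε.1.le
    have h4 : ‖vec θ‖ ≤ 1 := max_le (Real.abs_cos_le_one θ) (Real.abs_sin_le_one θ)
    rw [dist_eq_norm, tubeMap, add_sub_cancel_left, norm_smul, Real.norm_eq_abs]
    calc |t| * ‖vec θ‖ ≤ |t| * 1 := by gcongr
      _ ≤ c₀ * ε := by linarith

/-- The amplitude, in tube coordinates, of the part of the perturbation cut off by `φ`. -/
noncomputable def _root_.tubeAmp (y : ℝ → ℝ × ℝ) (R : ℝ → ℝ) (df φ : ℝ × ℝ → ℝ) (V : Set (ℝ × ℝ))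
    (q : ℝ × ℝ) : ℝ :=
  V.indicator (fun q => φ (tubeMap y q) * df (tubeMap y q) * (R q.1 - q.2)) q

lemma integrable_sgnInd_mul (T : Tube γ a c₀ ε₁ Ht y y' R df fp) {ε : ℝ} (hε : ε ∈ Set.Ioo 0 ε₁)
    {F : ℝ × ℝ → ℝ} (hF : Continuous F) (hFc : HasCompactSupport F) :
    Integrable fun q => sgnInd (ε * Ht ε q.1) q.2 * F q := by
  refine (hF.integrable_of_hasCompactSupport hFc).bdd_mul (c := 1) ?_
    (ae_of_all _ fun q => abs_sgnInd_le _ _)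
  have hc := T.continuous_Ht hε
  exact (measurable_sgnInd.comp (Measurable.prodMk
    (f := fun q : ℝ × ℝ => ε * Ht ε q.1) (g := fun q : ℝ × ℝ => q.2)
    ((continuous_const.mul (hc.comp continuous_fst)).measurable) measurable_snd)).aestronglyMeasurable

/-- Integration of the perturbation in tube coordinates. -/
theorem integrable_and_integral_eq (T : Tube γ a c₀ ε₁ Ht y y' R df fp) {θ₁ r : ℝ}
    (hr : |θ₁| + r ≤ a) (hR : ∀ θ, |θ - θ₁| < r → r ≤ R θ)
    (hinj : Set.InjOn (tubeMap y) (Metric.ball (θ₁, 0) r)) {φ : ℝ × ℝ → ℝ}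
    (hφ : ∀ z ∉ tubeMap y '' Metric.ball (θ₁, 0) r, φ z = 0)
    (hG : Continuous (tubeAmp y R df φ (Metric.ball (θ₁, 0) r))) {ε : ℝ} (hε : ε ∈ Set.Ioo 0 ε₁)
    {Ξ : ℝ × ℝ → ℝ} (hΞ : Continuous Ξ) :
    Integrable (fun z => Ξ z * (φ z * fp ε z)) ∧ ∫ z, Ξ z * (φ z * fp ε z) =
      ∫ q, sgnInd (ε * Ht ε q.1) q.2 *
        (tubeAmp y R df φ (Metric.ball (θ₁, 0) r) q * Ξ (tubeMap y q)) := by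
  set V : Set (ℝ × ℝ) := Metric.ball (θ₁, 0) r with hV
  have hVm : MeasurableSet V := measurableSet_ball
  have hmem : ∀ q ∈ V, |q.1 - θ₁| < r ∧ |q.2| < r := fun q hq => by
    have := Metric.mem_ball.1 hq
    rw [Prod.dist_eq, max_lt_iff, Real.dist_eq, Real.dist_eq, sub_zero] at this
    exact this
  have hda : ∀ q ∈ V, |q.1| < a := fun q hq => by
    have h1 := (hmem q hq).1
    have h2 := abs_add_le (q.1 - θ₁) θ₁
    rw [sub_add_cancel] at h2
    linarith
  have hd : ∀ q ∈ V, HasFDerivWithinAt (tubeMap y) (tubeDeriv (y' q.1) q) V q := fun q _ =>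
    (hasFDerivAt_tubeMap (T.deriv_y q.1)).hasFDerivWithinAt
  set E : ℝ × ℝ → ℝ := fun q => sgnInd (ε * Ht ε q.1) q.2 * (tubeAmp y R df φ V q * Ξ (tubeMap y q))
    with hE
  have hEq : ∀ q ∈ V, |(tubeDeriv (y' q.1) q).det| •
      (Ξ (tubeMap y q) * (φ (tubeMap y q) * fp ε (tubeMap y q))) = E q := fun q hq => by
    have h1 := hmem q hq
    have h2 := abs_lt.1 (hda q hq)
    rw [T.y'_eq _ (hda q hq), det_tubeDeriv, smul_eq_mul]
    simp only [hE, tubeAmp, Set.indicator_of_mem hq]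
    have h3 := T.tube ε hε q.1 ⟨h2.1.le, h2.2.le⟩ q.2
    rw [Prod.mk.eta] at h3
    rw [h3, abs_of_pos (by linarith [hR q.1 h1.1, (abs_lt.1 h1.2).2])]
    ring
  have hE0 : ∀ q ∉ V, E q = 0 := fun q hq => by
    simp only [hE, tubeAmp, Set.indicator_of_notMem hq, zero_mul, mul_zero]
  have hΨ0 : ∀ z ∉ tubeMap y '' V, Ξ z * (φ z * fp ε z) = 0 := fun z hz => by
    rw [hφ z hz, zero_mul, mul_zero]
  have hcs : HasCompactSupport fun q => tubeAmp y R df φ V q * Ξ (tubeMap y q) := by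
    refine HasCompactSupport.intro (isCompact_closedBall (θ₁, (0:ℝ)) r) fun q hq => ?_
    rw [tubeAmp, Set.indicator_of_notMem fun h => hq (Metric.ball_subset_closedBall h), zero_mul]
  have hEi : Integrable E := T.integrable_sgnInd_mul hε
    (hG.mul (hΞ.comp (contDiff_tubeMap T.smooth_y).continuous)) hcs
  have hUm : MeasurableSet (tubeMap y '' V) :=
    measurable_image_of_fderivWithin hVm hd hinj
  constructor
  · have h1 : IntegrableOn (fun z => Ξ z * (φ z * fp ε z)) (tubeMap y '' V) := by
      rw [integrableOn_image_iff_integrableOn_abs_det_fderiv_smul volume hVm hd hinj]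
      exact hEi.integrableOn.congr_fun (fun q hq => (hEq q hq).symm) hVm
    refine (integrableOn_iff_integrable_of_support_subset fun z hz => ?_).1 h1
    by_contra h
    exact hz (hΨ0 z h)
  · rw [← setIntegral_eq_integral_of_forall_compl_eq_zero hΨ0,
      integral_image_eq_integral_abs_det_fderiv_smul volume hVm hd hinj,
      setIntegral_congr_fun hVm hEq, setIntegral_eq_integral_of_forall_compl_eq_zero hE0]

end Tube

namespace Tube
variable {γ a c₀ ε₁ : ℝ} {Ht : ℝ → ℝ → ℝ} {y y' : ℝ → ℝ × ℝ} {R : ℝ → ℝ} {df : ℝ × ℝ → ℝ}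
  {fp : ℝ → ℝ × ℝ → ℝ}

/-- Integration across the tube, with the transversal variable rescaled to `[0, 1]`. -/
lemma integral_sgnInd_mul (T : Tube γ a c₀ ε₁ Ht y y' R df fp) {ε : ℝ} (hε : ε ∈ Set.Ioo 0 ε₁)
    {F : ℝ × ℝ → ℝ} (hF : Continuous F) (hFc : HasCompactSupport F) :
    ε⁻¹ * ∫ q, sgnInd (ε * Ht ε q.1) q.2 * F q =
      ∫ σ in (0:ℝ)..1, ∫ θ, Ht ε θ * F (θ, ε * (σ * Ht ε θ)) := by
  have hε0 := hε.1
  have hHc := T.continuous_Ht hε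
  have e1 : ∫ q, sgnInd (ε * Ht ε q.1) q.2 * F q =
      ∫ θ, ε * ∫ σ in (0:ℝ)..1, Ht ε θ * F (θ, ε * (σ * Ht ε θ)) := by
    rw [Measure.volume_eq_prod, integral_prod _ (by
      have := T.integrable_sgnInd_mul hε hF hFc
      rwa [Measure.volume_eq_prod] at this)]
    refine integral_congr_ae (ae_of_all _ fun θ => ?_)
    simp only
    rw [_root_.integral_sgnInd_mul (ε * Ht ε θ) fun t => F (θ, t), intervalIntegral.integral_const_mul,
      mul_assoc]
    congr 3
    funext σ
    rw [mul_left_comm]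
  rw [e1, integral_const_mul, ← mul_assoc, inv_mul_cancel₀ hε0.ne', one_mul]
  simp only [intervalIntegral.integral_of_le (zero_le_one (α := ℝ))]
  refine integral_integral_swap ?_
  set N : ℝ × ℝ → ℝ := fun p => Ht ε p.1 * F (p.1, ε * (p.2 * Ht ε p.1)) with hN
  change Integrable N _
  have hNc : Continuous N := by
    have h1 : Continuous fun p : ℝ × ℝ => Ht ε p.1 := hHc.comp continuous_fst
    exact h1.mul (hF.comp (continuous_fst.prodMk (continuous_const.mul (continuous_snd.mul h1))))
  obtain ⟨B, hB⟩ := hFc.isCompact.isBounded.exists_norm_le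
  have hi : IntegrableOn N (Set.Icc (-B) B ×ˢ Set.Icc 0 1) :=
    hNc.continuousOn.integrableOn_compact (isCompact_Icc.prod isCompact_Icc)
  have hi2 := (integrable_indicator_iff (measurableSet_Icc.prod measurableSet_Icc)).2 hi
  have hi3 : IntegrableOn N (Set.univ ×ˢ Set.Ioc (0:ℝ) 1) := by
    refine hi2.integrableOn.congr_fun (fun p hp => ?_) (MeasurableSet.univ.prod measurableSet_Ioc)
    by_cases hp1 : p.1 ∈ Set.Icc (-B) B
    · exact Set.indicator_of_mem (show p ∈ Set.Icc (-B) B ×ˢ Set.Icc 0 1 from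
        ⟨hp1, Set.Ioc_subset_Icc_self hp.2⟩) _
    · rw [Set.indicator_of_notMem fun h => hp1 h.1]
      have : F (p.1, ε * (p.2 * Ht ε p.1)) = 0 := by
        by_contra h
        have h2 := hB _ (subset_tsupport F h)
        exact hp1 (abs_le.1 ((norm_fst_le (p.1, ε * (p.2 * Ht ε p.1))).trans h2))
      simp only [hN, this, mul_zero]
  rwa [IntegrableOn, Measure.volume_eq_prod, ← Measure.prod_restrict, Measure.restrict_univ] at hi3

/-- The backprojected data of the part of the perturbation cut off by `φ`, as a sum of integrals
over the arc. -/
theorem viewSum_eq (T : Tube γ a c₀ ε₁ Ht y y' R df fp) {ik k w : ℝ → ℝ} {L ρ : ℝ}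
    (K : Kernels ik k w L ρ) {θ₁ r : ℝ}
    (hr : |θ₁| + r ≤ a) (hR : ∀ θ, |θ - θ₁| < r → r ≤ R θ)
    (hinj : Set.InjOn (tubeMap y) (Metric.ball (θ₁, 0) r)) {φ : ℝ × ℝ → ℝ}
    (hφ : ∀ z ∉ tubeMap y '' Metric.ball (θ₁, 0) r, φ z = 0)
    (hG : Continuous (tubeAmp y R df φ (Metric.ball (θ₁, 0) r))) {ε : ℝ} (hε : ε ∈ Set.Ioo 0 ε₁)
    (κ : ℝ) (x₀ xc : ℝ × ℝ) :
    viewSum κ k w ε (x₀ + ε • xc) (fun z => φ z * fp ε z) =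
      ∑ n ∈ views κ ε, ∫ σ in (0:ℝ)..1, arcInt y x₀ xc Ht (tubeAmp y R df φ (Metric.ball (θ₁, 0) r))
        (latKer k w (dot2 (vec (n * (κ * ε))) (x₀ + ε • xc) / ε)) ε σ (n * (κ * ε)) := by
  obtain ⟨C, -, hC⟩ := K.exists_decKer
  have hε0 := hε.1.ne'
  refine Finset.sum_congr rfl fun n _ => ?_
  set α : ℝ := n * (κ * ε)
  set u := dot2 (vec α) (x₀ + ε • xc) / ε
  have hΞ : Continuous fun z => latKer k w u (dot2 (vec α) (z - (x₀ + ε • xc)) / ε) := by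
    refine (hC u).continuous.comp ?_
    simp only [dot2, Prod.fst_sub, Prod.snd_sub]
    fun_prop
  have hcs : HasCompactSupport fun q => tubeAmp y R df φ (Metric.ball (θ₁, 0) r) q *
      latKer k w u (dot2 (vec α) (tubeMap y q - (x₀ + ε • xc)) / ε) := by
    refine HasCompactSupport.intro (isCompact_closedBall (θ₁, (0:ℝ)) r) fun q hq => ?_
    rw [tubeAmp, Set.indicator_of_notMem fun h => hq (Metric.ball_subset_closedBall h), zero_mul]
  have hFc : Continuous fun q => tubeAmp y R df φ (Metric.ball (θ₁, 0) r) q *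
      latKer k w u (dot2 (vec α) (tubeMap y q - (x₀ + ε • xc)) / ε) :=
    hG.mul (hΞ.comp (contDiff_tubeMap T.smooth_y).continuous)
  rw [(T.integrable_and_integral_eq hr hR hinj hφ hG hε hΞ).2,
    T.integral_sgnInd_mul hε hFc hcs]
  refine intervalIntegral.integral_congr fun σ _ => integral_congr_ae (ae_of_all _ fun θ => ?_)
  simp only [amp, shf]
  rw [mul_assoc]
  congr 3
  rw [tubeMap, dot2_sub_right, dot2_add_right, dot2_add_right, dot2_smul_right, dot2_smul_right,
    dot2_vec_vec, dot2_sub_right]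
  field_simp
  ring

end Tube

namespace Tube
variable {γ a c₀ ε₁ : ℝ} {Ht : ℝ → ℝ → ℝ} {y y' : ℝ → ℝ × ℝ} {R : ℝ → ℝ} {df : ℝ × ℝ → ℝ}
  {fp : ℝ → ℝ × ℝ → ℝ}

lemma exists_arcRadius (T : Tube γ a c₀ ε₁ Ht y y' R df fp) {θ₁ : ℝ} (hθ : |θ₁| < a) :
    ∃ r₀ > 0, ∃ R₁ R₂ Λ, ∀ r, 0 < r → r ≤ r₀ → ArcRadius R θ₁ r R₁ R₂ Λ ∧ r ≤ R₁ ∧ |θ₁| + 4 * r < a := by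
  have hRc : ContinuousAt R θ₁ := T.smooth_R.continuous.continuousAt
  have hR0 := T.R_pos θ₁ hθ
  obtain ⟨Λ, s, hs, hlip⟩ := T.smooth_R.contDiffAt.exists_lipschitzOnWith (x := θ₁)
  have h1 : ∀ᶠ θ in 𝓝 θ₁, R θ₁ / 2 < R θ := hRc.eventually_const_lt (half_lt_self hR0)
  have h2 : ∀ᶠ θ in 𝓝 θ₁, R θ < R θ₁ + 1 := hRc.eventually_lt_const (lt_add_one _)
  obtain ⟨d, hd, hball⟩ := Metric.eventually_nhds_iff.1 (h1.and (h2.and hs))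
  have hm : 0 < min (min (d / 5) (1 / 10)) (min (R θ₁ / 2) ((a - |θ₁|) / 5)) :=
    lt_min (lt_min (by positivity) (by norm_num)) (lt_min (by positivity) (by linarith))
  refine ⟨_, hm, R θ₁ / 2, R θ₁ + 1, Λ, fun r hr hr0 => ?_⟩
  simp only [le_min_iff] at hr0
  obtain ⟨⟨hrd, hr10⟩, hrR, hra⟩ := hr0
  have hmem : ∀ θ, |θ - θ₁| ≤ 4 * r → dist θ θ₁ < d := fun θ h => by
    rw [Real.dist_eq]; linarith
  refine ⟨⟨hr, hr10, half_pos hR0, Λ.2, fun θ h => (hball (hmem θ h)).1.le,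
    fun θ h => (hball (hmem θ h)).2.1.le, fun θ θ' h h' => ?_⟩, hrR, by linarith⟩
  exact hlip.dist_le_mul _ (hball (hmem θ h)).2.2 _ (hball (hmem θ' h')).2.2

lemma exists_injOn (T : Tube γ a c₀ ε₁ Ht y y' R df fp) {θ₁ : ℝ} (hθ : |θ₁| < a) :
    ∃ r₀ > 0, ∀ r ≤ r₀, Set.InjOn (tubeMap y) (Metric.closedBall (θ₁, 0) r) ∧
      IsOpen (tubeMap y '' Metric.ball (θ₁, 0) r) := by
  have hdet : (tubeDeriv (y' θ₁) (θ₁, 0)).det ≠ 0 := by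
    rw [T.y'_eq _ hθ, det_tubeDeriv (R θ₁) (θ₁, 0), sub_zero]
    exact (T.R_pos _ hθ).ne'
  have hd : HasFDerivAt (tubeMap y) ((tubeDeriv (y' θ₁) (θ₁, 0)).toContinuousLinearEquivOfDetNeZero hdet :
      ℝ × ℝ →L[ℝ] ℝ × ℝ) (θ₁, 0) := by
    rw [ContinuousLinearMap.coe_toContinuousLinearEquivOfDetNeZero]
    exact hasFDerivAt_tubeMap (T.deriv_y θ₁)
  have hc : ContDiffAt ℝ 1 (tubeMap y) (θ₁, 0) := (contDiff_tubeMap T.smooth_y).contDiffAt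
  set e := hc.toOpenPartialHomeomorph (tubeMap y) hd one_ne_zero with he
  have hcoe : (e : ℝ × ℝ → ℝ × ℝ) = tubeMap y := hc.toOpenPartialHomeomorph_coe hd one_ne_zero
  have hmem : (θ₁, 0) ∈ e.source := hc.mem_toOpenPartialHomeomorph_source hd one_ne_zero
  obtain ⟨d, hd0, hsub⟩ := Metric.nhds_basis_closedBall.mem_iff.1 (e.open_source.mem_nhds hmem)
  refine ⟨d, hd0, fun r hr => ?_⟩
  have hs : Metric.closedBall (θ₁, 0) r ⊆ e.source := (Metric.closedBall_subset_closedBall hr).trans hsub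
  rw [← hcoe]
  exact ⟨e.injOn.mono hs, e.isOpen_image_of_subset_source Metric.isOpen_ball
    (Metric.ball_subset_closedBall.trans hs)⟩

lemma contDiff_tubeAmp (T : Tube γ a c₀ ε₁ Ht y y' R df fp) {θ₁ r : ℝ}
    (hinj : Set.InjOn (tubeMap y) (Metric.closedBall (θ₁, 0) r)) {φ : ℝ × ℝ → ℝ} (hφ : ContDiff ℝ 1 φ)
    (hsub : tsupport φ ⊆ tubeMap y '' Metric.ball (θ₁, 0) r) :
    ContDiff ℝ 1 (tubeAmp y R df φ (Metric.ball (θ₁, 0) r)) := by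
  have hΦ := contDiff_tubeMap T.smooth_y
  have hs : ContDiff ℝ 1 fun q : ℝ × ℝ => φ (tubeMap y q) * df (tubeMap y q) * (R q.1 - q.2) :=
    ((hφ.comp hΦ).mul (T.smooth_df.comp hΦ)).mul ((T.smooth_R.comp contDiff_fst).sub contDiff_snd)
  have hcl : IsClosed (Metric.closedBall (θ₁, (0:ℝ)) r ∩ tubeMap y ⁻¹' tsupport φ) :=
    Metric.isClosed_closedBall.inter ((isClosed_tsupport φ).preimage hΦ.continuous)
  rw [contDiff_iff_contDiffAt]
  intro q
  by_cases hq : q ∈ Metric.ball (θ₁, (0:ℝ)) r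
  · refine hs.contDiffAt.congr_of_eventuallyEq ?_
    filter_upwards [Metric.isOpen_ball.mem_nhds hq] with p hp
    rw [tubeAmp, Set.indicator_of_mem hp]
  · refine (contDiffAt_const (c := (0:ℝ))).congr_of_eventuallyEq ?_
    have hq' : q ∉ Metric.closedBall (θ₁, (0:ℝ)) r ∩ tubeMap y ⁻¹' tsupport φ := fun h => by
      obtain ⟨p, hp, hpq⟩ := hsub h.2
      exact hq (hinj (Metric.ball_subset_closedBall hp) h.1 hpq ▸ hp)
    filter_upwards [hcl.isOpen_compl.mem_nhds hq'] with p hp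
    rw [tubeAmp]
    by_cases hpb : p ∈ Metric.ball (θ₁, (0:ℝ)) r
    · rw [Set.indicator_of_mem hpb, image_eq_zero_of_notMem_tsupport (f := φ)
        fun h => hp ⟨Metric.ball_subset_closedBall hpb, h⟩, zero_mul, zero_mul]
    · rw [Set.indicator_of_notMem hpb]

lemma exists_arcData (T : Tube γ a c₀ ε₁ Ht y y' R df fp) {θ₁ r R₁ R₂ Λ : ℝ}
    (hrad : ArcRadius R θ₁ r R₁ R₂ Λ) (hra : |θ₁| + 4 * r < a)
    (hinj : Set.InjOn (tubeMap y) (Metric.closedBall (θ₁, 0) r)) {φ : ℝ × ℝ → ℝ} (hφ : ContDiff ℝ 1 φ)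
    (hsub : tsupport φ ⊆ tubeMap y '' Metric.ball (θ₁, 0) r) :
    ∃ M Lg, ArcData γ y y' R θ₁ r R₁ R₂ Λ Ht (tubeAmp y R df φ (Metric.ball (θ₁, 0) r)) c₀ ε₁ M Lg := by
  have hG := T.contDiff_tubeAmp hinj hφ hsub
  have hcs : HasCompactSupport (tubeAmp y R df φ (Metric.ball (θ₁, 0) r)) := by
    refine HasCompactSupport.intro (isCompact_closedBall (θ₁, (0:ℝ)) r) fun q hq => ?_
    rw [tubeAmp, Set.indicator_of_notMem fun h => hq (Metric.ball_subset_closedBall h)]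
  obtain ⟨M, hM⟩ := hcs.exists_bound_of_continuous hG.continuous
  obtain ⟨C, hC⟩ := hG.lipschitzWith_of_hasCompactSupport hcs one_ne_zero
  refine ⟨M, C, ⟨hrad, T.γ_pos, T.γ_lt, T.ε₁_pos, T.ε₁_le, T.holder, T.deriv_y, T.cont_y', fun θ hθ => ?_,
    C.2, hM, fun q q' => ?_, fun θ t h => ?_⟩⟩
  · refine T.y'_eq θ ?_
    have h2 := abs_add_le (θ - θ₁) θ₁
    rw [sub_add_cancel] at h2
    linarith
  · have := hC.dist_le_mul q q'
    rw [Real.dist_eq] at this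
    refine this.trans ?_
    gcongr
    rw [Prod.dist_eq, Real.dist_eq, Real.dist_eq]
    exact max_le_add_of_nonneg (abs_nonneg _) (abs_nonneg _)
  · rw [tubeAmp, Set.indicator_of_notMem]
    intro hm
    have := Metric.mem_ball.1 hm
    rw [Prod.dist_eq, max_lt_iff, Real.dist_eq] at this
    exact not_le.2 this.1 h

/-- Tangents to the curve near a point other than `x₀` stay away from `x₀`, except possibly at a
single angle, where they move away linearly. -/
lemma exists_abs_dot2_ge (T : Tube γ a c₀ ε₁ Ht y y' R df fp) {θ₁ : ℝ} (hθ : |θ₁| < a) {x₀ : ℝ × ℝ}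
    (hx : x₀ ≠ y θ₁) :
    ∃ r₀ > 0, ∃ c > 0, ∀ α, |α - θ₁| ≤ r₀ → c * |α - θ₁| ≤ |dot2 (vec α) (y α - x₀)| := by
  set β : ℝ → ℝ := fun α => dot2 (vec α) (y α - x₀) with hβ
  set b : ℝ := dot2 (-Real.sin θ₁, Real.cos θ₁) (y θ₁ - x₀) with hb
  have hd : HasDerivAt β b θ₁ := by
    have h1 : HasDerivAt (fun θ => (y θ).1) (y' θ₁).1 θ₁ := (T.deriv_y θ₁).fst
    have h2 : HasDerivAt (fun θ => (y θ).2) (y' θ₁).2 θ₁ := (T.deriv_y θ₁).snd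
    refine (((Real.hasDerivAt_cos θ₁).mul (h1.sub_const x₀.1)).add
      ((Real.hasDerivAt_sin θ₁).mul (h2.sub_const x₀.2))).congr_deriv ?_
    rw [T.y'_eq _ hθ, hb]
    simp only [dot2, Prod.fst_sub, Prod.snd_sub]
    ring
  by_cases h0 : β θ₁ = 0
  · have hb0 : b ≠ 0 := fun hb0 => by
      have e1 : Real.cos θ₁ * ((y θ₁).1 - x₀.1) + Real.sin θ₁ * ((y θ₁).2 - x₀.2) = 0 := h0
      have e2 : -Real.sin θ₁ * ((y θ₁).1 - x₀.1) + Real.cos θ₁ * ((y θ₁).2 - x₀.2) = 0 := hb0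
      have e3 := Real.sin_sq_add_cos_sq θ₁
      refine hx (Prod.ext ?_ ?_)
      · linear_combination -Real.cos θ₁ * e1 + Real.sin θ₁ * e2 + ((y θ₁).1 - x₀.1) * e3
      · linear_combination -Real.sin θ₁ * e1 - Real.cos θ₁ * e2 + ((y θ₁).2 - x₀.2) * e3
    have hb1 : 0 < |b| / 2 := by positivity
    obtain ⟨d, hd0, hball⟩ := Metric.eventually_nhds_iff.1 (hd.isLittleO.def hb1)
    refine ⟨d / 2, by positivity, |b| / 2, hb1, fun α hα => ?_⟩
    have h1 := hball (y := α) (by rw [Real.dist_eq]; linarith)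
    rw [h0, sub_zero, Real.norm_eq_abs, Real.norm_eq_abs, smul_eq_mul] at h1
    have h2 := abs_sub_abs_le_abs_sub ((α - θ₁) * b) (β α)
    rw [abs_sub_comm, abs_mul] at h2
    change _ ≤ |β α|
    linarith
  · have hb1 : 0 < |β θ₁| / 2 := by positivity
    have h1 : ∀ᶠ α in 𝓝 θ₁, |β θ₁| / 2 < |β α| :=
      hd.continuousAt.abs.eventually_const_lt (half_lt_self (by positivity))
    obtain ⟨d, hd0, hball⟩ := Metric.eventually_nhds_iff.1 h1
    refine ⟨min (d / 2) 1, by positivity, |β θ₁| / 2, hb1, fun α hα => ?_⟩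
    rw [le_min_iff] at hα
    have h2 := hball (y := α) (by rw [Real.dist_eq]; linarith [hα.1])
    exact (mul_le_of_le_one_right hb1.le hα.2).trans h2.le

end Tube

/-- Riemann sums of an integrable power are bounded uniformly in the step size. -/
lemma exists_mul_sum_rpow_le {c γ : ℝ} (hc : 0 < c) (hγ : 0 < γ) :
    ∃ D, 0 ≤ D ∧ ∀ δ, 0 < δ → δ ≤ 1 → ∀ F : Finset ℤ,
      δ * ∑ n ∈ F, (1 + c * (n * δ) ^ 2) ^ (-((1 + γ) / 2)) ≤ D := by
  set q := (1 + γ) / 2 with hq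
  have hq0 : 0 ≤ q := by positivity
  have hi := (integrable_one_add_mul_sq_rpow hc hγ).const_mul ((2 + 2 * c * 1 ^ 2) ^ q)
  have hpos : ∀ t : ℝ, 0 ≤ (2 + 2 * c * 1 ^ 2) ^ q * (1 + c * t ^ 2) ^ (-q) := fun t => by positivity
  refine ⟨∫ t : ℝ, (2 + 2 * c * 1 ^ 2) ^ q * (1 + c * t ^ 2) ^ (-q), integral_nonneg hpos, fun δ hδ hδ1 F => ?_⟩
  set a : ℤ → ℝ := fun n => if n ∈ F then (1 + c * (n * δ) ^ 2) ^ (-q) else 0 with ha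
  have h := integral_comp_floor (F := F) (a := a) (fun n hn => if_neg hn) hδ 0
  have e : ∑ n ∈ F, a n = ∑ n ∈ F, (1 + c * (n * δ) ^ 2) ^ (-q) :=
    Finset.sum_congr rfl fun n hn => if_pos hn
  rw [← e, ← h.2]
  refine integral_mono h.1 hi fun t => ?_
  simp only [ha, add_zero]
  split_ifs with hF
  · refine rpow_neg_le_of_near hc hq0 hδ hδ1 ?_
    rw [abs_of_nonneg (sub_nonneg.2 (Int.floor_le _))]
    linarith [Int.lt_floor_add_one (t / δ)]
  · exact hpos t

namespace ArcData
variable {γ : ℝ} {y y' : ℝ → ℝ × ℝ} {R : ℝ → ℝ} {θ₁ r R₁ R₂ Λ : ℝ} {Ht : ℝ → ℝ → ℝ}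
  {g : ℝ × ℝ → ℝ} {c₀ ε₁ M Lg : ℝ}

lemma continuous_arcInt (h : ArcData γ y y' R θ₁ r R₁ R₂ Λ Ht g c₀ ε₁ M Lg) (x₀ xc : ℝ × ℝ) {Cp : ℝ}
    {p : ℝ → ℝ} (hp : DecKer p Cp) {ε : ℝ} (hε : ε ∈ Set.Ioo 0 ε₁) (α : ℝ) :
    Continuous fun σ => arcInt y x₀ xc Ht g p ε σ α := by
  have hH : Continuous (Ht ε) := by
    have h1 := (h.holder ε hε 0).continuous h.γ_pos
    have hs : 0 < √ε := Real.sqrt_pos.2 hε.1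
    have h2 : Continuous fun θ => Ht ε (0 + √ε * (θ / √ε)) := h1.comp (continuous_id.div_const _)
    refine h2.congr fun θ => ?_
    rw [zero_add, mul_div_cancel₀ _ hs.ne']
  have hg : Continuous g := by
    have : LipschitzWith (Real.toNNReal (2 * Lg)) g := LipschitzWith.of_dist_le_mul fun q q' => by
      have hL := h.Lg_nonneg
      rw [Real.dist_eq, Real.coe_toNNReal _ (by positivity)]
      refine (h.g_lip q q').trans ?_
      have h1 : |q.1 - q'.1| ≤ dist q q' := by
        rw [Prod.dist_eq, Real.dist_eq]; exact le_max_left _ _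
      have h2 : |q.2 - q'.2| ≤ dist q q' := by
        rw [Prod.dist_eq, Real.dist_eq, Real.dist_eq]; exact le_max_right _ _
      nlinarith
    exact this.continuous
  have hy : Continuous y := continuous_iff_continuousAt.2 fun θ => (h.deriv_y θ).continuousAt
  have hpc := hp.continuous
  set f : ℝ → ℝ → ℝ := fun σ θ =>
    amp Ht g ε σ θ * p (dot2 (vec α) (y θ - x₀) / ε + shf Ht xc ε σ α θ) with hf
  have hfc : Continuous (Function.uncurry f) := by
    simp only [hf, amp, shf, dot2, Function.uncurry_def, Prod.fst_sub, Prod.snd_sub]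
    fun_prop
  have e : (fun σ => arcInt y x₀ xc Ht g p ε σ α) = fun σ => ∫ θ in Set.Icc (θ₁ - r) (θ₁ + r), f σ θ := by
    funext σ
    refine (setIntegral_eq_integral_of_forall_compl_eq_zero fun θ hθ => ?_).symm
    rw [amp, h.g_zero, mul_zero, zero_mul]
    by_contra hlt
    push Not at hlt
    have := abs_lt.1 hlt
    exact hθ ⟨by linarith, by linarith⟩
  rw [e]
  exact continuous_parametric_integral_of_continuous hfc isCompact_Icc

/-- Uniform bound for the sum over all views of the contributions of the arc through `y 0`. -/
lemma exists_abs_sum_arcInt_zero_le (h : ArcData γ y y' R 0 r R₁ R₂ Λ Ht g c₀ ε₁ M Lg)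
    (xc : ℝ × ℝ) (Cp : ℝ) {κ : ℝ} (hκ : 0 < κ) :
    ∃ B, ∀ᶠ ε in 𝓝[>] (0:ℝ), ∀ σ ∈ Set.Icc (0:ℝ) 1, ∀ p : ℤ → ℝ → ℝ, (∀ n, DecKer (p n) Cp) →
      |κ * ∑ n ∈ views κ ε, arcInt y (y 0) xc Ht g (p n) ε σ (n * (κ * ε))| ≤ B := by
  obtain ⟨C, c, hC, hc, hbd⟩ := h.exists_abs_arcInt_zero_le xc Cp
  obtain ⟨D, hD, hs⟩ := exists_mul_sum_rpow_le hc h.γ_pos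
  refine ⟨C * D, ?_⟩
  have hδlim : Tendsto (fun ε => κ * √ε) (𝓝[>] 0) (𝓝 0) := by
    simpa using tendsto_sqrt_nhdsGT.const_mul κ
  filter_upwards [h.eventually_mem, hδlim.eventually (gt_mem_nhds one_pos)] with ε hε hδ σ hσ p hp
  have hε0 := hε.1
  have hsε := Real.sqrt_pos.2 hε0
  rw [abs_mul, abs_of_pos hκ]
  calc κ * |∑ n ∈ views κ ε, arcInt y (y 0) xc Ht g (p n) ε σ (n * (κ * ε))|
      ≤ κ * ∑ n ∈ views κ ε, √ε * (C * (1 + c * (n * (κ * √ε)) ^ 2) ^ (-((1 + γ) / 2))) := by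
        gcongr
        refine (Finset.abs_sum_le_sum_abs _ _).trans (Finset.sum_le_sum fun n hn => ?_)
        have h1 := hbd ε hε σ hσ _ (hp n) _ ((mem_views (mul_pos hκ hε0) n).1 hn)
        have e : ((n:ℝ) * (κ * ε)) ^ 2 / ε = (n * (κ * √ε)) ^ 2 := by
          rw [mul_pow, mul_pow, mul_pow, mul_pow, Real.sq_sqrt hε0.le]
          field_simp
        rwa [e] at h1
    _ = C * (κ * √ε * ∑ n ∈ views κ ε, (1 + c * (n * (κ * √ε)) ^ 2) ^ (-((1 + γ) / 2))) := by
        simp only [Finset.mul_sum]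
        exact Finset.sum_congr rfl fun n _ => by ring
    _ ≤ C * D := by
        gcongr
        exact hs _ (by positivity) hδ.le _

/-- The contributions of the arc through `y 0`, integrated over the tube. -/
theorem tendsto_sum_integral_arcInt (h : ArcData γ y y' R 0 r R₁ R₂ Λ Ht g c₀ ε₁ M Lg)
    {ik k w : ℝ → ℝ} {L ρ : ℝ} (K : Kernels ik k w L ρ) (xc : ℝ × ℝ) {κ : ℝ} (hκ : 0 < κ)
    (hlam : Irrational (κ * (y 0).2)) :
    Tendsto (fun ε => κ * (∑ n ∈ views κ ε, ∫ σ in (0:ℝ)..1, arcInt y (y 0) xc Ht g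
        (latKer k w (dot2 (vec (n * (κ * ε))) (y 0 + ε • xc) / ε)) ε σ (n * (κ * ε))) +
      2 * Real.pi / R 0 * g (0, 0) * ∫ σ in (0:ℝ)..1, Ht ε 0 * conv1 ik w (σ * Ht ε 0 - xc.1))
      (𝓝[>] 0) (𝓝 0) := by
  obtain ⟨Cp, hCp, hp⟩ := K.exists_decKer
  obtain ⟨B, hB⟩ := h.exists_abs_sum_arcInt_zero_le xc Cp hκ
  obtain ⟨LF, hF, -⟩ := K.conv1_ik_lipSupp
  obtain ⟨CF, hCF⟩ : ∃ CF, ∀ x, |conv1 ik w x| ≤ CF := ⟨_, hF.bound⟩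
  have hFc := hF.continuous
  set a : ℝ → ℝ → ℝ := fun ε σ => κ * ∑ n ∈ views κ ε, arcInt y (y 0) xc Ht g
    (latKer k w (dot2 (vec (n * (κ * ε))) (y 0 + ε • xc) / ε)) ε σ (n * (κ * ε)) with ha
  set b : ℝ → ℝ → ℝ := fun ε σ =>
    2 * Real.pi / R 0 * (g (0, 0) * Ht ε 0) * conv1 ik w (σ * Ht ε 0 - xc.1) with hb
  have hac : ∀ ε ∈ Set.Ioo 0 ε₁, Continuous (a ε) := fun ε hε =>
    continuous_const.mul (continuous_finsetSum _ fun n _ => h.continuous_arcInt _ _ (hp _) hε _)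
  have hbc : ∀ ε, Continuous (b ε) := fun ε => by simp only [hb]; fun_prop
  have key : Tendsto (fun ε => ∫ σ in (0:ℝ)..1, (a ε σ + b ε σ)) (𝓝[>] 0)
      (𝓝 (∫ _ in (0:ℝ)..1, (0:ℝ))) := by
    refine intervalIntegral.tendsto_integral_filter_of_dominated_convergence
      (fun _ => B + |2 * Real.pi / R 0| * (M * c₀) * CF) ?_ ?_ (by simp) ?_
    · filter_upwards [h.eventually_mem] with ε hε
      exact ((hac ε hε).add (hbc ε)).aestronglyMeasurable
    · filter_upwards [h.eventually_mem, hB] with ε hε h1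
      refine ae_of_all _ fun σ hσ => ?_
      rw [Set.uIoc_of_le zero_le_one] at hσ
      refine (norm_add_le _ _).trans (add_le_add (h1 σ (Set.Ioc_subset_Icc_self hσ) _ fun n => hp _) ?_)
      rw [Real.norm_eq_abs, hb, abs_mul, abs_mul, abs_mul (g (0, 0))]
      have := h.M_nonneg
      have := h.c₀_nonneg
      gcongr
      · exact h.g_bound _
      · exact h.abs_Ht_le hε 0
      · exact hCF _
    · refine ae_of_all _ fun σ hσ => ?_
      rw [Set.uIoc_of_le zero_le_one] at hσ
      exact h.tendsto_sum_arcInt K xc hκ hlam (Set.Ioc_subset_Icc_self hσ)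
  rw [intervalIntegral.integral_zero] at key
  refine key.congr' ?_
  filter_upwards [h.eventually_mem] with ε hε
  rw [intervalIntegral.integral_add ((hac ε hε).intervalIntegrable _ _) ((hbc ε).intervalIntegrable _ _)]
  congr 1
  · rw [ha, intervalIntegral.integral_const_mul, intervalIntegral.integral_finsetSum fun n _ =>
      (h.continuous_arcInt _ _ (hp _) hε _).intervalIntegrable _ _]
  · rw [← intervalIntegral.integral_const_mul]
    refine intervalIntegral.integral_congr fun σ _ => ?_
    simp only [hb]
    ring

/-- The contributions of an arc not passing through `x₀`, integrated over the tube. -/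
theorem tendsto_sum_integral_arcInt_remote (h : ArcData γ y y' R θ₁ r R₁ R₂ Λ Ht g c₀ ε₁ M Lg)
    {ik k w : ℝ → ℝ} {L ρ : ℝ} (K : Kernels ik k w L ρ) (x₀ xc : ℝ × ℝ) {κ c : ℝ} (hκ : 0 < κ)
    (hc : 0 < c) (hlow : ∀ α, |α - θ₁| ≤ 2 * r → c * |α - θ₁| ≤ |dot2 (vec α) (y α - x₀)|) :
    Tendsto (fun ε => ∑ n ∈ views κ ε, ∫ σ in (0:ℝ)..1, arcInt y x₀ xc Ht g
        (latKer k w (dot2 (vec (n * (κ * ε))) (x₀ + ε • xc) / ε)) ε σ (n * (κ * ε)))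
      (𝓝[>] 0) (𝓝 0) := by
  obtain ⟨Cp, hCp, hp⟩ := K.exists_decKer
  obtain ⟨C, hC, hb⟩ := h.exists_abs_sum_arcInt_le x₀ xc Cp hκ hc hlow
  have hγ : 0 < γ / 4 := by have := h.γ_pos; positivity
  have hlim : Tendsto (fun ε : ℝ => C * ε ^ (γ / 4)) (𝓝[>] 0) (𝓝 0) := by
    have := (tendsto_id_nhdsGT.rpow_const (p := γ / 4) (Or.inr hγ.le)).const_mul C
    rwa [Real.zero_rpow hγ.ne', mul_zero] at this
  have hev : ∀ᶠ ε in 𝓝[>] (0:ℝ), ε ∈ Set.Ioo 0 ε₁ := Ioo_mem_nhdsGT h.ε₁_pos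
  refine squeeze_zero_norm' ?_ hlim
  filter_upwards [hev] with ε hε
  rw [← intervalIntegral.integral_finsetSum fun n _ =>
      (h.continuous_arcInt _ _ (hp _) hε _).intervalIntegrable _ _]
  have h1 := intervalIntegral.norm_integral_le_of_norm_le_const (a := (0:ℝ)) (b := 1)
    (C := C * ε ^ (γ / 4)) (f := fun σ => ∑ n ∈ views κ ε, arcInt y x₀ xc Ht g
        (latKer k w (dot2 (vec (n * (κ * ε))) (x₀ + ε • xc) / ε)) ε σ (n * (κ * ε)))
    fun σ hσ => by
      rw [Set.uIoc_of_le zero_le_one] at hσ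
      exact hb ε hε σ (Set.Ioc_subset_Icc_self hσ) _ fun n => hp _
  simpa using h1

end ArcData

/-- The weighted perturbation `φ * fp` is integrable, and its backprojection at `y 0 + ε • xc`
is asymptotic to the predicted jump. -/
def HasJumpLimit (κ : ℝ) (ik k w : ℝ → ℝ) (Ht : ℝ → ℝ → ℝ) (y : ℝ → ℝ × ℝ) (df : ℝ × ℝ → ℝ)
    (fp : ℝ → ℝ × ℝ → ℝ) (xc : ℝ × ℝ) (φ : ℝ × ℝ → ℝ) : Prop :=
  (∀ᶠ ε in 𝓝[>] (0:ℝ), Integrable fun z => φ z * fp ε z) ∧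
    Tendsto (fun ε => κ * viewSum κ k w ε (y 0 + ε • xc) (fun z => φ z * fp ε z) +
      2 * Real.pi * (φ (y 0) * df (y 0)) *
        ∫ σ in (0:ℝ)..1, Ht ε 0 * conv1 ik w (σ * Ht ε 0 - xc.1)) (𝓝[>] 0) (𝓝 0)

namespace Tube
variable {γ a c₀ ε₁ : ℝ} {Ht : ℝ → ℝ → ℝ} {y y' : ℝ → ℝ × ℝ} {R : ℝ → ℝ} {df : ℝ × ℝ → ℝ}
  {fp : ℝ → ℝ × ℝ → ℝ} {ik k w : ℝ → ℝ} {L ρ κ : ℝ}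

lemma eventually_mem (T : Tube γ a c₀ ε₁ Ht y y' R df fp) : ∀ᶠ ε in 𝓝[>] (0:ℝ), ε ∈ Set.Ioo 0 ε₁ :=
  Ioo_mem_nhdsGT T.ε₁_pos

lemma tubeMap_zero (y : ℝ → ℝ × ℝ) (θ : ℝ) : tubeMap y (θ, 0) = y θ := by simp [tubeMap]

lemma mem_image_ball (y : ℝ → ℝ × ℝ) (θ : ℝ) {r : ℝ} (hr : 0 < r) :
    y θ ∈ tubeMap y '' Metric.ball (θ, 0) r :=
  ⟨(θ, 0), Metric.mem_ball_self hr, tubeMap_zero y θ⟩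

/-- Localization to a chart of the tube. -/
lemma integrable_and_viewSum_eq (T : Tube γ a c₀ ε₁ Ht y y' R df fp) (K : Kernels ik k w L ρ)
    {θ₁ r R₁ R₂ Λ : ℝ} (hrad : ArcRadius R θ₁ r R₁ R₂ Λ) (hrR : r ≤ R₁) (hra : |θ₁| + 4 * r < a)
    (hinj : Set.InjOn (tubeMap y) (Metric.closedBall (θ₁, 0) r)) {φ : ℝ × ℝ → ℝ} (hφ : ContDiff ℝ 1 φ)
    (hsub : tsupport φ ⊆ tubeMap y '' Metric.ball (θ₁, 0) r) (x₀ xc : ℝ × ℝ) (κ : ℝ) {ε : ℝ}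
    (hε : ε ∈ Set.Ioo 0 ε₁) :
    Integrable (fun z => φ z * fp ε z) ∧
      viewSum κ k w ε (x₀ + ε • xc) (fun z => φ z * fp ε z) =
      ∑ n ∈ views κ ε, ∫ σ in (0:ℝ)..1, arcInt y x₀ xc Ht (tubeAmp y R df φ (Metric.ball (θ₁, 0) r))
        (latKer k w (dot2 (vec (n * (κ * ε))) (x₀ + ε • xc) / ε)) ε σ (n * (κ * ε)) := by
  have hr := hrad.r_pos
  have h1 : |θ₁| + r ≤ a := by linarith
  have h2 : ∀ θ, |θ - θ₁| < r → r ≤ R θ := fun θ hθ => hrR.trans (hrad.low θ (by linarith))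
  have h3 := hinj.mono Metric.ball_subset_closedBall
  have h4 : ∀ z ∉ tubeMap y '' Metric.ball (θ₁, 0) r, φ z = 0 := fun z hz =>
    image_eq_zero_of_notMem_tsupport fun h => hz (hsub h)
  have h5 := (T.contDiff_tubeAmp hinj hφ hsub).continuous
  refine ⟨?_, T.viewSum_eq K h1 h2 h3 h4 h5 hε κ x₀ xc⟩
  have := (T.integrable_and_integral_eq h1 h2 h3 h4 h5 hε (Ξ := fun _ => 1) continuous_const).1
  simpa using this

/-- The arc through `y 0` produces the jump. -/
lemma exists_hasJumpLimit_zero (T : Tube γ a c₀ ε₁ Ht y y' R df fp) (K : Kernels ik k w L ρ)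
    (hκ : 0 < κ) (hlam : Irrational (κ * (y 0).2)) (xc : ℝ × ℝ) :
    ∃ U, IsOpen U ∧ y 0 ∈ U ∧ ∀ φ, ContDiff ℝ 1 φ → tsupport φ ⊆ U →
      HasJumpLimit κ ik k w Ht y df fp xc φ := by
  have h0 : |(0:ℝ)| < a := by simpa using T.a_pos
  obtain ⟨r₀, hr₀, R₁, R₂, Λ, hrad⟩ := T.exists_arcRadius h0
  obtain ⟨r₁, hr₁, hinj⟩ := T.exists_injOn h0
  set r := min r₀ r₁ with hr
  have hrp : 0 < r := lt_min hr₀ hr₁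
  obtain ⟨hrad, hrR, hra⟩ := hrad r hrp (min_le_left _ _)
  obtain ⟨hinj, hop⟩ := hinj r (min_le_right _ _)
  refine ⟨_, hop, mem_image_ball y 0 hrp, fun φ hφ hsub => ?_⟩
  have hloc := fun ε (hε : ε ∈ Set.Ioo 0 ε₁) =>
    T.integrable_and_viewSum_eq K hrad hrR hra hinj hφ hsub (y 0) xc κ hε
  obtain ⟨M, Lg, hA⟩ := T.exists_arcData hrad hra hinj hφ hsub
  refine ⟨T.eventually_mem.mono fun ε hε => (hloc ε hε).1, ?_⟩
  refine (hA.tendsto_sum_integral_arcInt K xc hκ hlam).congr' (T.eventually_mem.mono fun ε hε => ?_)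
  dsimp only
  rw [(hloc ε hε).2, tubeAmp, Set.indicator_of_mem (Metric.mem_ball_self hrp), tubeMap_zero, sub_zero]
  have hR := (T.R_pos 0 h0).ne'
  congr 2
  field_simp

/-- Arcs that avoid `y 0` do not contribute. -/
lemma exists_hasJumpLimit_of_ne (T : Tube γ a c₀ ε₁ Ht y y' R df fp) (K : Kernels ik k w L ρ)
    (hκ : 0 < κ) (xc : ℝ × ℝ) {θ₁ : ℝ} (hθ : |θ₁| < a) (hne : y 0 ≠ y θ₁) :
    ∃ U, IsOpen U ∧ y θ₁ ∈ U ∧ ∀ φ, ContDiff ℝ 1 φ → tsupport φ ⊆ U →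
      HasJumpLimit κ ik k w Ht y df fp xc φ := by
  obtain ⟨r₀, hr₀, R₁, R₂, Λ, hrad⟩ := T.exists_arcRadius hθ
  obtain ⟨r₁, hr₁, hinj⟩ := T.exists_injOn hθ
  obtain ⟨r₂, hr₂, c, hc, hlow⟩ := T.exists_abs_dot2_ge hθ hne
  set r := min (min r₀ r₁) (r₂ / 2) with hr
  have hrp : 0 < r := lt_min (lt_min hr₀ hr₁) (by positivity)
  have hr0 : r ≤ r₀ := (min_le_left _ _).trans (min_le_left _ _)
  have hr1 : r ≤ r₁ := (min_le_left _ _).trans (min_le_right _ _)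
  have hr2 : r ≤ r₂ / 2 := min_le_right _ _
  obtain ⟨hrad, hrR, hra⟩ := hrad r hrp hr0
  obtain ⟨hinj, hop⟩ := hinj r hr1
  refine ⟨_, hop.inter isOpen_compl_singleton, ⟨mem_image_ball y θ₁ hrp, hne.symm⟩,
    fun φ hφ hsub => ?_⟩
  have hφ0 : φ (y 0) = 0 := image_eq_zero_of_notMem_tsupport fun h => (hsub h).2 rfl
  replace hsub := hsub.trans Set.inter_subset_left
  have hloc := fun ε (hε : ε ∈ Set.Ioo 0 ε₁) =>
    T.integrable_and_viewSum_eq K hrad hrR hra hinj hφ hsub (y 0) xc κ hε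
  obtain ⟨M, Lg, hA⟩ := T.exists_arcData hrad hra hinj hφ hsub
  refine ⟨T.eventually_mem.mono fun ε hε => (hloc ε hε).1, ?_⟩
  have := (hA.tendsto_sum_integral_arcInt_remote K (y 0) xc hκ hc
    fun α hα => hlow α (by linarith)).const_mul κ
  rw [mul_zero] at this
  refine this.congr' (T.eventually_mem.mono fun ε hε => ?_)
  dsimp only
  rw [(hloc ε hε).2, hφ0]
  ring

/-- Nothing happens where the jump amplitude vanishes. -/
lemma hasJumpLimit_of_mul_eq_zero (T : Tube γ a c₀ ε₁ Ht y y' R df fp) (xc : ℝ × ℝ)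
    {φ : ℝ × ℝ → ℝ} (hφ : ∀ z, φ z * df z = 0) : HasJumpLimit κ ik k w Ht y df fp xc φ := by
  have h : ∀ ε ∈ Set.Ioo 0 ε₁, (fun z => φ z * fp ε z) = fun _ => 0 := fun ε hε => by
    funext z
    rcases mul_eq_zero.1 (hφ z) with h | h
    · rw [h, zero_mul]
    · rw [T.eq_zero_of_df hε h, mul_zero]
  refine ⟨T.eventually_mem.mono fun ε hε => ?_, ?_⟩
  · rw [h ε hε]
    exact integrable_zero _ _ _
  · refine (tendsto_const_nhds (x := (0:ℝ))).congr' (T.eventually_mem.mono fun ε hε => ?_)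
    dsimp only
    rw [h ε hε, hφ]
    simp [viewSum]

lemma exists_hasJumpLimit (T : Tube γ a c₀ ε₁ Ht y y' R df fp) (K : Kernels ik k w L ρ)
    (hκ : 0 < κ) (hlam : Irrational (κ * (y 0).2)) (xc : ℝ × ℝ) {θ₁ : ℝ} (hθ : θ₁ ∈ Set.Icc (-a) a) :
    ∃ U, IsOpen U ∧ y θ₁ ∈ U ∧ ∀ φ, ContDiff ℝ 1 φ → tsupport φ ⊆ U →
      HasJumpLimit κ ik k w Ht y df fp xc φ := by
  rcases (abs_le.2 hθ).lt_or_eq with hlt | heq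
  · by_cases hne : y 0 = y θ₁
    · rw [← hne]
      exact T.exists_hasJumpLimit_zero K hκ hlam xc
    · exact T.exists_hasJumpLimit_of_ne K hκ xc hlt hne
  · obtain ⟨δ, hδ, hv⟩ := T.vanish
    refine ⟨Metric.ball (y θ₁) δ, Metric.isOpen_ball, Metric.mem_ball_self hδ, fun φ _ hsub =>
      T.hasJumpLimit_of_mul_eq_zero xc fun z => ?_⟩
    by_cases hz : z ∈ Metric.ball (y θ₁) δ
    · have : df z = 0 := hv z <| by
        rcases (abs_eq T.a_pos.le).1 heq with h | h
        · exact Or.inl (by rwa [h, Metric.mem_ball] at hz)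
        · exact Or.inr (by rwa [h, Metric.mem_ball] at hz)
      rw [this, mul_zero]
    · rw [image_eq_zero_of_notMem_tsupport fun h => hz (hsub h), zero_mul]

end Tube

open scoped Manifold ContDiff in
/-- A finite family of `C¹` weights, subordinate to an open cover, adding up to one near a compact
set. -/
lemma IsCompact.exists_weights {ι : Type*} [Fintype ι] {S : Set (ℝ × ℝ)} (hS : IsCompact S)
    {U : ι → Set (ℝ × ℝ)} (hU : ∀ i, IsOpen (U i)) (hSU : S ⊆ ⋃ i, U i) :
    ∃ δ > 0, ∃ φ : ι → ℝ × ℝ → ℝ, (∀ i, ContDiff ℝ 1 (φ i)) ∧ (∀ i, tsupport (φ i) ⊆ U i) ∧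
      ∀ x ∈ Metric.cthickening δ S, ∑ i, φ i x = 1 := by
  obtain ⟨δ, hδ, hsub⟩ := hS.exists_cthickening_subset_open (isOpen_iUnion hU) hSU
  obtain ⟨f, hf⟩ := SmoothPartitionOfUnity.exists_isSubordinate 𝓘(ℝ, ℝ × ℝ)
    Metric.isClosed_cthickening U hU hsub
  refine ⟨δ, hδ, fun i => f i, fun i => ?_, hf, fun x hx => ?_⟩
  · exact (f i).contMDiff.contDiff.of_le (by exact_mod_cast le_top)
  · rw [← finsum_eq_sum_of_fintype]
    exact f.sum_eq_one hx

lemma viewSum_finsetSum {ik k w : ℝ → ℝ} {L ρ : ℝ} (K : Kernels ik k w L ρ) {ι : Type*} (s : Finset ι)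
    {f : ι → ℝ × ℝ → ℝ} (hf : ∀ i ∈ s, Integrable (f i)) (κ ε : ℝ) (x : ℝ × ℝ) :
    viewSum κ k w ε x (fun z => ∑ i ∈ s, f i z) = ∑ i ∈ s, viewSum κ k w ε x (f i) := by
  obtain ⟨C, -, hC⟩ := K.exists_decKer
  simp only [viewSum]
  rw [Finset.sum_comm]
  refine Finset.sum_congr rfl fun n _ => ?_
  rw [← Finset.mul_sum, ← integral_finsetSum]
  · simp only [Finset.mul_sum]
  · intro i hi
    set u := dot2 (vec (n * (κ * ε))) x / ε
    have hc := (hC u).continuous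
    refine (hf i hi).bdd_mul (c := C) ?_ (ae_of_all _ fun z => (hC u).bound_const _)
    refine (hc.comp ?_).aestronglyMeasurable
    simp only [dot2, Prod.fst_sub, Prod.snd_sub]
    fun_prop

namespace Tube
variable {γ a c₀ ε₁ : ℝ} {Ht : ℝ → ℝ → ℝ} {y y' : ℝ → ℝ × ℝ} {R : ℝ → ℝ} {df : ℝ × ℝ → ℝ}
  {fp : ℝ → ℝ × ℝ → ℝ} {ik k w : ℝ → ℝ} {L ρ κ : ℝ}

/-- The perturbation is integrable, and its backprojection has the predicted jump. -/
theorem hasJumpLimit_one (T : Tube γ a c₀ ε₁ Ht y y' R df fp) (K : Kernels ik k w L ρ)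
    (hκ : 0 < κ) (hlam : Irrational (κ * (y 0).2)) (xc : ℝ × ℝ) :
    HasJumpLimit κ ik k w Ht y df fp xc fun _ => 1 := by
  set S := y '' Set.Icc (-a) a with hSdef
  have hS : IsCompact S := isCompact_Icc.image T.smooth_y.continuous
  choose! U hUo hyU hlim using fun θ (hθ : θ ∈ Set.Icc (-a) a) => T.exists_hasJumpLimit K hκ hlam xc hθ
  obtain ⟨F, hF⟩ := hS.elim_finite_subcover (fun θ : Set.Icc (-a) a => U θ) (fun θ => hUo θ θ.2)
    (by
      rintro _ ⟨θ, hθ, rfl⟩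
      exact Set.mem_iUnion.2 ⟨⟨θ, hθ⟩, hyU θ hθ⟩)
  have hF' : S ⊆ ⋃ i : F, U i := fun x hx => by
    obtain ⟨i, hi, hxi⟩ := Set.mem_iUnion₂.1 (hF hx)
    exact Set.mem_iUnion.2 ⟨⟨i, hi⟩, hxi⟩
  obtain ⟨δ, hδ, φ, hφ, hφU, hsum⟩ := hS.exists_weights (U := fun i : F => U i)
    (fun i => hUo _ i.1.2) hF'
  have hJ := fun i => hlim _ i.1.2 (φ i) (hφ i) (hφU i)
  have h0 : y 0 ∈ S := ⟨0, ⟨by linarith [T.a_pos], T.a_pos.le⟩, rfl⟩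
  have hone : ∑ i, φ i (y 0) = 1 := hsum _ (Metric.self_subset_cthickening _ h0)
  have hint : ∀ᶠ ε in 𝓝[>] (0:ℝ), ∀ i, Integrable fun z => φ i z * fp ε z :=
    eventually_all.2 fun i => (hJ i).1
  have hsmall : ∀ᶠ ε in 𝓝[>] (0:ℝ), c₀ * ε < δ := by
    have : Tendsto (fun ε : ℝ => c₀ * ε) (𝓝[>] 0) (𝓝 0) := by
      have h : Tendsto (fun ε : ℝ => c₀ * ε) (𝓝 0) (𝓝 (c₀ * 0)) := tendsto_id.const_mul c₀
      rw [mul_zero] at h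
      exact h.mono_left nhdsWithin_le_nhds
    exact this.eventually (gt_mem_nhds hδ)
  have heq : ∀ᶠ ε in 𝓝[>] (0:ℝ), (fun z => (1:ℝ) * fp ε z) = fun z => ∑ i, φ i z * fp ε z := by
    filter_upwards [hsmall, T.eventually_mem] with ε hs hε
    funext z
    by_cases hz : fp ε z = 0
    · simp [hz]
    · obtain ⟨θ, hθ, hd⟩ := T.exists_of_ne_zero hε hz
      rw [← Finset.sum_mul, hsum z (Metric.mem_cthickening_of_dist_le z (y θ) δ S ⟨θ, hθ, rfl⟩
        (hd.trans hs.le))]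
  refine ⟨?_, ?_⟩
  · filter_upwards [hint, heq] with ε h1 h2
    rw [h2]
    exact integrable_finsetSum _ fun i _ => h1 i
  · have hlim := tendsto_finsetSum Finset.univ fun i _ => (hJ i).2
    rw [Finset.sum_const_zero] at hlim
    refine hlim.congr' ?_
    filter_upwards [hint, heq] with ε h1 h2
    rw [h2, viewSum_finsetSum K _ (fun i _ => h1 i), Finset.sum_add_distrib, ← Finset.mul_sum,
      ← Finset.sum_mul, ← Finset.mul_sum, ← Finset.sum_mul, hone]

end Tube

lemma exists_lipSupp {f : ℝ → ℝ} {C : ℝ} (hf : HasCompactSupport f) (hlip : ∀ x y, |f x - f y| ≤ C * |x - y|) :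
    ∃ L ρ, LipSupp f L ρ := by
  obtain ⟨r, hr⟩ := hf.isBounded.subset_closedBall 0
  refine ⟨|C| + 1, |r| + 1, fun x y => (hlip x y).trans ?_, fun x hx => ?_, by positivity, by positivity⟩
  · gcongr
    linarith [le_abs_self C]
  · refine image_eq_zero_of_notMem_tsupport fun h => ?_
    have h1 := hr h
    rw [Metric.mem_closedBall, dist_zero_right, Real.norm_eq_abs] at h1
    linarith [le_abs_self r]

lemma abs_sub_le_of_abs_deriv_le {f : ℝ → ℝ} {C : ℝ} (hf : ∀ x, DifferentiableAt ℝ f x)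
    (hC : ∀ᵐ x : ℝ, |deriv f x| ≤ C) (x y : ℝ) : |f x - f y| ≤ C * |x - y| := by
  have hi : IntervalIntegrable (deriv f) volume y x := by
    refine (intervalIntegrable_const (c := C)).mono_fun' (measurable_deriv f).aestronglyMeasurable ?_
    exact ae_restrict_of_ae (hC.mono fun x hx => hx)
  rw [← intervalIntegral.integral_eq_sub_of_hasDerivAt (fun x _ => (hf x).hasDerivAt) hi]
  exact intervalIntegral.norm_integral_le_of_norm_le_const_ae (f := deriv f)
    (hC.mono fun x hx _ => hx)

/-- A compactly supported function with bounded second derivative is Lipschitz, and so is its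
derivative. -/
lemma exists_lipSupp_deriv {f : ℝ → ℝ} (hf : HasCompactSupport f) (h1 : ∀ x, DifferentiableAt ℝ f x)
    (h2 : ∀ x, DifferentiableAt ℝ (deriv f) x) (hb : ∃ M : ℝ, ∀ᵐ x : ℝ, |deriv (deriv f) x| ≤ M) :
    ∃ L ρ, LipSupp f L ρ ∧ LipSupp (deriv f) L ρ := by
  obtain ⟨M, hM⟩ := hb
  obtain ⟨L₁, ρ₁, hd⟩ := exists_lipSupp hf.deriv (abs_sub_le_of_abs_deriv_le h2 hM)
  obtain ⟨L₂, ρ₂, hf'⟩ := exists_lipSupp hf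
    (abs_sub_le_of_abs_deriv_le h1 (ae_of_all _ fun x => hd.bound x))
  exact ⟨max L₁ L₂, max ρ₁ ρ₂, hf'.mono (le_max_right _ _) (le_max_right _ _),
    hd.mono (le_max_left _ _) (le_max_left _ _)⟩

lemma holderBdd_of_forward {f : ℝ → ℝ} {A γ γ' : ℝ} (hA : 0 ≤ A) (hb : ∀ x, |f x| ≤ A)
    (hf : ∀ x h, 0 < h → |f (x + h) - f x| ≤ A * h ^ γ) (hγ' : 0 < γ') (hle : γ' ≤ γ) :
    HolderBdd f (2 * A) γ' := by
  have key : ∀ x h, 0 < h → |f (x + h) - f x| ≤ 2 * A * h ^ γ' := fun x h hh => by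
    rcases le_total h 1 with h1 | h1
    · have := Real.rpow_le_rpow_of_exponent_ge hh h1 hle
      have := Real.rpow_nonneg hh.le γ'
      nlinarith [hf x h hh]
    · have h3 := Real.one_le_rpow h1 hγ'.le
      have := (abs_sub (f (x + h)) (f x)).trans (add_le_add (hb _) (hb _))
      nlinarith
  refine ⟨fun x => (hb x).trans (by linarith), fun x x' => ?_⟩
  rcases lt_trichotomy x x' with h | rfl | h
  · have := key x (x' - x) (sub_pos.2 h)
    rw [add_sub_cancel] at this
    rwa [abs_sub_comm (f x), abs_sub_comm x, abs_of_pos (sub_pos.2 h)]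
  · simp [hγ'.ne']
  · have := key x' (x - x') (sub_pos.2 h)
    rw [add_sub_cancel] at this
    rwa [abs_of_pos (sub_pos.2 h)]

/-- Convolution with a signed indicator. -/
lemma conv1_chiInd (F : ℝ → ℝ) (H x : ℝ) :
    conv1 F (chiInd H) x = ∫ σ in (0:ℝ)..1, H * F (x - σ * H) := by
  have hsub : ∫ σ in (0:ℝ)..1, H * F (x - σ * H) = ∫ t in (0:ℝ)..H, F (x - t) := by
    rw [intervalIntegral.integral_const_mul,
      intervalIntegral.mul_integral_comp_mul_right (f := fun t => F (x - t))]
    simp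
  rw [hsub, conv1_comm]
  rcases lt_trichotomy H 0 with h | rfl | h
  · rw [intervalIntegral.integral_symm, intervalIntegral.integral_of_le h.le,
      ← integral_Icc_eq_integral_Ioc, ← integral_indicator measurableSet_Icc, ← integral_neg]
    refine integral_congr_ae (ae_of_all _ fun t => ?_)
    simp only [chiInd, h, h.not_gt, Set.indicator_apply, Set.mem_Icc, false_and, true_and, if_false]
    split_ifs <;> simp
  · simp [chiInd]
  · rw [intervalIntegral.integral_of_le h.le,
      ← integral_Icc_eq_integral_Ioc, ← integral_indicator measurableSet_Icc]
    refine integral_congr_ae (ae_of_all _ fun t => ?_)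
    simp [chiInd, h, h.not_gt, Set.indicator_apply, Set.mem_Icc]

/-- A curve parametrized by its normal angle has velocity of length `R`. -/
lemma deriv_eq_of_tangent {y : ℝ → ℝ × ℝ} {a : ℝ} (hy1 : Differentiable ℝ (deriv y))
    (ht : ∀ θ ∈ Set.Icc (-a) a, dot2 (vec θ) (deriv y θ) = 0) {θ : ℝ} (hθ : |θ| < a) :
    deriv y θ = (dot2 (vec θ) (deriv (deriv y) θ) * Real.sin θ,
      -(dot2 (vec θ) (deriv (deriv y) θ) * Real.cos θ)) := by
  have hd := (hy1 θ).hasDerivAt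
  have h1 : HasDerivAt (fun θ => dot2 (vec θ) (deriv y θ))
      (-Real.sin θ * (deriv y θ).1 + Real.cos θ * (deriv (deriv y) θ).1 +
        (Real.cos θ * (deriv y θ).2 + Real.sin θ * (deriv (deriv y) θ).2)) θ :=
    ((Real.hasDerivAt_cos θ).mul hd.fst).add ((Real.hasDerivAt_sin θ).mul hd.snd)
  have h0 : (fun θ => dot2 (vec θ) (deriv y θ)) =ᶠ[𝓝 θ] fun _ => 0 := by
    filter_upwards [continuous_abs.continuousAt.eventually_lt_const hθ] with t htt
    exact ht t (abs_le.1 htt.le)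
  have h2 := h1.unique ((hasDerivAt_const θ (0:ℝ)).congr_of_eventuallyEq h0)
  have h3 := ht θ (abs_le.1 hθ.le)
  simp only [dot2, vec] at h3 ⊢
  have hcs := Real.sin_sq_add_cos_sq θ
  ext
  · simp only
    linear_combination Real.cos θ * h3 - Real.sin θ * h2 - (deriv y θ).1 * hcs
  · simp only
    linear_combination Real.sin θ * h3 + Real.cos θ * h2 - (deriv y θ).2 * hcs

/-- Theorem `main-res`, case `x₀ ∈ S`: if `x₀ = y_*(0) ∈ S` is
generic, then for every `x̌ ∈ ℝ²`,
`lim_{ε→0⁺} [f_ε^rec(x₀ + ε x̌) − Δf(x₀)(ik*w*χ_{H₀(0)})(Θ⃗₀ · x̌)] = 0`,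
where `H₀(0) = ε⁻¹ H_ε(0)` and `Θ⃗₀ = (1,0) = vec 0`. -/
theorem stmt_0
    (w ik : ℝ → ℝ) (κ γ a c₀ ε₀ : ℝ)
    (hκ : 0 < κ) (hγ : γ ∈ Set.Ioc (0:ℝ) 1) (ha : 0 < a)
    (hc₀ : 0 < c₀) (hε₀ : 0 < ε₀)
    -- the detector aperture function w ∈ C₀²(ℝ), even, with ∫ w = 1
    (hw_even : ∀ p : ℝ, w (-p) = w p)
    (hw_supp : HasCompactSupport w)
    (hw_d1 : ∀ p : ℝ, DifferentiableAt ℝ w p)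
    (hw_d2 : ∀ p : ℝ, DifferentiableAt ℝ (deriv w) p)
    (hw_bdd : ∃ M : ℝ, ∀ᵐ p : ℝ, |deriv (deriv w) p| ≤ M)
    (hw_int : ∫ p : ℝ, w p = 1)
    -- the interpolation kernel ik ∈ C₀²(ℝ), even, exact up to order 1
    (hik_even : ∀ p : ℝ, ik (-p) = ik p)
    (hik_supp : HasCompactSupport ik)
    (hik_d1 : ∀ p : ℝ, DifferentiableAt ℝ ik p)
    (hik_d2 : ∀ p : ℝ, DifferentiableAt ℝ (deriv ik) p)
    (hik_bdd : ∃ M : ℝ, ∀ᵐ p : ℝ, |deriv (deriv ik) p| ≤ M)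
    (hik_exact0 : ∀ u : ℝ, ∑' j : ℤ, ik (u - (j : ℝ)) = 1)
    (hik_exact1 : ∀ u : ℝ, ∑' j : ℤ, (j : ℝ) * ik (u - (j : ℝ)) = u)
    -- the perturbation family: H1 and H2
    (H : ℝ → ℝ → ℝ)
    (hH1 : ∀ ε ∈ Set.Ioo (0:ℝ) ε₀, ∀ s : ℝ, |H ε s| ≤ c₀ * ε)
    (hH2 : ∀ ε ∈ Set.Ioo (0:ℝ) ε₀, ∀ s h : ℝ, 0 < h →
      |H ε (s + Real.sqrt ε * h) - H ε s| ≤ c₀ * ε * h ^ γ)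
    -- the C⁴ curve S with positive curvature, parametrized by tangency:
    -- the line with normal Θ⃗(θ) through y_*(θ) is tangent to S at y_*(θ),
    -- and the radius of curvature R(θ) = Θ⃗ · y_*''(θ) is positive
    (y : ℝ → ℝ × ℝ)
    (hy_smooth : ContDiff ℝ 4 y)
    (hy_reg : ∀ θ ∈ Set.Icc (-a) a, deriv y θ ≠ 0)
    (hy_tangent : ∀ θ ∈ Set.Icc (-a) a, dot2 (vec θ) (deriv y θ) = 0)
    (hy_curv : ∀ θ ∈ Set.Icc (-a) a, 0 < dot2 (vec θ) (deriv (deriv y) θ))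
    -- the jump Δf ∈ C²(ℝ²), vanishing near the endpoints of the curve
    (df : ℝ × ℝ → ℝ)
    (hdf : ContDiff ℝ 2 df)
    (hdf_vanish : ∃ δ : ℝ, 0 < δ ∧ ∀ x : ℝ × ℝ,
      (dist x (y a) < δ ∨ dist x (y (-a)) < δ) → df x = 0)
    -- the perturbation function f_ε, supported in the tube between S and S_ε
    (fpert : ℝ → ℝ × ℝ → ℝ)
    (hfpert_tube : ∀ ε ∈ Set.Ioo (0:ℝ) ε₀, ∀ θ ∈ Set.Icc (-a) a, ∀ t : ℝ,
      fpert ε (y θ + t • vec θ) =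
        if 0 < t ∧ t < H ε θ then df (y θ + t • vec θ)
        else if H ε θ < t ∧ t < 0 then -df (y θ + t • vec θ) else 0)
    (hfpert_out : ∀ ε ∈ Set.Ioo (0:ℝ) ε₀, ∀ x : ℝ × ℝ,
      (∀ θ ∈ Set.Icc (-a) a, ∀ t : ℝ, x ≠ y θ + t • vec θ) → fpert ε x = 0)
    -- the discrete data f̂_ε(α_k, p_j), α_k = kκε, p_j = jε
    (fhat : ℝ → ℤ → ℤ → ℝ)
    (hfhat : ∀ ε : ℝ, ∀ k j : ℤ, fhat ε k j =
      ε⁻¹ * ∫ z : ℝ × ℝ,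
        w (((j : ℝ) * ε - dot2 (vec ((k : ℝ) * (κ * ε))) z) / ε) * fpert ε z)
    -- the principal value integrals appearing in the inversion formula
    (Ipv : ℝ → ℤ → ℝ × ℝ → ℝ)
    (hIpv : ∀ ε ∈ Set.Ioo (0:ℝ) ε₀, ∀ (k : ℤ) (x : ℝ × ℝ),
      Tendsto (fun δ : ℝ =>
          ∫ p in {p : ℝ | δ < |p - dot2 (vec ((k : ℝ) * (κ * ε))) x|},
            deriv (fun p' : ℝ =>
              ∑' j : ℤ, ik ((p' - (j : ℝ) * ε) / ε) * fhat ε k j) p /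
              (p - dot2 (vec ((k : ℝ) * (κ * ε))) x))
        (𝓝[>] (0:ℝ)) (𝓝 (Ipv ε k x)))
    -- the reconstruction from discrete data
    (frec : ℝ → ℝ × ℝ → ℝ)
    (hfrec : ∀ ε : ℝ, ∀ x : ℝ × ℝ, frec ε x =
      -(κ * ε / (2 * Real.pi)) * ∑' k : ℤ,
        (if |(k : ℝ) * (κ * ε)| ≤ Real.pi / 2
          then (1 / Real.pi) * Ipv ε k x else 0))
    -- genericity of x₀ = y_*(0): κ·(x₀·τ⃗) is irrational, τ⃗ the unit tangent
    (hgen : Irrational (κ * dot2 (y 0) (deriv y 0) /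
      Real.sqrt (dot2 (deriv y 0) (deriv y 0)))) :
    ∀ xc : ℝ × ℝ,
      Tendsto (fun ε : ℝ =>
          frec ε (y 0 + ε • xc) -
            df (y 0) *
              conv1 (conv1 ik w) (chiInd (ε⁻¹ * H ε 0)) (dot2 (vec 0) xc))
        (𝓝[>] (0:ℝ)) (𝓝 0) := by
  obtain ⟨Li, ρi, hik, hk⟩ := exists_lipSupp_deriv hik_supp hik_d1 hik_d2 hik_bdd
  obtain ⟨Lw, ρw, hw, -⟩ := exists_lipSupp_deriv hw_supp hw_d1 hw_d2 hw_bdd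
  have K : Kernels ik (deriv ik) w (max Li Lw) (max ρi ρw) :=
    { ik_lip := hik.mono (le_max_left _ _) (le_max_left _ _)
      k_lip := hk.mono (le_max_left _ _) (le_max_left _ _)
      w_lip := hw.mono (le_max_right _ _) (le_max_right _ _)
      deriv_ik := fun x => (hik_d1 x).hasDerivAt
      ik_even := hik_even
      w_even := hw_even
      w_int := hw_int
      exact := hik_exact0 }
  have hy3 : ContDiff ℝ 3 (deriv y) := hy_smooth.iterate_deriv' 3 1
  have hy2 : ContDiff ℝ 2 (deriv (deriv y)) := hy_smooth.iterate_deriv' 2 2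
  set R : ℝ → ℝ := fun θ => dot2 (vec θ) (deriv (deriv y) θ) with hR
  have hRs : ContDiff ℝ 1 R := by
    have h1 : ContDiff ℝ 1 (deriv (deriv y)) := hy2.of_le (by norm_num)
    simp only [hR, dot2, vec]
    exact (Real.contDiff_cos.mul h1.fst).add (Real.contDiff_sin.mul h1.snd)
  have hy' : ∀ θ, |θ| < a → deriv y θ = (R θ * Real.sin θ, -(R θ * Real.cos θ)) := fun θ hθ =>
    deriv_eq_of_tangent (hy3.differentiable (by norm_num)) hy_tangent hθ
  have hsub : ∀ ε ∈ Set.Ioo 0 (min ε₀ 1), ε ∈ Set.Ioo 0 ε₀ := fun ε hε =>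
    ⟨hε.1, hε.2.trans_le (min_le_left _ _)⟩
  have T : Tube (min γ (1 / 2)) a (2 * c₀) (min ε₀ 1) (fun ε θ => ε⁻¹ * H ε θ) y (deriv y) R df fpert :=
    { a_pos := ha
      γ_pos := lt_min hγ.1 (by norm_num)
      γ_lt := (min_le_right _ _).trans_lt (by norm_num)
      ε₁_pos := lt_min hε₀ one_pos
      ε₁_le := min_le_right _ _
      holder := fun ε hε c => by
        have hε0 := hε.1
        have hs : ∀ A, ε⁻¹ * (c₀ * ε * A) = c₀ * A := fun A => by field_simp
        refine holderBdd_of_forward hc₀.le (fun x => ?_) (γ := γ) (fun x h hh => ?_)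
          (lt_min hγ.1 (by norm_num)) (min_le_left _ _)
        · rw [abs_mul, abs_of_pos (inv_pos.2 hε0), ← mul_one c₀, ← hs]
          gcongr
          simpa using hH1 ε (hsub ε hε) (c + √ε * x)
        · rw [← mul_sub, abs_mul, abs_of_pos (inv_pos.2 hε0), ← hs, mul_add, ← add_assoc]
          gcongr
          exact hH2 ε (hsub ε hε) _ h hh
      smooth_y := hy_smooth.of_le (by norm_num)
      deriv_y := fun θ => (hy_smooth.differentiable (by norm_num) θ).hasDerivAt
      cont_y' := hy3.continuous
      smooth_R := hRs
      R_pos := fun θ hθ => hy_curv θ (abs_le.1 hθ.le)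
      y'_eq := hy'
      smooth_df := hdf.of_le (by norm_num)
      vanish := hdf_vanish
      tube := fun ε hε θ hθ t => by
        rw [mul_inv_cancel_left₀ hε.1.ne', tubeMap, hfpert_tube ε (hsub ε hε) θ hθ t, sgnInd]
        split_ifs <;> simp
      out := fun ε hε x hx => hfpert_out ε (hsub ε hε) x hx }
  have h0 : |(0:ℝ)| < a := by simpa using ha
  have hlam : Irrational (κ * (y 0).2) := by
    have hR0 : 0 < R 0 := T.R_pos 0 h0
    have e : κ * dot2 (y 0) (deriv y 0) / √(dot2 (deriv y 0) (deriv y 0)) = -(κ * (y 0).2) := by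
      rw [hy' 0 h0]
      simp only [dot2, Real.sin_zero, Real.cos_zero, mul_zero, mul_one, zero_add, neg_mul_neg]
      rw [Real.sqrt_mul_self hR0.le]
      field_simp
    rw [e] at hgen
    simpa using hgen.neg
  intro xc
  obtain ⟨hint, hlim⟩ := T.hasJumpLimit_one K hκ hlam xc
  have hlim' := hlim.const_mul (-(1 / (2 * Real.pi)))
  rw [mul_zero] at hlim'
  obtain ⟨B, hB⟩ := (isCompact_Icc.image T.smooth_y.continuous : IsCompact (y '' Set.Icc (-a) a)).isBounded.exists_norm_le
  refine hlim'.congr' ?_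
  filter_upwards [hint, T.eventually_mem] with ε hint hε
  have hε1 : ε < 1 := hε.2.trans_le (min_le_right _ _)
  simp only [one_mul] at hint ⊢
  have hsupp : ∀ z, B + 2 * c₀ + 1 ≤ ‖z‖ → fpert ε z = 0 := fun z hz => by
    by_contra hne
    obtain ⟨θ, hθ, hd⟩ := T.exists_of_ne_zero hε hne
    have h1 := hB _ ⟨θ, hθ, rfl⟩
    have h2 : ‖z‖ ≤ dist z (y θ) + ‖y θ‖ := by
      rw [dist_eq_norm]
      simpa using norm_add_le (z - y θ) (y θ)
    nlinarith
  rw [hfrec, K.reconstruction_eq hκ hε.1 hint hsupp (y 0 + ε • xc) (hfhat ε)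
    (hIpv ε (hsub ε hε) · (y 0 + ε • xc)), conv1_chiInd]
  have e : ∀ σ, conv1 ik w (σ * (ε⁻¹ * H ε 0) - xc.1) =
      conv1 ik w (dot2 (vec 0) xc - σ * (ε⁻¹ * H ε 0)) := fun σ => by
    rw [← K.conv1_even]
    simp [dot2, vec]
  simp only [e]
  have := Real.pi_pos
  field_simp
  ring
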